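/- There exist universal constants ρ ≥ 2 and c' > 0 such that for all integers 1 ≤ r < R with ρ·r < R and all z, w ∈ ∂B_r, the total μ^{z,w}-mass of the set M^{z,w}_{r,R} of paths from z to w that intersect ∂B_R and do not disconnect B_r from ∂B_R satisfies μ^{z,w}(M^{z,w}_{r,R}) ≤ c'·(R/r)^{−1/2}·log(R/r). -/

import Mathlib

open MeasureTheory Set
open scoped ENNReal NNReal

noncomputable section

namespace RWLSPaper

open scoped Classical

/-- Vertices of the square lattice `ℤ²`. -/
abbrev Lat : Type := ℤ × ℤ

/-- The plane `ℝ²`, with the Euclidean metric. -/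
abbrev Plane : Type := EuclideanSpace ℝ (Fin 2)

/-- Embedding of the lattice into the plane. -/
def emb (z : Lat) : Plane := (WithLp.equiv 2 (Fin 2 → ℝ)).symm ![(z.1 : ℝ), (z.2 : ℝ)]

/-- Lattice adjacency: Euclidean distance one. -/
def Adj (a b : Lat) : Prop := (a.1 - b.1) ^ 2 + (a.2 - b.2) ^ 2 = 1

/-- ℓ∞ norm on the lattice. -/
def linf (a : Lat) : ℤ := max |a.1| |a.2|

/-- The box `B_R(z) = {w : |w - z|_∞ ≤ R}`. -/
def box (z : Lat) (R : ℤ) : Set Lat := {w | linf (w - z) ≤ R}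

/-- Inner vertex boundary of a set of vertices. -/
def bdry (A : Set Lat) : Set Lat := {z | z ∈ A ∧ ∃ w, w ∉ A ∧ linf (z - w) = 1}

/-- A set of vertices, embedded in the plane. -/
def embS (A : Set Lat) : Set Plane := emb '' A

/-- The boundary of the box `B_R(z)`, embedded in the plane. -/
def bdryE (z : Lat) (R : ℤ) : Set Plane := embS (bdry (box z R))

/-- The solid box `z + [-R,R]²` in the plane. -/
def boxP (z : Lat) (R : ℤ) : Set Plane :=
  {p | |p 0 - (z.1 : ℝ)| ≤ (R : ℝ) ∧ |p 1 - (z.2 : ℝ)| ≤ (R : ℝ)}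

/-- Trace of a list of vertices: the vertices, together with the segments joining
consecutive ones. -/
def traceL (l : List Lat) : Set Plane :=
  (⋃ z ∈ l, {emb z}) ∪ ⋃ p ∈ l.zip l.tail, segment ℝ (emb p.1) (emb p.2)

/-- Nearest-neighbour paths: nonempty lists of successively adjacent vertices. -/
def IsPath (l : List Lat) : Prop := l ≠ [] ∧ l.Chain' Adj

/-- Number of steps of a path. -/
def steps (l : List Lat) : ℕ := l.length - 1

/-- Paths from `z` to `w` with at least one step. -/
def PathsBetween (z w : Lat) : Set (List Lat) :=
  {l | IsPath l ∧ l.head? = some z ∧ l.getLast? = some w ∧ 2 ≤ l.length}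

/-- Total mass of a set of paths under the measure giving weight `4^{-|η|}` to each
path `η`. -/
def pathMass (M : Set (List Lat)) : ℝ≥0∞ :=
  ∑' l : M, (4 : ℝ≥0∞)⁻¹ ^ steps l.1

/-- `A` disconnects `B` from `C` in the plane: every continuous path joining a point
of `B` to a point of `C` meets `A`. -/
def Disconnects (A B C : Set Plane) : Prop :=
  ∀ γ : ℝ → Plane, ContinuousOn γ (Icc 0 1) → γ 0 ∈ B → γ 1 ∈ C →
    ∃ t ∈ Icc (0 : ℝ) 1, γ t ∈ A

/-- The set `M^{z,w}_{r,R}` of paths from `z` to `w` which intersect `∂B_R` and do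
not disconnect `B_r` from `∂B_R`. -/
def MSet (z w : Lat) (r R : ℤ) : Set (List Lat) :=
  {l | l ∈ PathsBetween z w ∧ (traceL l ∩ bdryE 0 R).Nonempty ∧
    ¬ Disconnects (traceL l) (embS (box 0 r)) (bdryE 0 R)}

/-- Nearest-neighbour walks from `u` to `v` staying in `D`. -/
def WalksIn (D : Set Lat) (u v : Lat) : Set (List Lat) :=
  {l | IsPath l ∧ l.head? = some u ∧ l.getLast? = some v ∧ ∀ x ∈ l, x ∈ D}

/-- The Green's function of simple random walk killed upon exiting `D`, through the
path-sum formula `G_D(u,v) = Σ_{η : u → v, η ⊆ D} 4^{-|η|}`. -/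
def green (D : Set Lat) (u v : Lat) : ℝ≥0∞ :=
  ∑' l : WalksIn D u v, (4 : ℝ≥0∞)⁻¹ ^ steps l.1

/-! ### Loops -/

/-- A rooted loop, encoded by its cyclic word: a nonempty list of vertices which,
cyclically, are successively adjacent. -/
structure RootedLoop where
  word : List Lat
  ne : word ≠ []
  adj : (word ++ word.take 1).Chain' Adj

/-- Rerooting (cyclic relabeling) relation on rooted loops. -/
def loopRot (l l' : RootedLoop) : Prop := ∃ k, l'.word = l.word.rotate k

/-- Unrooted loops: rooted loops modulo rerooting. -/
def ULoop : Type := Quot loopRot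

/-- A representative of an unrooted loop. -/
def ULoop.out (γ : ULoop) : RootedLoop := Quot.out γ

/-- Number of steps of a loop. -/
def ULoop.steps (γ : ULoop) : ℕ := γ.out.word.length

/-- Vertices visited by a loop. -/
def ULoop.verts (γ : ULoop) : Set Lat := {x | x ∈ γ.out.word}

/-- The trace of a loop in the plane. -/
def ULoop.trace (γ : ULoop) : Set Plane := traceL (γ.out.word ++ γ.out.word.take 1)

/-- The multiplicity `J(γ)`: the largest `j` such that `γ` is the concatenation of
`j` copies of a single loop. -/
def ULoop.mult (γ : ULoop) : ℕ :=
  sSup {j : ℕ | ∃ u : List Lat, u ≠ [] ∧ γ.out.word = (List.replicate j u).flatten}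

/-- The unrooted loop measure: `ν(γ) = 4^{-|γ|} / J(γ)`. -/
def loopWeight (γ : ULoop) : ℝ≥0 := (4 : ℝ≥0)⁻¹ ^ γ.steps / (γ.mult : ℝ≥0)

/-- Total `ν`-mass of a set of loops. -/
def nuMass (S : Set ULoop) : ℝ≥0∞ := ∑' γ : S, (loopWeight γ.1 : ℝ≥0∞)

/-- `ν(γ)` if `γ` is contained in `D`, and `0` otherwise. -/
def nuD (D : Set Lat) (γ : ULoop) : ℝ≥0 := if ULoop.verts γ ⊆ D then loopWeight γ else 0

/-! ### The random walk loop soup -/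

/-- Loop configurations: multiplicity functions on unrooted loops. -/
abbrev Config : Type := ULoop → ℕ

/-- The set of loops appearing in a configuration. -/
def Config.loops (ω : Config) : Set ULoop := {γ | ω γ ≠ 0}

/-- The Poisson probability mass function with mean `r`. -/
def poissonProb (r : ℝ≥0) (k : ℕ) : ℝ≥0∞ :=
  ENNReal.ofReal (Real.exp (-(r : ℝ)) * (r : ℝ) ^ k / k.factorial)

/-- `P` is the law of the random walk loop soup in `D` with intensity `α`: a Poisson
point process with intensity `α·ν` restricted to loops contained in `D`; equivalently,
the multiplicities of the various loops are independent, the multiplicity of a loop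
`γ ⊆ D` being Poisson-distributed with mean `α ν(γ)`. -/
def IsLoopSoup (D : Set Lat) (α : ℝ) (P : Measure Config) : Prop :=
  IsProbabilityMeasure P ∧
  ∀ (s : Finset ULoop) (m : ULoop → ℕ),
    P {ω | ∀ γ ∈ s, ω γ = m γ} = ∏ γ ∈ s, poissonProb (α.toNNReal * nuD D γ) (m γ)

/-- Decreasing events of the loop soup. -/
def DecreasingEvent (E : Set Config) : Prop :=
  ∀ ω ω' : Config, (∀ γ, ω' γ ≤ ω γ) → ω ∈ E → ω' ∈ E

/-! ### Clusters -/

/-- Two loops are adjacent when they intersect. -/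
def Touches (γ γ' : ULoop) : Prop := (ULoop.verts γ ∩ ULoop.verts γ').Nonempty

/-- Connection of loops within a family `L` of loops: transitive closure of adjacency. -/
def linkedL (L : Set ULoop) : ULoop → ULoop → Prop :=
  Relation.ReflTransGen (fun a b => a ∈ L ∧ b ∈ L ∧ Touches a b)

/-- The cluster of `γ` in `L`, as a set of loops. -/
def clusterClass (L : Set ULoop) (γ : ULoop) : Set ULoop := {γ' | γ' ∈ L ∧ linkedL L γ γ'}

/-- The subset of the plane covered by a family of loops. -/
def classTrace (K : Set ULoop) : Set Plane := ⋃ γ ∈ K, ULoop.trace γ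

/-- The clusters of a loop configuration, regarded as subsets of the plane. -/
def clusters (L : Set ULoop) : Set (Set Plane) :=
  {C | ∃ γ ∈ L, C = classTrace (clusterClass L γ)}

/-- `Λ(A, L)`: the union of `A` with all the clusters of `L` meeting `A`. -/
def LamL (A : Set Plane) (L : Set ULoop) : Set Plane :=
  A ∪ ⋃ C ∈ {C | C ∈ clusters L ∧ (C ∩ A).Nonempty}, C

/-- Connection within an arbitrary family of subsets of the plane (two members being
adjacent when they intersect). -/
def linkedS (F : Set (Set Plane)) : Set Plane → Set Plane → Prop :=
  Relation.ReflTransGen (fun a b => a ∈ F ∧ b ∈ F ∧ (a ∩ b).Nonempty)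

/-- Clusters of a family of subsets of the plane. -/
def clustersS (F : Set (Set Plane)) : Set (Set Plane) :=
  {C | ∃ S ∈ F, C = ⋃ S' ∈ {S' | S' ∈ F ∧ linkedS F S S'}, S'}

/-- `Λ(A, F)` for a family `F` of subsets of the plane. -/
def LamS (A : Set Plane) (F : Set (Set Plane)) : Set Plane :=
  A ∪ ⋃ C ∈ {C | C ∈ clustersS F ∧ (C ∩ A).Nonempty}, C

/-- The traces of a family of loops. -/
def traces (L : Set ULoop) : Set (Set Plane) := ULoop.trace '' L

/-! ### Filling, frontier, outermost clusters, crossings -/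

/-- The filling of a set: the complement of the union of all unbounded connected
subsets of the complement of its closure. -/
def Fill (A : Set Plane) : Set Plane :=
  {x | ∀ C : Set Plane, C ⊆ (closure A)ᶜ → IsConnected C → x ∈ C → Bornology.IsBounded C}

/-- The frontier of a loop: the topological boundary of the filling of its trace. -/
def loopFrontier (γ : ULoop) : Set Plane := frontier (Fill (ULoop.trace γ))

/-- The frontiers of the loops of a family. -/
def frontiers (L : Set ULoop) : Set (Set Plane) := loopFrontier '' L

/-- An outermost cluster of `L`. -/
def Outermost (L : Set ULoop) (C : Set Plane) : Prop :=
  C ∈ clusters L ∧ ∀ C' ∈ clusters L, C' ≠ C → ¬ Fill C ⊆ Fill C'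

/-- `S` crosses the annulus `A_{r,R}(z)`: it meets both `∂B_r(z)` and `∂B_R(z)`. -/
def CrossesAnn (S : Set Plane) (z : Lat) (r R : ℤ) : Prop :=
  (S ∩ bdryE z r).Nonempty ∧ (S ∩ bdryE z R).Nonempty

/-! ### Arm events -/

/-- The four-arm event: at least two distinct outermost clusters cross `A_{l,d}(z)`. -/
def fourArm (z : Lat) (l d : ℤ) (L : Set ULoop) : Prop :=
  ∃ C1 C2 : Set Plane, Outermost L C1 ∧ Outermost L C2 ∧ C1 ≠ C2 ∧
    CrossesAnn C1 z l d ∧ CrossesAnn C2 z l d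

/-- The four-arm event, as a set of configurations. -/
def A4 (z : Lat) (l d : ℤ) : Set Config := {ω | fourArm z l d ω.loops}

/-- The truncated four-arm event `→𝒜(z;l,d)`. -/
def A4trunc (z : Lat) (l d : ℤ) : Set Config :=
  {ω | fourArm z l d ω.loops ∧ LamL (embS (box z l)) ω.loops ⊆ boxP z (2 * d)}

/-- The truncated inward four-arm event `←𝒜(z;l,d)`. -/
def A4in (z : Lat) (l d : ℤ) : Set Config :=
  {ω | fourArm z l d ω.loops ∧
    LamL (embS (bdry (box z d))) ω.loops ∩ embS (box z (l / 2)) = ∅}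

/-- Lattice points in the open upper half-plane `ℍ`. -/
def upperLat : Set Lat := {w | 0 < w.2}

/-- The upper part of the boundary of `B_R`, embedded in the plane. -/
def bdryEP (R : ℤ) : Set Plane := embS (bdry (box 0 R) ∩ upperLat)

/-- `S` crosses the half-annulus `A^+_{r,R}`. -/
def CrossesAnnP (S : Set Plane) (r R : ℤ) : Prop :=
  (S ∩ bdryEP r).Nonempty ∧ (S ∩ bdryEP R).Nonempty

/-- The interior two-arm event: some outermost cluster has a frontier crossing `A_{l,d}`. -/
def A2 (l d : ℤ) : Set Config :=
  {ω | ∃ C, Outermost ω.loops C ∧ CrossesAnn (frontier (Fill C)) 0 l d}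

/-- The boundary two-arm event. -/
def A2P (l d : ℤ) : Set Config :=
  {ω | ∃ C, Outermost ω.loops C ∧ CrossesAnnP (frontier (Fill C)) l d}

/-- The boundary four-arm event. -/
def A4P (l d : ℤ) : Set Config :=
  {ω | ∃ C1 C2, Outermost ω.loops C1 ∧ Outermost ω.loops C2 ∧ C1 ≠ C2 ∧
    CrossesAnnP C1 l d ∧ CrossesAnnP C2 l d}

/-- Outward truncation condition: `Λ(B_l, ·) ⊆ B_{2d}`. -/
def TruncOut (l d : ℤ) (ω : Config) : Prop :=
  LamL (embS (box 0 l)) ω.loops ⊆ boxP 0 (2 * d)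

/-- Inward truncation condition: `Λ(∂B_d, ·) ∩ B_{⌊l/2⌋} = ∅`. -/
def TruncIn (l d : ℤ) (ω : Config) : Prop :=
  LamL (embS (bdry (box 0 d))) ω.loops ∩ embS (box 0 (l / 2)) = ∅

/-! ### Random walks and qualities -/

/-- `μ` is the law of the simple random walk on `ℤ²` started at `z`, as a measure on
`ℕ → ℤ²`. -/
def IsSRW (z : Lat) (μ : Measure (ℕ → Lat)) : Prop :=
  IsProbabilityMeasure μ ∧
  ∀ (n : ℕ) (f : ℕ → Lat), f 0 = z → (∀ i < n, Adj (f i) (f (i + 1))) →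
    μ {w | ∀ i ≤ n, w i = f i} = (4 : ℝ≥0∞)⁻¹ ^ n

/-- First hitting time of a set of vertices by a walk. -/
def hitTime (w : ℕ → Lat) (A : Set Lat) : ℕ := sInf {i | w i ∈ A}

/-- Position of a walk at its first hitting of `A`. -/
def hitPt (w : ℕ → Lat) (A : Set Lat) : Lat := w (hitTime w A)

/-- Trace of a walk, stopped at its first hitting of `A`. -/
def stoppedTrace (w : ℕ → Lat) (A : Set Lat) : Set Plane :=
  traceL ((List.range (hitTime w A + 1)).map w)

/-- The walk stays in `D` up to its first hitting of `A`. -/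
def StaysIn (w : ℕ → Lat) (D A : Set Lat) : Prop := ∀ i ≤ hitTime w A, w i ∈ D

/-- `μ` is the law of the simple random walk started at `z`, conditioned to stay in
`D` until it first hits `A`. -/
def IsCondSRW (z : Lat) (D A : Set Lat) (μ : Measure (ℕ → Lat)) : Prop :=
  ∃ ν : Measure (ℕ → Lat), IsSRW z ν ∧
    μ = (ν {w | StaysIn w D A})⁻¹ • ν.restrict {w | StaysIn w D A}

/-- Lattice ball of real radius (ℓ∞ distance). -/
def ballV (c : Lat) (ρ : ℝ) : Set Lat := {w | ((linf (w - c) : ℤ) : ℝ) ≤ ρ}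

/-- Union of the stopped traces of a packet of walks. -/
def packTrace {j : ℕ} (ws : Fin j → ℕ → Lat) (A : Set Lat) : Set Plane :=
  ⋃ i, stoppedTrace (ws i) A

/-- Union of the balls of radius `ρ` around the hitting points of a packet of walks. -/
def packBalls {j : ℕ} (ws : Fin j → ℕ → Lat) (A : Set Lat) (ρ : ℝ) : Set Plane :=
  ⋃ i, embS (ballV (hitPt (ws i) A) ρ)

/-- The frontiers of the loops of `ω` not contained in `B_r`. -/
def outerFrontiers (r : ℤ) (ω : Config) : Set (Set Plane) :=
  frontiers {γ | γ ∈ ω.loops ∧ ¬ ULoop.verts γ ⊆ box 0 r}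

/-- The frontiers of the loops of `ω` meeting `B_R`. -/
def meetFrontiers (R : ℤ) (ω : Config) : Set (Set Plane) :=
  frontiers {γ | γ ∈ ω.loops ∧ (ULoop.verts γ ∩ box 0 R).Nonempty}

/-- Quality at scale `s` for two packets of walks inside a loop soup, with initial
configuration `(Lr, V1, V2)` at scale `r`. -/
def qualityJK (Lr : Set ULoop) (V1 V2 : Set Lat) (r : ℤ) {j k : ℕ}
    (w1 : Fin j → ℕ → Lat) (w2 : Fin k → ℕ → Lat) (ω : Config) (s : ℤ) : ℝ :=
  sSup {δ : ℝ | 0 ≤ δ ∧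
    LamS (embS V1 ∪ packTrace w1 (bdry (box 0 s)) ∪ packBalls w1 (bdry (box 0 s)) (δ * (s : ℝ)))
        (traces Lr ∪ outerFrontiers r ω) ∩
      (embS V2 ∪ packTrace w2 (bdry (box 0 s)) ∪
        packBalls w2 (bdry (box 0 s)) (δ * (s : ℝ))) = ∅}

/-- Quality at scale `s` for a single pair of walks. -/
def qualityPair (Lr : Set ULoop) (V1 V2 : Set Lat) (r : ℤ)
    (w1 w2 : ℕ → Lat) (ω : Config) (s : ℤ) : ℝ :=
  qualityJK Lr V1 V2 r (fun _ : Fin 1 => w1) (fun _ : Fin 1 => w2) ω s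

/-- Reversed quality at scale `s`, for two packets walking inward from `∂B_R`. -/
def qualityRev (L : Set ULoop) (V1 V2 : Set Lat) (R : ℤ) {j k : ℕ}
    (w1 : Fin j → ℕ → Lat) (w2 : Fin k → ℕ → Lat) (ω : Config) (s : ℤ) : ℝ :=
  sSup {δ : ℝ | 0 ≤ δ ∧
    LamS (embS V1 ∪ packTrace w1 (bdry (box 0 s)) ∪ packBalls w1 (bdry (box 0 s)) (δ * (s : ℝ)))
        (traces L ∪ meetFrontiers R ω) ∩
      (embS V2 ∪ packTrace w2 (bdry (box 0 s)) ∪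
        packBalls w2 (bdry (box 0 s)) (δ * (s : ℝ))) = ∅}

/-- Quality at scale `s` for one packet of walks, with non-disconnection of `U`. -/
def qualityDisc (Lr : Set ULoop) (U : Set Lat) (r : ℤ) {j : ℕ}
    (ws : Fin j → ℕ → Lat) (ω : Config) (s : ℤ) : ℝ :=
  sSup {δ : ℝ | 0 ≤ δ ∧
    embS U ∩ Fill (LamS
      (packTrace ws (bdry (box 0 s)) ∪ packBalls ws (bdry (box 0 s)) (δ * (s : ℝ)))
      (traces Lr ∪ outerFrontiers r ω)) = ∅}

/-! ### Crossing loops and bad clusters -/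

/-- Crossing loops: loops contained in `D` which cross `A_{d,k}` without
disconnecting `B_d` from `∂B_k`. -/
def crossingLoops (D : Set Lat) (d k : ℤ) : Set ULoop :=
  {γ | ULoop.verts γ ⊆ D ∧ CrossesAnn (ULoop.trace γ) 0 d k ∧
    ¬ Disconnects (ULoop.trace γ) (embS (box 0 d)) (bdryE 0 k)}

/-- `K` is a bad cluster of `L` for the annulus `A_{l,d}`, relative to the set `CL` of
crossing loops: an outermost cluster crossing `A_{l,d}` which no longer crosses it
once its crossing loops are removed. -/
def IsBad (CL : Set ULoop) (l d : ℤ) (L : Set ULoop) (K : Set ULoop) : Prop :=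
  (∃ γ ∈ L, K = clusterClass L γ) ∧
  Outermost L (classTrace K) ∧ CrossesAnn (classTrace K) 0 l d ∧
  ¬ CrossesAnn (classTrace (K \ CL)) 0 l d

/-- `E_1`: the four-arm event holds, with exactly one bad cluster. -/
def E1 (CL : Set ULoop) (l d : ℤ) : Set Config :=
  {ω | fourArm 0 l d ω.loops ∧ ∃! K : Set ULoop, IsBad CL l d ω.loops K}

/-- `E_2`: the four-arm event holds, with at least two bad clusters. -/
def E2 (CL : Set ULoop) (l d : ℤ) : Set Config :=
  {ω | fourArm 0 l d ω.loops ∧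
    ∃ K K' : Set ULoop, K ≠ K' ∧ IsBad CL l d ω.loops K ∧ IsBad CL l d ω.loops K'}

/-- Number of crossing loops of a configuration, counted with multiplicity. -/
def crossingCount (CL : Set ULoop) (ω : Config) : ℝ≥0∞ := ∑' γ : CL, (ω γ.1 : ℝ≥0∞)

/-! ### Arcs of the square -/

/-- The square curve `{‖p‖_∞ = n}`: the closed polygonal curve through `∂B_n`. -/
def sqCurve (n : ℤ) : Set Plane := {p | max |p 0| |p 1| = (n : ℝ)}

/-- `J` is one of the two arcs of the closed curve `∂B_n` with endpoints `x` and `y`. -/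
def IsArc (n : ℤ) (x y : Lat) (J : Set Plane) : Prop :=
  IsClosed J ∧ IsConnected J ∧ J ⊆ sqCurve n ∧ emb x ∈ J ∧ emb y ∈ J ∧
  IsConnected ((sqCurve n \ J) ∪ {emb x, emb y})

lemma isChain_mid {α : Type*} {S : α → α → Prop} {l m : List α} (h : l.IsChain S)
    (hm : m <:+: l) : m.IsChain S := by
  obtain ⟨a, b, rfl⟩ := hm
  exact h.left_of_append.right_of_append

/-! ### Ordered dual numbers -/

abbrev DR : Type := DualNumber ℝ
abbrev DC : Type := DualNumber ℂ

instance drPartialOrder : PartialOrder DR :=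
  PartialOrder.lift (fun x : DR => ((x.fst, x.snd) : ℝ × ℝ))
    (fun x y h => by
      have h1 : x.fst = y.fst := congrArg Prod.fst h
      have h2 : x.snd = y.snd := congrArg Prod.snd h
      exact TrivSqZeroExt.ext h1 h2)

lemma dr_le_def (x y : DR) : x ≤ y ↔ x.fst ≤ y.fst ∧ x.snd ≤ y.snd := Iff.rfl

lemma dr_fst_mul (x y : DR) : (x * y).fst = x.fst * y.fst := by simp
lemma dr_snd_mul (x y : DR) : (x * y).snd = x.fst * y.snd + x.snd * y.fst := by simp [mul_comm]
lemma dc_snd_mul (x y : DC) : (x * y).snd = x.fst * y.snd + x.snd * y.fst := by simp [mul_comm]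

instance drIsOrderedAddMonoid : IsOrderedAddMonoid DR where
  add_le_add_left a b h c := by
    rw [dr_le_def] at *
    simp only [TrivSqZeroExt.fst_add, TrivSqZeroExt.snd_add]
    exact ⟨by linarith [h.1], by linarith [h.2]⟩

instance drIsOrderedRing : IsOrderedRing DR :=
  @IsOrderedRing.of_mul_nonneg DR _ _ _ ⟨by rw [dr_le_def]; simp⟩ (by
    intro a b ha hb
    rw [dr_le_def] at *
    simp only [TrivSqZeroExt.fst_zero, TrivSqZeroExt.snd_zero] at ha hb
    simp only [TrivSqZeroExt.fst_zero, TrivSqZeroExt.snd_zero, dr_fst_mul, dr_snd_mul]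
    exact ⟨mul_nonneg ha.1 hb.1,
      add_nonneg (mul_nonneg ha.1 hb.2) (mul_nonneg ha.2 hb.1)⟩)

/-- Functoriality of dual numbers. -/
def dmap {R S : Type*} [CommRing R] [CommRing S] (f : R →+* S) :
    DualNumber R →+* DualNumber S where
  toFun x := TrivSqZeroExt.inl (f x.fst) + TrivSqZeroExt.inr (f x.snd)
  map_one' := by ext <;> simp
  map_zero' := by ext <;> simp
  map_add' x y := by ext <;> simp
  map_mul' x y := by ext <;> simp [mul_comm]

lemma dmap_fst {R S : Type*} [CommRing R] [CommRing S] (f : R →+* S) (x : DualNumber R) :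
    (dmap f x).fst = f x.fst := by simp [dmap]
lemma dmap_snd {R S : Type*} [CommRing R] [CommRing S] (f : R →+* S) (x : DualNumber R) :
    (dmap f x).snd = f x.snd := by simp [dmap]

/-- Real dual numbers inside complex ones. -/
def cR : DR →+* DC := dmap Complex.ofRealHom
/-- Conjugation. -/
def dconj : DC →+* DC := dmap (starRingEnd ℂ)
/-- Componentwise real part. -/
def dre (x : DC) : DR := TrivSqZeroExt.inl x.fst.re + TrivSqZeroExt.inr x.snd.re

lemma cR_fst (x : DR) : (cR x).fst = (x.fst : ℂ) := by simp [cR, dmap_fst]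
lemma cR_snd (x : DR) : (cR x).snd = (x.snd : ℂ) := by simp [cR, dmap_snd]
lemma dconj_fst (x : DC) : (dconj x).fst = starRingEnd ℂ x.fst := by simp [dconj, dmap_fst]
lemma dconj_snd (x : DC) : (dconj x).snd = starRingEnd ℂ x.snd := by simp [dconj, dmap_snd]
lemma dre_fst (x : DC) : (dre x).fst = x.fst.re := by simp [dre]
lemma dre_snd (x : DC) : (dre x).snd = x.snd.re := by simp [dre]

lemma cR_inj {x y : DR} (h : cR x = cR y) : x = y := by
  apply TrivSqZeroExt.ext
  · have := congrArg TrivSqZeroExt.fst h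
    rw [cR_fst, cR_fst] at this; exact_mod_cast this
  · have := congrArg TrivSqZeroExt.snd h
    rw [cR_snd, cR_snd] at this; exact_mod_cast this

lemma dconj_cR (x : DR) : dconj (cR x) = cR x := by
  apply TrivSqZeroExt.ext
  · rw [dconj_fst, cR_fst]; simp
  · rw [dconj_snd, cR_snd]; simp

lemma dre_cR (x : DR) : dre (cR x) = x := by
  apply TrivSqZeroExt.ext
  · rw [dre_fst, cR_fst]; simp
  · rw [dre_snd, cR_snd]; simp

lemma cR_dre {x : DC} (h : dconj x = x) : cR (dre x) = x := by
  apply TrivSqZeroExt.ext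
  · rw [cR_fst, dre_fst]
    have := congrArg TrivSqZeroExt.fst h
    rw [dconj_fst] at this
    exact Complex.conj_eq_iff_re.mp this
  · rw [cR_snd, dre_snd]
    have := congrArg TrivSqZeroExt.snd h
    rw [dconj_snd] at this
    exact Complex.conj_eq_iff_re.mp this

/-- Fourth-root-of-unity phases. -/
def ph (k : ZMod 4) : DC := TrivSqZeroExt.inl (Complex.I ^ k.val)

/-- The phase as complex number. -/
def phc (k : ZMod 4) : ℂ := Complex.I ^ k.val

lemma phc_add (k l : ZMod 4) : phc (k + l) = phc k * phc l := by
  unfold phc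
  rw [ZMod.val_add, ← pow_add]
  conv_rhs => rw [← Nat.mod_add_div (k.val + l.val) 4, pow_add, pow_mul]
  simp

lemma phc_zero : phc 0 = 1 := by simp [phc]
lemma phc_neg (k : ZMod 4) : phc (-k) = starRingEnd ℂ (phc k) := by
  fin_cases k
  · change Complex.I ^ 0 = starRingEnd ℂ (Complex.I ^ 0)
    simp
  · change Complex.I ^ 3 = starRingEnd ℂ (Complex.I ^ 1)
    simp [Complex.I_pow_three]
  · change Complex.I ^ 2 = starRingEnd ℂ (Complex.I ^ 2)
    simp
  · change Complex.I ^ 1 = starRingEnd ℂ (Complex.I ^ 3)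
    simp [Complex.I_pow_three]

lemma phc_norm (k : ZMod 4) : ‖phc k‖ = 1 := by simp [phc]

lemma ph_eq (k : ZMod 4) : ph k = TrivSqZeroExt.inl (phc k) := rfl
lemma ph_add (k l : ZMod 4) : ph (k + l) = ph k * ph l := by
  rw [ph_eq, phc_add]; simp [ph_eq]
lemma ph_zero : ph 0 = 1 := by simp [ph]
lemma ph_neg (k : ZMod 4) : ph (-k) = dconj (ph k) := by
  apply TrivSqZeroExt.ext
  · rw [dconj_fst, ph_eq, ph_eq]; simp [phc_neg]
  · rw [dconj_snd, ph_eq, ph_eq]; simp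

lemma sum_zmod4 {M : Type*} [AddCommMonoid M] (f : ZMod 4 → M) :
    ∑ k, f k = f 0 + f 1 + f 2 + f 3 := Fin.sum_univ_four f

/-- If `f = ∑ i^k L_k` with `L_2 = 0` and `f` self-conjugate then `f = L_0`. -/
lemma selfconj_phase (L : ZMod 4 → DR) (f : DC) (hf : f = ∑ k, ph k * cR (L k))
    (h2 : L 2 = 0) (hc : dconj f = f) : f = cR (L 0) := by
  have e : f = cR (L 0) + ph 1 * cR (L 1 - L 3) := by
    rw [hf, sum_zmod4, h2, ph_zero]
    have h3 : ph 3 = - ph 1 := by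
      apply TrivSqZeroExt.ext <;> simp [ph_eq, phc]
      change Complex.I ^ 3 = - Complex.I ^ 1
      simp [Complex.I_pow_three]
    rw [h3, map_zero, map_sub]; ring
  have hph : dconj (ph 1) = - ph 1 := by
    have : (1 : ZMod 4) = -3 := by decide
    rw [this, ph_neg]
    have h3 : ph 3 = - ph 1 := by
      apply TrivSqZeroExt.ext <;> simp [ph_eq, phc]
      change Complex.I ^ 3 = - Complex.I ^ 1
      simp [Complex.I_pow_three]
    rw [← ph_neg, ← ph_neg, neg_neg, h3, ← this]
  rw [e, map_add, map_mul, dconj_cR, dconj_cR, hph] at hc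
  have h0 : ph 1 * cR (L 1 - L 3) = 0 := by
    have : (2 : DC) * (ph 1 * cR (L 1 - L 3)) = 0 := by linear_combination -hc
    have h2' : (2 : DC) * TrivSqZeroExt.inl (1 / 2 : ℂ) = 1 := by
      rw [two_mul]
      apply TrivSqZeroExt.ext
      · simp only [TrivSqZeroExt.fst_add, TrivSqZeroExt.fst_inl, TrivSqZeroExt.fst_one]; norm_num
      · simp
    linear_combination (TrivSqZeroExt.inl (1 / 2 : ℂ)) * this - (ph 1 * cR (L 1 - L 3)) * h2'
  rw [e, h0, add_zero]
  
/-- The real part extracts the `k = 0` term when `L_2 = 0`. -/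
lemma dre_phase (L : ZMod 4 → DR) (f : DC) (hf : f = ∑ k, ph k * cR (L k))
    (h2 : L 2 = 0) : (L 0).snd ≤ ‖f.snd‖ := by
  have e : f.snd.re = (L 0).snd := by
    rw [hf, sum_zmod4, h2]
    simp only [TrivSqZeroExt.snd_add, dc_snd_mul, cR_snd, cR_fst, Complex.add_re, ph_eq,
      TrivSqZeroExt.snd_inl, TrivSqZeroExt.fst_inl, phc]
    change (Complex.I ^ 0 * ((L 0).snd : ℂ) + 0 * _).re + (Complex.I ^ 1 * ((L 1).snd : ℂ) + 0 * _).re +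
      (_ * ((0 : DR).snd : ℂ) + 0 * _).re + (Complex.I ^ 3 * ((L 3).snd : ℂ) + 0 * _).re = _
    simp [Complex.I_pow_three]
  rw [← e]; exact Complex.re_le_norm _
set_option linter.unusedSectionVars false
/-! ### Multigraphs with phases -/

structure MG (V E : Type) where
  src : E → V
  tgt : E → V
  w : E → ZMod 4
  wt : E → DR
  wt_nonneg : ∀ e, 0 ≤ wt e
  rev : E → E
  rev_rev : ∀ e, rev (rev e) = e
  src_rev : ∀ e, src (rev e) = tgt e
  w_rev : ∀ e, w (rev e) = - w e
  wt_rev : ∀ e, wt (rev e) = wt e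

namespace MG

variable {V E : Type} [Fintype V] [DecidableEq V] [Fintype E] (G : MG V E)

/-- Walks (lists of darts) from `a` to `b` in `D`. -/
def WkIn (D : Finset V) : V → V → List E → Prop
  | a, b, [] => a = b ∧ a ∈ D
  | a, b, d :: ds => G.src d = a ∧ a ∈ D ∧ WkIn D (G.tgt d) b ds

/-- Phase class of a list of darts. -/
def cl (ds : List E) : ZMod 4 := (ds.map G.w).sum
/-- Weight of a list of darts. -/
def wtl (ds : List E) : DR := (ds.map G.wt).prod

lemma cl_append (l1 l2 : List E) : G.cl (l1 ++ l2) = G.cl l1 + G.cl l2 := by simp [cl]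
lemma cl_cons (d : E) (l : List E) : G.cl (d :: l) = G.w d + G.cl l := by simp [cl]
lemma wtl_append (l1 l2 : List E) : G.wtl (l1 ++ l2) = G.wtl l1 * G.wtl l2 := by simp [wtl]
lemma wtl_cons (d : E) (l : List E) : G.wtl (d :: l) = G.wt d * G.wtl l := by simp [wtl]
lemma wtl_nonneg (l : List E) : 0 ≤ G.wtl l := by
  induction l with
  | nil => simp [wtl]
  | cons d l ih => rw [wtl_cons]; exact mul_nonneg (G.wt_nonneg d) ih

lemma WkIn_append {D : Finset V} {a b : V} {l1 l2 : List E} :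
    G.WkIn D a b (l1 ++ l2) ↔ ∃ c, G.WkIn D a c l1 ∧ G.WkIn D c b l2 := by
  induction l1 generalizing a with
  | nil =>
    constructor
    · intro h
      refine ⟨a, ⟨rfl, ?_⟩, h⟩
      cases l2 with
      | nil => exact h.2
      | cons d l => exact h.2.1
    · rintro ⟨c, ⟨rfl, _⟩, h⟩; exact h
  | cons d l ih =>
    simp only [List.cons_append, WkIn, ih]
    constructor
    · rintro ⟨h1, h2, c, h3, h4⟩; exact ⟨c, ⟨h1, h2, h3⟩, h4⟩
    · rintro ⟨c, ⟨h1, h2, h3⟩, h4⟩; exact ⟨h1, h2, c, h3, h4⟩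

lemma WkIn_mono {D D' : Finset V} (h : D ⊆ D') {a b : V} {l : List E} (hl : G.WkIn D a b l) :
    G.WkIn D' a b l := by
  induction l generalizing a with
  | nil => exact ⟨hl.1, h hl.2⟩
  | cons d l ih => exact ⟨hl.1, h hl.2.1, ih hl.2.2⟩

lemma WkIn_start {D : Finset V} {a b : V} {l : List E} (hl : G.WkIn D a b l) : a ∈ D := by
  cases l with
  | nil => exact hl.2
  | cons d l => exact hl.2.1

lemma WkIn_end {D : Finset V} {a b : V} {l : List E} (hl : G.WkIn D a b l) : b ∈ D := by
  induction l generalizing a with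
  | nil => exact hl.1 ▸ hl.2
  | cons d l ih => exact ih hl.2.2

lemma WkIn_src {D : Finset V} {a b : V} {l : List E} (hl : G.WkIn D a b l) :
    ∀ d ∈ l, G.src d ∈ D := by
  induction l generalizing a with
  | nil => simp
  | cons d l ih =>
    intro e he
    rcases List.mem_cons.mp he with rfl | h
    · rw [hl.1]; exact hl.2.1
    · exact ih hl.2.2 e h

/-- Good lists: closed subwalks have trivial class. -/
def Good (ds : List E) : Prop :=
  ∀ l1 l2 l3 c, ds = l1 ++ l2 ++ l3 → G.WkIn Finset.univ c c l2 → G.cl l2 = 0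

lemma Good.middle {ds l1 l2 l3 : List E} (h : G.Good ds) (e : ds = l1 ++ l2 ++ l3) :
    G.Good l2 := by
  intro m1 m2 m3 c hm hw
  exact h (l1 ++ m1) m2 (m3 ++ l3) c (by rw [e, hm]; simp) hw

lemma first_return {D : Finset V} {a b : V} {ds : List E} (h : G.WkIn D b a ds) (hb : b ≠ a) :
    ∃ mid d rest, ds = mid ++ d :: rest ∧ G.WkIn (D.erase a) b (G.src d) mid ∧
      G.tgt d = a ∧ G.WkIn D a a rest := by
  induction ds generalizing b with
  | nil => exact absurd h.1 hb
  | cons d ds ih =>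
    obtain ⟨h1, h2, h3⟩ := h
    by_cases ht : G.tgt d = a
    · exact ⟨[], d, ds, rfl, ⟨h1.symm, Finset.mem_erase.mpr ⟨hb, h2⟩⟩, ht, ht ▸ h3⟩
    · obtain ⟨mid, d', rest, e, k1, k2, k3⟩ := ih h3 ht
      exact ⟨d :: mid, d', rest, by rw [e]; rfl, ⟨h1, Finset.mem_erase.mpr ⟨hb, h2⟩, k1⟩, k2, k3⟩

lemma last_visit {D : Finset V} {a b c : V} {ds : List E} (h : G.WkIn D c b ds) (hb : b ≠ a) :
    (G.WkIn (D.erase a) c b ds) ∨ ∃ lp d rest, ds = lp ++ d :: rest ∧ G.WkIn D c a lp ∧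
      G.src d = a ∧ G.WkIn (D.erase a) (G.tgt d) b rest := by
  induction ds generalizing c with
  | nil => exact Or.inl ⟨h.1, Finset.mem_erase.mpr ⟨h.1 ▸ hb, h.2⟩⟩
  | cons d ds ih =>
    obtain ⟨h1, h2, h3⟩ := h
    rcases ih h3 with k | ⟨lp, d', rest, e, k1, k2, k3⟩
    · by_cases hc : c = a
      · exact Or.inr ⟨[], d, ds, rfl, ⟨hc, h2⟩, by rw [h1, hc], k⟩
      · exact Or.inl ⟨h1, Finset.mem_erase.mpr ⟨hc, h2⟩, k⟩
    · exact Or.inr ⟨d :: lp, d', rest, by rw [e]; rfl, ⟨h1, h2, k1⟩, k2, k3⟩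

/-- Lists of length at most `L`. -/
def words (E : Type) [Fintype E] (L : ℕ) : Finset (List E) := (List.finite_length_le E L).toFinset

lemma mem_words {L : ℕ} {l : List E} : l ∈ words E L ↔ l.length ≤ L := by simp [words]

/-- Truncated good mass. -/
def gg (D : Finset V) (L : ℕ) (a b : V) (k : ZMod 4) : DR :=
  ∑ ds ∈ words E L, if G.WkIn D a b ds ∧ G.Good ds ∧ G.cl ds = k then G.wtl ds else 0

lemma sum_le_of_cover {ι γ : Type*} (M : Finset γ) (T : Finset ι) (F : ι → γ) (f : γ → DR)
    (g : ι → DR) (hg : ∀ t ∈ T, 0 ≤ g t) (h : ∀ m ∈ M, f m ≠ 0 → ∃ t ∈ T, F t = m ∧ f m ≤ g t) :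
    ∑ m ∈ M, f m ≤ ∑ t ∈ T, g t := by
  classical
  rw [← Finset.sum_filter_ne_zero]
  have h' : ∀ m : {m // m ∈ M.filter (fun m => f m ≠ 0)}, ∃ t ∈ T, F t = m.1 ∧ f m.1 ≤ g t := by
    intro m
    have := Finset.mem_filter.mp m.2
    exact h m.1 this.1 this.2
  choose i hi using h'
  have hinj : Function.Injective i := by
    intro m m' e
    apply Subtype.ext
    rw [← (hi m).2.1, ← (hi m').2.1, e]
  calc ∑ m ∈ M.filter (fun m => f m ≠ 0), f m
      = ∑ m ∈ (M.filter (fun m => f m ≠ 0)).attach, f m.1 := (Finset.sum_attach _ _).symm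
    _ ≤ ∑ m ∈ (M.filter (fun m => f m ≠ 0)).attach, g (i m) :=
        Finset.sum_le_sum (fun m _ => (hi m).2.2)
    _ = ∑ t ∈ (M.filter (fun m => f m ≠ 0)).attach.image i, g t :=
        (Finset.sum_image (fun x _ y _ e => hinj e)).symm
    _ ≤ ∑ t ∈ T, g t := by
        apply Finset.sum_le_sum_of_subset_of_nonneg
        · intro t ht
          obtain ⟨m, _, rfl⟩ := Finset.mem_image.mp ht
          exact (hi m).1
        · intro t ht _; exact hg t ht

lemma gg_nonneg (D : Finset V) (L : ℕ) (a b : V) (k : ZMod 4) : 0 ≤ G.gg D L a b k := by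
  apply Finset.sum_nonneg
  intro ds _
  split_ifs
  · exact G.wtl_nonneg ds
  · exact le_rfl

/-- Bound for good walks between distinct points. -/
lemma gg_ne_le (D : Finset V) (L : ℕ) {a b : V} (hab : b ≠ a) (k : ZMod 4) :
    G.gg D L a b k ≤ G.gg D L a a 0 *
      ∑ d, if G.src d = a ∧ G.tgt d ∈ D.erase a then
        G.wt d * G.gg (D.erase a) L (G.tgt d) b (k - G.w d) else 0 := by
  have key : G.gg D L a b k ≤ ∑ t ∈ (words E L) ×ˢ ((Finset.univ : Finset E) ×ˢ (words E L)),
      (if G.WkIn D a a t.1 ∧ G.Good t.1 ∧ G.cl t.1 = 0 then G.wtl t.1 else 0) *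
      (if G.src t.2.1 = a ∧ G.tgt t.2.1 ∈ D.erase a then G.wt t.2.1 *
        (if G.WkIn (D.erase a) (G.tgt t.2.1) b t.2.2 ∧ G.Good t.2.2 ∧
          G.cl t.2.2 = k - G.w t.2.1 then G.wtl t.2.2 else 0) else 0) := by
    apply sum_le_of_cover _ _ (fun t => t.1 ++ t.2.1 :: t.2.2)
    · intro t _
      apply mul_nonneg
      · split_ifs
        · exact G.wtl_nonneg _
        · exact le_rfl
      · split_ifs
        · exact mul_nonneg (G.wt_nonneg _) (G.wtl_nonneg _)
        · simp
        · exact le_rfl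
    · intro ds hds hne
      by_cases hc : G.WkIn D a b ds ∧ G.Good ds ∧ G.cl ds = k
      swap
      · exact absurd (if_neg hc) hne
      obtain ⟨hw, hg, hk⟩ := hc
      have hlen := mem_words.mp hds
      rcases G.last_visit hw hab with h | ⟨lp, d, rest, e, h1, h2, h3⟩
      · exact absurd (G.WkIn_start h) (by simp)
      · have hgl : G.Good lp := Good.middle G (l1 := []) (l3 := d :: rest) hg (by simp [e])
        have hgr : G.Good rest := Good.middle G (l1 := lp ++ [d]) (l3 := []) hg (by simp [e])
        have hcl : G.cl lp = 0 := hg [] lp (d :: rest) a (by simp [e])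
          (G.WkIn_mono (Finset.subset_univ _) h1)
        have hl1 : lp.length ≤ L := by rw [e] at hlen; simp at hlen; omega
        have hl2 : rest.length ≤ L := by rw [e] at hlen; simp at hlen; omega
        have hclr : G.cl rest = k - G.w d := by
          rw [e, cl_append, cl_cons, hcl] at hk
          rw [← hk]; ring
        refine ⟨(lp, d, rest), ?_, e.symm, ?_⟩
        · simp [mem_words, hl1, hl2]
        · rw [if_pos ⟨hw, hg, hk⟩]
          simp only
          rw [if_pos ⟨h1, hgl, hcl⟩, if_pos ⟨h2, G.WkIn_start h3⟩, if_pos ⟨h3, hgr, hclr⟩, e,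
            wtl_append, wtl_cons]
  refine key.trans (le_of_eq ?_)
  rw [Finset.sum_product]
  unfold gg
  rw [Finset.sum_mul]
  refine Finset.sum_congr rfl (fun lp _ => ?_)
  dsimp only
  rw [Finset.mul_sum, Finset.sum_product]
  refine Finset.sum_congr rfl (fun d _ => ?_)
  dsimp only
  by_cases h : G.src d = a ∧ G.tgt d ∈ D.erase a
  · simp only [if_pos h]
    rw [Finset.mul_sum, Finset.mul_sum]
  · simp only [if_neg h, mul_zero, Finset.sum_const_zero]

/-- Class-`0` first-return mass. -/
def ell (g : V → V → ZMod 4 → DR) (D : Finset V) (a : V) (k : ZMod 4) : DR :=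
  (∑ d, if G.src d = a ∧ G.tgt d = a ∧ G.w d = k then G.wt d else 0) +
  ∑ d, ∑ d', if (G.src d = a ∧ G.tgt d ∈ D.erase a) ∧ (G.src d' ∈ D.erase a ∧ G.tgt d' = a) then
    G.wt d * g (G.tgt d) (G.src d') (k - G.w d - G.w d') * G.wt d' else 0

lemma gg_zero (D : Finset V) (a : V) (ha : a ∈ D) : G.gg D 0 a a 0 = 1 := by
  have : words E 0 = {[]} := by
    ext l; simp [mem_words]
  unfold gg
  rw [this, Finset.sum_singleton, if_pos]
  · simp [wtl]
  · refine ⟨⟨rfl, ha⟩, ?_, by simp [cl]⟩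
    intro l1 l2 l3 c e _
    have : l2 = [] := by
      have := congrArg List.length e
      simp at this
      exact List.length_eq_zero_iff.mp (by omega)
    simp [this, cl]

lemma gg_self_le (D : Finset V) (L : ℕ) {a : V} (ha : a ∈ D) :
    G.gg D (L + 1) a a 0 ≤ 1 + G.ell (G.gg (D.erase a) L) D a 0 * G.gg D L a a 0 := by
  let F : (Unit ⊕ ((E × List E) ⊕ ((E × E) × (List E × List E)))) → List E := fun t =>
    match t with
    | Sum.inl _ => []
    | Sum.inr (Sum.inl p) => p.1 :: p.2
    | Sum.inr (Sum.inr p) => p.1.1 :: (p.2.1 ++ p.1.2 :: p.2.2)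
  let g : (Unit ⊕ ((E × List E) ⊕ ((E × E) × (List E × List E)))) → DR := fun t =>
    match t with
    | Sum.inl _ => 1
    | Sum.inr (Sum.inl p) => (if G.src p.1 = a ∧ G.tgt p.1 = a ∧ G.w p.1 = 0 then G.wt p.1 else 0) *
        (if G.WkIn D a a p.2 ∧ G.Good p.2 ∧ G.cl p.2 = 0 then G.wtl p.2 else 0)
    | Sum.inr (Sum.inr p) => (if (G.src p.1.1 = a ∧ G.tgt p.1.1 ∈ D.erase a) ∧
          (G.src p.1.2 ∈ D.erase a ∧ G.tgt p.1.2 = a) then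
          G.wt p.1.1 * (if G.WkIn (D.erase a) (G.tgt p.1.1) (G.src p.1.2) p.2.1 ∧ G.Good p.2.1 ∧
            G.cl p.2.1 = 0 - G.w p.1.1 - G.w p.1.2 then G.wtl p.2.1 else 0) * G.wt p.1.2 else 0) *
        (if G.WkIn D a a p.2.2 ∧ G.Good p.2.2 ∧ G.cl p.2.2 = 0 then G.wtl p.2.2 else 0)
  have key : G.gg D (L + 1) a a 0 ≤ ∑ t ∈ (Finset.univ : Finset Unit).disjSum
      (((Finset.univ : Finset E) ×ˢ words E L).disjSum
        ((Finset.univ : Finset (E × E)) ×ˢ (words E L ×ˢ words E L))), g t := by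
    apply sum_le_of_cover _ _ F
    · rintro (t | t | t) _
      · exact zero_le_one
      · apply mul_nonneg <;> split_ifs <;>
          first | exact G.wtl_nonneg _ | exact G.wt_nonneg _ | exact le_rfl
      · apply mul_nonneg <;> split_ifs <;>
          first
          | exact G.wtl_nonneg _
          | exact mul_nonneg (mul_nonneg (G.wt_nonneg _) (G.wtl_nonneg _)) (G.wt_nonneg _)
          | exact le_rfl
          | simp
    · intro ds hds hne
      by_cases hc : G.WkIn D a a ds ∧ G.Good ds ∧ G.cl ds = 0
      swap
      · exact absurd (if_neg hc) hne
      rw [if_pos hc]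
      obtain ⟨hw, hg, hk⟩ := hc
      have hlen := mem_words.mp hds
      cases ds with
      | nil => exact ⟨Sum.inl (), by simp, rfl, by simp [g, wtl]⟩
      | cons d ds =>
        obtain ⟨h1, h2, h3⟩ := hw
        by_cases ht : G.tgt d = a
        · rw [ht] at h3
          have hgr : G.Good ds := Good.middle G (l1 := [d]) (l3 := []) hg (by simp)
          have hcl : G.cl ds = 0 := hg [d] ds [] a (by simp)
            (G.WkIn_mono (Finset.subset_univ _) h3)
          have hwd : G.w d = 0 := by rw [cl_cons, hcl, add_zero] at hk; exact hk
          refine ⟨Sum.inr (Sum.inl (d, ds)), ?_, rfl, ?_⟩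
          · simp [mem_words]; simpa using hlen
          · simp only [g]
            rw [if_pos ⟨h1, ht, hwd⟩, if_pos ⟨h3, hgr, hcl⟩, wtl_cons]
        · obtain ⟨mid, d', rest, e, k1, k2, k3⟩ := G.first_return h3 ht
          have hgr : G.Good rest := Good.middle G (l1 := d :: (mid ++ [d'])) (l3 := []) hg
            (by simp [e])
          have hgm : G.Good mid := Good.middle G (l1 := [d]) (l3 := d' :: rest) hg (by simp [e])
          have hcl : G.cl rest = 0 := hg (d :: (mid ++ [d'])) rest [] a (by simp [e])
            (G.WkIn_mono (Finset.subset_univ _) k3)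
          have hclm : G.cl mid = 0 - G.w d - G.w d' := by
            rw [e, cl_cons, cl_append, cl_cons, hcl] at hk
            rw [← hk]; ring
          refine ⟨Sum.inr (Sum.inr ((d, d'), (mid, rest))), ?_, by simp [F, e], ?_⟩
          · rw [e] at hlen
            simp at hlen
            simp [mem_words]; omega
          · simp only [g]
            rw [if_pos ⟨⟨h1, G.WkIn_start k1⟩, G.WkIn_end k1, k2⟩,
              if_pos ⟨k1, hgm, hclm⟩, if_pos ⟨k3, hgr, hcl⟩, e, wtl_cons, wtl_append, wtl_cons]
            apply le_of_eq; ring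
  refine key.trans (le_of_eq ?_)
  rw [Finset.sum_disjSum, Finset.sum_disjSum]
  simp only [g, Finset.univ_unique, Finset.sum_singleton]
  congr 1
  unfold ell
  rw [add_mul]
  congr 1
  · rw [Finset.sum_product]
    simp only
    unfold gg
    rw [Finset.sum_mul]
    refine Finset.sum_congr rfl (fun d _ => ?_)
    rw [Finset.mul_sum]
  · rw [Finset.sum_product, Finset.sum_mul, Fintype.sum_prod_type]
    refine Finset.sum_congr rfl (fun d _ => ?_)
    rw [Finset.sum_mul]
    refine Finset.sum_congr rfl (fun d' _ => ?_)
    rw [Finset.sum_product]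
    simp only
    unfold gg
    split_ifs with h
    · rw [Finset.mul_sum, Finset.mul_sum, Finset.sum_mul]
      rw [Finset.sum_comm]
      refine Finset.sum_congr rfl (fun m _ => ?_)
      rw [Finset.sum_mul]
    · simp

end MG
set_option linter.unusedSectionVars false
namespace MG
open Matrix

variable {V E : Type} [Fintype V] [DecidableEq V] [Fintype E] (G : MG V E)

/-- Phase adjacency matrix. -/
def B (a b : V) : DC := ∑ e, if G.src e = a ∧ G.tgt e = b then ph (G.w e) * cR (G.wt e) else 0

/-- Restricted phase adjacency matrix. -/
def Am (D : Finset V) : Matrix V V DC := fun a b => if a ∈ D ∧ b ∈ D then G.B a b else 0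

/-- Phase Green function. -/
def Gam (D : Finset V) : Matrix V V DC := (1 - G.Am D)⁻¹

lemma tgt_rev (e : E) : G.tgt (G.rev e) = G.src e := by
  have := G.src_rev (G.rev e)
  rw [G.rev_rev] at this; exact this.symm

lemma dconj_B (a b : V) : dconj (G.B a b) = G.B b a := by
  unfold B
  rw [map_sum]
  refine Fintype.sum_equiv ⟨G.rev, G.rev, G.rev_rev, G.rev_rev⟩ _ _ (fun e => ?_)
  simp only [Equiv.coe_fn_mk, G.src_rev, G.tgt_rev, G.w_rev, G.wt_rev]
  by_cases h : G.src e = a ∧ G.tgt e = b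
  · rw [if_pos h, if_pos ⟨h.2, h.1⟩, map_mul, ph_neg, dconj_cR]
  · rw [if_neg h, if_neg (fun h' => h ⟨h'.2, h'.1⟩), map_zero]


lemma M_Gam (hU : ∀ D, IsUnit (1 - G.Am D).det) (D : Finset V) : (1 - G.Am D) * G.Gam D = 1 := Matrix.mul_nonsing_inv _ (hU D)
lemma Gam_M (hU : ∀ D, IsUnit (1 - G.Am D).det) (D : Finset V) : G.Gam D * (1 - G.Am D) = 1 := Matrix.nonsing_inv_mul _ (hU D)

lemma Gam_herm (hU : ∀ D, IsUnit (1 - G.Am D).det) (D : Finset V) (a b : V) : dconj (G.Gam D a b) = G.Gam D b a := by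
  have h1 : ((1 - G.Am D).map dconj)ᵀ = 1 - G.Am D := by
    ext1 x y
    simp only [transpose_apply, map_apply, Matrix.sub_apply, map_sub]
    congr 1
    · rw [one_apply, one_apply]
      by_cases h : x = y
      · simp [h]
      · rw [if_neg h, if_neg (Ne.symm h), map_zero]
    · unfold Am
      by_cases h : x ∈ D ∧ y ∈ D
      · rw [if_pos h, if_pos h.symm, dconj_B]
      · rw [if_neg h, if_neg (fun h' => h h'.symm), map_zero]
  have h2 : ((G.Gam D).map dconj)ᵀ * (1 - G.Am D) = 1 := by
    have := congrArg (fun M : Matrix V V DC => (M.map dconj)ᵀ) (G.M_Gam hU D)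
    simp only [Matrix.map_mul, transpose_mul, h1] at this
    rw [this, Matrix.map_one _ (map_zero _) (map_one _), transpose_one]
  have h3 : ((G.Gam D).map dconj)ᵀ = G.Gam D := by
    calc ((G.Gam D).map dconj)ᵀ = ((G.Gam D).map dconj)ᵀ * ((1 - G.Am D) * G.Gam D) := by
          rw [G.M_Gam hU, Matrix.mul_one]
      _ = G.Gam D := by rw [← Matrix.mul_assoc, h2, Matrix.one_mul]
  have := congrFun (congrFun h3 b) a
  simpa using this

lemma Gam_out (hU : ∀ D, IsUnit (1 - G.Am D).det) (D : Finset V) (c b : V) (hb : b ∉ D) (hcb : c ≠ b) : G.Gam D c b = 0 := by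
  have := congrFun (congrFun (G.Gam_M hU D) c) b
  rw [Matrix.mul_sub, Matrix.mul_one, Matrix.sub_apply, mul_apply] at this
  have h0 : ∑ j, G.Gam D c j * G.Am D j b = 0 := by
    apply Finset.sum_eq_zero; intro j _
    simp [Am, hb]
  rw [h0, sub_zero, one_apply_ne hcb] at this
  exact this

lemma Gam_eq (hU : ∀ D, IsUnit (1 - G.Am D).det) (D : Finset V) (c b : V) :
    G.Gam D c b = (1 : Matrix V V DC) c b + ∑ j, G.Am D c j * G.Gam D j b := by
  have := congrFun (congrFun (G.M_Gam hU D) c) b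
  rw [Matrix.sub_mul, Matrix.one_mul, Matrix.sub_apply, mul_apply] at this
  rw [← this]; ring

lemma Am_sum (D : Finset V) (c : V) (hc : c ∈ D) (g : V → DC) :
    ∑ j, G.Am D c j * g j = ∑ j ∈ D, G.B c j * g j := by
  rw [← Finset.sum_subset (Finset.subset_univ D)]
  · refine Finset.sum_congr rfl (fun j hj => ?_)
    simp [Am, hc, hj]
  · intro j _ hj; simp [Am, hj]

lemma Gam_eq' (hU : ∀ D, IsUnit (1 - G.Am D).det) (D : Finset V) (c b : V) (hc : c ∈ D) :
    G.Gam D c b = (1 : Matrix V V DC) c b + ∑ j ∈ D, G.B c j * G.Gam D j b := by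
  rw [G.Gam_eq hU D c b, G.Am_sum D c hc]

/-- Schur complement step. -/
lemma Gam_schur (hU : ∀ D, IsUnit (1 - G.Am D).det) (D : Finset V) (a c b : V) (ha : a ∈ D) (hc : c ∈ D.erase a) :
    G.Gam D c b = ∑ j ∈ D.erase a, G.Gam (D.erase a) c j *
      ((1 : Matrix V V DC) j b + G.B j a * G.Gam D a b) := by
  set D' := D.erase a with hD'
  have e : G.Gam D c b = ∑ j, G.Gam D' c j * ((1 - G.Am D') * G.Gam D) j b := by
    rw [← mul_apply, ← Matrix.mul_assoc, G.Gam_M hU, Matrix.one_mul]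
  rw [e, ← Finset.sum_subset (Finset.subset_univ D')]
  · refine Finset.sum_congr rfl (fun j hj => ?_)
    congr 1
    rw [Matrix.sub_mul, Matrix.one_mul, Matrix.sub_apply, mul_apply, G.Am_sum D' j hj,
      G.Gam_eq' hU D j b (Finset.mem_of_mem_erase hj), ← Finset.add_sum_erase D _ ha]
    ring
  · intro j _ hj
    rw [G.Gam_out hU D' c j hj (fun h => hj (h ▸ hc)), zero_mul]

/-- Return matrix element. -/
lemma Gam_first (hU : ∀ D, IsUnit (1 - G.Am D).det) (D : Finset V) (a b : V) (ha : a ∈ D) (hb : b ∈ D) :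
    (1 - (G.B a a + ∑ c ∈ D.erase a, ∑ j ∈ D.erase a, G.B a c * G.Gam (D.erase a) c j * G.B j a)) *
      G.Gam D a b = if a = b then 1 else ∑ c ∈ D.erase a, G.B a c * G.Gam (D.erase a) c b := by
  have e := G.Gam_eq' hU D a b ha
  rw [← Finset.add_sum_erase D _ ha] at e
  have e2 : ∑ c ∈ D.erase a, G.B a c * G.Gam D c b =
      (∑ c ∈ D.erase a, G.B a c * ∑ j ∈ D.erase a, G.Gam (D.erase a) c j * (1 : Matrix V V DC) j b)
      + (∑ c ∈ D.erase a, ∑ j ∈ D.erase a, G.B a c * G.Gam (D.erase a) c j * G.B j a)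
        * G.Gam D a b := by
    rw [Finset.sum_mul, ← Finset.sum_add_distrib]
    refine Finset.sum_congr rfl (fun c hc => ?_)
    rw [G.Gam_schur hU D a c b ha hc, Finset.mul_sum, Finset.mul_sum, Finset.sum_mul,
      ← Finset.sum_add_distrib]
    refine Finset.sum_congr rfl (fun j hj => ?_)
    ring
  rw [e2] at e
  by_cases hab : a = b
  · subst hab
    rw [if_pos rfl]
    have z : ∑ c ∈ D.erase a, G.B a c * ∑ j ∈ D.erase a, G.Gam (D.erase a) c j *
        (1 : Matrix V V DC) j a = 0 := by
      apply Finset.sum_eq_zero; intro c _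
      rw [Finset.sum_eq_zero, mul_zero]
      intro j hj
      rw [one_apply_ne (Finset.ne_of_mem_erase hj), mul_zero]
    rw [z, one_apply_eq, zero_add] at e
    linear_combination e
  · rw [if_neg hab]
    have z : ∑ c ∈ D.erase a, G.B a c * ∑ j ∈ D.erase a, G.Gam (D.erase a) c j *
        (1 : Matrix V V DC) j b = ∑ c ∈ D.erase a, G.B a c * G.Gam (D.erase a) c b := by
      refine Finset.sum_congr rfl (fun c _ => ?_)
      rw [Finset.sum_eq_single b]
      · simp
      · intro j _ hj; rw [one_apply_ne hj, mul_zero]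
      · intro h; exact absurd (Finset.mem_erase.mpr ⟨Ne.symm hab, hb⟩) h
    rw [z, one_apply_ne hab, zero_add] at e
    linear_combination e

lemma sum_B_left (a : V) (S : Finset V) (g : V → DC) :
    ∑ c ∈ S, G.B a c * g c =
      ∑ d, if G.src d = a ∧ G.tgt d ∈ S then ph (G.w d) * cR (G.wt d) * g (G.tgt d) else 0 := by
  unfold B
  simp only [Finset.sum_mul]
  rw [Finset.sum_comm]
  refine Finset.sum_congr rfl (fun d _ => ?_)
  by_cases h : G.src d = a ∧ G.tgt d ∈ S
  · rw [if_pos h, Finset.sum_eq_single (G.tgt d)]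
    · rw [if_pos ⟨h.1, rfl⟩]
    · intro c _ hc; rw [if_neg (fun h' => hc h'.2.symm), zero_mul]
    · intro h'; exact absurd h.2 h'
  · rw [if_neg h]
    apply Finset.sum_eq_zero
    intro c hc
    rw [if_neg, zero_mul]
    rintro ⟨h1, rfl⟩; exact h ⟨h1, hc⟩

lemma sum_B_right (a : V) (S : Finset V) (g : V → DC) :
    ∑ c ∈ S, g c * G.B c a =
      ∑ d, if G.src d ∈ S ∧ G.tgt d = a then g (G.src d) * (ph (G.w d) * cR (G.wt d)) else 0 := by
  unfold B
  simp only [Finset.mul_sum]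
  rw [Finset.sum_comm]
  refine Finset.sum_congr rfl (fun d _ => ?_)
  by_cases h : G.src d ∈ S ∧ G.tgt d = a
  · rw [if_pos h, Finset.sum_eq_single (G.src d)]
    · rw [if_pos ⟨rfl, h.2⟩]
    · intro c _ hc; rw [if_neg (fun h' => hc h'.1.symm), mul_zero]
    · intro h'; exact absurd h.1 h'
  · rw [if_neg h]
    apply Finset.sum_eq_zero
    intro c hc
    rw [if_neg, mul_zero]
    rintro ⟨rfl, h1⟩; exact h ⟨hc, h1⟩

lemma phase_shift (N : ZMod 4 → DR) (u : ZMod 4) :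
    ph u * ∑ k, ph k * cR (N k) = ∑ k, ph k * cR (N (k - u)) := by
  rw [Finset.mul_sum]
  refine Fintype.sum_equiv (Equiv.addRight u) _ _ (fun k => ?_)
  simp only [Equiv.coe_addRight, add_sub_cancel_right]
  rw [ph_add]; ring

/-- The invariant of the induction. -/
structure Inv (D : Finset V) (N : V → V → ZMod 4 → DR) : Prop where
  eq : ∀ a ∈ D, ∀ b ∈ D, G.Gam D a b = ∑ k, ph k * cR (N a b k)
  nonneg : ∀ a ∈ D, ∀ b ∈ D, ∀ k, 0 ≤ N a b k
  simple : ∀ a ∈ D, ∀ b ∈ D, ∀ k, N a b k ≠ 0 →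
    ∃ ds, G.WkIn D a b ds ∧ (ds.map G.src ++ [b]).Nodup ∧ G.cl ds = k
  le : ∀ a ∈ D, ∀ b ∈ D, ∀ k L, G.gg D L a b k ≤ N a b k

/-- No simple closed walk of class 2. -/
def PL : Prop := ∀ c ds, ds ≠ [] → G.WkIn Finset.univ c c ds → (ds.map G.src).Nodup → G.cl ds ≠ 2

lemma ell_two (hPL : G.PL) {D : Finset V} {a : V} (ha : a ∈ D) {N : V → V → ZMod 4 → DR}
    (hN : G.Inv (D.erase a) N) : G.ell N D a 2 = 0 := by
  unfold ell
  rw [Finset.sum_eq_zero, Finset.sum_eq_zero, add_zero]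
  · intro d _
    apply Finset.sum_eq_zero
    intro d' _
    split_ifs with h
    · by_contra hne
      have hn : N (G.tgt d) (G.src d') (2 - G.w d - G.w d') ≠ 0 := by
        intro h0; apply hne; rw [h0]; simp
      obtain ⟨ds, h1, h2, h3⟩ := hN.simple _ h.1.2 _ h.2.1 _ hn
      refine hPL a (d :: (ds ++ [d'])) (by simp) ?_ ?_ ?_
      · refine ⟨h.1.1, Finset.mem_univ _, ?_⟩
        rw [WkIn_append]
        exact ⟨_, G.WkIn_mono (Finset.subset_univ _) h1, rfl, Finset.mem_univ _, h.2.2,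
          Finset.mem_univ _⟩
      · simp only [List.map_cons, List.map_append, List.map_nil]
        rw [List.nodup_cons]
        refine ⟨?_, h2⟩
        rw [h.1.1]
        intro hm
        rcases List.mem_append.mp hm with hm | hm
        · obtain ⟨e, he, hea⟩ := List.mem_map.mp hm
          have := G.WkIn_src h1 e he
          rw [hea] at this
          simp at this
        · simp at hm
          have := h.2.1
          rw [← hm] at this; simp at this
      · rw [cl_cons, cl_append, h3]
        simp [cl]
    · rfl
  · intro d _
    split_ifs with h
    · exfalso
      refine hPL a [d] (by simp) ⟨h.1, Finset.mem_univ _, h.2.1, Finset.mem_univ _⟩ (by simp) ?_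
      simp [cl, h.2.2]
    · rfl

lemma ell_nonneg {D : Finset V} {a : V} {N : V → V → ZMod 4 → DR}
    (hN : ∀ x ∈ D.erase a, ∀ b ∈ D.erase a, ∀ k, 0 ≤ N x b k) (k : ZMod 4) :
    0 ≤ G.ell N D a k := by
  unfold ell
  apply add_nonneg
  · apply Finset.sum_nonneg; intro d _
    split_ifs
    · exact G.wt_nonneg _
    · exact le_rfl
  · apply Finset.sum_nonneg; intro d _
    apply Finset.sum_nonneg; intro d' _
    split_ifs with h
    · exact mul_nonneg (mul_nonneg (G.wt_nonneg _) (hN _ h.1.2 _ h.2.1 _)) (G.wt_nonneg _)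
    · exact le_rfl

lemma ell_mono {D : Finset V} {a : V} {N N' : V → V → ZMod 4 → DR}
    (hN : ∀ x ∈ D.erase a, ∀ b ∈ D.erase a, ∀ k, N x b k ≤ N' x b k) (k : ZMod 4) :
    G.ell N D a k ≤ G.ell N' D a k := by
  unfold ell
  refine add_le_add le_rfl ?_
  apply Finset.sum_le_sum; intro d _
  apply Finset.sum_le_sum; intro d' _
  split_ifs with h
  · exact mul_le_mul_of_nonneg_right
      (mul_le_mul_of_nonneg_left (hN _ h.1.2 _ h.2.1 _) (G.wt_nonneg _)) (G.wt_nonneg _)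
  · exact le_rfl

lemma ret_eq {D : Finset V} {a : V} {N : V → V → ZMod 4 → DR}
    (hN : G.Inv (D.erase a) N) :
    G.B a a + ∑ c ∈ D.erase a, ∑ j ∈ D.erase a, G.B a c * G.Gam (D.erase a) c j * G.B j a =
      ∑ k, ph k * cR (G.ell N D a k) := by
  unfold ell
  simp only [map_add, mul_add, Finset.sum_add_distrib]
  congr 1
  · unfold B
    simp only [map_sum, Finset.mul_sum]
    rw [Finset.sum_comm]
    refine Finset.sum_congr rfl (fun d _ => ?_)
    rw [Finset.sum_eq_single (G.w d)]
    · by_cases h : G.src d = a ∧ G.tgt d = a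
      · rw [if_pos h, if_pos ⟨h.1, h.2, rfl⟩]
      · rw [if_neg h, if_neg (fun h' => h ⟨h'.1, h'.2.1⟩)]; simp
    · intro k _ hk
      rw [if_neg (fun h' => hk h'.2.2.symm)]; simp
    · simp
  · have e1 : ∀ c ∈ D.erase a, ∑ j ∈ D.erase a, G.B a c * G.Gam (D.erase a) c j * G.B j a =
        G.B a c * ∑ d', if G.src d' ∈ D.erase a ∧ G.tgt d' = a then
          G.Gam (D.erase a) c (G.src d') * (ph (G.w d') * cR (G.wt d')) else 0 := by
      intro c _
      rw [← sum_B_right, Finset.mul_sum]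
      exact Finset.sum_congr rfl (fun j _ => by ring)
    rw [Finset.sum_congr rfl e1, sum_B_left]
    simp only [map_sum, Finset.mul_sum]
    rw [Finset.sum_comm]
    refine Finset.sum_congr rfl (fun d _ => ?_)
    rw [Finset.sum_comm]
    by_cases hd : G.src d = a ∧ G.tgt d ∈ D.erase a
    swap
    · rw [if_neg hd]
      symm
      apply Finset.sum_eq_zero; intro d' _
      apply Finset.sum_eq_zero; intro k _
      rw [if_neg (fun h => hd h.1), map_zero, mul_zero]
    rw [if_pos hd]
    refine Finset.sum_congr rfl (fun d' _ => ?_)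
    by_cases hd' : G.src d' ∈ D.erase a ∧ G.tgt d' = a
    swap
    · rw [if_neg hd', mul_zero]
      symm
      apply Finset.sum_eq_zero; intro k _
      rw [if_neg (fun h => hd' h.2), map_zero, mul_zero]
    rw [if_pos hd', hN.eq _ hd.2 _ hd'.1]
    have := phase_shift (N (G.tgt d) (G.src d')) (G.w d + G.w d')
    simp only [if_pos (And.intro hd hd'), map_mul]
    have e2 : ∑ k, ph k * (cR (G.wt d) * cR (N (G.tgt d) (G.src d') (k - G.w d - G.w d')) *
        cR (G.wt d')) = cR (G.wt d) * cR (G.wt d') *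
        ∑ k, ph k * cR (N (G.tgt d) (G.src d') (k - (G.w d + G.w d'))) := by
      rw [Finset.mul_sum]
      refine Finset.sum_congr rfl (fun k _ => ?_)
      rw [sub_sub]; ring
    rw [e2, ← this, ph_add]
    ring

lemma gg_self_ne (D : Finset V) (L : ℕ) (a : V) (k : ZMod 4) (hk : k ≠ 0) :
    G.gg D L a a k = 0 := by
  unfold gg
  apply Finset.sum_eq_zero
  intro ds _
  rw [if_neg]
  rintro ⟨h1, h2, h3⟩
  apply hk
  rw [← h3]
  exact h2 [] ds [] a (by simp) (G.WkIn_mono (Finset.subset_univ _) h1)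

lemma inv_exists (hU : ∀ D, IsUnit (1 - G.Am D).det)
    (hpos : ∀ D, ∀ a ∈ D, 0 ≤ (G.Gam D a a).fst.re) (hPL : G.PL) (D : Finset V) :
    ∃ N, G.Inv D N := by
  induction D using Finset.strongInduction with
  | H D ih =>
  have ih' : ∀ a : V, ∃ N, a ∈ D → G.Inv (D.erase a) N := by
    intro a
    by_cases ha : a ∈ D
    · obtain ⟨N, hN⟩ := ih (D.erase a) (Finset.erase_ssubset ha)
      exact ⟨N, fun _ => hN⟩
    · exact ⟨fun _ _ _ => 0, fun h => absurd h ha⟩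
  choose N' hN' using ih'
  have hret : ∀ a ∈ D, G.B a a + ∑ c ∈ D.erase a, ∑ j ∈ D.erase a,
      G.B a c * G.Gam (D.erase a) c j * G.B j a = cR (G.ell (N' a) D a 0) := by
    intro a ha
    apply selfconj_phase _ _ (G.ret_eq (hN' a ha)) (G.ell_two hPL ha (hN' a ha))
    rw [map_add, dconj_B, map_sum]
    congr 1
    simp only [map_sum, map_mul, dconj_B, G.Gam_herm hU]
    rw [Finset.sum_comm]
    exact Finset.sum_congr rfl (fun c _ => Finset.sum_congr rfl (fun j _ => by ring))
  have hgr : ∀ a ∈ D, cR (dre (G.Gam D a a)) = G.Gam D a a := fun a _ =>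
    cR_dre (G.Gam_herm hU D a a)
  have hmul : ∀ a ∈ D, (1 - G.ell (N' a) D a 0) * dre (G.Gam D a a) = 1 := by
    intro a ha
    apply cR_inj
    rw [map_mul, hgr a ha, map_sub, map_one, ← hret a ha, G.Gam_first hU D a a ha ha, if_pos rfl]
  have hell : ∀ a ∈ D, 0 ≤ G.ell (N' a) D a 0 := fun a ha => G.ell_nonneg (hN' a ha).nonneg 0
  have hgr0 : ∀ a ∈ D, 0 ≤ dre (G.Gam D a a) := by
    intro a ha
    have h1 := congrArg TrivSqZeroExt.fst (hmul a ha)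
    have h2 := congrArg TrivSqZeroExt.snd (hmul a ha)
    rw [dr_fst_mul] at h1
    rw [dr_snd_mul] at h2
    have h3 := (dr_le_def _ _).mp (hell a ha)
    have h4 : 0 ≤ (dre (G.Gam D a a)).fst := by rw [dre_fst]; exact hpos D a ha
    set g := dre (G.Gam D a a)
    set l := G.ell (N' a) D a 0
    simp only [TrivSqZeroExt.fst_sub, TrivSqZeroExt.fst_one, TrivSqZeroExt.snd_sub,
      TrivSqZeroExt.snd_one, TrivSqZeroExt.fst_zero, TrivSqZeroExt.snd_zero] at h1 h2 h3
    rw [dr_le_def]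
    refine ⟨h4, ?_⟩
    simp only [TrivSqZeroExt.snd_zero]
    have : g.snd = g.fst ^ 2 * l.snd := by linear_combination g.fst * h2 - g.snd * h1
    rw [this]; exact mul_nonneg (sq_nonneg _) h3.2
  let N : V → V → ZMod 4 → DR := fun a b k => if a = b then (if k = 0 then dre (G.Gam D a a) else 0)
    else dre (G.Gam D a a) * ∑ d, if G.src d = a ∧ G.tgt d ∈ D.erase a then
      G.wt d * N' a (G.tgt d) b (k - G.w d) else 0
  have hself : ∀ a ∈ D, ∀ L, G.gg D L a a 0 ≤ dre (G.Gam D a a) := by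
    intro a ha L
    have hfix : dre (G.Gam D a a) = 1 + G.ell (N' a) D a 0 * dre (G.Gam D a a) := by
      linear_combination hmul a ha
    induction L with
    | zero =>
      rw [gg_zero _ _ _ ha, hfix]
      exact le_add_of_nonneg_right (mul_nonneg (hell a ha) (hgr0 a ha))
    | succ L ihL =>
      rw [hfix]
      refine (G.gg_self_le D L ha).trans ?_
      refine add_le_add le_rfl ?_
      refine mul_le_mul (G.ell_mono (fun x hx b hb k => (hN' a ha).le x hx b hb k L) 0) ihL
        (G.gg_nonneg _ _ _ _ _) (hell a ha)
  refine ⟨N, ⟨?_, ?_, ?_, ?_⟩⟩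
  · intro a ha b hb
    by_cases hab : a = b
    · subst hab
      rw [Finset.sum_eq_single 0]
      · simp only [N, if_true, ph_zero, one_mul]; exact (hgr a ha).symm
      · intro k _ hk; simp only [N, if_true, if_neg hk, map_zero, mul_zero]
      · simp
    · have e := G.Gam_first hU D a b ha hb
      rw [if_neg hab, hret a ha, sum_B_left] at e
      have hm : (1 - cR (G.ell (N' a) D a 0)) * cR (dre (G.Gam D a a)) = 1 := by
        rw [← map_one cR, ← map_sub, ← map_mul, hmul a ha]
      have e2 : G.Gam D a b = cR (dre (G.Gam D a a)) * ∑ d, if G.src d = a ∧ G.tgt d ∈ D.erase a then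
          ph (G.w d) * cR (G.wt d) * G.Gam (D.erase a) (G.tgt d) b else 0 := by
        linear_combination cR (dre (G.Gam D a a)) * e - G.Gam D a b * hm
      have hbD : b ∈ D.erase a := Finset.mem_erase.mpr ⟨Ne.symm hab, hb⟩
      rw [e2]
      simp only [N, if_neg hab, map_mul]
      have e3 : ∀ k : ZMod 4, ph k * (cR (dre (G.Gam D a a)) * cR (∑ d,
          if G.src d = a ∧ G.tgt d ∈ D.erase a then
            G.wt d * N' a (G.tgt d) b (k - G.w d) else 0)) = cR (dre (G.Gam D a a)) *
          ∑ d, ph k * cR (if G.src d = a ∧ G.tgt d ∈ D.erase a then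
            G.wt d * N' a (G.tgt d) b (k - G.w d) else 0) := by
        intro k; rw [map_sum, ← Finset.mul_sum]; ring
      rw [Finset.sum_congr rfl (fun k _ => e3 k), ← Finset.mul_sum, Finset.sum_comm]
      congr 1
      refine Finset.sum_congr rfl (fun d _ => ?_)
      by_cases hd : G.src d = a ∧ G.tgt d ∈ D.erase a
      · simp only [if_pos hd]
        rw [(hN' a ha).eq _ hd.2 _ hbD]
        have := phase_shift (N' a (G.tgt d) b) (G.w d)
        calc _ = cR (G.wt d) * (ph (G.w d) * ∑ k, ph k * cR (N' a (G.tgt d) b k)) := by ring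
          _ = _ := by
            rw [this, Finset.mul_sum]
            refine Finset.sum_congr rfl (fun k _ => ?_)
            rw [map_mul]; ring
      · simp only [if_neg hd, map_zero, mul_zero, Finset.sum_const_zero]
  · intro a ha b hb k
    simp only [N]
    split_ifs with h1 h2
    · exact hgr0 a ha
    · exact le_rfl
    · apply mul_nonneg (hgr0 a ha)
      apply Finset.sum_nonneg; intro d _
      split_ifs with h
      · exact mul_nonneg (G.wt_nonneg _)
          ((hN' a ha).nonneg _ h.2 _ (Finset.mem_erase.mpr ⟨Ne.symm h1, hb⟩) _)
      · exact le_rfl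
  · intro a ha b hb k hne
    simp only [N] at hne
    split_ifs at hne with h1 h2
    · exact ⟨[], ⟨h1, ha⟩, by simp, by simp [cl, h2]⟩
    · exact absurd rfl hne
    · obtain ⟨d, _, hd⟩ := Finset.exists_ne_zero_of_sum_ne_zero (right_ne_zero_of_mul hne)
      split_ifs at hd with h
      · obtain ⟨ds, k1, k2, k3⟩ := (hN' a ha).simple _ h.2 _
          (Finset.mem_erase.mpr ⟨Ne.symm h1, hb⟩) _ (right_ne_zero_of_mul hd)
        refine ⟨d :: ds, ⟨h.1, ha, G.WkIn_mono (Finset.erase_subset _ _) k1⟩, ?_, ?_⟩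
        · rw [List.map_cons, List.cons_append, List.nodup_cons]
          refine ⟨?_, k2⟩
          rw [h.1]
          intro hm
          rcases List.mem_append.mp hm with hm | hm
          · obtain ⟨e, he, hea⟩ := List.mem_map.mp hm
            have := G.WkIn_src k1 e he
            rw [hea] at this
            simp at this
          · simp at hm; exact h1 hm
        · rw [cl_cons, k3]; ring
      · exact absurd rfl hd
  · intro a ha b hb k L
    simp only [N]
    split_ifs with h1 h2
    · subst h1; rw [h2]; exact hself a ha L
    · subst h1; rw [gg_self_ne _ _ _ _ _ h2]
    · refine (G.gg_ne_le D L (Ne.symm h1) k).trans ?_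
      have hs : ∀ (g : V → V → ZMod 4 → DR), (∀ x ∈ D.erase a, ∀ k, 0 ≤ g x b k) → 0 ≤ ∑ d,
          if G.src d = a ∧ G.tgt d ∈ D.erase a then G.wt d * g (G.tgt d) b (k - G.w d) else 0 := by
        intro g hg
        apply Finset.sum_nonneg; intro d _
        split_ifs with h
        · exact mul_nonneg (G.wt_nonneg _) (hg _ h.2 _)
        · exact le_rfl
      refine mul_le_mul (hself a ha L) ?_ (hs _ (fun _ _ _ => G.gg_nonneg _ _ _ _ _)) (hgr0 a ha)
      apply Finset.sum_le_sum; intro d _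
      split_ifs with h
      · exact mul_le_mul_of_nonneg_left ((hN' a ha).le _ h.2 _
          (Finset.mem_erase.mpr ⟨Ne.symm h1, hb⟩) _ L) (G.wt_nonneg _)
      · exact le_rfl

/-- Main algebraic bound. -/
theorem gg_snd_le (hU : ∀ D, IsUnit (1 - G.Am D).det)
    (hpos : ∀ D, ∀ a ∈ D, 0 ≤ (G.Gam D a a).fst.re) (hPL : G.PL) (a b : V) (c : ZMod 4)
    (hc : ∀ ds, G.WkIn Finset.univ a b ds → (ds.map G.src ++ [b]).Nodup → G.cl ds + c ≠ 2) (L : ℕ) :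
    (G.gg Finset.univ L a b (-c)).snd ≤ ‖(G.Gam Finset.univ a b).snd‖ := by
  obtain ⟨N, hN⟩ := G.inv_exists hU hpos hPL Finset.univ
  have h1 := hN.eq a (Finset.mem_univ _) b (Finset.mem_univ _)
  have h2 : ph c * G.Gam Finset.univ a b = ∑ k, ph k * cR (N a b (k - c)) := by
    rw [h1, phase_shift]
  have h3 := dre_phase (fun k => N a b (k - c)) _ h2 (by
    by_contra hne
    obtain ⟨ds, k1, k2, k3⟩ := hN.simple a (Finset.mem_univ _) b (Finset.mem_univ _) _ hne
    exact hc ds k1 k2 (by rw [k3]; ring))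
  have h4 := ((dr_le_def _ _).mp (hN.le a (Finset.mem_univ _) b (Finset.mem_univ _) (-c) L)).2
  simp only [zero_sub] at h3
  refine h4.trans (h3.trans (le_of_eq ?_))
  rw [dc_snd_mul, ph_eq]
  simp [phc_norm]

end MG
set_option linter.unusedSectionVars false
namespace MG
open Matrix

variable {V E : Type} [Fintype V] [DecidableEq V] [Fintype E] (G : MG V E)

/-- Complex phase adjacency matrix (base part). -/
def B0 (a b : V) : ℂ :=
  ∑ e, if G.src e = a ∧ G.tgt e = b then phc (G.w e) * ((G.wt e).fst : ℂ) else 0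
/-- Base matrix. -/
def A0 (D : Finset V) : Matrix V V ℂ := fun a b => if a ∈ D ∧ b ∈ D then G.B0 a b else 0

lemma B_fst (a b : V) : (G.B a b).fst = G.B0 a b := by
  unfold B B0
  rw [TrivSqZeroExt.fst_sum]
  refine Finset.sum_congr rfl (fun e _ => ?_)
  split_ifs
  · rw [TrivSqZeroExt.fst_mul, cR_fst, ph_eq, TrivSqZeroExt.fst_inl]
  · rfl

lemma B_snd (a b : V) : (G.B a b).snd =
    ∑ e, if G.src e = a ∧ G.tgt e = b then phc (G.w e) * ((G.wt e).snd : ℂ) else 0 := by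
  unfold B
  rw [TrivSqZeroExt.snd_sum]
  refine Finset.sum_congr rfl (fun e _ => ?_)
  split_ifs
  · rw [dc_snd_mul, cR_snd, ph_eq, TrivSqZeroExt.fst_inl, TrivSqZeroExt.snd_inl, zero_mul, add_zero]
  · rfl

lemma map_fst_M (D : Finset V) :
    (TrivSqZeroExt.fstHom ℂ ℂ ℂ).toRingHom.mapMatrix (1 - G.Am D) = 1 - G.A0 D := by
  rw [map_sub, map_one]
  congr 1
  ext1 a b
  simp only [RingHom.mapMatrix_apply, map_apply, Am, A0]
  split_ifs
  · exact G.B_fst a b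
  · exact map_zero _

lemma norm_phc_mul (k : ZMod 4) (x : ℝ) (hx : 0 ≤ x) (z : ℂ) : ‖phc k * (x : ℂ) * z‖ = x * ‖z‖ := by
  rw [norm_mul, norm_mul, phc_norm, one_mul, Complex.norm_real, Real.norm_of_nonneg hx]

lemma wt_fst_nonneg (e : E) : 0 ≤ (G.wt e).fst := ((dr_le_def _ _).mp (G.wt_nonneg e)).1
lemma wt_snd_nonneg (e : E) : 0 ≤ (G.wt e).snd := ((dr_le_def _ _).mp (G.wt_nonneg e)).2

lemma A0_mulVec (D : Finset V) (u : V → ℂ) (a : V) (ha : a ∈ D) :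
    ((G.A0 D).mulVec u) a = ∑ e, if G.src e = a ∧ G.tgt e ∈ D then
      phc (G.w e) * ((G.wt e).fst : ℂ) * u (G.tgt e) else 0 := by
  unfold mulVec dotProduct A0 B0
  simp only
  have : ∀ b, (if a ∈ D ∧ b ∈ D then ∑ e, if G.src e = a ∧ G.tgt e = b then
      phc (G.w e) * ((G.wt e).fst : ℂ) else 0 else 0) * u b =
      ∑ e, if G.tgt e = b then (if G.src e = a ∧ G.tgt e ∈ D then
      phc (G.w e) * ((G.wt e).fst : ℂ) * u (G.tgt e) else 0) else 0 := by
    intro b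
    by_cases hb : b ∈ D
    · rw [if_pos ⟨ha, hb⟩, Finset.sum_mul]
      refine Finset.sum_congr rfl (fun e _ => ?_)
      by_cases h1 : G.tgt e = b
      · rw [if_pos h1]
        by_cases h2 : G.src e = a
        · rw [if_pos ⟨h2, h1⟩, if_pos ⟨h2, h1 ▸ hb⟩, h1]
        · rw [if_neg (fun h => h2 h.1), if_neg (fun h => h2 h.1), zero_mul]
      · rw [if_neg h1, if_neg (fun h => h1 h.2), zero_mul]
    · rw [if_neg (fun h => hb h.2), zero_mul]
      symm; apply Finset.sum_eq_zero; intro e _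
      by_cases h1 : G.tgt e = b
      · rw [if_pos h1, if_neg (fun h => hb (h1 ▸ h.2))]
      · rw [if_neg h1]
  rw [Finset.sum_congr rfl (fun b _ => this b), Finset.sum_comm]
  refine Finset.sum_congr rfl (fun e _ => ?_)
  rw [Finset.sum_ite_eq]
  simp

/-- Strict barrier. -/
def Barrier (h : V → ℝ) : Prop := (∀ a, 0 < h a) ∧
  ∀ a, (∑ e, if G.src e = a then (G.wt e).fst * h (G.tgt e) else 0) < h a

lemma det_ne_zero {h : V → ℝ} (hb : G.Barrier h) (D : Finset V) : (1 - G.A0 D).det ≠ 0 := by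
  intro hd
  obtain ⟨u, hu, hu0⟩ := Matrix.exists_mulVec_eq_zero_iff.mpr hd
  obtain ⟨c, hc⟩ := Function.ne_iff.mp hu
  have : Nonempty V := ⟨c⟩
  obtain ⟨a, ha⟩ := Finite.exists_max (fun v => ‖u v‖ / h v)
  have hpos : 0 < ‖u a‖ / h a :=
    lt_of_lt_of_le (div_pos (norm_pos_iff.mpr hc) (hb.1 c)) (ha c)
  have e := congrFun hu0 a
  rw [Matrix.sub_mulVec, Matrix.one_mulVec, Pi.sub_apply, Pi.zero_apply, sub_eq_zero] at e
  have hua : 0 < ‖u a‖ := by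
    by_contra hh
    have : ‖u a‖ = 0 := le_antisymm (not_lt.mp hh) (norm_nonneg _)
    rw [this] at hpos; simp at hpos
  by_cases haD : a ∈ D
  · rw [G.A0_mulVec D u a haD] at e
    have h1 : ‖u a‖ ≤ ∑ e, if G.src e = a then (G.wt e).fst * (‖u a‖ / h a * h (G.tgt e)) else 0 := by
      conv_lhs => rw [e]
      refine (norm_sum_le _ _).trans (Finset.sum_le_sum (fun d _ => ?_))
      have h2 : ‖u (G.tgt d)‖ ≤ ‖u a‖ / h a * h (G.tgt d) := by
        have := ha (G.tgt d)
        rwa [div_le_iff₀ (hb.1 _)] at this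
      have h3 : 0 ≤ (G.wt d).fst * (‖u a‖ / h a * h (G.tgt d)) :=
        mul_nonneg (G.wt_fst_nonneg d) ((norm_nonneg _).trans h2)
      by_cases k : G.src d = a
      · rw [if_pos k]
        split_ifs
        · rw [norm_phc_mul _ _ (G.wt_fst_nonneg d)]
          exact mul_le_mul_of_nonneg_left h2 (G.wt_fst_nonneg d)
        · simpa using h3
      · rw [if_neg k, if_neg (fun h => k h.1), norm_zero]
    have h4 : (∑ e, if G.src e = a then (G.wt e).fst * (‖u a‖ / h a * h (G.tgt e)) else 0) =
        ‖u a‖ / h a * ∑ e, if G.src e = a then (G.wt e).fst * h (G.tgt e) else 0 := by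
      rw [Finset.mul_sum]
      refine Finset.sum_congr rfl (fun d _ => ?_)
      split_ifs <;> ring
    rw [h4] at h1
    have h5 := mul_lt_mul_of_pos_left (hb.2 a) hpos
    rw [div_mul_cancel₀ _ (hb.1 a).ne'] at h5
    linarith
  · have : (G.A0 D).mulVec u a = 0 := by
      unfold mulVec dotProduct A0
      apply Finset.sum_eq_zero; intro b _
      simp [haD]
    rw [this] at e
    rw [e] at hua; simp at hua

lemma hU_of_barrier {h : V → ℝ} (hb : G.Barrier h) (D : Finset V) : IsUnit (1 - G.Am D).det := by
  rw [TrivSqZeroExt.isUnit_iff_isUnit_fst]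
  have e : ((1 - G.Am D).det).fst = (1 - G.A0 D).det := by
    rw [← G.map_fst_M D, ← RingHom.map_det]; rfl
  rw [e]
  exact (G.det_ne_zero hb D).isUnit

/-- Base Green function. -/
def Gam0 (D : Finset V) : Matrix V V ℂ := (1 - G.A0 D)⁻¹

lemma Gam_fst {h : V → ℝ} (hb : G.Barrier h) (D : Finset V) (a b : V) :
    (G.Gam D a b).fst = G.Gam0 D a b := by
  have e := G.M_Gam (G.hU_of_barrier hb) D
  have e2 := congrArg (TrivSqZeroExt.fstHom ℂ ℂ ℂ).toRingHom.mapMatrix e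
  rw [map_mul, map_one, G.map_fst_M] at e2
  have e3 := Matrix.inv_eq_right_inv e2
  unfold Gam0
  rw [e3]; rfl

lemma Gam0_right {h : V → ℝ} (hb : G.Barrier h) (D : Finset V) : (1 - G.A0 D) * G.Gam0 D = 1 :=
  Matrix.mul_nonsing_inv _ (G.det_ne_zero hb D).isUnit
lemma Gam0_left {h : V → ℝ} (hb : G.Barrier h) (D : Finset V) : G.Gam0 D * (1 - G.A0 D) = 1 :=
  Matrix.nonsing_inv_mul _ (G.det_ne_zero hb D).isUnit

lemma Gam_snd {h : V → ℝ} (hb : G.Barrier h) (a b : V) :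
    (G.Gam Finset.univ a b).snd = ∑ e, G.Gam0 Finset.univ a (G.src e) *
      (phc (G.w e) * ((G.wt e).snd : ℂ)) * G.Gam0 Finset.univ (G.tgt e) b := by
  set S : Matrix V V ℂ := fun x y => (G.Gam Finset.univ x y).snd
  set T : Matrix V V ℂ := fun x y => (G.B x y).snd
  have e : (1 - G.A0 Finset.univ) * S = T * G.Gam0 Finset.univ := by
    ext1 x y
    have := congrArg TrivSqZeroExt.snd (G.Gam_eq' (G.hU_of_barrier hb) Finset.univ x y
      (Finset.mem_univ _))
    rw [TrivSqZeroExt.snd_add, TrivSqZeroExt.snd_sum] at this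
    have h1 : ((1 : Matrix V V DC) x y).snd = 0 := by
      rw [one_apply]; split_ifs <;> simp
    rw [h1, zero_add] at this
    simp only [dc_snd_mul, G.Gam_fst hb, B_fst] at this
    rw [Finset.sum_add_distrib] at this
    rw [Matrix.sub_mul, Matrix.one_mul, Matrix.sub_apply, mul_apply, mul_apply]
    simp only [S, T, A0, Finset.mem_univ, and_self, if_true]
    rw [this]; ring
  have e2 : S = G.Gam0 Finset.univ * (T * G.Gam0 Finset.univ) := by
    rw [← e, ← Matrix.mul_assoc, G.Gam0_left hb, Matrix.one_mul]
  have e3 := congrFun (congrFun e2 a) b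
  simp only [S] at e3
  rw [e3, mul_apply]
  have eT : ∀ x y, T x y = ∑ e, if G.src e = x ∧ G.tgt e = y then
      phc (G.w e) * ((G.wt e).snd : ℂ) else 0 := fun x y => G.B_snd x y
  simp only [mul_apply, eT, Finset.sum_mul, Finset.mul_sum]
  have : ∀ x, ∑ y, ∑ e, G.Gam0 Finset.univ a x * ((if G.src e = x ∧ G.tgt e = y then
      phc (G.w e) * ((G.wt e).snd : ℂ) else 0) * G.Gam0 Finset.univ y b) =
      ∑ e, if G.src e = x then G.Gam0 Finset.univ a (G.src e) *
      (phc (G.w e) * ((G.wt e).snd : ℂ)) * G.Gam0 Finset.univ (G.tgt e) b else 0 := by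
    intro x
    rw [Finset.sum_comm]
    refine Finset.sum_congr rfl (fun e _ => ?_)
    by_cases hx : G.src e = x
    · rw [if_pos hx, Finset.sum_eq_single (G.tgt e)]
      · rw [if_pos ⟨hx, rfl⟩, hx]; ring
      · intro y _ hy; rw [if_neg (fun h => hy h.2.symm)]; ring
      · simp
    · rw [if_neg hx]
      apply Finset.sum_eq_zero; intro y _
      rw [if_neg (fun h => hx h.1)]; ring
  rw [Finset.sum_congr rfl (fun x _ => this x), Finset.sum_comm]
  refine Finset.sum_congr rfl (fun e _ => ?_)
  rw [Finset.sum_ite_eq]; simp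

lemma Gam_snd_norm_le {h : V → ℝ} (hb : G.Barrier h) (a b : V) :
    ‖(G.Gam Finset.univ a b).snd‖ ≤ ∑ e, (G.wt e).snd * (‖G.Gam0 Finset.univ a (G.src e)‖ *
      ‖G.Gam0 Finset.univ (G.tgt e) b‖) := by
  rw [G.Gam_snd hb]
  refine (norm_sum_le _ _).trans (Finset.sum_le_sum (fun e _ => le_of_eq ?_))
  rw [norm_mul, norm_mul, norm_mul, phc_norm, Complex.norm_real,
    Real.norm_of_nonneg (G.wt_snd_nonneg e)]
  ring

lemma hpos_of_row {h : V → ℝ} (hb : G.Barrier h)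
    (hrow : ∀ a, (∑ e, if G.src e = a then (G.wt e).fst else 0) ≤ 1) (D : Finset V) (a : V)
    (ha : a ∈ D) : 0 ≤ (G.Gam D a a).fst.re := by
  rw [G.Gam_fst hb]
  set x : V → ℂ := fun c => G.Gam0 D c a with hx
  have hx0 : ∀ c, c ∉ D → x c = 0 := by
    intro c hc
    have := congrFun (congrFun (G.Gam0_right hb D) c) a
    rw [Matrix.sub_mul, Matrix.one_mul, Matrix.sub_apply, mul_apply,
      Finset.sum_eq_zero, sub_zero, one_apply_ne (fun h : c = a => hc (h ▸ ha))] at this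
    · exact this
    · intro j _; simp [A0, hc]
  have e1 : ∀ c ∈ D, x c - ((G.A0 D).mulVec x) c = if c = a then 1 else 0 := by
    intro c _
    have := congrFun (congrFun (G.Gam0_right hb D) c) a
    rw [Matrix.sub_mul, Matrix.one_mul, Matrix.sub_apply, mul_apply, one_apply] at this
    exact this
  have e2 : ∑ c ∈ D, starRingEnd ℂ (x c) * (x c - ((G.A0 D).mulVec x) c) = starRingEnd ℂ (x a) := by
    rw [Finset.sum_eq_single a]
    · rw [e1 a ha]; simp
    · intro c hc hca; rw [e1 c hc, if_neg hca, mul_zero]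
    · intro h; exact absurd ha h
  have e3 : (x a).re = (∑ c ∈ D, ‖x c‖ ^ 2) -
      (∑ c ∈ D, starRingEnd ℂ (x c) * ((G.A0 D).mulVec x) c).re := by
    have := congrArg Complex.re e2
    rw [Complex.conj_re] at this
    rw [← this]
    simp only [mul_sub, Finset.sum_sub_distrib, Complex.sub_re]
    congr 1
    rw [Complex.re_sum]
    refine Finset.sum_congr rfl (fun c _ => ?_)
    rw [mul_comm, Complex.mul_conj, Complex.ofReal_re, Complex.normSq_eq_norm_sq]
  have e4 : ‖∑ c ∈ D, starRingEnd ℂ (x c) * ((G.A0 D).mulVec x) c‖ ≤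
      ∑ e, (G.wt e).fst * (‖x (G.src e)‖ * ‖x (G.tgt e)‖) := by
    have : ∑ c ∈ D, starRingEnd ℂ (x c) * ((G.A0 D).mulVec x) c =
        ∑ e, if G.src e ∈ D ∧ G.tgt e ∈ D then starRingEnd ℂ (x (G.src e)) *
        (phc (G.w e) * ((G.wt e).fst : ℂ) * x (G.tgt e)) else 0 := by
      have e5 : ∀ c ∈ D, starRingEnd ℂ (x c) * ((G.A0 D).mulVec x) c =
          ∑ e, if G.src e = c then (if G.src e ∈ D ∧ G.tgt e ∈ D then
          starRingEnd ℂ (x (G.src e)) *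
          (phc (G.w e) * ((G.wt e).fst : ℂ) * x (G.tgt e)) else 0) else 0 := by
        intro c hc
        rw [G.A0_mulVec D x c hc, Finset.mul_sum]
        refine Finset.sum_congr rfl (fun e _ => ?_)
        by_cases h1 : G.src e = c
        · rw [if_pos h1]
          by_cases h2 : G.tgt e ∈ D
          · rw [if_pos ⟨h1, h2⟩, if_pos ⟨h1 ▸ hc, h2⟩, h1]
          · rw [if_neg (fun h => h2 h.2), if_neg (fun h => h2 h.2), mul_zero]
        · rw [if_neg h1, if_neg (fun h => h1 h.1), mul_zero]
      rw [Finset.sum_congr rfl e5, Finset.sum_comm]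
      refine Finset.sum_congr rfl (fun e _ => ?_)
      rw [Finset.sum_ite_eq]
      by_cases h1 : G.src e ∈ D
      · rw [if_pos h1]
      · rw [if_neg h1, if_neg (fun h => h1 h.1)]
    rw [this]
    refine (norm_sum_le _ _).trans (Finset.sum_le_sum (fun e _ => ?_))
    split_ifs
    · rw [norm_mul, norm_phc_mul _ _ (G.wt_fst_nonneg e), RCLike.norm_conj]
      apply le_of_eq; ring
    · rw [norm_zero]
      exact mul_nonneg (G.wt_fst_nonneg e) (mul_nonneg (norm_nonneg _) (norm_nonneg _))
  have e6 : ∑ e, (G.wt e).fst * (‖x (G.src e)‖ * ‖x (G.tgt e)‖) ≤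
      ∑ e, (G.wt e).fst * ‖x (G.src e)‖ ^ 2 := by
    have s1 : ∑ e, (G.wt e).fst * ‖x (G.tgt e)‖ ^ 2 = ∑ e, (G.wt e).fst * ‖x (G.src e)‖ ^ 2 := by
      refine Fintype.sum_equiv ⟨G.rev, G.rev, G.rev_rev, G.rev_rev⟩ _ _ (fun e => ?_)
      simp only [Equiv.coe_fn_mk, G.src_rev, G.wt_rev]
    have s2 : ∑ e, (G.wt e).fst * (‖x (G.src e)‖ * ‖x (G.tgt e)‖) ≤
        ∑ e, ((G.wt e).fst * ‖x (G.src e)‖ ^ 2 + (G.wt e).fst * ‖x (G.tgt e)‖ ^ 2) / 2 := by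
      refine Finset.sum_le_sum (fun e _ => ?_)
      nlinarith [G.wt_fst_nonneg e, mul_nonneg (G.wt_fst_nonneg e)
        (sq_nonneg (‖x (G.src e)‖ - ‖x (G.tgt e)‖))]
    rw [← Finset.sum_div, Finset.sum_add_distrib, s1] at s2
    linarith
  have e7 : ∑ e, (G.wt e).fst * ‖x (G.src e)‖ ^ 2 ≤ ∑ c ∈ D, ‖x c‖ ^ 2 := by
    have : ∑ e, (G.wt e).fst * ‖x (G.src e)‖ ^ 2 =
        ∑ c, ‖x c‖ ^ 2 * ∑ e, if G.src e = c then (G.wt e).fst else 0 := by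
      simp only [Finset.mul_sum]
      rw [Finset.sum_comm]
      refine Finset.sum_congr rfl (fun e _ => ?_)
      simp [mul_comm]
    rw [this]
    calc _ ≤ ∑ c, ‖x c‖ ^ 2 * 1 :=
          Finset.sum_le_sum (fun c _ => mul_le_mul_of_nonneg_left (hrow c) (sq_nonneg _))
      _ = ∑ c ∈ D, ‖x c‖ ^ 2 := by
          simp only [mul_one]
          symm
          apply Finset.sum_subset (Finset.subset_univ D)
          intro c _ hc; rw [hx0 c hc]; simp
  change 0 ≤ (x a).re
  rw [e3]
  have := Complex.re_le_norm (∑ c ∈ D, starRingEnd ℂ (x c) * ((G.A0 D).mulVec x) c)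
  linarith

/-- Summary bound. -/
theorem gg_snd_bound {h : V → ℝ} (hb : G.Barrier h)
    (hrow : ∀ a, (∑ e, if G.src e = a then (G.wt e).fst else 0) ≤ 1)
    (hPL : G.PL) (a b : V) (c : ZMod 4)
    (hc : ∀ ds, G.WkIn Finset.univ a b ds → (ds.map G.src ++ [b]).Nodup → G.cl ds + c ≠ 2) (L : ℕ) :
    (G.gg Finset.univ L a b (-c)).snd ≤ ∑ e, (G.wt e).snd *
      (‖G.Gam0 Finset.univ a (G.src e)‖ * ‖G.Gam0 Finset.univ (G.tgt e) b‖) :=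
  (G.gg_snd_le (G.hU_of_barrier hb) (G.hpos_of_row hb hrow) hPL a b c hc L).trans
    (G.Gam_snd_norm_le hb a b)

end MG
/-! ### Winding numbers of lattice walks -/

lemma adj_cases {p q : Lat} (h : Adj p q) :
    (q.1 = p.1 + 1 ∧ q.2 = p.2) ∨ (q.1 = p.1 - 1 ∧ q.2 = p.2) ∨
    (q.1 = p.1 ∧ q.2 = p.2 + 1) ∨ (q.1 = p.1 ∧ q.2 = p.2 - 1) := by
  unfold Adj at h
  have h1 : (p.1 - q.1) ^ 2 ≤ 1 := by nlinarith [sq_nonneg (p.2 - q.2)]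
  have h2 : (p.2 - q.2) ^ 2 ≤ 1 := by nlinarith [sq_nonneg (p.1 - q.1)]
  have h3 : -1 ≤ p.1 - q.1 ∧ p.1 - q.1 ≤ 1 := abs_le.mp (by
    rwa [← sq_le_one_iff_abs_le_one])
  have h4 : -1 ≤ p.2 - q.2 ∧ p.2 - q.2 ≤ 1 := abs_le.mp (by
    rwa [← sq_le_one_iff_abs_le_one])
  obtain ⟨u, hu⟩ : ∃ u, u = p.1 - q.1 := ⟨_, rfl⟩
  obtain ⟨v, hv⟩ : ∃ v, v = p.2 - q.2 := ⟨_, rfl⟩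
  rw [← hu, ← hv] at h
  have hu1 : -1 ≤ u ∧ u ≤ 1 := hu ▸ h3
  have hv1 : -1 ≤ v ∧ v ≤ 1 := hv ▸ h4
  have : (u = -1 ∨ u = 0 ∨ u = 1) ∧ (v = -1 ∨ v = 0 ∨ v = 1) := by omega
  rcases this with ⟨rfl | rfl | rfl, rfl | rfl | rfl⟩ <;> norm_num at h <;> omega

lemma adj_of_cases {p q : Lat} (h : (q.1 = p.1 + 1 ∧ q.2 = p.2) ∨ (q.1 = p.1 - 1 ∧ q.2 = p.2) ∨
    (q.1 = p.1 ∧ q.2 = p.2 + 1) ∨ (q.1 = p.1 ∧ q.2 = p.2 - 1)) : Adj p q := by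
  unfold Adj
  rcases h with ⟨h1, h2⟩ | ⟨h1, h2⟩ | ⟨h1, h2⟩ | ⟨h1, h2⟩ <;> rw [h1, h2] <;> ring

lemma adj_symm {p q : Lat} (h : Adj p q) : Adj q p := by
  unfold Adj at *; rw [← h]; ring

lemma linf_le_iff {v : Lat} {n : ℤ} :
    linf v ≤ n ↔ (-n ≤ v.1 ∧ v.1 ≤ n) ∧ (-n ≤ v.2 ∧ v.2 ≤ n) := by
  unfold linf; rw [max_le_iff, abs_le, abs_le]

/-- Signed crossing of the ray to the right of the face `f`. -/
def nuF (f p q : Lat) : ℤ :=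
  if f.1 < p.1 then (if p.2 = f.2 ∧ q.2 = f.2 + 1 then 1 else
    if p.2 = f.2 + 1 ∧ q.2 = f.2 then -1 else 0) else 0

/-- Signed traversal of the edge `xy`. -/
def sgE (p q x y : Lat) : ℤ := (if p = x ∧ q = y then 1 else 0) - (if p = y ∧ q = x then 1 else 0)

lemma nuF_symm (f : Lat) {p q : Lat} (h : Adj p q) : nuF f q p = - nuF f p q := by
  unfold nuF
  rcases adj_cases h with h | h | h | h <;> split_ifs <;> omega

lemma nuF_jumpH (a b : ℤ) {p q : Lat} (h : Adj p q) :
    nuF (a, b) p q - nuF (a + 1, b) p q = sgE p q (a + 1, b) (a + 1, b + 1) := by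
  obtain ⟨p1, p2⟩ := p
  obtain ⟨q1, q2⟩ := q
  have := adj_cases h
  unfold nuF sgE
  simp only [Prod.mk.injEq] at *
  rcases this with h | h | h | h <;> split_ifs <;> omega

/-- Potential. -/
def phiF (a b : ℤ) (v : Lat) : ℤ := if v.2 = b + 1 ∧ a < v.1 then 1 else 0

lemma nuF_jumpV (a b : ℤ) {p q : Lat} (h : Adj p q) :
    nuF (a, b) p q - nuF (a, b + 1) p q =
      phiF a b q - phiF a b p - sgE p q (a, b + 1) (a + 1, b + 1) := by
  obtain ⟨p1, p2⟩ := p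
  obtain ⟨q1, q2⟩ := q
  have := adj_cases h
  unfold nuF sgE phiF
  simp only [Prod.mk.injEq] at *
  rcases this with h | h | h | h <;> split_ifs <;> omega

section cyc
variable {n : ℕ} [NeZero n] (γ : ZMod n → Lat)

/-- Winding number of a cyclic walk. -/
def cycN (f : Lat) : ℤ := ∑ i, nuF f (γ i) (γ (i + 1))
/-- Signed number of traversals. -/
def cycS (x y : Lat) : ℤ := ∑ i, sgE (γ i) (γ (i + 1)) x y

lemma cycN_jumpH (hadj : ∀ i, Adj (γ i) (γ (i + 1))) (a b : ℤ) :
    cycN γ (a, b) - cycN γ (a + 1, b) = cycS γ (a + 1, b) (a + 1, b + 1) := by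
  unfold cycN cycS
  rw [← Finset.sum_sub_distrib]
  exact Finset.sum_congr rfl (fun i _ => nuF_jumpH a b (hadj i))

lemma cycN_jumpV (hadj : ∀ i, Adj (γ i) (γ (i + 1))) (a b : ℤ) :
    cycN γ (a, b) - cycN γ (a, b + 1) = - cycS γ (a, b + 1) (a + 1, b + 1) := by
  unfold cycN cycS
  rw [← Finset.sum_sub_distrib, Finset.sum_congr rfl (fun i _ => nuF_jumpV a b (hadj i))]
  simp only [Finset.sum_sub_distrib]
  have : ∑ i, phiF a b (γ (i + 1)) = ∑ i, phiF a b (γ i) :=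
    Fintype.sum_equiv (Equiv.addRight (1 : ZMod n)) _ _ (fun i => rfl)
  rw [this]; ring

lemma cycS_eq (hinj : Function.Injective γ) (j : ZMod n) (x : Lat) :
    cycS γ (γ j) x = (if γ (j + 1) = x then 1 else 0) - (if γ (j - 1) = x then 1 else 0) := by
  unfold cycS sgE
  rw [Finset.sum_sub_distrib]
  congr 1
  · rw [Finset.sum_eq_single j]
    · simp
    · intro i _ hij
      rw [if_neg (fun h => hij (hinj h.1))]
    · simp
  · rw [Finset.sum_eq_single (j - 1)]
    · simp
    · intro i _ hij
      rw [if_neg]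
      rintro ⟨_, h2⟩
      apply hij
      rw [← hinj h2]; ring
    · simp

lemma sgE_symm (p q x y : Lat) : sgE p q y x = - sgE p q x y := by unfold sgE; ring
lemma cycS_symm (x y : Lat) : cycS γ y x = - cycS γ x y := by
  unfold cycS; rw [← Finset.sum_neg_distrib]
  exact Finset.sum_congr rfl (fun i _ => sgE_symm _ _ _ _)

/-- Left face of a step. -/
def leftF (p q : Lat) : Lat :=
  if q.1 = p.1 + 1 then p else if q.2 = p.2 + 1 then (p.1 - 1, p.2) else
  if q.1 = p.1 - 1 then (p.1 - 1, p.2 - 1) else (p.1, p.2 - 1)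

lemma left_const (hn : 3 ≤ n) (hinj : Function.Injective γ) (hadj : ∀ i, Adj (γ i) (γ (i + 1)))
    (j : ZMod n) :
    cycN γ (leftF (γ (j - 1)) (γ j)) = cycN γ (leftF (γ j) (γ (j + 1))) := by
  obtain ⟨x, y, hq⟩ : ∃ x y : ℤ, γ j = (x, y) := ⟨_, _, rfl⟩
  have h1 := adj_cases (hadj j)
  have h2 := adj_cases (by simpa using hadj (j - 1) : Adj (γ (j - 1)) (γ j))
  have hne : γ (j - 1) ≠ γ (j + 1) := by
    intro h
    have h := hinj h
    have h3 : (2 : ZMod n) = 0 := by linear_combination -h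
    have : ((2 : ℕ) : ZMod n) = 0 := by exact_mod_cast h3
    rw [ZMod.natCast_eq_zero_iff] at this
    have := Nat.le_of_dvd (by norm_num) this
    omega
  have jE := cycN_jumpV γ hadj x (y - 1)
  have jN := cycN_jumpH γ hadj (x - 1) y
  have jW := cycN_jumpV γ hadj (x - 1) (y - 1)
  have jS := cycN_jumpH γ hadj (x - 1) (y - 1)
  simp only [sub_add_cancel] at jE jN jW jS
  have cE := cycS_eq γ hinj j (x + 1, y)
  have cN := cycS_eq γ hinj j (x, y + 1)
  have cW := cycS_eq γ hinj j (x - 1, y)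
  have cS := cycS_eq γ hinj j (x, y - 1)
  rw [hq] at cE cN cW cS h1 h2
  rw [cycS_symm γ (x, y) (x - 1, y)] at jW
  rw [cycS_symm γ (x, y) (x, y - 1)] at jS
  rw [cE] at jE
  rw [cN] at jN
  rw [cW] at jW
  rw [cS] at jS
  rw [hq]
  obtain ⟨s1, s2, hs⟩ : ∃ s1 s2 : ℤ, γ (j + 1) = (s1, s2) := ⟨_, _, rfl⟩
  obtain ⟨p1, p2, hp⟩ : ∃ p1 p2 : ℤ, γ (j - 1) = (p1, p2) := ⟨_, _, rfl⟩
  clear cE cN cW cS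
  rw [hs] at h1 hne jE jN jW jS ⊢
  rw [hp] at h2 hne jE jN jW jS ⊢
  simp only [Prod.mk.injEq, ne_eq] at h1 h2 hne jE jN jW jS
  have eqs : (p1 = x - 1 ∧ p2 = y) ∨ (p1 = x + 1 ∧ p2 = y) ∨ (p1 = x ∧ p2 = y - 1) ∨
    (p1 = x ∧ p2 = y + 1) := by
    clear jE jN jW jS hne h1
    omega
  clear h2 hq hs hp
  have f1 : ∀ t : ℤ, ¬ (t - 1 = t + 1) := by intro t; omega
  have f2 : ∀ t : ℤ, ¬ (t + 1 = t - 1) := by intro t; omega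
  have f3 : ∀ t : ℤ, ¬ (t = t + 1 + 1) := by intro t; omega
  have f4 : ∀ t : ℤ, ¬ (t = t - 1) := by intro t; omega
  have f5 : ∀ t : ℤ, ¬ (t = t - 1 - 1) := by intro t; omega
  unfold leftF
  simp only
  rcases h1 with ⟨rfl, rfl⟩ | ⟨rfl, rfl⟩ | ⟨rfl, rfl⟩ | ⟨rfl, rfl⟩ <;>
  rcases eqs with ⟨rfl, rfl⟩ | ⟨rfl, rfl⟩ | ⟨rfl, rfl⟩ | ⟨rfl, rfl⟩ <;>
  simp only [true_and, and_true, and_self, not_true_eq_false, add_eq_left, sub_eq_self,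
    one_ne_zero, if_true, if_false, false_and, and_false, left_eq_add, sub_add_cancel,
    add_sub_cancel_right, right_eq_add, f1, f2, f3, f4, f5] at hne jE jN jW jS ⊢ <;>
  linarith

end cyc
section cyc2
variable {n : ℕ} [NeZero n] (γ : ZMod n → Lat)

lemma left_const_all (hn : 3 ≤ n) (hinj : Function.Injective γ)
    (hadj : ∀ i, Adj (γ i) (γ (i + 1))) (j : ZMod n) :
    cycN γ (leftF (γ j) (γ (j + 1))) = cycN γ (leftF (γ 0) (γ (0 + 1))) := by
  have : ∀ k : ℕ, cycN γ (leftF (γ (k : ZMod n)) (γ ((k : ZMod n) + 1))) =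
      cycN γ (leftF (γ 0) (γ (0 + 1))) := by
    intro k
    induction k with
    | zero => simp
    | succ k ih =>
      rw [← ih]
      have := left_const γ hn hinj hadj ((k : ZMod n) + 1)
      simp only [add_sub_cancel_right] at this
      push_cast
      exact this.symm
  have h := this j.val
  rwa [ZMod.natCast_zmod_val] at h

lemma cyc_nb (hn : 3 ≤ n) (hinj : Function.Injective γ) (j : ZMod n) :
    γ (j - 1) ≠ γ (j + 1) := by
  intro h
  have h := hinj h
  have h3 : (2 : ZMod n) = 0 := by linear_combination -h
  have : ((2 : ℕ) : ZMod n) = 0 := by exact_mod_cast h3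
  rw [ZMod.natCast_eq_zero_iff] at this
  have := Nat.le_of_dvd (by norm_num) this
  omega

lemma cyc_step (hn : 3 ≤ n) (hinj : Function.Injective γ)
    (hadj : ∀ i, Adj (γ i) (γ (i + 1))) (a b : ℤ) :
    cycN γ (a, b) = cycN γ (a + 1, b) ∨
    (cycN γ (a, b) = cycN γ (leftF (γ 0) (γ (0 + 1))) ∧
      cycN γ (a + 1, b) = cycN γ (leftF (γ 0) (γ (0 + 1))) - 1) ∨
    (cycN γ (a, b) = cycN γ (leftF (γ 0) (γ (0 + 1))) - 1 ∧
      cycN γ (a + 1, b) = cycN γ (leftF (γ 0) (γ (0 + 1)))) := by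
  have hj := cycN_jumpH γ hadj a b
  by_cases hs : cycS γ (a + 1, b) (a + 1, b + 1) = 0
  · left; omega
  right
  obtain ⟨i, -, hi⟩ := Finset.exists_ne_zero_of_sum_ne_zero hs
  have hl := left_const_all γ hn hinj hadj i
  have hc := cycS_eq γ hinj i (γ (i + 1))
  rw [if_pos rfl, if_neg (cyc_nb γ hn hinj i)] at hc
  by_cases hu : γ i = (a + 1, b) ∧ γ (i + 1) = (a + 1, b + 1)
  · left
    rw [hu.1, hu.2] at hl hc
    have : leftF (a + 1, b) (a + 1, b + 1) = (a, b) := by simp [leftF]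
    rw [this] at hl
    omega
  · right
    have hd : γ i = (a + 1, b + 1) ∧ γ (i + 1) = (a + 1, b) := by
      by_contra hd
      apply hi
      simp [sgE, hu, hd]
    rw [hd.1, hd.2] at hl hc
    have : leftF (a + 1, b + 1) (a + 1, b) = (a + 1, b) := by
      have h : ¬ (b = b + 1 + 1) := by omega
      simp [leftF, h]
    rw [this] at hl
    rw [cycS_symm] at hc
    omega

lemma cyc_far (a b : ℤ) (h : ∀ i, (γ i).1 ≤ a) : cycN γ (a, b) = 0 := by
  unfold cycN nuF
  apply Finset.sum_eq_zero
  intro i _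
  have := h i
  rw [if_neg]
  simp only; omega

lemma cyc_abs_le (hinj : Function.Injective γ)
    (hadj : ∀ i, Adj (γ i) (γ (i + 1))) (f : Lat) : |cycN γ f| ≤ 1 := by
  rcases Nat.lt_or_ge n 3 with hn | hn
  · have h0 := NeZero.ne n
    have : n = 1 ∨ n = 2 := by omega
    rcases this with rfl | rfl
    · have := hadj 0
      rw [Subsingleton.elim ((0 : ZMod 1) + 1) 0] at this
      simp [Adj] at this
    · have : cycN γ f = nuF f (γ 0) (γ 1) + nuF f (γ 1) (γ 0) := by
        unfold cycN
        exact Fin.sum_univ_two (fun i : ZMod 2 => nuF f (γ i) (γ (i + 1)))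
      have h01 : Adj (γ 0) (γ 1) := by simpa using hadj 0
      rw [this, nuF_symm f h01]
      simp
  obtain ⟨a, b⟩ := f
  obtain ⟨X, hX⟩ : ∃ X : ℤ, ∀ i, (γ i).1 ≤ X := by
    obtain ⟨X, hX⟩ := (Set.finite_range (fun i => (γ i).1)).bddAbove
    exact ⟨X, fun i => hX ⟨i, rfl⟩⟩
  set κ := cycN γ (leftF (γ 0) (γ (0 + 1))) with hκ
  have key : ∀ k : ℕ, ∀ a : ℤ, X - k ≤ a → cycN γ (a, b) = 0 ∨
      ((cycN γ (a, b) = κ ∨ cycN γ (a, b) = κ - 1) ∧ (κ = 0 ∨ κ = 1)) := by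
    intro k
    induction k with
    | zero =>
      intro a ha
      left
      apply cyc_far
      intro i
      have := hX i
      push_cast at ha
      omega
    | succ k ih =>
      intro a ha
      have h1 := ih (a + 1) (by push_cast at ha; omega)
      have h2 := cyc_step γ hn hinj hadj a b
      rw [← hκ] at h2
      omega
  have := key (X - a).toNat a (by omega)
  rw [abs_le]
  omega

end cyc2

/-! ### Winding of lists -/

/-- Winding of a list about a face. -/
def NW (f : Lat) : List Lat → ℤ
  | [] => 0
  | [_] => 0
  | a :: b :: t => nuF f a b + NW f (b :: t)

@[simp] lemma NW_nil (f : Lat) : NW f [] = 0 := rfl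
@[simp] lemma NW_single (f a : Lat) : NW f [a] = 0 := rfl
@[simp] lemma NW_cons (f a b : Lat) (t : List Lat) :
    NW f (a :: b :: t) = nuF f a b + NW f (b :: t) := rfl

lemma NW_append (f : Lat) (l1 l2 : List Lat) (a : Lat) :
    NW f (l1 ++ a :: l2) = NW f (l1 ++ [a]) + NW f (a :: l2) := by
  induction l1 with
  | nil => simp
  | cons b t ih =>
    cases t with
    | nil => simp
    | cons c t =>
      simp only [List.cons_append, NW_cons] at ih ⊢
      rw [ih]; ring

lemma NW_reverse (f : Lat) (l : List Lat) (h : l.IsChain Adj) :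
    NW f l.reverse = - NW f l := by
  induction l with
  | nil => simp
  | cons a t ih =>
    cases t with
    | nil => simp
    | cons b t =>
      rw [List.isChain_cons_cons] at h
      have := ih h.2
      simp only [List.reverse_cons, List.append_assoc, List.cons_append, List.nil_append,
        NW_cons] at this ⊢
      rw [NW_append, this, NW_cons, nuF_symm f h.1]; simp

lemma NW_eq_sum (f : Lat) (l : List Lat) :
    NW f l = ∑ i ∈ Finset.range (l.length - 1), nuF f (l.getD i 0) (l.getD (i + 1) 0) := by
  induction l with
  | nil => simp
  | cons a t ih =>
    cases t with
    | nil => simp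
    | cons b t =>
      rw [NW_cons, ih]
      simp only [List.length_cons, Nat.add_sub_cancel]
      rw [Finset.sum_range_succ', add_comm]
      simp

lemma NW_cycle (f a : Lat) (t : List Lat) (hnd : (a :: t).Nodup)
    (hch : (a :: t ++ [a]).IsChain Adj) : |NW f (a :: t ++ [a])| ≤ 1 := by
  obtain ⟨l, hl⟩ : ∃ l, l = a :: t := ⟨_, rfl⟩
  have hpos : 0 < l.length := by rw [hl]; simp
  haveI : NeZero l.length := ⟨hpos.ne'⟩
  let γ : ZMod l.length → Lat := fun i => l.getD i.val 0
  have hval : ∀ i : ZMod l.length, i.val < l.length := fun i => ZMod.val_lt i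
  have hinj : Function.Injective γ := by
    intro i j hij
    simp only [γ] at hij
    rw [List.getD_eq_getElem _ _ (hval i), List.getD_eq_getElem _ _ (hval j)] at hij
    have := (List.Nodup.getElem_inj_iff (hl ▸ hnd)).mp hij
    exact ZMod.val_injective _ this
  have hγ1 : ∀ i : ZMod l.length, γ i = (l ++ [a]).getD i.val 0 := by
    intro i
    simp only [γ]
    rw [List.getD_append _ _ _ _ (hval i)]
  have hγ2 : ∀ i : ZMod l.length, γ (i + 1) = (l ++ [a]).getD (i.val + 1) 0 := by
    intro i
    have hv : (i + 1).val = (i.val + 1) % l.length := by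
      rw [ZMod.val_add, ZMod.val_one_eq_one_mod, Nat.add_mod_mod]
    rcases Nat.lt_or_ge (i.val + 1) l.length with h | h
    · rw [Nat.mod_eq_of_lt h] at hv
      rw [hγ1, hv]
    · have h2 : i.val + 1 = l.length := by have := hval i; omega
      rw [h2, Nat.mod_self] at hv
      simp only [γ]
      rw [hv, h2, List.getD_append_right _ _ _ _ le_rfl]
      simp [hl]
  have hadj : ∀ i, Adj (γ i) (γ (i + 1)) := by
    intro i
    rw [hγ1, hγ2]
    rw [← hl] at hch
    have h1 : i.val + 1 < (l ++ [a]).length := by simpa using hval i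
    rw [List.getD_eq_getElem _ _ (by omega), List.getD_eq_getElem _ _ h1]
    exact List.isChain_iff_getElem.mp hch i.val h1
  have h := cyc_abs_le γ hinj hadj f
  have : NW f (a :: t ++ [a]) = cycN γ f := by
    rw [← hl, NW_eq_sum, cycN]
    simp only [List.length_append, List.length_singleton, Nat.add_sub_cancel]
    symm
    apply Finset.sum_bij (fun (i : ZMod l.length) _ => i.val)
    · intro i _; simpa using hval i
    · intro i _ j _ h; exact ZMod.val_injective _ h
    · intro k hk
      refine ⟨(k : ZMod l.length), Finset.mem_univ _, ?_⟩
      rw [ZMod.val_natCast, Nat.mod_eq_of_lt (by simpa using hk)]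
    · intro i _
      rw [hγ1, hγ2]
  rw [this]; exact h
/-! ### Dual paths and vanishing winding -/

/-- The unordered pairs agree. -/
def sameE (p0 q0 p q : Lat) : Prop := (p = p0 ∧ q = q0) ∨ (p = q0 ∧ q = p0)

/-- The list uses the edge `pq`. -/
def usedE (l : List Lat) (p q : Lat) : Prop := [p, q] <:+: l ∨ [q, p] <:+: l

lemma usedE_mono {l l' : List Lat} (h : l <:+: l') {p q : Lat} (hu : usedE l p q) :
    usedE l' p q := hu.imp (fun x => x.trans h) (fun x => x.trans h)

lemma usedE_symm {l : List Lat} {p q : Lat} (hu : usedE l p q) : usedE l q p := hu.symm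

/-- The faces `f`, `g` are separated by the edge `pq`. -/
def crossE (f g p q : Lat) : Prop :=
  (∃ a b : ℤ, ((f = (a, b) ∧ g = (a + 1, b)) ∨ (g = (a, b) ∧ f = (a + 1, b))) ∧
    p = (a + 1, b) ∧ q = (a + 1, b + 1)) ∨
  (∃ a b : ℤ, ((f = (a, b) ∧ g = (a, b + 1)) ∨ (g = (a, b) ∧ f = (a, b + 1))) ∧
    p = (a, b + 1) ∧ q = (a + 1, b + 1))

/-- Dual step avoiding the edges of `l`. -/
def DS (l : List Lat) (f g : Lat) : Prop := ∃ p q, crossE f g p q ∧ ¬ usedE l p q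

/-- Discrete non-disconnection. -/
def ND (l : List Lat) (r R : ℤ) : Prop :=
  ∃ b q : Lat, linf b ≤ r ∧ linf q = R ∧ Relation.ReflTransGen (DS l) b q

lemma ND_mono {l l' : List Lat} (h : l <:+: l') {r R : ℤ} (hn : ND l' r R) : ND l r R := by
  obtain ⟨b, q, hb, hq, hr⟩ := hn
  refine ⟨b, q, hb, hq, Relation.ReflTransGen.mono ?_ _ _ hr⟩
  rintro f g ⟨p, q, hc, hu⟩
  exact ⟨p, q, hc, fun hh => hu (usedE_mono h hh)⟩

lemma NW_H (a b : ℤ) (Z : List Lat)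
    (hZ : Z.IsChain (fun p q => Adj p q ∧ ¬ sameE (a + 1, b) (a + 1, b + 1) p q)) :
    NW (a, b) Z = NW (a + 1, b) Z := by
  induction Z with
  | nil => rfl
  | cons x t ih =>
    cases t with
    | nil => rfl
    | cons y t =>
      rw [List.isChain_cons_cons] at hZ
      rw [NW_cons, NW_cons, ih hZ.2]
      have := nuF_jumpH a b hZ.1.1
      have h2 : sgE x y (a + 1, b) (a + 1, b + 1) = 0 := by
        have := hZ.1.2
        unfold sameE at this
        push Not at this
        unfold sgE
        rw [if_neg (fun h => this.1 h.1 h.2), if_neg (fun h => this.2 h.1 h.2)]; rfl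
      omega

lemma NW_V (a b : ℤ) (x : Lat) (t : List Lat)
    (hZ : (x :: t).IsChain (fun p q => Adj p q ∧ ¬ sameE (a, b + 1) (a + 1, b + 1) p q)) :
    NW (a, b) (x :: t) - NW (a, b + 1) (x :: t) =
      phiF a b ((x :: t).getLast (by simp)) - phiF a b x := by
  induction t generalizing x with
  | nil => simp
  | cons y t ih =>
      rw [List.isChain_cons_cons] at hZ
      have h1 := ih y hZ.2
      rw [NW_cons, NW_cons]
      have := nuF_jumpV a b hZ.1.1
      have h2 : sgE x y (a, b + 1) (a + 1, b + 1) = 0 := by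
        have := hZ.1.2
        unfold sameE at this
        push Not at this
        unfold sgE
        rw [if_neg (fun h => this.1 h.1 h.2), if_neg (fun h => this.2 h.1 h.2)]; rfl
      rw [List.getLast_cons (by simp)]
      omega

lemma NW_cross {f g p q : Lat} (hc : crossE f g p q) (x : Lat) (t : List Lat)
    (hlast : (x :: t).getLast (by simp) = x)
    (hZ : (x :: t).IsChain (fun p' q' => Adj p' q' ∧ ¬ sameE p q p' q')) :
    NW f (x :: t) = NW g (x :: t) := by
  rcases hc with ⟨a, b, h, rfl, rfl⟩ | ⟨a, b, h, rfl, rfl⟩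
  · have := NW_H a b _ hZ
    rcases h with ⟨rfl, rfl⟩ | ⟨rfl, rfl⟩
    · exact this
    · exact this.symm
  · have := NW_V a b x t hZ
    rw [hlast] at this
    rcases h with ⟨rfl, rfl⟩ | ⟨rfl, rfl⟩ <;> omega

/-- Faces inside the box of radius `n`. -/
def insF (n : ℤ) (f : Lat) : Prop := -n ≤ f.1 ∧ f.1 < n ∧ -n ≤ f.2 ∧ f.2 < n

lemma linf_eq_iff {v : Lat} {n : ℤ} : linf v = n ↔
    ((-n ≤ v.1 ∧ v.1 ≤ n) ∧ (-n ≤ v.2 ∧ v.2 ≤ n)) ∧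
      (v.1 = n ∨ v.1 = -n ∨ v.2 = n ∨ v.2 = -n) := by
  have h1 := @linf_le_iff v n
  have h2 := @linf_le_iff v (n - 1)
  have : linf v = n ↔ linf v ≤ n ∧ ¬ linf v ≤ n - 1 := by omega
  rw [this, h1, h2]
  omega

lemma cross_ring {n : ℤ} {f g p q : Lat} (hc : crossE f g p q) (hf : insF n f)
    (hg : ¬ insF n g) : linf p = n ∧ linf q = n ∧ Adj p q := by
  rw [linf_eq_iff, linf_eq_iff]
  unfold insF at *
  rcases hc with ⟨a, b, h, rfl, rfl⟩ | ⟨a, b, h, rfl, rfl⟩ <;>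
  rcases h with ⟨rfl, rfl⟩ | ⟨rfl, rfl⟩ <;>
  refine ⟨?_, ?_, by simp [Adj]⟩ <;> simp only at * <;> omega

lemma ring_cross {n : ℤ} {f g p q : Lat} (hc : crossE f g p q) (hp : linf p = n)
    (hq : linf q = n) : ¬ (insF n f ↔ insF n g) := by
  rw [linf_eq_iff] at hp hq
  unfold insF at *
  rcases hc with ⟨a, b, h, rfl, rfl⟩ | ⟨a, b, h, rfl, rfl⟩ <;>
  rcases h with ⟨rfl, rfl⟩ | ⟨rfl, rfl⟩ <;> simp only at * <;> omega

lemma cross_ins {n : ℤ} {f g p q : Lat} (hc : crossE f g p q) (hf : insF n f) :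
    insF (n + 1) g := by
  unfold insF at *
  rcases hc with ⟨a, b, h, rfl, rfl⟩ | ⟨a, b, h, rfl, rfl⟩ <;>
  rcases h with ⟨rfl, rfl⟩ | ⟨rfl, rfl⟩ <;> simp only at * <;> omega

lemma last_exit {α : Type*} {r : α → α → Prop} (P : α → Prop) {b q : α}
    (h : Relation.ReflTransGen r b q) (hb : P b) (hq : ¬ P q) :
    ∃ f g, P f ∧ ¬ P g ∧ r f g ∧
      Relation.ReflTransGen (fun x y => r x y ∧ ¬ P x ∧ ¬ P y) g q := by
  have : Relation.ReflTransGen (fun x y => r x y ∧ ¬ P x ∧ ¬ P y) b q ∨ ∃ f g, P f ∧ ¬ P g ∧ r f g ∧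
      Relation.ReflTransGen (fun x y => r x y ∧ ¬ P x ∧ ¬ P y) g q := by
    clear hb
    induction h using Relation.ReflTransGen.head_induction_on with
    | refl => exact Or.inl .refl
    | head hac hcb ih =>
      rename_i a c
      rcases ih with h1 | h1
      · have hc : ¬ P c := by
          rcases h1.cases_head with h2 | ⟨d, h2, -⟩
          · exact h2 ▸ hq
          · exact h2.2.1
        by_cases ha : P a
        · exact Or.inr ⟨a, c, ha, hc, hac, h1⟩
        · exact Or.inl (h1.head ⟨hac, ha, hc⟩)
      · exact Or.inr h1
  rcases this with h1 | h1
  · rcases h1.cases_head with h2 | ⟨d, h2, -⟩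
    · exact absurd hb (h2 ▸ hq)
    · exact absurd hb h2.2.1
  · exact h1

lemma first_exit {α : Type*} {r : α → α → Prop} (P : α → Prop) {b q : α}
    (h : Relation.ReflTransGen r b q) (hb : P b) (hq : ¬ P q) :
    ∃ f g, P f ∧ ¬ P g ∧ r f g ∧
      Relation.ReflTransGen (fun x y => r x y ∧ P x ∧ P y) b f := by
  induction h using Relation.ReflTransGen.head_induction_on with
  | refl => exact absurd hb hq
  | head hac hcb ih =>
    rename_i a c
    by_cases hc : P c
    · obtain ⟨f, g, h1, h2, h3, h4⟩ := ih hc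
      exact ⟨f, g, h1, h2, h3, h4.head ⟨hac, hb, hc⟩⟩
    · exact ⟨a, c, hb, hc, hac, .refl⟩

/-- Admissible steps of closed test walks. -/
def zrel (l : List Lat) (r' R1 : ℤ) (pi qi po qo : Lat) (p q : Lat) : Prop :=
  Adj p q ∧ r' ≤ linf p ∧ linf p ≤ R1 ∧ r' ≤ linf q ∧ linf q ≤ R1 ∧
  (usedE l p q ∨ (linf p = r' ∧ linf q = r' ∧ ¬ sameE pi qi p q) ∨
    (linf p = R1 ∧ linf q = R1 ∧ ¬ sameE po qo p q))

lemma NW_ins {r' : ℤ} (hr : 1 ≤ r') (x : Lat) (t : List Lat)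
    (hlast : (x :: t).getLast (by simp) = x)
    (hZ : (x :: t).IsChain (fun p q => Adj p q ∧ r' ≤ linf p ∧ r' ≤ linf q)) {f : Lat}
    (hf : insF r' f) : NW f (x :: t) = NW (0, 0) (x :: t) := by
  have hstep : ∀ f g p q, crossE f g p q → insF r' f → insF r' g →
      NW f (x :: t) = NW g (x :: t) := by
    intro f g p q hc h1 h2
    refine NW_cross hc x t hlast (hZ.imp ?_)
    rintro a b ⟨h3, h4, h5⟩
    refine ⟨h3, fun hs => ?_⟩
    have hp : r' ≤ linf p ∧ r' ≤ linf q := by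
      rcases hs with ⟨rfl, rfl⟩ | ⟨rfl, rfl⟩ <;> exact ⟨by assumption, by assumption⟩
    have hp1 : ¬ (linf p ≤ r' - 1) := by omega
    have hq1 : ¬ (linf q ≤ r' - 1) := by omega
    rw [linf_le_iff] at hp1 hq1
    unfold insF at h1 h2
    rcases hc with ⟨a, b, h, rfl, rfl⟩ | ⟨a, b, h, rfl, rfl⟩ <;>
    rcases h with ⟨rfl, rfl⟩ | ⟨rfl, rfl⟩ <;> simp only at * <;> omega
  obtain ⟨a, b⟩ := f
  have hA : ∀ k : ℕ, ∀ a b : ℤ, (a.natAbs ≤ k) → insF r' (a, b) →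
      NW (a, b) (x :: t) = NW (0, b) (x :: t) := by
    intro k
    induction k with
    | zero =>
      intro a b h1 h2
      have : a = 0 := by omega
      rw [this]
    | succ k ih =>
      intro a b h1 h2
      rcases lt_trichotomy a 0 with h | h | h
      · have h3 : insF r' (a + 1, b) := by unfold insF at *; simp only at *; omega
        rw [← ih (a + 1) b (by omega) h3]
        exact hstep _ _ _ _ (Or.inl ⟨a, b, Or.inl ⟨rfl, rfl⟩, rfl, rfl⟩) h2 h3
      · rw [h]
      · have h3 : insF r' (a - 1, b) := by unfold insF at *; simp only at *; omega
        rw [← ih (a - 1) b (by omega) h3]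
        exact hstep _ _ _ _ (Or.inl ⟨a - 1, b, Or.inr ⟨rfl, by simp⟩, rfl, rfl⟩) h2 h3
  have hB : ∀ k : ℕ, ∀ b : ℤ, (b.natAbs ≤ k) → insF r' (0, b) →
      NW (0, b) (x :: t) = NW (0, 0) (x :: t) := by
    intro k
    induction k with
    | zero =>
      intro b h1 h2
      have : b = 0 := by omega
      rw [this]
    | succ k ih =>
      intro b h1 h2
      rcases lt_trichotomy b 0 with h | h | h
      · have h3 : insF r' (0, b + 1) := by unfold insF at *; simp only at *; omega
        rw [← ih (b + 1) (by omega) h3]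
        exact hstep _ _ _ _ (Or.inr ⟨0, b, Or.inl ⟨rfl, rfl⟩, rfl, rfl⟩) h2 h3
      · rw [h]
      · have h3 : insF r' (0, b - 1) := by unfold insF at *; simp only at *; omega
        rw [← ih (b - 1) (by omega) h3]
        exact hstep _ _ _ _ (Or.inr ⟨0, b - 1, Or.inr ⟨rfl, by simp⟩, rfl, rfl⟩) h2 h3
  rw [hA _ a b le_rfl hf]
  refine hB _ b le_rfl ?_
  unfold insF at *; simp only at *; omega

lemma NW_far {R1 : ℤ} (x : Lat) (t : List Lat)
    (hlast : (x :: t).getLast (by simp) = x)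
    (hZ : (x :: t).IsChain (fun p q => Adj p q ∧ linf p ≤ R1 ∧ linf q ≤ R1)) {f : Lat}
    (hf : ¬ insF R1 f) : NW f (x :: t) = 0 := by
  have h1 : ∀ g : Lat, R1 ≤ g.1 ∨ R1 ≤ g.2 ∨ g.2 < - R1 → NW g (x :: t) = 0 := by
    intro g hg
    clear hlast
    induction t generalizing x with
    | nil => rfl
    | cons y t ih =>
      rw [List.isChain_cons_cons] at hZ
      rw [NW_cons, ih y hZ.2]
      obtain ⟨⟨-, h1, h2⟩, -⟩ := hZ
      rw [linf_le_iff] at h1 h2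
      unfold nuF
      split_ifs <;> omega
  have hstep : ∀ a b : ℤ, a < -R1 → NW (a, b) (x :: t) = NW (a, b + 1) (x :: t) := by
    intro a b hab
    refine NW_cross (Or.inr ⟨a, b, Or.inl ⟨rfl, rfl⟩, rfl, rfl⟩) x t hlast (hZ.imp ?_)
    rintro p q ⟨h3, h4, h5⟩
    refine ⟨h3, fun hs => ?_⟩
    rw [linf_le_iff] at h4 h5
    rcases hs with ⟨rfl, rfl⟩ | ⟨rfl, rfl⟩ <;> simp only at * <;> omega
  by_cases hc : R1 ≤ f.1 ∨ R1 ≤ f.2 ∨ f.2 < - R1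
  · exact h1 f hc
  · obtain ⟨a, b⟩ := f
    have ha : a < -R1 := by unfold insF at hf; simp only at *; omega
    have : ∀ k : ℕ, NW (a, b) (x :: t) = NW (a, b + k) (x :: t) := by
      intro k
      induction k with
      | zero => simp
      | succ k ih => rw [ih, hstep _ _ ha]; push_cast; rw [add_assoc]
    rw [this (R1 - b).toNat]
    apply h1
    simp only at *; omega

lemma loop_zero {l : List Lat} {r R r' R1 : ℤ} (h : ND l r R) (hr1 : r + 1 ≤ r') (hr0 : 0 ≤ r)
    (hR : r' + 1 ≤ R1) (hR1 : R1 + 1 ≤ R) : ∃ pi qi po qo,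
    (linf pi = r' ∧ linf qi = r' ∧ Adj pi qi) ∧ (linf po = R1 ∧ linf qo = R1 ∧ Adj po qo) ∧
    ∀ (x : Lat) (t : List Lat), (x :: t).getLast (by simp) = x →
      (x :: t).IsChain (zrel l r' R1 pi qi po qo) → NW (0, 0) (x :: t) = 0 := by
  obtain ⟨b, q, hb, hq, hpath⟩ := h
  have hbi : insF r' b := by rw [linf_le_iff] at hb; unfold insF; omega
  have hqi : ¬ insF R1 q := by rw [linf_eq_iff] at hq; unfold insF; omega
  have hqi' : ¬ insF r' q := by rw [linf_eq_iff] at hq; unfold insF; omega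
  obtain ⟨f, g, hf, hg, ⟨pi, qi, hci, hui⟩, hp2⟩ := last_exit (insF r') hpath hbi hqi'
  have hgR : insF R1 g := by
    have := cross_ins hci hf
    unfold insF at *; omega
  obtain ⟨f', g', hf', hg', ⟨⟨po, qo, hco, huo⟩, hnf', hng'⟩, hp3⟩ :=
    first_exit (insF R1) hp2 hgR hqi
  refine ⟨pi, qi, po, qo, cross_ring hci hf hg, cross_ring hco hf' hg', ?_⟩
  intro x t hlast hZ
  have ri := cross_ring hci hf hg
  have ro := cross_ring hco hf' hg'
  have hus : ∀ {p q a b : Lat}, sameE p q a b → usedE l a b → usedE l p q := by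
    rintro p q a b (⟨rfl, rfl⟩ | ⟨rfl, rfl⟩) h
    · exact h
    · exact usedE_symm h
  have hring : ∀ {p q a b : Lat} {n : ℤ}, sameE p q a b → linf a = n → linf b = n →
      linf p = n ∧ linf q = n := by
    rintro p q a b n (⟨rfl, rfl⟩ | ⟨rfl, rfl⟩) h1 h2
    · exact ⟨h1, h2⟩
    · exact ⟨h2, h1⟩
  have e0 : NW f (x :: t) = NW (0, 0) (x :: t) :=
    NW_ins (by omega) x t hlast (hZ.imp fun a b h => ⟨h.1, h.2.1, h.2.2.2.1⟩) hf
  have e1 : NW f (x :: t) = NW g (x :: t) := by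
    refine NW_cross hci x t hlast (hZ.imp ?_)
    rintro a b ⟨h1, -, -, -, -, h2⟩
    refine ⟨h1, fun hs => ?_⟩
    rcases h2 with h2 | h2 | h2
    · exact hui (hus hs h2)
    · exact h2.2.2 hs
    · have := hring hs h2.1 h2.2.1
      omega
  have e2 : NW f' (x :: t) = NW g' (x :: t) := by
    refine NW_cross hco x t hlast (hZ.imp ?_)
    rintro a b ⟨h1, -, -, -, -, h2⟩
    refine ⟨h1, fun hs => ?_⟩
    rcases h2 with h2 | h2 | h2
    · exact huo (hus hs h2)
    · have := hring hs h2.1 h2.2.1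
      omega
    · exact h2.2.2 hs
  have e3 : NW g' (x :: t) = 0 :=
    NW_far x t hlast (hZ.imp fun a b h => ⟨h.1, h.2.2.1, h.2.2.2.2.1⟩) hg'
  have e4 : NW g (x :: t) = NW f' (x :: t) := by
    clear hf' hg' hco huo hnf' hng' e2 e3 ro
    induction hp3 with
    | refl => rfl
    | tail _ hs ih =>
      rw [ih]
      obtain ⟨⟨⟨p, q, hc, hu⟩, hn1, hn2⟩, hP1, hP2⟩ := hs
      refine NW_cross hc x t hlast (hZ.imp ?_)
      rintro a b ⟨h1, -, -, -, -, h2⟩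
      refine ⟨h1, fun hs => ?_⟩
      rcases h2 with h2 | h2 | h2
      · exact hu (hus hs h2)
      · have := hring hs h2.1 h2.2.1
        exact ring_cross hc this.1 this.2 (by simp [hn1, hn2])
      · have := hring hs h2.1 h2.2.1
        exact ring_cross hc this.1 this.2 (by simp [hP1, hP2])
  rw [← e0, e1, e4, e2, e3]
/-! ### From continuous to dual paths -/

lemma infix_zip {p q : Lat} {l : List Lat} (h : [p, q] <:+: l) : (p, q) ∈ l.zip l.tail := by
  obtain ⟨s, t, rfl⟩ := h
  induction s with
  | nil => simp
  | cons a s ih =>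
    cases s with
    | nil => simp
    | cons b s =>
      simp only [List.cons_append, List.nil_append, List.append_assoc, List.tail_cons,
        List.zip_cons_cons, List.mem_cons] at ih ⊢
      right
      exact ih

lemma usedE_trace {p q : Lat} {l : List Lat} (h : usedE l p q) :
    segment ℝ (emb p) (emb q) ⊆ traceL l := by
  unfold traceL
  rcases h with h | h
  · intro x hx
    right
    simp only [Set.mem_iUnion]
    exact ⟨(p, q), infix_zip h, hx⟩
  · intro x hx
    right
    simp only [Set.mem_iUnion]
    rw [segment_symm] at hx
    exact ⟨(q, p), infix_zip h, hx⟩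

lemma mem_seg_v {x : Plane} {a b : ℤ} (h0 : x 0 = a) (h1 : ⌊x 1⌋ = b) :
    x ∈ segment ℝ (emb (a, b)) (emb (a, b + 1)) := by
  rw [Int.floor_eq_iff] at h1
  rw [segment_eq_image]
  refine ⟨x 1 - b, ⟨by linarith, by linarith⟩, ?_⟩
  ext i
  fin_cases i
  · simp [emb, h0]; ring
  · simp [emb]; ring

lemma mem_seg_h {x : Plane} {a b : ℤ} (h0 : ⌊x 0⌋ = a) (h1 : x 1 = b) :
    x ∈ segment ℝ (emb (a, b)) (emb (a + 1, b)) := by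
  rw [Int.floor_eq_iff] at h0
  rw [segment_eq_image]
  refine ⟨x 0 - a, ⟨by linarith, by linarith⟩, ?_⟩
  ext i
  fin_cases i
  · simp [emb]; ring
  · simp [emb, h1]; ring

lemma mem_seg_h' {x : Plane} {a b : ℤ} (h0 : x 0 = a) (h1 : x 1 = b) :
    x ∈ segment ℝ (emb (a - 1, b)) (emb (a, b)) := by
  have : x = emb (a, b) := by
    ext i
    fin_cases i
    · simp [emb, h0]
    · simp [emb, h1]
  rw [this]; exact right_mem_segment _ _ _

/-- The face containing a point. -/
def faceOf (x : Plane) : Lat := (⌊x 0⌋, ⌊x 1⌋)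

lemma DS_symm {l : List Lat} {f g : Lat} (h : DS l f g) : DS l g f := by
  obtain ⟨p, q, hc, hu⟩ := h
  refine ⟨p, q, ?_, hu⟩
  rcases hc with ⟨a, b, h, h2⟩ | ⟨a, b, h, h2⟩
  · exact Or.inl ⟨a, b, h.symm, h2⟩
  · exact Or.inr ⟨a, b, h.symm, h2⟩

lemma DS_star_symm {l : List Lat} {f g : Lat} (h : Relation.ReflTransGen (DS l) f g) :
    Relation.ReflTransGen (DS l) g f := by
  induction h with
  | refl => exact .refl
  | tail _ h ih => exact ih.head (DS_symm h)

lemma face_local {l : List Lat} {x y : Plane} (hx : x ∉ traceL l)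
    (h0 : ⌊y 0⌋ = ⌊x 0⌋ ∨ (x 0 = ⌊x 0⌋ ∧ ⌊y 0⌋ = ⌊x 0⌋ - 1))
    (h1 : ⌊y 1⌋ = ⌊x 1⌋ ∨ (x 1 = ⌊x 1⌋ ∧ ⌊y 1⌋ = ⌊x 1⌋ - 1)) :
    Relation.ReflTransGen (DS l) (faceOf x) (faceOf y) := by
  unfold faceOf
  obtain ⟨a, ha⟩ : ∃ a, a = ⌊x 0⌋ := ⟨_, rfl⟩
  obtain ⟨b, hb⟩ : ∃ b, b = ⌊x 1⌋ := ⟨_, rfl⟩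
  rw [← ha] at h0 ⊢
  rw [← hb] at h1 ⊢
  have e1 : x 0 = a → DS l (a, b) (a - 1, b) := fun h =>
    ⟨(a - 1 + 1, b), (a - 1 + 1, b + 1), Or.inl ⟨a - 1, b, Or.inr ⟨rfl, by simp⟩, rfl, rfl⟩, by
      intro hu
      rw [sub_add_cancel] at hu
      exact hx (usedE_trace hu (mem_seg_v h hb.symm))⟩
  have e2 : x 1 = b → DS l (a, b) (a, b - 1) := fun h =>
    ⟨(a, b - 1 + 1), (a + 1, b - 1 + 1), Or.inr ⟨a, b - 1, Or.inr ⟨rfl, by simp⟩, rfl, rfl⟩, by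
      intro hu
      rw [sub_add_cancel] at hu
      exact hx (usedE_trace hu (mem_seg_h ha.symm h))⟩
  have e3 : x 0 = a → x 1 = b → DS l (a - 1, b) (a - 1, b - 1) := fun h h' =>
    ⟨(a - 1, b - 1 + 1), (a - 1 + 1, b - 1 + 1),
      Or.inr ⟨a - 1, b - 1, Or.inr ⟨rfl, by simp⟩, rfl, rfl⟩, by
      intro hu
      rw [sub_add_cancel, sub_add_cancel] at hu
      exact hx (usedE_trace hu (mem_seg_h' h h'))⟩
  rcases h0 with h0 | ⟨h0, h0'⟩
  · rw [h0]
    rcases h1 with h1 | ⟨h1, h1'⟩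
    · rw [h1]
    · rw [h1']; exact .single (e2 h1)
  · rw [h0']
    rcases h1 with h1 | ⟨h1, h1'⟩
    · rw [h1]; exact .single (e1 h0)
    · rw [h1']; exact (Relation.ReflTransGen.single (e1 h0)).tail (e3 h0 h1)

lemma floor_local {f : ℝ → ℝ} {s : Set ℝ} {t : ℝ} (hf : ContinuousWithinAt f s t) :
    ∀ᶠ u in nhdsWithin t s, ⌊f u⌋ = ⌊f t⌋ ∨ (f t = ⌊f t⌋ ∧ ⌊f u⌋ = ⌊f t⌋ - 1) := by
  by_cases h : f t = ⌊f t⌋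
  · have h1 : ∀ᶠ u in nhdsWithin t s, f u ∈ Set.Ioo (f t - 1) (f t + 1) :=
      hf (Ioo_mem_nhds (by linarith) (by linarith))
    filter_upwards [h1] with u hu
    by_cases h2 : (⌊f t⌋ : ℝ) ≤ f u
    · left; rw [Int.floor_eq_iff]; exact ⟨h2, by linarith [hu.2]⟩
    · right
      refine ⟨h, ?_⟩
      rw [Int.floor_eq_iff]; push_cast
      constructor <;> linarith [hu.1]
  · have h3 := Int.floor_le (f t)
    have h4 := Int.lt_floor_add_one (f t)
    have h5 : (⌊f t⌋ : ℝ) < f t := lt_of_le_of_ne h3 (fun h' => h h'.symm)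
    have h1 : ∀ᶠ u in nhdsWithin t s, f u ∈ Set.Ioo (⌊f t⌋ : ℝ) (⌊f t⌋ + 1) :=
      hf (Ioo_mem_nhds h5 h4)
    filter_upwards [h1] with u hu
    left; rw [Int.floor_eq_iff]; exact ⟨hu.1.le, hu.2⟩

lemma faceOf_emb (p : Lat) : faceOf (emb p) = p := by
  unfold faceOf
  ext <;> simp [emb]

lemma linf_bdry {z : Lat} {R : ℤ} (h : z ∈ bdry (box 0 R)) : linf z = R := by
  obtain ⟨h1, w, h2, h3⟩ := h
  simp only [box, Set.mem_setOf_eq, sub_zero] at h1 h2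
  rw [linf_eq_iff]
  rw [linf_le_iff] at h1 h2
  rw [linf_eq_iff] at h3
  simp only [Prod.fst_sub, Prod.snd_sub] at h3
  omega

lemma ND_of_not_disconnects {l : List Lat} {r R : ℤ}
    (h : ¬ Disconnects (traceL l) (embS (box 0 r)) (bdryE 0 R)) : ND l r R := by
  unfold Disconnects at h
  push Not at h
  obtain ⟨γ, hγ, h0, h1, hav⟩ := h
  obtain ⟨b, hb, hb'⟩ := h0
  obtain ⟨q, hq, hq'⟩ := h1
  refine ⟨b, q, ?_, linf_bdry hq, ?_⟩
  · simpa [box] using hb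
  have key := (isPreconnected_Icc (a := (0 : ℝ)) (b := 1)).induction₂
    (fun t u => Relation.ReflTransGen (DS l) (faceOf (γ t)) (faceOf (γ u))) ?_ ?_ ?_
    (x := 0) (y := 1) (by simp) (by simp)
  · rw [← hb', ← hq', faceOf_emb, faceOf_emb] at key
    exact key
  · intro t ht
    have hc : ∀ i : Fin 2, ContinuousWithinAt (fun u => γ u i) (Set.Icc 0 1) t := by
      intro i
      have := (hγ t ht)
      exact (EuclideanSpace.proj (𝕜 := ℝ) i).continuous.continuousAt.comp_continuousWithinAt this
    filter_upwards [floor_local (hc 0), floor_local (hc 1)] with u h1 h2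
    exact face_local (hav t ht) h1 h2
  · intro x y z _ _ _ h1 h2
    exact h1.trans h2
  · intro x y _ _ h1
    exact DS_star_symm h1

lemma hits_ring {l : List Lat} {R : ℤ} (hl : IsPath l)
    (h : (traceL l ∩ bdryE 0 R).Nonempty) : ∃ v ∈ l, linf v = R := by
  obtain ⟨x, hx, q, hq, rfl⟩ := h
  have hR := linf_bdry hq
  have inj : ∀ p, emb q = emb p → q = p := by
    intro p hp
    rw [← faceOf_emb q, hp, faceOf_emb]
  unfold traceL at hx
  rcases hx with hx | hx
  · simp only [Set.mem_iUnion, Set.mem_singleton_iff] at hx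
    obtain ⟨p, hp, h⟩ := hx
    rw [← inj p h] at hp
    exact ⟨q, hp, hR⟩
  · simp only [Set.mem_iUnion] at hx
    obtain ⟨⟨p, p'⟩, hp, h⟩ := hx
    have hadj : Adj p p' := by
      obtain ⟨i, hi, hi2⟩ := List.getElem_of_mem hp
      have := List.isChain_iff_getElem.mp hl.2 i (by
        simp only [List.length_zip, List.length_tail] at hi; omega)
      simp only [List.getElem_zip, Prod.mk.injEq, List.getElem_tail] at hi2
      rw [hi2.1, hi2.2] at this
      exact this
    have hm : p ∈ l ∧ p' ∈ l := by
      have := List.of_mem_zip hp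
      exact ⟨this.1, List.mem_of_mem_tail this.2⟩
    rw [segment_eq_image] at h
    obtain ⟨θ, hθ, h⟩ := h
    have c0 : (1 - θ) * p.1 + θ * p'.1 = (q.1 : ℝ) := by
      have := congrArg (fun v : Plane => v 0) h
      simpa [emb] using this
    have c1 : (1 - θ) * p.2 + θ * p'.2 = (q.2 : ℝ) := by
      have := congrArg (fun v : Plane => v 1) h
      simpa [emb] using this
    have hk : ∃ k : ℤ, θ = k := by
      rcases adj_cases hadj with h | h | h | h
      · refine ⟨q.1 - p.1, ?_⟩; rw [h.1] at c0; push_cast at *; linarith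
      · refine ⟨p.1 - q.1, ?_⟩; rw [h.1] at c0; push_cast at *; linarith
      · refine ⟨q.2 - p.2, ?_⟩; rw [h.2] at c1; push_cast at *; linarith
      · refine ⟨p.2 - q.2, ?_⟩; rw [h.2] at c1; push_cast at *; linarith
    obtain ⟨k, rfl⟩ := hk
    have k0 : (0 : ℤ) ≤ k := by exact_mod_cast hθ.1
    have k1 : k ≤ 1 := by exact_mod_cast hθ.2
    have : k = 0 ∨ k = 1 := by omega
    rcases this with rfl | rfl
    · have : q = p := by
        ext
        · have : (p.1 : ℝ) = q.1 := by simpa using c0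
          exact_mod_cast this.symm
        · have : (p.2 : ℝ) = q.2 := by simpa using c1
          exact_mod_cast this.symm
      exact ⟨q, this ▸ hm.1, hR⟩
    · have : q = p' := by
        ext
        · have : (p'.1 : ℝ) = q.1 := by simpa using c0
          exact_mod_cast this.symm
        · have : (p'.2 : ℝ) = q.2 := by simpa using c1
          exact_mod_cast this.symm
      exact ⟨q, this ▸ hm.2, hR⟩
/-! ### Arcs in rings -/

/-- Parametrization of the ring of radius `n`. -/
def thp (n k : ℤ) : Lat :=
  if k < 2 * n then (n, -n + k) else if k < 4 * n then (3 * n - k, n) else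
  if k < 6 * n then (-n, 5 * n - k) else (k - 7 * n, -n)

/-- Shifted parametrization. -/
def ths (n j i : ℤ) : Lat := if j + 1 + i < 8 * n then thp n (j + 1 + i) else
  thp n (j + 1 + i - 8 * n)

lemma thp_linf {n k : ℤ} (hn : 1 ≤ n) (h0 : 0 ≤ k) (h1 : k < 8 * n) : linf (thp n k) = n := by
  rw [linf_eq_iff]; unfold thp; split_ifs <;> simp <;> omega

lemma thp_surj {n : ℤ} (hn : 1 ≤ n) {p : Lat} (h : linf p = n) :
    ∃ k, 0 ≤ k ∧ k < 8 * n ∧ thp n k = p := by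
  rw [linf_eq_iff] at h
  obtain ⟨a, b⟩ := p
  simp only at h
  by_cases h1 : a = n ∧ b < n
  · refine ⟨b + n, by omega, by omega, ?_⟩
    unfold thp; rw [if_pos (by omega)]; ext <;> simp only <;> omega
  by_cases h2 : b = n ∧ -n < a
  · refine ⟨3 * n - a, by omega, by omega, ?_⟩
    unfold thp; rw [if_neg (by omega), if_pos (by omega)]; ext <;> simp only <;> omega
  by_cases h3 : a = -n ∧ -n < b
  · refine ⟨5 * n - b, by omega, by omega, ?_⟩
    unfold thp; rw [if_neg (by omega), if_neg (by omega), if_pos (by omega)]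
    ext <;> simp only <;> omega
  · refine ⟨a + 7 * n, by omega, by omega, ?_⟩
    unfold thp; rw [if_neg (by omega), if_neg (by omega), if_neg (by omega)]
    ext <;> simp only <;> omega

lemma thp_inj {n k k' : ℤ} (hn : 1 ≤ n) (h0 : 0 ≤ k) (h1 : k < 8 * n) (h0' : 0 ≤ k')
    (h1' : k' < 8 * n) (h : thp n k = thp n k') : k = k' := by
  unfold thp at h
  rw [Prod.ext_iff] at h
  split_ifs at h <;> simp only at h <;> omega

lemma thp_adj {n k : ℤ} (h0 : 0 ≤ k) (h1 : k + 1 < 8 * n) : Adj (thp n k) (thp n (k + 1)) := by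
  apply adj_of_cases
  unfold thp
  split_ifs <;> simp <;> omega

lemma thp_adj_last {n : ℤ} (hn : 1 ≤ n) : Adj (thp n (8 * n - 1)) (thp n 0) := by
  apply adj_of_cases
  unfold thp
  split_ifs <;> simp <;> omega

lemma thp_edge {n k k' : ℤ} (hn : 1 ≤ n) (h0 : 0 ≤ k) (h1 : k < 8 * n) (h0' : 0 ≤ k')
    (h1' : k' < 8 * n) (h : Adj (thp n k) (thp n k')) :
    k' = k + 1 ∨ k = k' + 1 ∨ (k = 8 * n - 1 ∧ k' = 0) ∨ (k = 0 ∧ k' = 8 * n - 1) := by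
  have h := adj_cases h
  unfold thp at h
  split_ifs at h <;> simp only at h <;> omega

lemma ths_arc {n j : ℤ} (hn : 1 ≤ n) (hj0 : 0 ≤ j) (hj : j < 8 * n) (m : ℕ) (a : ℤ) (ha : 0 ≤ a)
    (ham : a + m < 8 * n) : ∃ α : List Lat, α.head? = some (ths n j a) ∧
      α.getLast? = some (ths n j (a + m)) ∧ (∀ p ∈ α, ∃ i, a ≤ i ∧ i ≤ a + m ∧ p = ths n j i) ∧
      α.Nodup ∧ α.IsChain (fun p q => Adj p q ∧
        ∃ i, 0 ≤ i ∧ i + 1 < 8 * n ∧ p = ths n j i ∧ q = ths n j (i + 1)) := by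
  induction m generalizing a with
  | zero =>
    refine ⟨[ths n j a], by simp, by simp, ?_, by simp, by simp⟩
    intro p hp
    exact ⟨a, le_rfl, by simp, by simpa using hp⟩
  | succ m ih =>
    push_cast at ham
    obtain ⟨α, h1, h2, h3, h4, h5⟩ := ih (a + 1) (by omega) (by omega)
    refine ⟨ths n j a :: α, by simp, ?_, ?_, ?_, ?_⟩
    · rw [List.getLast?_cons, h2]; simp; ring_nf
    · intro p hp
      rcases List.mem_cons.mp hp with rfl | hp
      · exact ⟨a, le_rfl, by omega, rfl⟩
      · obtain ⟨i, h6, h7, h8⟩ := h3 p hp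
        exact ⟨i, by omega, by push_cast; omega, h8⟩
    · rw [List.nodup_cons]
      refine ⟨?_, h4⟩
      intro hm
      obtain ⟨i, h6, h7, h8⟩ := h3 _ hm
      unfold ths at h8
      split_ifs at h8
      all_goals have := thp_inj hn (by omega) (by omega) (by omega) (by omega) h8
      all_goals omega
    · rw [List.isChain_cons]
      refine ⟨?_, h5⟩
      intro y hy
      rw [h1] at hy
      simp only [Option.mem_def, Option.some.injEq] at hy
      subst hy
      refine ⟨?_, a, ha, by omega, rfl, rfl⟩
      unfold ths
      split_ifs with h6 h7 h7
      · have := thp_adj (n := n) (k := j + 1 + a) (by omega) (by omega)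
        rwa [show j + 1 + (a + 1) = j + 1 + a + 1 by ring]
      · have := thp_adj_last hn
        rwa [show j + 1 + a = 8 * n - 1 by omega, show j + 1 + (a + 1) - 8 * n = 0 by omega]
      · omega
      · have := thp_adj (n := n) (k := j + 1 + a - 8 * n) (by omega) (by omega)
        rwa [show j + 1 + (a + 1) - 8 * n = j + 1 + a - 8 * n + 1 by ring]

lemma ths_surj {n j : ℤ} (hn : 1 ≤ n) (hj0 : 0 ≤ j) (hj : j < 8 * n) {p : Lat}
    (h : linf p = n) : ∃ i, 0 ≤ i ∧ i < 8 * n ∧ ths n j i = p := by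
  obtain ⟨k, h0, h1, rfl⟩ := thp_surj hn h
  unfold ths
  by_cases hk : j + 1 ≤ k
  · refine ⟨k - j - 1, by omega, by omega, ?_⟩
    rw [if_pos (by omega)]; congr 1; ring
  · refine ⟨k - j - 1 + 8 * n, by omega, by omega, ?_⟩
    rw [if_neg (by omega)]; congr 1; ring

lemma adj_rev_chain {P : Lat → Lat → Prop} (hP : ∀ p q, P p q → P q p) {α : List Lat}
    (h : α.IsChain P) : α.reverse.IsChain P := by
  rw [List.isChain_reverse]
  exact h.imp (fun a b hab => hP _ _ hab)

lemma ring_arc {n : ℤ} (hn : 1 ≤ n) {p0 q0 u v : Lat} (hp : linf p0 = n) (hq : linf q0 = n)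
    (hpq : Adj p0 q0) (hu : linf u = n) (hv : linf v = n) :
    ∃ α : List Lat, α.head? = some u ∧ α.getLast? = some v ∧ (∀ p ∈ α, linf p = n) ∧ α.Nodup ∧
      α.IsChain (fun p q => Adj p q ∧ ¬ sameE p0 q0 p q) := by
  obtain ⟨k, hk0, hk1, rfl⟩ := thp_surj hn hp
  obtain ⟨k', hk0', hk1', rfl⟩ := thp_surj hn hq
  have hed := thp_edge hn hk0 hk1 hk0' hk1' hpq
  have hed : ∃ j, 0 ≤ j ∧ j < 8 * n ∧ sameE (thp n j) (ths n j 0) (thp n k) (thp n k') := by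
    rcases hed with h | h | h | h
    · refine ⟨k, hk0, hk1, Or.inl ⟨rfl, ?_⟩⟩
      unfold ths; rw [if_pos (by omega), h, add_zero]
    · refine ⟨k', hk0', hk1', Or.inr ⟨?_, rfl⟩⟩
      unfold ths; rw [if_pos (by omega), h, add_zero]
    · refine ⟨k, hk0, hk1, Or.inl ⟨rfl, ?_⟩⟩
      unfold ths; rw [if_neg (by omega)]; congr 1; omega
    · refine ⟨k', hk0', hk1', Or.inr ⟨?_, rfl⟩⟩
      unfold ths; rw [if_neg (by omega)]; congr 1; omega
  obtain ⟨j, hj0, hj1, hse⟩ := hed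
  have hinj : ∀ i i', 0 ≤ i → i < 8 * n → 0 ≤ i' → i' < 8 * n → ths n j i = ths n j i' → i = i' := by
    intro i i' h1 h2 h3 h4 h5
    unfold ths at h5
    split_ifs at h5
    all_goals have := thp_inj hn (by omega) (by omega) (by omega) (by omega) h5
    all_goals omega
  have hlast : thp n j = ths n j (8 * n - 1) := by
    unfold ths; rw [if_neg (by omega)]; congr 1; ring
  have hlin : ∀ i, 0 ≤ i → i < 8 * n → linf (ths n j i) = n := by
    intro i h1 h2
    unfold ths; split_ifs <;> apply thp_linf hn <;> omega
  have hns : ∀ i, 0 ≤ i → i + 1 < 8 * n →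
      ¬ sameE (thp n k) (thp n k') (ths n j i) (ths n j (i + 1)) := by
    intro i h1 h2 hs
    have : (ths n j i = ths n j (8 * n - 1) ∧ ths n j (i + 1) = ths n j 0) ∨
        (ths n j i = ths n j 0 ∧ ths n j (i + 1) = ths n j (8 * n - 1)) := by
      rw [← hlast]
      rcases hse with ⟨h3, h4⟩ | ⟨h3, h4⟩ <;> rw [h3, h4] at hs
      · exact hs
      · exact hs.symm
    rcases this with h | h
    · have := hinj _ _ (by omega) (by omega) (by omega) (by omega) h.1
      omega
    · have := hinj _ _ (by omega) (by omega) (by omega) (by omega) h.1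
      have := hinj _ _ (by omega) (by omega) (by omega) (by omega) h.2
      omega
  obtain ⟨a, ha0, ha1, rfl⟩ := ths_surj hn hj0 hj1 hu
  obtain ⟨b, hb0, hb1, rfl⟩ := ths_surj hn hj0 hj1 hv
  rcases le_total a b with hab | hab
  · obtain ⟨α, h1, h2, h3, h4, h5⟩ := ths_arc hn hj0 hj1 (b - a).toNat a ha0 (by omega)
    have e : a + ((b - a).toNat : ℤ) = b := by omega
    rw [e] at h2 h3
    refine ⟨α, h1, h2, ?_, h4, h5.imp ?_⟩
    · intro p hp
      obtain ⟨i, h6, h7, rfl⟩ := h3 p hp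
      exact hlin i (by omega) (by omega)
    · rintro p q ⟨h6, i, h7, h8, rfl, rfl⟩
      exact ⟨h6, hns i h7 h8⟩
  · obtain ⟨α, h1, h2, h3, h4, h5⟩ := ths_arc hn hj0 hj1 (a - b).toNat b hb0 (by omega)
    have e : b + ((a - b).toNat : ℤ) = a := by omega
    rw [e] at h2 h3
    refine ⟨α.reverse, by simpa using h2, by simpa using h1, ?_, by simpa using h4, ?_⟩
    · intro p hp
      obtain ⟨i, h6, h7, rfl⟩ := h3 p (by simpa using hp)
      exact hlin i (by omega) (by omega)
    · apply adj_rev_chain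
      · rintro p q ⟨h6, h7⟩
        exact ⟨adj_symm h6, fun h => h7 (by unfold sameE at *; tauto)⟩
      · refine h5.imp ?_
        rintro p q ⟨h6, i, h7, h8, rfl, rfl⟩
        exact ⟨h6, hns i h7 h8⟩
/-! ### The lattice multigraph with a chord -/

/-- The four neighbours. -/
def nbF (v : Lat) : Finset Lat :=
  {(v.1 + 1, v.2), (v.1 - 1, v.2), (v.1, v.2 + 1), (v.1, v.2 - 1)}

lemma mem_nbF {v q : Lat} : q ∈ nbF v ↔ Adj v q := by
  unfold nbF
  simp only [Finset.mem_insert, Finset.mem_singleton, Prod.ext_iff]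
  constructor
  · intro h; apply adj_of_cases; omega
  · intro h; have := adj_cases h; omega

lemma sum_nbF {M : Type*} [AddCommMonoid M] (v : Lat) (f : Lat → M) :
    ∑ q ∈ nbF v, f q =
      f (v.1 + 1, v.2) + (f (v.1 - 1, v.2) + (f (v.1, v.2 + 1) + f (v.1, v.2 - 1))) := by
  unfold nbF
  rw [Finset.sum_insert, Finset.sum_insert, Finset.sum_insert, Finset.sum_singleton]
  · simp only [Finset.mem_singleton, Prod.ext_iff, not_and]; omega
  · simp only [Finset.mem_insert, Finset.mem_singleton, Prod.ext_iff, not_or, not_and]; omega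
  · simp only [Finset.mem_insert, Finset.mem_singleton, Prod.ext_iff, not_or, not_and]; omega

/-- The open annulus. -/
abbrev AV (r1 R1 : ℤ) : Type := {v : Lat // r1 < linf v ∧ linf v < R1}

lemma box_finite (n : ℤ) : {v : Lat | linf v ≤ n}.Finite := by
  apply ((Set.finite_Icc (-n) n).prod (Set.finite_Icc (-n) n)).subset
  intro v hv
  have := linf_le_iff.mp hv
  exact ⟨⟨this.1.1, this.1.2⟩, ⟨this.2.1, this.2.2⟩⟩

instance avFintype (r1 R1 : ℤ) : Fintype (AV r1 R1) :=
  (Set.Finite.subset (box_finite R1) (fun _ hv => hv.2.le) :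
    {v : Lat | r1 < linf v ∧ linf v < R1}.Finite).fintype

/-- Darts. -/
abbrev AE (r1 R1 : ℤ) : Type := {p : AV r1 R1 × AV r1 R1 // Adj p.1.1 p.2.1} ⊕ Bool

instance aeFintype (r1 R1 : ℤ) : Fintype (AE r1 R1) := inferInstance

/-- The face of the origin. -/
abbrev f0 : Lat := (0, 0)

/-- Lattice multigraph with chord `u' → v'`. -/
def LG {r1 R1 : ℤ} (u' v' : AV r1 R1) (mo : ZMod 4) : MG (AV r1 R1) (AE r1 R1) where
  src := Sum.elim (fun e => e.1.1) (fun b => bif b then u' else v')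
  tgt := Sum.elim (fun e => e.1.2) (fun b => bif b then v' else u')
  w := Sum.elim (fun e => ((nuF f0 e.1.1.1 e.1.2.1 : ℤ) : ZMod 4)) (fun b => bif b then mo else -mo)
  wt := Sum.elim (fun _ => TrivSqZeroExt.inl (1 / 4)) (fun _ => TrivSqZeroExt.inr 1)
  wt_nonneg := by
    rintro (e | b)
    · rw [dr_le_def]; simp
    · rw [dr_le_def]; simp
  rev := Sum.elim (fun e => Sum.inl ⟨(e.1.2, e.1.1), adj_symm e.2⟩) (fun b => Sum.inr (!b))
  rev_rev := by rintro (e | b) <;> simp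
  src_rev := by
    rintro (e | b)
    · simp
    · cases b <;> simp
  w_rev := by
    rintro (e | b)
    · simp only [Sum.elim_inl]; rw [nuF_symm f0 e.2]; simp
    · cases b <;> simp
  wt_rev := by rintro (e | b) <;> simp

section LGsec
variable {r1 R1 : ℤ} (u' v' : AV r1 R1) (mo : ZMod 4)

/-- Expansion of darts into lattice vertices. -/
def exD (α : List Lat) : AE r1 R1 → List Lat :=
  Sum.elim (fun e => [e.1.1.1]) (fun b => bif b then u'.1 :: α else v'.1 :: α.reverse)

/-- `α` is an outer arc of class `mo`. -/
structure OArc (α : List Lat) : Prop where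
  chain : (u'.1 :: α ++ [v'.1]).IsChain Adj
  nw : ((NW f0 (u'.1 :: α ++ [v'.1]) : ℤ) : ZMod 4) = mo
  ring : ∀ p ∈ α, linf p = R1
  nodup : α.Nodup

variable {u' v' mo}

lemma exD_chain {α : List Lat} (h : OArc u' v' mo α) (d : AE r1 R1) :
    (exD u' v' α d ++ [((LG u' v' mo).tgt d).1]).IsChain Adj := by
  rcases d with e | b
  · simp only [exD, LG, Sum.elim_inl, List.singleton_append, List.isChain_cons_cons,
      List.isChain_singleton, and_true]
    exact e.2
  · cases b
    · have := adj_rev_chain (P := Adj) (fun p q hpq => adj_symm hpq) h.chain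
      simpa [exD, LG] using this
    · exact h.chain

lemma exD_nw {α : List Lat} (h : OArc u' v' mo α) (d : AE r1 R1) :
    ((NW f0 (exD u' v' α d ++ [((LG u' v' mo).tgt d).1]) : ℤ) : ZMod 4) = (LG u' v' mo).w d := by
  rcases d with e | b
  · simp [exD, LG]
  · cases b
    · have h2 := NW_reverse f0 _ h.chain
      have h3 := h.nw
      simp only [List.reverse_append, List.reverse_cons, List.reverse_nil, List.nil_append,
        List.singleton_append] at h2
      simp only [exD, LG, Sum.elim_inr, cond_false, List.cons_append] at *
      rw [h2]; push_cast; rw [h3]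
    · exact h.nw

lemma exD_head {α : List Lat} (d : AE r1 R1) :
    ∃ t, exD u' v' α d = ((LG u' v' mo).src d).1 :: t := by
  rcases d with e | b
  · exact ⟨[], rfl⟩
  · cases b
    · exact ⟨α.reverse, rfl⟩
    · exact ⟨α, rfl⟩

lemma flat_head {α : List Lat} {a b : AV r1 R1} {ds : List (AE r1 R1)}
    (h : (LG u' v' mo).WkIn Finset.univ a b ds) :
    ∃ t, ds.flatMap (exD u' v' α) ++ [b.1] = a.1 :: t := by
  cases ds with
  | nil => exact ⟨[], by simp [h.1]⟩
  | cons d ds =>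
    obtain ⟨t, ht⟩ := exD_head (u' := u') (v' := v') (mo := mo) (α := α) d
    rw [h.1] at ht
    exact ⟨t ++ (ds.flatMap (exD u' v' α) ++ [b.1]), by simp [ht]⟩

lemma flat_chain {α : List Lat} {P : Lat → Lat → Prop} {a b : AV r1 R1} {ds : List (AE r1 R1)}
    (h : (LG u' v' mo).WkIn Finset.univ a b ds)
    (hd : ∀ d ∈ ds, (exD u' v' α d ++ [((LG u' v' mo).tgt d).1]).IsChain P) :
    (ds.flatMap (exD u' v' α) ++ [b.1]).IsChain P := by
  induction ds generalizing a with
  | nil => simp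
  | cons d ds ih =>
    obtain ⟨t, ht⟩ := flat_head (α := α) h.2.2
    have h1 := ih h.2.2 (fun d hd' => hd d (List.mem_cons_of_mem _ hd'))
    rw [List.flatMap_cons, List.append_assoc, ht, List.isChain_split]
    rw [ht] at h1
    exact ⟨hd d (by simp), h1⟩

lemma flat_nw {α : List Lat} (hα : OArc u' v' mo α) {a b : AV r1 R1} {ds : List (AE r1 R1)}
    (h : (LG u' v' mo).WkIn Finset.univ a b ds) :
    ((NW f0 (ds.flatMap (exD u' v' α) ++ [b.1]) : ℤ) : ZMod 4) = (LG u' v' mo).cl ds := by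
  induction ds generalizing a with
  | nil => simp [MG.cl]
  | cons d ds ih =>
    obtain ⟨t, ht⟩ := flat_head (α := α) h.2.2
    have h1 := ih h.2.2
    rw [List.flatMap_cons, List.append_assoc, ht, NW_append, MG.cl_cons]
    rw [ht] at h1
    push_cast
    rw [h1, exD_nw hα]

lemma flat_nodup {α : List Lat} (hα : OArc u' v' mo α) {ds : List (AE r1 R1)}
    (hnd : (ds.map (LG u' v' mo).src).Nodup)
    (hb : ¬ (Sum.inr true ∈ ds ∧ Sum.inr false ∈ ds)) :
    (ds.flatMap (exD u' v' α)).Nodup := by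
  have hV : ∀ v : AV r1 R1, v.1 ∉ α := fun v hv => by
    have := hα.ring _ hv
    have := v.2.2
    omega
  rw [List.nodup_flatMap]
  constructor
  · rintro (e | b) -
    · simp [exD]
    · cases b <;> simp [exD, hV, hα.nodup]
  · have h1 : ds.Pairwise (fun d d' => (LG u' v' mo).src d ≠ (LG u' v' mo).src d') :=
      List.pairwise_map.mp hnd
    refine List.Pairwise.imp_of_mem ?_ h1
    intro d d' hd hd' hne
    have hne' : ((LG u' v' mo).src d).1 ≠ ((LG u' v' mo).src d').1 := fun h => hne (Subtype.ext h)
    rcases d with e | b <;> rcases d' with e' | b'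
    · simp only [Function.onFun, exD, LG, Sum.elim_inl, List.disjoint_singleton,
        List.mem_singleton] at *
      exact Ne.symm hne'
    · have h3 := hV e.1.1
      cases b' <;> simp [Function.onFun, exD, LG] at hne' ⊢ <;>
        exact ⟨hne', h3⟩
    · have h3 := hV e'.1.1
      cases b <;> simp [Function.onFun, exD, LG] at hne' ⊢ <;>
        exact ⟨Ne.symm hne', h3⟩
    · exfalso
      cases b <;> cases b' <;> simp_all

lemma not_both {a b : AV r1 R1} {ds : List (AE r1 R1)}
    (h : (LG u' v' mo).WkIn Finset.univ a b ds) (hnd : (ds.map (LG u' v' mo).src ++ [b]).Nodup) :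
    ¬ (Sum.inr true ∈ ds ∧ Sum.inr false ∈ ds) := by
  rintro ⟨h1, h2⟩
  obtain ⟨l1, l2, rfl⟩ := List.append_of_mem h1
  obtain ⟨c, hw1, hw2⟩ := (MG.WkIn_append _).mp h
  obtain ⟨-, -, hw3⟩ := hw2
  have ht : (LG u' v' mo).tgt (Sum.inr true) = v' := rfl
  have hs : (LG u' v' mo).src (Sum.inr true) = u' := rfl
  have ht' : (LG u' v' mo).tgt (Sum.inr false) = u' := rfl
  have hs' : (LG u' v' mo).src (Sum.inr false) = v' := rfl
  rw [ht] at hw3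
  simp only [List.map_append, List.map_cons, hs] at hnd
  cases l2 with
  | nil =>
    have : b = v' := hw3.1.symm
    rw [this] at hnd
    have hm : v' ∈ l1.map (LG u' v' mo).src := by
      simp at h2
      exact List.mem_map.mpr ⟨_, h2, hs'⟩
    rw [List.append_assoc, List.nodup_append] at hnd
    exact hnd.2.2 v' hm v' (by simp) rfl
  | cons d l3 =>
    obtain ⟨hd, -, hw4⟩ := hw3
    have hdd : d = Sum.inr false := by
      by_contra hne
      have : Sum.inr false ∈ l1 ∨ Sum.inr false ∈ l3 := by
        simp at h2
        rcases h2 with h | h | h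
        · exact Or.inl h
        · exact absurd h.symm hne
        · exact Or.inr h
      simp only [List.map_cons, hd] at hnd
      rcases this with h | h
      · have hm : v' ∈ l1.map (LG u' v' mo).src := List.mem_map.mpr ⟨_, h, hs'⟩
        rw [List.append_assoc, List.nodup_append] at hnd
        exact hnd.2.2 v' hm v' (by simp) rfl
      · have hm : v' ∈ l3.map (LG u' v' mo).src := List.mem_map.mpr ⟨_, h, hs'⟩
        rw [List.append_assoc, List.nodup_append] at hnd
        have := hnd.2.1
        simp only [List.cons_append, List.nodup_cons] at this
        exact this.2.1 (by simp only [List.mem_append]; exact Or.inl hm)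
    subst hdd
    rw [ht'] at hw4
    rw [List.append_assoc, List.nodup_append] at hnd
    have := hnd.2.1
    simp only [List.cons_append, List.nodup_cons] at this
    apply this.1
    cases l3 with
    | nil => have := hw4.1; simp [this]
    | cons e l4 => simp [hw4.1]

lemma zmod4_ne_two {k : ℤ} (h : |k| ≤ 1) : ((k : ℤ) : ZMod 4) ≠ 2 := by
  rw [abs_le] at h
  have : k = -1 ∨ k = 0 ∨ k = 1 := by omega
  rcases this with rfl | rfl | rfl <;> decide

lemma LG_PL {α : List Lat} (hα : OArc u' v' mo α) : (LG u' v' mo).PL := by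
  intro c ds hne hw hnd
  by_cases hb : Sum.inr true ∈ ds ∧ Sum.inr false ∈ ds
  · cases ds with
    | nil => exact absurd rfl hne
    | cons d ds =>
      obtain ⟨hd, -, hw2⟩ := hw
      have hnd2 : (ds.map (LG u' v' mo).src ++ [c]).Nodup := by
        rw [List.map_cons, hd] at hnd
        exact (List.perm_append_singleton _ _).nodup_iff.mpr hnd
      have hnb := not_both hw2 hnd2
      have key : ∀ bb : Bool, d = Sum.inr bb → Sum.inr (!bb) ∈ ds →
          (LG u' v' mo).cl (d :: ds) ≠ 2 := by
        rintro bb rfl hm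
        have e1 : (LG u' v' mo).tgt (Sum.inr bb) = (LG u' v' mo).src (Sum.inr (!bb)) := by
          cases bb <;> rfl
        have e2 : (LG u' v' mo).tgt (Sum.inr (!bb)) = (LG u' v' mo).src (Sum.inr bb) := by
          cases bb <;> rfl
        have e3 : (LG u' v' mo).w (Sum.inr (!bb)) = - (LG u' v' mo).w (Sum.inr bb) := by
          cases bb <;> simp [LG]
        cases ds with
        | nil => simp at hm
        | cons d2 l3 =>
          obtain ⟨hd2, -, hw3⟩ := hw2
          have : d2 = Sum.inr (!bb) := by
            by_contra hne2
            have hm3 : Sum.inr (!bb) ∈ l3 := by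
              rcases List.mem_cons.mp hm with h | h
              · exact absurd h.symm hne2
              · exact h
            rw [List.map_cons, List.map_cons, hd2, e1] at hnd
            have := (List.nodup_cons.mp (List.nodup_cons.mp hnd).2).1
            exact this (List.mem_map.mpr ⟨_, hm3, rfl⟩)
          subst this
          rw [e2, hd] at hw3
          cases l3 with
          | nil =>
            simp only [MG.cl, List.map_cons, List.map_nil, List.sum_cons, List.sum_nil, e3]
            simp only [add_zero, add_neg_cancel]
            decide
          | cons d4 l4 =>
            exfalso
            rw [List.map_cons, List.map_cons, List.map_cons, hd, hw3.1] at hnd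
            exact (List.nodup_cons.mp hnd).1 (by simp)
      rcases List.mem_cons.mp hb.1 with h1 | h1
      · refine key true h1.symm ?_
        rcases List.mem_cons.mp hb.2 with h2 | h2
        · rw [← h1] at h2; simp at h2
        · exact h2
      · rcases List.mem_cons.mp hb.2 with h2 | h2
        · exact key false h2.symm h1
        · exact absurd ⟨h1, h2⟩ hnb
  · have h1 := flat_nodup hα hnd hb
    have h2 := flat_nw hα hw
    have h3 := flat_chain (α := α) hw (fun d _ => exD_chain hα d)
    rw [← h2]
    cases ds with
    | nil => exact absurd rfl hne
    | cons d ds =>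
      obtain ⟨t, ht⟩ := exD_head (u' := u') (v' := v') (mo := mo) (α := α) d
      rw [hw.1] at ht
      rw [List.flatMap_cons, ht, List.cons_append] at h1 h3 ⊢
      exact zmod4_ne_two (NW_cycle f0 c.1 _ h1 h3)

/-- `β` is an inner arc of class `c` from `y'` to `x'`. -/
structure IArc (y' x' : AV r1 R1) (c : ZMod 4) (β : List Lat) : Prop where
  chain : (y'.1 :: β ++ [x'.1]).IsChain Adj
  nw : ((NW f0 (y'.1 :: β ++ [x'.1]) : ℤ) : ZMod 4) = c
  ring : ∀ p ∈ β, linf p = r1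
  nodup : β.Nodup

lemma LG_hc {α β : List Lat} (hα : OArc u' v' mo α) (hr : r1 < R1) {x' y' : AV r1 R1} {c : ZMod 4}
    (hβ : IArc y' x' c β) (ds : List (AE r1 R1))
    (hw : (LG u' v' mo).WkIn Finset.univ x' y' ds)
    (hnd : (ds.map (LG u' v' mo).src ++ [y']).Nodup) : (LG u' v' mo).cl ds + c ≠ 2 := by
  have hnb := not_both hw hnd
  rw [List.nodup_append] at hnd
  have h1 := flat_nodup hα hnd.1 hnb
  have h2 := flat_nw hα hw
  have h3 := flat_chain (α := α) hw (fun d _ => exD_chain hα d)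
  obtain ⟨t, ht⟩ := flat_head (α := α) hw
  have hV : ∀ v : AV r1 R1, linf v.1 ≠ r1 ∧ linf v.1 ≠ R1 := fun v => by
    have := v.2; omega
  have hmem : ∀ p ∈ ds.flatMap (exD u' v' α), linf p = R1 ∨ ∃ d ∈ ds, p = ((LG u' v' mo).src d).1 := by
    intro p hp
    rw [List.mem_flatMap] at hp
    obtain ⟨d, hd, hp⟩ := hp
    rcases d with e | b
    · right; exact ⟨_, hd, by simpa [exD, LG] using hp⟩
    · cases b <;> simp only [exD, Sum.elim_inr, cond_true, cond_false, List.mem_cons,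
        List.mem_reverse] at hp <;> rcases hp with hp | hp
      · right; exact ⟨_, hd, hp⟩
      · left; exact hα.ring _ hp
      · right; exact ⟨_, hd, hp⟩
      · left; exact hα.ring _ hp
  have hall : (ds.flatMap (exD u' v' α) ++ (y'.1 :: β)).Nodup := by
    rw [List.nodup_append]
    refine ⟨h1, ?_, ?_⟩
    · rw [List.nodup_cons]
      exact ⟨fun h => (hV y').1 (hβ.ring _ h), hβ.nodup⟩
    · intro p hp q hq hpq
      subst hpq
      rcases List.mem_cons.mp hq with rfl | hq
      · rcases hmem _ hp with h | ⟨d, hd, h⟩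
        · exact (hV y').2 h
        · exact hnd.2.2 _ (List.mem_map.mpr ⟨d, hd, rfl⟩) y' (by simp) (Subtype.ext h.symm)
      · have := hβ.ring _ hq
        rcases hmem _ hp with h | ⟨d, hd, h⟩
        · omega
        · rw [h] at this; exact (hV _).1 this
  have hch : (ds.flatMap (exD u' v' α) ++ (y'.1 :: β) ++ [x'.1]).IsChain Adj := by
    rw [List.append_assoc, List.cons_append, List.isChain_split]
    exact ⟨h3, hβ.chain⟩
  have hnw : NW f0 (ds.flatMap (exD u' v' α) ++ (y'.1 :: β) ++ [x'.1]) =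
      NW f0 (ds.flatMap (exD u' v' α) ++ [y'.1]) + NW f0 (y'.1 :: β ++ [x'.1]) := by
    rw [List.append_assoc, List.cons_append, NW_append]
  have : ∃ t', ds.flatMap (exD u' v' α) ++ (y'.1 :: β) = x'.1 :: t' := by
    refine ⟨t ++ β, ?_⟩
    rw [← List.cons_append, ← ht]; simp
  obtain ⟨t', ht'⟩ := this
  rw [ht'] at hall hch hnw
  have := NW_cycle f0 _ _ hall hch
  rw [← h2, ← hβ.nw]
  rw [hnw] at this
  have h5 := zmod4_ne_two this
  push_cast at h5
  exact h5

end LGsec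
section LG2
variable {r1 R1 : ℤ} {u' v' : AV r1 R1} {mo : ZMod 4}

lemma good_of_zero {α : List Lat} (hα : OArc u' v' mo α) {P : Lat → Lat → Prop}
    (hz : ∀ (x : Lat) (t : List Lat), (x :: t).getLast (by simp) = x → (x :: t).IsChain P →
      NW f0 (x :: t) = 0) {ds : List (AE r1 R1)}
    (hd : ∀ d ∈ ds, (exD u' v' α d ++ [((LG u' v' mo).tgt d).1]).IsChain P) :
    (LG u' v' mo).Good ds := by
  intro l1 l2 l3 c e hw
  have h1 := flat_chain (α := α) hw (fun d hd' => hd d (by rw [e]; simp [hd']))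
  have h2 := flat_nw hα hw
  obtain ⟨t, ht⟩ := flat_head (α := α) hw
  rw [ht] at h1 h2
  have hl : (c.1 :: t).getLast (by simp) = c.1 := by
    have := congrArg List.getLast? ht
    rw [List.getLast?_append_of_ne_nil _ (by simp), List.getLast?_singleton,
      List.getLast?_eq_getLast_of_ne_nil (by simp)] at this
    exact (Option.some.inj this).symm
  rw [hz _ _ hl h1] at h2
  rw [← h2]; simp

lemma cl_of_zero {α β : List Lat} (hα : OArc u' v' mo α) {P : Lat → Lat → Prop}
    (hz : ∀ (x : Lat) (t : List Lat), (x :: t).getLast (by simp) = x → (x :: t).IsChain P →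
      NW f0 (x :: t) = 0) {ds : List (AE r1 R1)} {x' y' : AV r1 R1} {c : ZMod 4}
    (hd : ∀ d ∈ ds, (exD u' v' α d ++ [((LG u' v' mo).tgt d).1]).IsChain P)
    (hw : (LG u' v' mo).WkIn Finset.univ x' y' ds)
    (hβ : IArc y' x' c β) (hβP : (y'.1 :: β ++ [x'.1]).IsChain P) :
    (LG u' v' mo).cl ds = - c := by
  have h1 := flat_chain (α := α) hw hd
  have h2 := flat_nw hα hw
  obtain ⟨t, ht⟩ := flat_head (α := α) hw
  have hch : (ds.flatMap (exD u' v' α) ++ (y'.1 :: (β ++ [x'.1]))).IsChain P := by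
    rw [List.isChain_split]
    exact ⟨h1, hβP⟩
  have hnw : NW f0 (ds.flatMap (exD u' v' α) ++ (y'.1 :: (β ++ [x'.1]))) =
      NW f0 (ds.flatMap (exD u' v' α) ++ [y'.1]) + NW f0 (y'.1 :: β ++ [x'.1]) := by
    rw [List.cons_append, NW_append]
  have he : ds.flatMap (exD u' v' α) ++ (y'.1 :: (β ++ [x'.1])) = x'.1 :: (t ++ β ++ [x'.1]) := by
    have := congrArg (· ++ (β ++ [x'.1])) ht
    simpa using this
  rw [he] at hch hnw
  have hl : (x'.1 :: (t ++ β ++ [x'.1])).getLast (by simp) = x'.1 := by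
    rw [List.getLast_cons (by simp), List.getLast_append_of_ne_nil (by simp) (by simp)]
    simp
  rw [hz _ _ hl hch] at hnw
  have h3 := congrArg (fun k : ℤ => (k : ZMod 4)) hnw
  simp only [Int.cast_zero, Int.cast_add, h2, hβ.nw] at h3
  exact eq_neg_of_add_eq_zero_left h3.symm

/-- Lattice walks in the annulus. -/
structure InD (r1 R1 : ℤ) (a b : Lat) (η : List Lat) : Prop where
  chain : η.IsChain Adj
  mem : ∀ p ∈ η, r1 < linf p ∧ linf p < R1
  head : η.head? = some a
  last : η.getLast? = some b

lemma encode {η : List Lat} {a b : AV r1 R1} (h : InD r1 R1 a.1 b.1 η) :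
    ∃ ds : List (AE r1 R1), (∀ d ∈ ds, d.isLeft = true) ∧
      (LG u' v' mo).WkIn Finset.univ a b ds ∧
      ds.map (fun d => ((LG u' v' mo).src d).1) ++ [b.1] = η ∧
      (LG u' v' mo).wtl ds = TrivSqZeroExt.inl ((1 / 4) ^ ds.length) ∧
      ∀ d ∈ ds, ∀ α, ∃ p q, exD u' v' α d ++ [((LG u' v' mo).tgt d).1] = [p, q] ∧
        [p, q] <:+: η := by
  induction η generalizing a with
  | nil => simpa using h.head
  | cons p t ih =>
    have hp : p = a.1 := by simpa using h.head
    subst hp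
    cases t with
    | nil =>
      have hb : a.1 = b.1 := by simpa using h.last
      have hb : a = b := Subtype.ext hb
      subst hb
      exact ⟨[], by simp, ⟨rfl, Finset.mem_univ _⟩, by simp, by simp [MG.wtl], by simp⟩
    | cons q t =>
      have hc := List.isChain_cons_cons.mp h.chain
      have hq := h.mem q (by simp)
      obtain ⟨ds, h1, h2, h3, h4, h5⟩ := ih (a := ⟨q, hq⟩)
        ⟨hc.2, fun p hp => h.mem p (List.mem_cons_of_mem _ hp), by simp, by simpa using h.last⟩
      refine ⟨Sum.inl ⟨(a, ⟨q, hq⟩), hc.1⟩ :: ds, ?_, ⟨rfl, Finset.mem_univ _, h2⟩, ?_, ?_, ?_⟩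
      · intro d hd
        rcases List.mem_cons.mp hd with rfl | hd
        · rfl
        · exact h1 d hd
      · rw [List.map_cons, List.cons_append, h3]; rfl
      · rw [MG.wtl_cons, h4]
        simp only [LG, Sum.elim_inl, List.length_cons]
        rw [← TrivSqZeroExt.inl_mul, pow_succ']
      · intro d hd α
        rcases List.mem_cons.mp hd with rfl | hd
        · exact ⟨a.1, q, rfl, ⟨[], t, by simp⟩⟩
        · obtain ⟨p, q', h6, h7⟩ := h5 d hd α
          exact ⟨p, q', h6, h7.trans (List.suffix_cons _ _).isInfix⟩

lemma LG_barrier : ∃ h, (LG u' v' mo).Barrier h := by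
  have hsum : ∀ (a : AV r1 R1) (f : Lat → ℝ), (∀ q, linf q ≤ R1 → 0 ≤ f q) →
      (∑ e, if (LG u' v' mo).src e = a then ((LG u' v' mo).wt e).fst *
        f ((LG u' v' mo).tgt e).1 else 0) ≤ ∑ q ∈ nbF a.1, 1 / 4 * f q := by
    intro a f hf
    have e1 : (∑ e, if (LG u' v' mo).src e = a then ((LG u' v' mo).wt e).fst *
        f ((LG u' v' mo).tgt e).1 else 0) =
        ∑ e : {p : AV r1 R1 × AV r1 R1 // Adj p.1.1 p.2.1},
          if e.1.1 = a then 1 / 4 * f e.1.2.1 else 0 := by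
      rw [Fintype.sum_sum_type, Finset.sum_eq_zero (f := fun b : Bool => _), add_zero]
      · refine Finset.sum_congr rfl fun e _ => ?_
        by_cases h : e.1.1 = a
        · rw [if_pos h, if_pos (show (LG u' v' mo).src (Sum.inl e) = a from h)]; rfl
        · rw [if_neg h, if_neg (show ¬ (LG u' v' mo).src (Sum.inl e) = a from h)]
      · intro b _
        split_ifs
        · simp [LG]
        · rfl
    rw [e1, ← Finset.sum_filter]
    rw [← Finset.sum_image (s := Finset.univ.filter
      (fun e : {p : AV r1 R1 × AV r1 R1 // Adj p.1.1 p.2.1} => e.1.1 = a))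
      (g := fun e => e.1.2.1) (f := fun q => 1 / 4 * f q)]
    · apply Finset.sum_le_sum_of_subset_of_nonneg
      · intro q hq
        obtain ⟨e, he, rfl⟩ := Finset.mem_image.mp hq
        have := (Finset.mem_filter.mp he).2
        rw [mem_nbF, ← this]; exact e.2
      · intro q hq _
        have h1 := adj_cases (mem_nbF.mp hq)
        have h2 := a.2.2
        have h3 : linf a.1 ≤ R1 - 1 := by omega
        have := hf q (by rw [linf_le_iff] at *; omega)
        positivity
    · intro e he e' he' hee
      have h1 := (Finset.mem_filter.mp (Finset.mem_coe.mp he)).2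
      have h2 := (Finset.mem_filter.mp (Finset.mem_coe.mp he')).2
      apply Subtype.ext
      apply Prod.ext
      · rw [h1, h2]
      · exact Subtype.ext hee
  have hpos : ∀ q : Lat, linf q ≤ R1 → 0 < (2 * (R1 : ℝ) ^ 2 + 1 - (q.1 ^ 2 + q.2 ^ 2 : ℤ)) := by
    intro q hq
    rw [linf_le_iff] at hq
    have : q.1 ^ 2 ≤ R1 ^ 2 := by nlinarith
    have : q.2 ^ 2 ≤ R1 ^ 2 := by nlinarith
    have : (0 : ℤ) < 2 * R1 ^ 2 + 1 - (q.1 ^ 2 + q.2 ^ 2) := by linarith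
    exact_mod_cast this
  refine ⟨fun a => 2 * (R1 : ℝ) ^ 2 + 1 - (a.1.1 ^ 2 + a.1.2 ^ 2 : ℤ), fun a => hpos _ a.2.2.le, ?_⟩
  intro a
  refine (hsum a (fun q => 2 * (R1 : ℝ) ^ 2 + 1 - (q.1 ^ 2 + q.2 ^ 2 : ℤ))
    (fun q hq => (hpos q hq).le)).trans_lt ?_
  rw [sum_nbF]
  push_cast
  nlinarith

lemma LG_row (a : AV r1 R1) :
    (∑ e, if (LG u' v' mo).src e = a then ((LG u' v' mo).wt e).fst else 0) ≤ 1 := by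
  have e1 : (∑ e, if (LG u' v' mo).src e = a then ((LG u' v' mo).wt e).fst else 0) =
      ∑ e : {p : AV r1 R1 × AV r1 R1 // Adj p.1.1 p.2.1},
        if e.1.1 = a then (1 / 4 : ℝ) else 0 := by
    rw [Fintype.sum_sum_type, Finset.sum_eq_zero (f := fun b : Bool => _), add_zero]
    · refine Finset.sum_congr rfl fun e _ => ?_
      by_cases h : e.1.1 = a
      · rw [if_pos h, if_pos (show (LG u' v' mo).src (Sum.inl e) = a from h)]; rfl
      · rw [if_neg h, if_neg (show ¬ (LG u' v' mo).src (Sum.inl e) = a from h)]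
    · intro b _
      split_ifs
      · simp [LG]
      · rfl
  rw [e1, ← Finset.sum_filter, Finset.sum_const, nsmul_eq_mul]
  have : (Finset.univ.filter
      (fun e : {p : AV r1 R1 × AV r1 R1 // Adj p.1.1 p.2.1} => e.1.1 = a)).card ≤ (nbF a.1).card := by
    apply Finset.card_le_card_of_injOn (fun e => e.1.2.1)
    · intro e he
      have := (Finset.mem_filter.mp (Finset.mem_coe.mp he)).2
      rw [Finset.mem_coe, mem_nbF, ← this]; exact e.2
    · intro e he e' he' hee
      have h1 := (Finset.mem_filter.mp (Finset.mem_coe.mp he)).2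
      have h2 := (Finset.mem_filter.mp (Finset.mem_coe.mp he')).2
      apply Subtype.ext
      apply Prod.ext
      · rw [h1, h2]
      · exact Subtype.ext hee
  have h4 : (nbF a.1).card ≤ 4 := by unfold nbF; exact Finset.card_le_four
  have : ((Finset.univ.filter
      (fun e : {p : AV r1 R1 × AV r1 R1 // Adj p.1.1 p.2.1} => e.1.1 = a)).card : ℝ) ≤ 4 := by
    exact_mod_cast this.trans h4
  linarith

/-- Twisted adjacency. -/
def TA (r1 R1 : ℤ) : Matrix (AV r1 R1) (AV r1 R1) ℂ := fun a b =>
  if Adj a.1 b.1 then phc ((nuF f0 a.1 b.1 : ℤ) : ZMod 4) * (1 / 4) else 0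

/-- Twisted Green function. -/
def TG (r1 R1 : ℤ) : Matrix (AV r1 R1) (AV r1 R1) ℂ := (1 - TA r1 R1)⁻¹

lemma LG_A0 : (LG u' v' mo).A0 Finset.univ = TA r1 R1 := by
  ext a b
  simp only [MG.A0, MG.B0, Finset.mem_univ, and_self, if_true]
  rw [Fintype.sum_sum_type]
  simp only [LG, Sum.elim_inl, Sum.elim_inr, TrivSqZeroExt.fst_inl, TrivSqZeroExt.fst_inr,
    Complex.ofReal_zero, mul_zero, ite_self, Finset.sum_const_zero, add_zero]
  unfold TA
  by_cases h : Adj a.1 b.1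
  · rw [if_pos h, Finset.sum_eq_single ⟨(a, b), h⟩]
    · simp
    · intro e _ hne
      refine if_neg ?_
      rintro ⟨h1, h2⟩
      exact hne (Subtype.ext (Prod.ext h1 h2))
    · simp
  · rw [if_neg h]
    apply Finset.sum_eq_zero
    intro e _
    refine if_neg ?_
    rintro ⟨h1, h2⟩
    apply h
    rw [← h1, ← h2]; exact e.2

lemma LG_Gam0 : (LG u' v' mo).Gam0 Finset.univ = TG r1 R1 := by
  unfold MG.Gam0 TG
  rw [LG_A0]

lemma TG_right [Nonempty (AV r1 R1)] : (1 - TA r1 R1) * TG r1 R1 = 1 := by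
  obtain ⟨u⟩ := ‹Nonempty (AV r1 R1)›
  obtain ⟨h, hb⟩ := LG_barrier (u' := u) (v' := u) (mo := 0)
  rw [← LG_Gam0 (u' := u) (v' := u) (mo := 0), ← LG_A0 (u' := u) (v' := u) (mo := 0)]
  exact MG.Gam0_right _ hb _

end LG2
lemma chain_wrap {P : Lat → Lat → Prop} {α : List Lat} {u v a b : Lat} (h : α.IsChain P)
    (hu : α.head? = some u) (hv : α.getLast? = some v) (ha : P a u) (hb : P v b) :
    (a :: α ++ [b]).IsChain P := by
  rw [List.cons_append, List.isChain_cons]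
  refine ⟨?_, ?_⟩
  · intro y hy
    have : (α ++ [b]).head? = some u := by rw [List.head?_append, hu]; rfl
    rw [this] at hy
    obtain rfl : u = y := by simpa using hy
    exact ha
  · rw [List.isChain_append]
    refine ⟨h, List.isChain_singleton _, ?_⟩
    intro x hx y hy
    rw [hv] at hx
    obtain rfl : v = x := by simpa using hx
    obtain rfl : b = y := by simpa using hy
    exact hb

/-- Weight of a vertex list. -/
def Wt (l : List Lat) : ℝ := (1 / 4) ^ l.length

lemma Wt_nonneg (l : List Lat) : 0 ≤ Wt l := by unfold Wt; positivity
lemma Wt_pos (l : List Lat) : 0 < Wt l := by unfold Wt; positivity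

/-- Pairs of annulus crossings contained in a nondisconnecting list. -/
def PairND (r R r1 R1 : ℤ) (x x' u' u v v' y' y : Lat) (p : List Lat × List Lat) : Prop :=
  InD r1 R1 x' u' p.1 ∧ InD r1 R1 v' y' p.2 ∧ ∃ l : List Lat, l.IsChain Adj ∧ ND l r R ∧
    (x :: p.1 ++ [u]) <:+: l ∧ (v :: p.2 ++ [y]) <:+: l

section pair
variable {r R r1 R1 : ℤ} {x' u' v' y' : AV r1 R1}

/-- Encoded pairs. -/
def PW (x' u' v' y' : AV r1 R1) (mo c : ZMod 4) (p : List Lat × List Lat) : Prop :=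
  (∃ α, OArc u' v' mo α) ∧ (∃ β, IArc y' x' c β) ∧ ∃ ds1 ds2 : List (AE r1 R1),
    (∀ d ∈ ds1, d.isLeft = true) ∧ (∀ d ∈ ds2, d.isLeft = true) ∧
    ds1.map (fun d => ((LG u' v' mo).src d).1) ++ [u'.1] = p.1 ∧
    ds2.map (fun d => ((LG u' v' mo).src d).1) ++ [y'.1] = p.2 ∧
    (LG u' v' mo).WkIn Finset.univ x' y' (ds1 ++ Sum.inr true :: ds2) ∧
    (LG u' v' mo).Good (ds1 ++ Sum.inr true :: ds2) ∧
    (LG u' v' mo).cl (ds1 ++ Sum.inr true :: ds2) = - c ∧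
    (LG u' v' mo).wtl (ds1 ++ Sum.inr true :: ds2) =
      TrivSqZeroExt.inr ((1 / 4) ^ (ds1.length + ds2.length))

lemma pair_word {x y u v : Lat} (h0 : 0 ≤ r) (h1 : r + 1 ≤ r1) (h2 : r1 + 1 ≤ R1)
    (h3 : R1 + 1 ≤ R) (hx : linf x = r1) (hy : linf y = r1) (hu : linf u = R1) (hv : linf v = R1)
    {p : List Lat × List Lat} (hp : PairND r R r1 R1 x x'.1 u'.1 u v v'.1 y'.1 y p) :
    ∃ mo c, PW x' u' v' y' mo c p := by
  obtain ⟨hp1, hp2, l, hl, hnd, hi1, hi2⟩ := hp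
  obtain ⟨pi, qi, po, qo, ⟨hpi, hqi, hai⟩, ⟨hpo, hqo, hao⟩, hz⟩ := loop_zero hnd h1 h0 h2 h3
  obtain ⟨α, a1, a2, a3, a4, a5⟩ := ring_arc (by omega) hpo hqo hao hu hv
  obtain ⟨β, b1, b2, b3, b4, b5⟩ := ring_arc (by omega) hpi hqi hai hy hx
  set P := zrel l r1 R1 pi qi po qo with hP
  have used : ∀ a b : Lat, [a, b] <:+: l → r1 ≤ linf a → linf a ≤ R1 → r1 ≤ linf b →
      linf b ≤ R1 → P a b := by
    intro a b hab c1 c2 c3 c4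
    have : [a, b].IsChain Adj := isChain_mid hl hab
    exact ⟨(List.isChain_cons_cons.mp this).1, c1, c2, c3, c4, Or.inl (Or.inl hab)⟩
  have e1 : [x, x'.1] <:+: x :: p.1 ++ [u] := by
    obtain ⟨t, ht⟩ : ∃ t, p.1 = x'.1 :: t := by
      have := hp1.head
      cases h : p.1 with
      | nil => simp [h] at this
      | cons a t => simp [h] at this; exact ⟨t, by rw [this]⟩
    rw [ht]; exact ⟨[], t ++ [u], by simp⟩
  have e2 : [v, v'.1] <:+: v :: p.2 ++ [y] := by
    obtain ⟨t, ht⟩ : ∃ t, p.2 = v'.1 :: t := by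
      have := hp2.head
      cases h : p.2 with
      | nil => simp [h] at this
      | cons a t => simp [h] at this; exact ⟨t, by rw [this]⟩
    rw [ht]; exact ⟨[], t ++ [y], by simp⟩
  have e3 : [u'.1, u] <:+: x :: p.1 ++ [u] := by
    obtain ⟨t, ht⟩ := List.getLast?_eq_some_iff.mp hp1.last
    rw [ht]; exact ⟨x :: t, [], by simp⟩
  have e4 : [y'.1, y] <:+: v :: p.2 ++ [y] := by
    obtain ⟨t, ht⟩ := List.getLast?_eq_some_iff.mp hp2.last
    rw [ht]; exact ⟨v :: t, [], by simp⟩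
  have s1 : p.1 <:+: l := List.IsInfix.trans ⟨[x], [u], by simp⟩ hi1
  have s2 : p.2 <:+: l := List.IsInfix.trans ⟨[v], [y], by simp⟩ hi2
  have psym : ∀ a b, P a b → P b a := by
    rintro a b ⟨q1, q2, q3, q4, q5, q6⟩
    refine ⟨adj_symm q1, q4, q5, q2, q3, ?_⟩
    rcases q6 with q | ⟨q, q', q''⟩ | ⟨q, q', q''⟩
    · exact Or.inl (usedE_symm q)
    · exact Or.inr (Or.inl ⟨q', q, fun h => q'' (by unfold sameE at *; tauto)⟩)
    · exact Or.inr (Or.inr ⟨q', q, fun h => q'' (by unfold sameE at *; tauto)⟩)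
  have hx' := x'.2; have hu' := u'.2; have hv' := v'.2; have hy' := y'.2
  have cα : (u'.1 :: α ++ [v'.1]).IsChain P := by
    refine chain_wrap ?_ a1 a2 (used _ _ (e3.trans hi1) ?_ ?_ ?_ ?_)
      (used _ _ (e2.trans hi2) ?_ ?_ ?_ ?_) <;> try omega
    rw [List.isChain_iff_getElem] at a5 ⊢
    intro i hi
    have k1 := a3 _ (List.getElem_mem (show i < α.length by omega))
    have k2 := a3 _ (List.getElem_mem hi)
    obtain ⟨k3, k4⟩ := a5 i hi
    exact ⟨k3, by omega, by omega, by omega, by omega, Or.inr (Or.inr ⟨k1, k2, k4⟩)⟩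
  have cβ : (y'.1 :: β ++ [x'.1]).IsChain P := by
    refine chain_wrap ?_ b1 b2 (used _ _ (e4.trans hi2) ?_ ?_ ?_ ?_)
      (used _ _ (e1.trans hi1) ?_ ?_ ?_ ?_) <;> try omega
    rw [List.isChain_iff_getElem] at b5 ⊢
    intro i hi
    have k1 := b3 _ (List.getElem_mem (show i < β.length by omega))
    have k2 := b3 _ (List.getElem_mem hi)
    obtain ⟨k3, k4⟩ := b5 i hi
    exact ⟨k3, by omega, by omega, by omega, by omega, Or.inr (Or.inl ⟨k1, k2, k4⟩)⟩
  have oα : OArc u' v' ((NW f0 (u'.1 :: α ++ [v'.1]) : ℤ) : ZMod 4) α :=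
    ⟨cα.imp (fun _ _ h => h.1), rfl, a3, a4⟩
  have iβ : IArc y' x' ((NW f0 (y'.1 :: β ++ [x'.1]) : ℤ) : ZMod 4) β :=
    ⟨cβ.imp (fun _ _ h => h.1), rfl, b3, b4⟩
  refine ⟨_, _, ⟨α, oα⟩, ⟨β, iβ⟩, ?_⟩
  set mo := ((NW f0 (u'.1 :: α ++ [v'.1]) : ℤ) : ZMod 4)
  obtain ⟨ds1, f1, f2, f3, f4, f5⟩ := encode (u' := u') (v' := v') (mo := mo) hp1
  obtain ⟨ds2, g1, g2, g3, g4, g5⟩ := encode (u' := u') (v' := v') (mo := mo) hp2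
  have hw : (LG u' v' mo).WkIn Finset.univ x' y' (ds1 ++ Sum.inr true :: ds2) :=
    (MG.WkIn_append _).mpr ⟨u', f2, rfl, Finset.mem_univ _, g2⟩
  have inD : ∀ (η : List Lat) (a b : Lat), InD r1 R1 a b η → η <:+: l → ∀ p q, [p, q] <:+: η →
      [p, q].IsChain P := by
    intro η a b hη hηl p q hpq
    have m1 := hη.mem p (hpq.subset (by simp))
    have m2 := hη.mem q (hpq.subset (by simp))
    simpa using used p q (hpq.trans hηl) (by omega) (by omega) (by omega) (by omega)
  have hd : ∀ d ∈ ds1 ++ Sum.inr true :: ds2,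
      (exD u' v' α d ++ [((LG u' v' mo).tgt d).1]).IsChain P := by
    intro d hd
    rcases List.mem_append.mp hd with hd | hd
    · obtain ⟨p', q', h6, h7⟩ := f5 d hd α
      rw [h6]; exact inD _ _ _ hp1 s1 _ _ h7
    · rcases List.mem_cons.mp hd with rfl | hd
      · exact cα
      · obtain ⟨p', q', h6, h7⟩ := g5 d hd α
        rw [h6]; exact inD _ _ _ hp2 s2 _ _ h7
  refine ⟨ds1, ds2, f1, g1, f3, g3, hw, good_of_zero oα hz hd, cl_of_zero oα hz hd hw iβ cβ, ?_⟩
  rw [MG.wtl_append, MG.wtl_cons, f4, g4]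
  simp only [LG, Sum.elim_inr]
  rw [TrivSqZeroExt.inr_mul_inl, TrivSqZeroExt.inl_mul_inr]
  simp [pow_add, mul_comm]

/-- Decoding. -/
def decW (u' v' y' : AV r1 R1) (mo : ZMod 4) (ds : List (AE r1 R1)) : List Lat × List Lat :=
  ((ds.takeWhile (fun d => d.isLeft)).map (fun d => ((LG u' v' mo).src d).1) ++ [u'.1],
   (ds.dropWhile (fun d => d.isLeft)).tail.map (fun d => ((LG u' v' mo).src d).1) ++ [y'.1])

lemma pw_bound (h2 : r1 < R1) (mo c : ZMod 4) (M : Finset (List Lat × List Lat)) :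
    (∑ p ∈ M, if PW x' u' v' y' mo c p then 16 * (Wt p.1 * Wt p.2) else 0) ≤
      ‖TG r1 R1 x' u'‖ * ‖TG r1 R1 v' y'‖ + ‖TG r1 R1 x' v'‖ * ‖TG r1 R1 u' y'‖ := by
  by_cases hne : ∃ p, PW x' u' v' y' mo c p
  swap
  · rw [Finset.sum_eq_zero]
    · positivity
    · intro p _
      rw [if_neg (fun h => hne ⟨p, h⟩)]
  obtain ⟨_, ⟨α, hα⟩, ⟨β, hβ⟩, _⟩ := hne
  obtain ⟨h, hb⟩ := LG_barrier (u' := u') (v' := v') (mo := mo)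
  set L : ℕ := ∑ p ∈ M, (p.1.length + p.2.length) with hL
  have key := (LG u' v' mo).gg_snd_bound hb LG_row (LG_PL hα) x' y' c (LG_hc hα h2 hβ) L
  rw [Fintype.sum_sum_type, LG_Gam0] at key
  have k1 : ∀ e, ((LG u' v' mo).wt (Sum.inl e)).snd = 0 := fun e => by simp [LG]
  have k2 : ∀ e, ((LG u' v' mo).wt (Sum.inr e)).snd = 1 := fun e => by simp [LG]
  have k3 : (LG u' v' mo).src (Sum.inr true) = u' := rfl
  have k4 : (LG u' v' mo).tgt (Sum.inr true) = v' := rfl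
  have k5 : (LG u' v' mo).src (Sum.inr false) = v' := rfl
  have k6 : (LG u' v' mo).tgt (Sum.inr false) = u' := rfl
  simp only [k1, zero_mul, Finset.sum_const_zero, zero_add, k2, one_mul, Fintype.sum_bool,
    k3, k4, k5, k6] at key
  refine le_trans ?_ key
  have cov := MG.sum_le_of_cover M (MG.words (AE r1 R1) L) (decW u' v' y' mo)
    (fun p => (TrivSqZeroExt.inr (if PW x' u' v' y' mo c p then 16 * (Wt p.1 * Wt p.2) else 0) : DR))
    (fun ds => if (LG u' v' mo).WkIn Finset.univ x' y' ds ∧ (LG u' v' mo).Good ds ∧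
      (LG u' v' mo).cl ds = -c then (LG u' v' mo).wtl ds else 0) ?_ ?_
  · have := ((dr_le_def _ _).mp cov).2
    rw [TrivSqZeroExt.snd_sum] at this
    simp only [TrivSqZeroExt.snd_inr] at this
    exact this
  · intro ds _
    split_ifs
    · exact (LG u' v' mo).wtl_nonneg ds
    · exact le_rfl
  · intro p hp hf
    have hpw : PW x' u' v' y' mo c p := by
      by_contra hcon
      apply hf
      simp [hcon]
    have hpw' := hpw
    obtain ⟨_, _, ds1, ds2, q1, q2, q3, q4, q5, q6, q7, q8⟩ := hpw
    refine ⟨ds1 ++ Sum.inr true :: ds2, ?_, ?_, ?_⟩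
    · rw [MG.mem_words, hL]
      have : p.1.length + p.2.length ≤ ∑ p ∈ M, (p.1.length + p.2.length) :=
        Finset.single_le_sum (f := fun p : List Lat × List Lat => p.1.length + p.2.length)
          (fun _ _ => Nat.zero_le _) hp
      have l1 := congrArg List.length q3
      have l2 := congrArg List.length q4
      simp at l1 l2 ⊢
      omega
    · have t1 : (ds1 ++ Sum.inr true :: ds2).takeWhile (fun d => d.isLeft) = ds1 := by
        rw [List.takeWhile_append_of_pos q1]; simp
      have t2 : (ds1 ++ Sum.inr true :: ds2).dropWhile (fun d => d.isLeft) =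
          Sum.inr true :: ds2 := by
        rw [List.dropWhile_append_of_pos q1]; simp
      unfold decW
      rw [t1, t2, List.tail_cons, q3, q4]
    · rw [if_pos hpw', if_pos ⟨q5, q6, q7⟩, q8]
      have l1 := congrArg List.length q3
      have l2 := congrArg List.length q4
      simp at l1 l2
      have : 16 * (Wt p.1 * Wt p.2) = (1 / 4) ^ (ds1.length + ds2.length) := by
        unfold Wt
        rw [← l1, ← l2]; ring
      rw [this]

theorem pair_bound {x y u v : Lat} (h0 : 0 ≤ r) (h1 : r + 1 ≤ r1) (h2 : r1 + 1 ≤ R1)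
    (h3 : R1 + 1 ≤ R) (hx : linf x = r1) (hy : linf y = r1) (hu : linf u = R1) (hv : linf v = R1)
    (M : Finset (List Lat × List Lat))
    (hM : ∀ p ∈ M, PairND r R r1 R1 x x'.1 u'.1 u v v'.1 y'.1 y p) :
    ∑ p ∈ M, Wt p.1 * Wt p.2 ≤
      ‖TG r1 R1 x' u'‖ * ‖TG r1 R1 v' y'‖ + ‖TG r1 R1 x' v'‖ * ‖TG r1 R1 u' y'‖ := by
  set N := ‖TG r1 R1 x' u'‖ * ‖TG r1 R1 v' y'‖ + ‖TG r1 R1 x' v'‖ * ‖TG r1 R1 u' y'‖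
  have e1 : ∑ p ∈ M, 16 * (Wt p.1 * Wt p.2) ≤ ∑ p ∈ M, ∑ k : ZMod 4 × ZMod 4,
      if PW x' u' v' y' k.1 k.2 p then 16 * (Wt p.1 * Wt p.2) else 0 := by
    apply Finset.sum_le_sum
    intro p hp
    obtain ⟨mo, c, hpw⟩ := pair_word h0 h1 h2 h3 hx hy hu hv (hM p hp)
    have := Finset.single_le_sum (f := fun k : ZMod 4 × ZMod 4 =>
      if PW x' u' v' y' k.1 k.2 p then 16 * (Wt p.1 * Wt p.2) else 0)
      (fun k _ => by
        have := Wt_nonneg p.1; have := Wt_nonneg p.2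
        split_ifs <;> positivity) (Finset.mem_univ (mo, c))
    dsimp only at this
    rwa [if_pos hpw] at this
  rw [Finset.sum_comm] at e1
  have e2 := Finset.sum_le_sum (s := Finset.univ) (fun (k : ZMod 4 × ZMod 4) _ =>
    pw_bound (x' := x') (u' := u') (v' := v') (y' := y') (by omega) k.1 k.2 M)
  have e3 := e1.trans e2
  rw [← Finset.mul_sum, Finset.sum_const] at e3
  have : (Finset.univ : Finset (ZMod 4 × ZMod 4)).card = 16 := by simp [ZMod.card]
  rw [this] at e3
  simp only [nsmul_eq_mul] at e3
  push_cast at e3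
  linarith

end pair
/-- Lattice average. -/
def avg (g : Lat → ℝ) (v : Lat) : ℝ := 1 / 4 * ∑ q ∈ nbF v, g q

lemma avg_sub (g h : Lat → ℝ) (v : Lat) : avg (fun q => g q - h q) v = avg g v - avg h v := by
  unfold avg; rw [Finset.sum_sub_distrib]; ring

lemma avg_mono {g h : Lat → ℝ} {v : Lat} (hh : ∀ q, Adj v q → g q ≤ h q) : avg g v ≤ avg h v := by
  unfold avg
  have := Finset.sum_le_sum (s := nbF v) (f := g) (g := h) (fun q hq => hh q (mem_nbF.mp hq))
  linarith

lemma avg_eq (g : Lat → ℝ) (v : Lat) : avg g v = 1 / 4 * (g (v.1 + 1, v.2) + g (v.1 - 1, v.2) +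
    g (v.1, v.2 + 1) + g (v.1, v.2 - 1)) := by
  unfold avg; rw [sum_nbF]; ring

/-- Maximum principle. -/
lemma mp (S : Finset Lat) (g : Lat → ℝ) (hs : ∀ v ∈ S, g v ≤ avg g v)
    (hb : ∀ v, v ∉ S → (∃ u ∈ S, Adj u v) → g v ≤ 0) : ∀ v ∈ S, g v ≤ 0 := by
  by_contra hcon
  push Not at hcon
  obtain ⟨v0, hv0, hpos⟩ := hcon
  obtain ⟨m, hm, hmax⟩ := S.exists_max_image g ⟨v0, hv0⟩
  have hgm : 0 < g m := hpos.trans_le (hmax v0 hv0)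
  obtain ⟨v, hv, hvx⟩ := (S.filter (fun v => g v = g m)).exists_max_image (fun v => v.1)
    ⟨m, by simp [hm]⟩
  rw [Finset.mem_filter] at hv
  have hle : ∀ q, Adj v q → g q ≤ g m := by
    intro q hq
    by_cases hqS : q ∈ S
    · exact hmax q hqS
    · exact (hb q hqS ⟨v, hv.1, hq⟩).trans hgm.le
  have hlt : g (v.1 + 1, v.2) < g m := by
    by_cases hqS : (v.1 + 1, v.2) ∈ S
    · refine lt_of_le_of_ne (hmax _ hqS) fun he => ?_
      have := hvx (v.1 + 1, v.2) (by simp [hqS, he])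
      simp at this
    · exact (hb _ hqS ⟨v, hv.1, by simp [Adj]⟩).trans_lt hgm
  have h1 := hs v hv.1
  rw [avg_eq] at h1
  have h2 := hle (v.1 - 1, v.2) (by simp [Adj])
  have h3 := hle (v.1, v.2 + 1) (by simp [Adj])
  have h4 := hle (v.1, v.2 - 1) (by simp [Adj])
  rw [hv.2] at h1
  linarith

lemma mp2 (S : Finset Lat) (g H : Lat → ℝ) (f : Lat → ℝ) (hs : ∀ v ∈ S, g v ≤ f v + avg g v)
    (hH : ∀ v ∈ S, f v + avg H v ≤ H v)
    (hb : ∀ v, v ∉ S → (∃ u ∈ S, Adj u v) → g v ≤ H v) : ∀ v ∈ S, g v ≤ H v := by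
  have := mp S (fun v => g v - H v) (fun v hv => by
    rw [avg_sub]; linarith [hs v hv, hH v hv]) (fun v hv hu => by linarith [hb v hv hu])
  intro v hv
  linarith [this v hv]

/-- Weighted strict maximum principle. -/
lemma mpc (S : Finset Lat) (c : Lat → Lat → ℝ) (g H : Lat → ℝ) (hc : ∀ v q, 0 ≤ c v q)
    (hpos : ∀ v ∈ S, 0 < H v) (hH : ∀ v ∈ S, ∑ q ∈ nbF v, c v q * H q < H v)
    (hg : ∀ v ∈ S, g v ≤ ∑ q ∈ nbF v, c v q * g q)
    (hb : ∀ v ∈ S, ∀ q, Adj v q → q ∉ S → c v q ≠ 0 → g q ≤ H q ∧ 0 ≤ H q) :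
    ∀ v ∈ S, g v ≤ H v := by
  by_contra hcon
  push Not at hcon
  obtain ⟨v0, hv0, hlt⟩ := hcon
  obtain ⟨v, hv, hmax⟩ := S.exists_max_image (fun v => g v / H v) ⟨v0, hv0⟩
  set t := g v / H v with ht
  have ht1 : 1 < t := lt_of_lt_of_le ((one_lt_div (hpos v0 hv0)).mpr hlt) (hmax v0 hv0)
  have hgv : g v = t * H v := by rw [ht, div_mul_cancel₀ _ (hpos v hv).ne']
  have h1 : ∑ q ∈ nbF v, c v q * g q ≤ ∑ q ∈ nbF v, t * (c v q * H q) := by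
    apply Finset.sum_le_sum
    intro q hq
    by_cases hcq : c v q = 0
    · simp [hcq]
    have : g q ≤ t * H q := by
      by_cases hqS : q ∈ S
      · have := hmax q hqS
        rwa [div_le_iff₀ (hpos q hqS)] at this
      · obtain ⟨h1, h2⟩ := hb v hv q (mem_nbF.mp hq) hqS hcq
        nlinarith
    calc c v q * g q ≤ c v q * (t * H q) := mul_le_mul_of_nonneg_left this (hc v q)
      _ = t * (c v q * H q) := by ring
  rw [← Finset.mul_sum] at h1
  have h2 := hg v hv
  have h3 := hH v hv
  have : t * ∑ q ∈ nbF v, c v q * H q < t * H v := mul_lt_mul_of_pos_left h3 (by linarith)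
  linarith

/-- Discrete Dirichlet problem. -/
lemma dirichlet (S : Finset Lat) (φ : Lat → ℝ) :
    ∃ g : Lat → ℝ, (∀ v ∈ S, g v = avg g v) ∧ ∀ v, v ∉ S → g v = φ v := by
  let ext : (S → ℝ) →ₗ[ℝ] (Lat → ℝ) :=
    { toFun := fun g v => if h : v ∈ S then g ⟨v, h⟩ else 0
      map_add' := fun g h => by ext v; by_cases hv : v ∈ S <;> simp [hv]
      map_smul' := fun c g => by ext v; by_cases hv : v ∈ S <;> simp [hv] }
  have hin : ∀ g (v : S), ext g v.1 = g v := fun g v => by simp [ext]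
  have hout : ∀ g v, v ∉ S → ext g v = 0 := fun g v hv => by simp [ext, hv]
  let av : (Lat → ℝ) →ₗ[ℝ] (S → ℝ) :=
    { toFun := fun g v => avg g v.1
      map_add' := fun g h => by
        ext v; simp only [avg, Pi.add_apply]; rw [Finset.sum_add_distrib]; ring
      map_smul' := fun c g => by
        ext v; simp only [avg, Pi.smul_apply, smul_eq_mul, RingHom.id_apply]
        rw [← Finset.mul_sum]; ring }
  let T : (S → ℝ) →ₗ[ℝ] (S → ℝ) := LinearMap.id - av ∘ₗ ext
  have hT : ∀ g v, T g v = g v - avg (ext g) v.1 := fun g v => rfl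
  have hinj : Function.Injective T := by
    rw [← LinearMap.ker_eq_bot, LinearMap.ker_eq_bot']
    intro g hg
    have key : ∀ g, T g = 0 → ∀ v, g v ≤ 0 := by
      intro g hg v
      have := mp S (ext g) (fun v hv => by
        have h1 := congrFun hg ⟨v, hv⟩
        rw [hT] at h1
        have h2 := hin g ⟨v, hv⟩
        simp only [Pi.zero_apply] at h1 h2
        rw [h2]; linarith) (fun v hv _ => (hout g v hv).le) v.1 v.2
      rwa [hin] at this
    ext v
    have h1 := key g hg v
    have h2 := key (-g) (by rw [map_neg, hg, neg_zero]) v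
    simp only [Pi.neg_apply] at h2
    simp only [Pi.zero_apply]
    linarith
  obtain ⟨g, hg⟩ := LinearMap.injective_iff_surjective.mp hinj
    (av (fun v => if v ∈ S then 0 else φ v))
  refine ⟨fun v => ext g v + if v ∈ S then 0 else φ v, ?_, ?_⟩
  · intro v hv
    have h1 := congrFun hg ⟨v, hv⟩
    rw [hT] at h1
    have h2 := hin g ⟨v, hv⟩
    have h3 : avg (fun v => ext g v + if v ∈ S then 0 else φ v) v = avg (ext g) v +
        avg (fun v => if v ∈ S then 0 else φ v) v := by
      unfold avg; rw [Finset.sum_add_distrib]; ring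
    have h4 : av (fun v => if v ∈ S then 0 else φ v) ⟨v, hv⟩ =
      avg (fun v => if v ∈ S then 0 else φ v) v := rfl
    simp only [hv, if_true] at h2 ⊢
    rw [h3, ← h4, ← h1, h2]
    ring
  · intro v hv
    simp only [hv, if_false, hout g v hv, zero_add]

/-- Euclidean square norm. -/
def nsq (v : Lat) : ℝ := (v.1 : ℝ) ^ 2 + (v.2 : ℝ) ^ 2

lemma nsq_nonneg (v : Lat) : 0 ≤ nsq v := by unfold nsq; positivity

lemma log_sub (v : Lat) : Real.log (nsq v + 1 / 2) + (if v = 0 then 1 else 0) ≤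
    avg (fun q => Real.log (nsq q + 1 / 2)) v := by
  rw [avg_eq]
  have p : ∀ q, 0 < nsq q + 1 / 2 := fun q => by have := nsq_nonneg q; linarith
  split_ifs with h
  · subst h
    have e0 : nsq (0 : Lat) = 0 := by simp [nsq]
    have e1 : nsq ((0 : Lat).1 + 1, (0 : Lat).2) = 1 := by simp [nsq]
    have e2 : nsq ((0 : Lat).1 - 1, (0 : Lat).2) = 1 := by simp [nsq]
    have e3 : nsq ((0 : Lat).1, (0 : Lat).2 + 1) = 1 := by simp [nsq]
    have e4 : nsq ((0 : Lat).1, (0 : Lat).2 - 1) = 1 := by simp [nsq]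
    rw [e0, e1, e2, e3, e4]
    have : Real.log (1 + 1 / 2) - Real.log (0 + 1 / 2) = Real.log 3 := by
      rw [← Real.log_div (by norm_num) (by norm_num)]; norm_num
    have h3 : 1 ≤ Real.log 3 := by
      rw [Real.le_log_iff_exp_le (by norm_num)]
      exact Real.exp_one_lt_d9.le.trans (by norm_num)
    linarith
  · have hm : (nsq v + 1 / 2) ^ 4 ≤ (nsq (v.1 + 1, v.2) + 1 / 2) * (nsq (v.1 - 1, v.2) + 1 / 2) *
        (nsq (v.1, v.2 + 1) + 1 / 2) * (nsq (v.1, v.2 - 1) + 1 / 2) := by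
      have hn := nsq_nonneg v
      simp only [nsq] at *
      push_cast
      set x : ℝ := (v.1 : ℝ)
      set y : ℝ := (v.2 : ℝ)
      nlinarith [sq_nonneg (x * y)]
    have := Real.log_le_log (by have := p v; positivity) hm
    rw [Real.log_pow, Real.log_mul (by have := p (v.1 + 1, v.2); have := p (v.1 - 1, v.2); have := p (v.1, v.2 + 1); positivity) (p _).ne',
      Real.log_mul (by have := p (v.1 + 1, v.2); have := p (v.1 - 1, v.2); positivity) (p _).ne',
      Real.log_mul (p _).ne' (p _).ne'] at this
    push_cast at this
    linarith

lemma linf_nsq {v : Lat} : (linf v : ℝ) ^ 2 ≤ nsq v ∧ nsq v ≤ 2 * (linf v : ℝ) ^ 2 := by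
  have h1 : |v.1| ≤ linf v := le_max_left _ _
  have h2 : |v.2| ≤ linf v := le_max_right _ _
  have h3 : linf v = |v.1| ∨ linf v = |v.2| := max_choice _ _
  have k1 : v.1 ^ 2 ≤ linf v ^ 2 := by rw [← sq_abs]; exact pow_le_pow_left₀ (abs_nonneg _) h1 2
  have k2 : v.2 ^ 2 ≤ linf v ^ 2 := by rw [← sq_abs v.2]; exact pow_le_pow_left₀ (abs_nonneg _) h2 2
  have k3 : linf v ^ 2 ≤ v.1 ^ 2 + v.2 ^ 2 := by
    rcases h3 with h | h <;> rw [h, sq_abs] <;> nlinarith [sq_nonneg v.1, sq_nonneg v.2]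
  unfold nsq
  constructor
  · exact_mod_cast k3
  · have : v.1 ^ 2 + v.2 ^ 2 ≤ 2 * linf v ^ 2 := by linarith
    exact_mod_cast this

lemma linf_adj {v q : Lat} (h : Adj v q) : linf v - 1 ≤ linf q ∧ linf q ≤ linf v + 1 := by
  have h1 := adj_cases h
  have h2 : linf q ≤ linf v + 1 := by
    rw [linf_le_iff]
    have := (linf_le_iff (v := v) (n := linf v)).mp le_rfl
    omega
  have h3 : linf v ≤ linf q + 1 := by
    rw [linf_le_iff]
    have := (linf_le_iff (v := q) (n := linf q)).mp le_rfl
    omega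
  omega

lemma log_super {v : Lat} (hv : 4 ≤ linf v) :
    avg (fun q => Real.log (nsq q - 1)) v ≤ Real.log (nsq v - 1) := by
  rw [avg_eq]
  have p : ∀ q, 3 ≤ linf q → 0 < nsq q - 1 := fun q hq => by
    have := (linf_nsq (v := q)).1
    have h3 : (3 : ℝ) ≤ linf q := by exact_mod_cast hq
    nlinarith
  have q1 := p (v.1 + 1, v.2) (by have := linf_adj (v := v) (q := (v.1 + 1, v.2)) (by simp [Adj]); omega)
  have q2 := p (v.1 - 1, v.2) (by have := linf_adj (v := v) (q := (v.1 - 1, v.2)) (by simp [Adj]); omega)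
  have q3 := p (v.1, v.2 + 1) (by have := linf_adj (v := v) (q := (v.1, v.2 + 1)) (by simp [Adj]); omega)
  have q4 := p (v.1, v.2 - 1) (by have := linf_adj (v := v) (q := (v.1, v.2 - 1)) (by simp [Adj]); omega)
  have q0 := p v (by omega)
  have hm : (nsq (v.1 + 1, v.2) - 1) * (nsq (v.1 - 1, v.2) - 1) *
        (nsq (v.1, v.2 + 1) - 1) * (nsq (v.1, v.2 - 1) - 1) ≤ (nsq v - 1) ^ 4 := by
    have hn : 9 ≤ nsq v := by
      have := (linf_nsq (v := v)).1
      have h3 : (4 : ℝ) ≤ linf v := by exact_mod_cast hv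
      nlinarith
    clear q1 q2 q3 q4 q0 p
    simp only [nsq] at *
    push_cast
    set x : ℝ := (v.1 : ℝ)
    set y : ℝ := (v.2 : ℝ)
    nlinarith [sq_nonneg (x ^ 2 - y ^ 2), mul_nonneg (sub_nonneg.mpr hn) (sub_nonneg.mpr hn)]
  have := Real.log_le_log (by positivity) hm
  rw [Real.log_pow, Real.log_mul (by positivity) q4.ne', Real.log_mul (by positivity) q3.ne',
    Real.log_mul q1.ne' q2.ne'] at this
  push_cast at this
  linarith
/-- Lattice point as a complex number. -/
def zc (v : Lat) : ℂ := ⟨(v.1 : ℝ), (v.2 : ℝ)⟩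

/-- Euclidean norm. -/
def rho (v : Lat) : ℝ := ‖zc v‖

lemma rho_sq (v : Lat) : rho v ^ 2 = nsq v := by
  unfold rho nsq
  rw [← Complex.normSq_eq_norm_sq, Complex.normSq_apply]
  simp only [zc]; ring

lemma rho_nonneg (v : Lat) : 0 ≤ rho v := norm_nonneg _

lemma rho_linf (v : Lat) (h : 0 ≤ linf v) : (linf v : ℝ) ≤ rho v ∧ rho v ≤ 2 * linf v := by
  have h1 := linf_nsq (v := v)
  rw [← rho_sq] at h1
  have h2 := rho_nonneg v
  have h3 : (0 : ℝ) ≤ linf v := by exact_mod_cast h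
  constructor
  · exact abs_le_of_sq_le_sq' h1.1 h2 |>.2
  · exact abs_le_of_sq_le_sq' (by nlinarith) (by linarith) |>.2

lemma inv_super {v : Lat} (hv : 4 ≤ rho v) :
    1 / rho v + 1 / 8 * (1 / rho v) ^ 3 ≤ avg (fun q => 1 / rho q) v := by
  have key : ∀ q, 0 < rho q → (1 / rho v) * (1 - (nsq q / nsq v - 1) / 2 +
      3 / 8 * (nsq q / nsq v - 1) ^ 2 - 5 / 16 * (nsq q / nsq v - 1) ^ 3) ≤ 1 / rho q := by
    intro q hq
    have h0 : 0 < rho v := by linarith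
    set σ := rho q / rho v with hσ
    have hσ0 : 0 < σ := by positivity
    have e1 : nsq q / nsq v = σ ^ 2 := by rw [← rho_sq, ← rho_sq, hσ, div_pow]
    rw [e1]
    have e2 : 1 / rho q = (1 / rho v) * (1 / σ) := by rw [hσ]; field_simp
    rw [e2]
    apply mul_le_mul_of_nonneg_left _ (by positivity)
    rw [le_div_iff₀ hσ0]
    have : 0 ≤ (σ - 1) ^ 4 * (5 * σ ^ 3 + 20 * σ ^ 2 + 29 * σ + 16) := by positivity
    nlinarith [this]
  have hp : ∀ q, Adj v q → 0 < rho q := by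
    intro q hq
    by_contra h
    have h0 : rho q = 0 := le_antisymm (not_lt.mp h) (rho_nonneg q)
    have h1 := rho_sq q
    rw [h0] at h1
    have h2 := rho_sq v
    have hn : 16 ≤ nsq v := by rw [← h2]; nlinarith
    unfold nsq at h1 hn
    have a1 : (q.1 : ℝ) = 0 := by nlinarith [sq_nonneg (q.1 : ℝ), sq_nonneg (q.2 : ℝ)]
    have a2 : (q.2 : ℝ) = 0 := by nlinarith [sq_nonneg (q.1 : ℝ), sq_nonneg (q.2 : ℝ)]
    have b1 : q.1 = 0 := by exact_mod_cast a1
    have b2 : q.2 = 0 := by exact_mod_cast a2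
    unfold Adj at hq
    rw [b1, b2] at hq
    have : ((v.1 : ℝ) - 0) ^ 2 + ((v.2 : ℝ) - 0) ^ 2 = 1 := by exact_mod_cast hq
    nlinarith
  have k1 := key (v.1 + 1, v.2) (hp _ (by simp [Adj]))
  have k2 := key (v.1 - 1, v.2) (hp _ (by simp [Adj]))
  have k3 := key (v.1, v.2 + 1) (hp _ (by simp [Adj]))
  have k4 := key (v.1, v.2 - 1) (hp _ (by simp [Adj]))
  rw [avg_eq]
  have h0 : 0 < rho v := by linarith
  have hn : 16 ≤ nsq v := by rw [← rho_sq]; nlinarith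
  set n := nsq v with hnn
  have hn2 : (v.1 : ℝ) ^ 2 + (v.2 : ℝ) ^ 2 = n := rfl
  have e1 : nsq (v.1 + 1, v.2) = n + 2 * v.1 + 1 := by rw [← hn2]; simp only [nsq]; push_cast; ring
  have e2 : nsq (v.1 - 1, v.2) = n - 2 * v.1 + 1 := by rw [← hn2]; simp only [nsq]; push_cast; ring
  have e3 : nsq (v.1, v.2 + 1) = n + 2 * v.2 + 1 := by rw [← hn2]; simp only [nsq]; push_cast; ring
  have e4 : nsq (v.1, v.2 - 1) = n - 2 * v.2 + 1 := by rw [← hn2]; simp only [nsq]; push_cast; ring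
  rw [e1] at k1; rw [e2] at k2; rw [e3] at k3; rw [e4] at k4
  have tot := add_le_add (add_le_add (add_le_add k1 k2) k3) k4
  rw [← mul_add, ← mul_add, ← mul_add] at tot
  set x : ℝ := (v.1 : ℝ)
  set y : ℝ := (v.2 : ℝ)
  have hn0 : n ≠ 0 := by positivity
  have poly : (1 - ((n + 2 * x + 1) / n - 1) / 2 + 3 / 8 * ((n + 2 * x + 1) / n - 1) ^ 2 -
      5 / 16 * ((n + 2 * x + 1) / n - 1) ^ 3) + (1 - ((n - 2 * x + 1) / n - 1) / 2 +
      3 / 8 * ((n - 2 * x + 1) / n - 1) ^ 2 - 5 / 16 * ((n - 2 * x + 1) / n - 1) ^ 3) +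
      (1 - ((n + 2 * y + 1) / n - 1) / 2 + 3 / 8 * ((n + 2 * y + 1) / n - 1) ^ 2 -
      5 / 16 * ((n + 2 * y + 1) / n - 1) ^ 3) + (1 - ((n - 2 * y + 1) / n - 1) / 2 +
      3 / 8 * ((n - 2 * y + 1) / n - 1) ^ 2 - 5 / 16 * ((n - 2 * y + 1) / n - 1) ^ 3) =
      4 + 1 / n - 6 * (1 / n) ^ 2 - 5 / 4 * (1 / n) ^ 3 := by
    have : y ^ 2 = n - x ^ 2 := by linarith
    field_simp
    ring_nf
    rw [this]
    ring
  rw [poly] at tot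
  have hi : 1 / n ≤ 1 / 16 := one_div_le_one_div_of_le (by norm_num) hn
  have hi0 : 0 < 1 / n := by positivity
  have hr : (1 / rho v) ^ 2 = 1 / n := by rw [hnn, ← rho_sq, one_div_pow]
  have hr0 : 0 < 1 / rho v := by positivity
  have : 4 + 1 / 2 * (1 / n) ≤ 4 + 1 / n - 6 * (1 / n) ^ 2 - 5 / 4 * (1 / n) ^ 3 := by
    nlinarith [mul_pos hi0 hi0, mul_nonneg hi0.le (sub_nonneg.mpr hi), mul_nonneg (mul_pos hi0 hi0).le (sub_nonneg.mpr hi)]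
  have h5 := mul_le_mul_of_nonneg_left this hr0.le
  have h6 : (1 / rho v) ^ 3 = 1 / rho v * (1 / n) := by rw [← hr]; ring
  rw [h6]
  linarith

lemma pw_exp (a : ℂ) : ∃ C δ : ℝ, 0 < C ∧ 0 < δ ∧ ∀ ξ : ℂ, ‖ξ‖ ≤ δ →
    ‖(1 + ξ) ^ a + (1 + -ξ) ^ a + (1 + Complex.I * ξ) ^ a + (1 + -(Complex.I * ξ)) ^ a - 4‖ ≤
      C * ‖ξ‖ ^ 4 := by
  have han : AnalyticAt ℂ (fun ξ : ℂ => (1 + ξ) ^ a) 0 :=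
    (analyticAt_const.add analyticAt_id).cpow analyticAt_const (by simp)
  obtain ⟨p, hp⟩ := han
  have hO := hp.isBigO_sub_partialSum_pow 4
  obtain ⟨C, hC⟩ := hO.bound
  obtain ⟨δ, hδ, hb⟩ := Metric.eventually_nhds_iff.mp hC
  have h0 : (p 0) (fun _ => (0:ℂ)) = 1 := by
    have := hp.coeff_zero (fun _ => 0)
    simpa using this
  have hc0 : p.coeff 0 = 1 := by
    rw [FormalMultilinearSeries.coeff, ← h0]
    congr 1; ext i; exact i.elim0
  set c1 := p.coeff 1
  set c2 := p.coeff 2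
  set c3 := p.coeff 3
  have hP : ∀ y : ℂ, p.partialSum 4 y = 1 + c1 * y + c2 * y ^ 2 + c3 * y ^ 3 := by
    intro y
    unfold FormalMultilinearSeries.partialSum
    simp only [Finset.sum_range_succ, Finset.sum_range_zero, zero_add,
      FormalMultilinearSeries.apply_eq_pow_smul_coeff, hc0, smul_eq_mul, pow_zero, pow_one]
    ring
  have hB : ∀ y : ℂ, ‖y‖ < δ → ‖(1 + y) ^ a - (1 + c1 * y + c2 * y ^ 2 + c3 * y ^ 3)‖ ≤
      |C| * ‖y‖ ^ 4 := by
    intro y hy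
    have := hb (y := y) (by simpa using hy)
    rw [hP, zero_add] at this
    refine this.trans ?_
    rw [norm_pow, norm_norm]
    exact mul_le_mul_of_nonneg_right (le_abs_self _) (by positivity)
  refine ⟨4 * |C| + 1, δ / 2, by positivity, by positivity, ?_⟩
  intro ξ hξ
  have h1 := hB ξ (by linarith)
  have h2 := hB (-ξ) (by rw [norm_neg]; linarith)
  have h3 := hB (Complex.I * ξ) (by rw [norm_mul, Complex.norm_I, one_mul]; linarith)
  have h4 := hB (-(Complex.I * ξ)) (by rw [norm_neg, norm_mul, Complex.norm_I, one_mul]; linarith)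
  rw [norm_neg] at h2 h4
  rw [norm_mul Complex.I, Complex.norm_I, one_mul] at h3 h4
  have hsum : (1 + ξ) ^ a + (1 + -ξ) ^ a + (1 + Complex.I * ξ) ^ a + (1 + -(Complex.I * ξ)) ^ a - 4 =
    ((1 + ξ) ^ a - (1 + c1 * ξ + c2 * ξ ^ 2 + c3 * ξ ^ 3)) +
    ((1 + -ξ) ^ a - (1 + c1 * -ξ + c2 * (-ξ) ^ 2 + c3 * (-ξ) ^ 3)) +
    ((1 + Complex.I * ξ) ^ a - (1 + c1 * (Complex.I * ξ) + c2 * (Complex.I * ξ) ^ 2 +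
      c3 * (Complex.I * ξ) ^ 3)) +
    ((1 + -(Complex.I * ξ)) ^ a - (1 + c1 * -(Complex.I * ξ) + c2 * (-(Complex.I * ξ)) ^ 2 +
      c3 * (-(Complex.I * ξ)) ^ 3)) := by
    linear_combination (2 * c2 * ξ ^ 2) * Complex.I_sq
  rw [hsum]
  refine (norm_add₄_le).trans ?_
  have : 0 ≤ ‖ξ‖ ^ 4 := by positivity
  linarith

/-- Angle. -/
def ang (v : Lat) : ℝ := (-zc v).arg
/-- Continued angle at a neighbour. -/
def angc (v q : Lat) : ℝ := ang v + (zc q / zc v).arg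

/-- Power functions. -/
def QQ (b κ : ℝ) (v : Lat) : ℝ := rho v ^ b * Real.cos (b * ang v + κ)
/-- Continued power functions. -/
def AQ (b κ : ℝ) (v q : Lat) : ℝ := rho q ^ b * Real.cos (b * angc v q + κ)

lemma AQ_eq (b κ : ℝ) {v q : Lat} (hv : zc v ≠ 0) (hq : zc q ≠ 0) : AQ b κ v q =
    (Complex.exp (κ * Complex.I) * (-zc v) ^ (b : ℂ) * (zc q / zc v) ^ (b : ℂ)).re := by
  have h1 : zc q / zc v ≠ 0 := div_ne_zero hq hv
  rw [Complex.cpow_def_of_ne_zero (neg_ne_zero.mpr hv), Complex.cpow_def_of_ne_zero h1,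
    ← Complex.exp_add, ← Complex.exp_add, Complex.exp_re]
  have e1 : (κ * Complex.I + Complex.log (-zc v) * b + Complex.log (zc q / zc v) * b).re =
      Real.log (rho q) * b := by
    simp [Complex.log_re, rho]
    rw [Real.log_div (by simpa using hq) (by simpa using hv)]; ring
  have e2 : (κ * Complex.I + Complex.log (-zc v) * b + Complex.log (zc q / zc v) * b).im =
      b * angc v q + κ := by
    simp [Complex.log_im, angc, ang]
    ring
  rw [e1, e2, AQ, Real.rpow_def_of_pos (by unfold rho; simpa using hq)]

lemma QQ_eq (b κ : ℝ) {v : Lat} (hv : zc v ≠ 0) : QQ b κ v =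
    (Complex.exp (κ * Complex.I) * (-zc v) ^ (b : ℂ)).re := by
  have := AQ_eq b κ hv hv
  rw [div_self hv, Complex.one_cpow, mul_one] at this
  rw [← this, AQ, QQ, angc, div_self hv]
  simp

lemma AQ_sum (b : ℝ) : ∃ C N : ℝ, 0 < C ∧ 4 ≤ N ∧ ∀ κ v, N ≤ rho v →
    ∑ q ∈ nbF v, AQ b κ v q ≤ 4 * QQ b κ v + C * rho v ^ b * (1 / rho v) ^ 4 := by
  obtain ⟨C, δ, hC, hδ, h⟩ := pw_exp b
  refine ⟨C, max 4 (1 / δ), hC, le_max_left _ _, ?_⟩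
  intro κ v hv
  have h4 : 4 ≤ rho v := (le_max_left _ _).trans hv
  have hd : 1 / δ ≤ rho v := (le_max_right _ _).trans hv
  have hv0 : zc v ≠ 0 := by
    intro h0; unfold rho at h4; rw [h0, norm_zero] at h4; linarith
  have hq0 : ∀ d : ℂ, ‖d‖ = 1 → zc v + d ≠ 0 := by
    intro d hd h0
    have : zc v = -d := eq_neg_of_add_eq_zero_left h0
    unfold rho at h4
    rw [this, norm_neg, hd] at h4; linarith
  have e1 : zc (v.1 + 1, v.2) = zc v + 1 := by apply Complex.ext <;> simp [zc]
  have e2 : zc (v.1 - 1, v.2) = zc v + -1 := by apply Complex.ext <;> simp [zc]; ring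
  have e3 : zc (v.1, v.2 + 1) = zc v + Complex.I := by apply Complex.ext <;> simp [zc]
  have e4 : zc (v.1, v.2 - 1) = zc v + -Complex.I := by apply Complex.ext <;> simp [zc]; ring
  rw [sum_nbF, AQ_eq b κ hv0 (by rw [e1]; exact hq0 _ (by simp)),
    AQ_eq b κ hv0 (by rw [e2]; exact hq0 _ (by simp)),
    AQ_eq b κ hv0 (by rw [e3]; exact hq0 _ (by simp)),
    AQ_eq b κ hv0 (by rw [e4]; exact hq0 _ (by simp)), QQ_eq b κ hv0, e1, e2, e3, e4]
  set ξ := (zc v)⁻¹ with hξ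
  have g1 : (zc v + 1) / zc v = 1 + ξ := by rw [hξ]; field_simp
  have g2 : (zc v + -1) / zc v = 1 + -ξ := by rw [hξ]; field_simp
  have g3 : (zc v + Complex.I) / zc v = 1 + Complex.I * ξ := by rw [hξ]; field_simp
  have g4 : (zc v + -Complex.I) / zc v = 1 + -(Complex.I * ξ) := by rw [hξ]; field_simp
  rw [g1, g2, g3, g4]
  have hx : ‖ξ‖ = 1 / rho v := by rw [hξ, norm_inv, one_div]; rfl
  have hb := h ξ (by rw [hx, one_div_le (by linarith) hδ]; exact hd)
  rw [hx] at hb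
  set A := Complex.exp (κ * Complex.I) * (-zc v) ^ (b : ℂ) with hA
  have hAn : ‖A‖ = rho v ^ b := by
    rw [hA, norm_mul, Complex.norm_exp_ofReal_mul_I, one_mul,
      Complex.norm_cpow_real, norm_neg]; rfl
  have key : (A * ((1 + ξ) ^ (b : ℂ) + (1 + -ξ) ^ (b : ℂ) + (1 + Complex.I * ξ) ^ (b : ℂ) +
      (1 + -(Complex.I * ξ)) ^ (b : ℂ) - 4)).re ≤ rho v ^ b * (C * (1 / rho v) ^ 4) := by
    refine (Complex.re_le_norm _).trans ?_
    rw [norm_mul, hAn]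
    exact mul_le_mul_of_nonneg_left hb (Real.rpow_nonneg (rho_nonneg v) b)
  have e5 : A * ((1 + ξ) ^ (b : ℂ) + (1 + -ξ) ^ (b : ℂ) + (1 + Complex.I * ξ) ^ (b : ℂ) +
      (1 + -(Complex.I * ξ)) ^ (b : ℂ) - 4) = A * (1 + ξ) ^ (b : ℂ) + (A * (1 + -ξ) ^ (b : ℂ) +
      (A * (1 + Complex.I * ξ) ^ (b : ℂ) + A * (1 + -(Complex.I * ξ)) ^ (b : ℂ))) - (4 : ℝ) * A := by
    push_cast; ring
  rw [e5, Complex.sub_re, Complex.add_re, Complex.add_re, Complex.add_re, Complex.re_ofReal_mul]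
    at key
  linarith


lemma zc_ne {v : Lat} (h : 0 < rho v) : zc v ≠ 0 := by
  intro h0; unfold rho at h; rw [h0, norm_zero] at h; exact lt_irrefl _ h

lemma neg_zc_polar {v q : Lat} (hv : zc v ≠ 0) :
    -zc q = (rho q : ℂ) * Complex.exp (angc v q * Complex.I) := by
  have h1 := Complex.norm_mul_exp_arg_mul_I (-zc v)
  have h2 := Complex.norm_mul_exp_arg_mul_I (zc q / zc v)
  have h3 : -zc q = (-zc v) * (zc q / zc v) := by field_simp
  rw [norm_neg] at h1
  rw [norm_div] at h2
  have hn : (‖zc v‖ : ℂ) ≠ 0 := by simpa using hv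
  have h4 : (-zc v) * (zc q / zc v) =
      (‖zc v‖ * Complex.exp ((-zc v).arg * Complex.I)) *
      ((‖zc q‖ / ‖zc v‖ : ℝ) * Complex.exp ((zc q / zc v).arg * Complex.I)) := by rw [h1, h2]
  rw [h3, h4, angc, ang, rho]
  push_cast
  rw [add_mul, Complex.exp_add]
  field_simp

lemma zc_re_sin {v q : Lat} (hv : zc v ≠ 0) : (q.1 : ℝ) = -(rho q * Real.cos (angc v q)) ∧
    (q.2 : ℝ) = -(rho q * Real.sin (angc v q)) := by
  have h := neg_zc_polar (q := q) hv
  rw [Complex.exp_mul_I, ← Complex.ofReal_cos, ← Complex.ofReal_sin] at h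
  have h1 := congrArg Complex.re h
  have h2 := congrArg Complex.im h
  rw [Complex.re_ofReal_mul] at h1
  rw [Complex.im_ofReal_mul] at h2
  simp [zc, -Complex.ofReal_cos, -Complex.ofReal_sin] at h1 h2
  constructor <;> linarith

lemma angc_self {v : Lat} (hv : zc v ≠ 0) : angc v v = ang v := by
  rw [angc, div_self hv]; simp

lemma adj_dist {v q : Lat} (h : Adj v q) : ‖zc q - zc v‖ = 1 := by
  have : ‖zc q - zc v‖ ^ 2 = 1 := by
    rw [← Complex.normSq_eq_norm_sq, Complex.normSq_apply]
    unfold Adj at h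
    have h' : ((v.1 : ℝ) - q.1) ^ 2 + ((v.2 : ℝ) - q.2) ^ 2 = 1 := by exact_mod_cast h
    simp [zc]; nlinarith
  nlinarith [norm_nonneg (zc q - zc v)]

lemma argq_lt {v q : Lat} (h : Adj v q) (hr : 2 ≤ rho v) : |(zc q / zc v).arg| < Real.pi / 2 := by
  have hv : zc v ≠ 0 := zc_ne (by linarith)
  have hd := adj_dist h
  have e : zc q / zc v = 1 + (zc q - zc v) / zc v := by field_simp; ring
  have hb : ‖(zc q - zc v) / zc v‖ ≤ 1 / 2 := by
    rw [norm_div, hd]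
    exact one_div_le_one_div_of_le (by norm_num) hr
  have hre : 0 < (zc q / zc v).re := by
    rw [e, Complex.add_re, Complex.one_re]
    have := (abs_le.mp (Complex.abs_re_le_norm ((zc q - zc v) / zc v))).1
    linarith
  exact Complex.abs_arg_lt_pi_div_two_iff.mpr (Or.inl hre)

/-- Crossing edges. -/
def Crs (v q : Lat) : Prop := 1 ≤ v.1 ∧ ((v.2 = 1 ∧ q.2 = 0) ∨ (v.2 = 0 ∧ q.2 = 1))

lemma ang_nc {v q : Lat} (h : Adj v q) (hr : 2 ≤ rho v) (hc : ¬ Crs v q) :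
    angc v q = ang q := by
  have hv : zc v ≠ 0 := zc_ne (by linarith)
  have hlt := abs_lt.mp (argq_lt h hr)
  have hq : zc q ≠ 0 := by
    intro h0
    have hd := adj_dist h
    rw [h0, zero_sub, norm_neg] at hd
    unfold rho at hr; linarith
  have e : -zc q = (-zc v) * (zc q / zc v) := by field_simp
  have hp := Real.pi_pos
  have a1 := Complex.neg_pi_lt_arg (-zc v)
  have a2 := Complex.arg_le_pi (-zc v)
  have s1 := zc_re_sin (q := v) hv
  rw [angc_self hv] at s1
  have s2 := zc_re_sin (q := q) hv
  have rq : 0 < rho q := by unfold rho; simpa using hq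
  have hr0 : 0 < rho v := by linarith
  have key : (-zc v).arg + (zc q / zc v).arg ∈ Set.Ioc (-Real.pi) Real.pi := by
    by_contra hcon
    apply hc
    rw [Set.mem_Ioc, not_and_or, not_lt, not_le] at hcon
    unfold angc ang at s2
    unfold ang at s1
    rcases hcon with hcon | hcon
    · have c1 : Real.cos (-zc v).arg < 0 := by
        rw [← Real.cos_neg]
        exact Real.cos_neg_of_pi_div_two_lt_of_lt (by linarith) (by linarith)
      have c2 : Real.sin (-zc v).arg < 0 := Real.sin_neg_of_neg_of_neg_pi_lt (by linarith) a1
      have c3 : 0 ≤ Real.sin ((-zc v).arg + (zc q / zc v).arg) := by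
        rw [← Real.sin_add_two_pi]
        exact Real.sin_nonneg_of_nonneg_of_le_pi (by linarith) (by linarith)
      have x1 : (0 : ℝ) < v.1 := by rw [s1.1]; nlinarith
      have x2 : (0 : ℝ) < v.2 := by rw [s1.2]; nlinarith
      have x3 : (q.2 : ℝ) ≤ 0 := by rw [s2.2]; nlinarith
      norm_cast at x1 x2 x3
      refine ⟨by omega, Or.inl ?_⟩
      rcases adj_cases h with h | h | h | h <;> omega
    · have c1 : Real.cos (-zc v).arg < 0 :=
        Real.cos_neg_of_pi_div_two_lt_of_lt (by linarith) (by linarith)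
      have c2 : 0 ≤ Real.sin (-zc v).arg := Real.sin_nonneg_of_nonneg_of_le_pi (by linarith) a2
      have c3 : Real.sin ((-zc v).arg + (zc q / zc v).arg) < 0 := by
        rw [← Real.sin_sub_two_pi]
        exact Real.sin_neg_of_neg_of_neg_pi_lt (by linarith) (by linarith)
      have x1 : (0 : ℝ) < v.1 := by rw [s1.1]; nlinarith
      have x2 : (v.2 : ℝ) ≤ 0 := by rw [s1.2]; nlinarith
      have x3 : (0 : ℝ) < q.2 := by rw [s2.2]; nlinarith
      norm_cast at x1 x2 x3
      refine ⟨by omega, Or.inr ?_⟩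
      rcases adj_cases h with h | h | h | h <;> omega
  rw [angc, ang, ang, e, Complex.arg_mul (neg_ne_zero.mpr hv) (div_ne_zero hq hv) key]

lemma ang_down {x : ℤ} (hx : 2 ≤ x) : angc (x, 1) (x, 0) = -Real.pi := by
  have hA : Adj (x, 1) (x, 0) := by unfold Adj; simp
  have hx' : (2 : ℝ) ≤ x := by exact_mod_cast hx
  have hr : 2 ≤ rho (x, 1) := by
    have := rho_sq (x, 1); have := rho_nonneg (x, 1)
    simp [nsq] at *; nlinarith
  have hv : zc (x, 1) ≠ 0 := zc_ne (by linarith)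
  have hlt := abs_lt.mp (argq_lt hA hr)
  have a1 := Complex.neg_pi_lt_arg (-zc (x, 1))
  have hn : (-zc (x, 1)).arg < 0 := Complex.arg_neg_iff.mpr (by simp [zc])
  have s2 := (zc_re_sin (q := (x, 0)) hv).1
  have rq : rho (x, 0) = x := by
    have := rho_sq (x, 0); have := rho_nonneg (x, 0)
    simp [nsq] at *; nlinarith
  simp only [rq] at s2
  have hc : Real.cos (angc (x, 1) (x, 0) + Real.pi) = 1 := by
    rw [Real.cos_add_pi]; nlinarith
  have hp := Real.pi_pos
  rw [Real.cos_eq_one_iff_of_lt_of_lt (by unfold angc ang; linarith) (by unfold angc ang; linarith)] at hc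
  linarith

lemma ang_L {x : ℤ} (hx : 2 ≤ x) : angc (x, 0) (x, 1) = 2 * Real.pi - angc (x, 0) (x, -1) := by
  have hA : Adj (x, 0) (x, -1) := by unfold Adj; simp
  have hx' : (2 : ℝ) ≤ x := by exact_mod_cast hx
  have hr : 2 ≤ rho (x, 0) := by
    have := rho_sq (x, 0); have := rho_nonneg (x, 0)
    simp [nsq] at *; nlinarith
  have hlt := abs_lt.mp (argq_lt hA hr)
  have hp := Real.pi_pos
  have e : zc (x, 1) / zc (x, 0) = (starRingEnd ℂ) (zc (x, -1) / zc (x, 0)) := by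
    rw [map_div₀]
    congr 1 <;> apply Complex.ext <;> simp [zc]
  have ea : ang (x, 0) = Real.pi := by
    unfold ang
    have : -zc (x, 0) = ((-(x : ℝ) : ℝ) : ℂ) := by apply Complex.ext <;> simp [zc]
    rw [this, Complex.arg_ofReal_of_neg (by linarith)]
  unfold angc
  rw [e, Complex.arg_conj, if_neg (by linarith), ea]; ring

/-- First barrier. -/
def Psi (M : ℝ) (v : Lat) : ℝ := QQ (1/4) (-(Real.pi/4)) v + 1 / (4 * M) * QQ (1/2) (Real.pi/2) v +
  (1 - 1 / rho v)
/-- Continued first barrier. -/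
def APsi (M : ℝ) (v q : Lat) : ℝ := AQ (1/4) (-(Real.pi/4)) v q +
  1 / (4 * M) * AQ (1/2) (Real.pi/2) v q + (1 - 1 / rho q)
/-- Second barrier. -/
def Psj (v : Lat) : ℝ := QQ (1/4) 0 v + (1 - 1 / rho v)

/-- Weights of the folded problem. -/
def cw (v q : Lat) : ℝ := if 1 ≤ v.1 ∧ v.2 = 1 ∧ q.2 = 0 then 0 else
  if 1 ≤ v.1 ∧ v.2 = 0 then (if q.2 = 1 then 0 else if q.2 = -1 then 1/2 else 1/4) else 1/4

lemma cw_nonneg (v q : Lat) : 0 ≤ cw v q := by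
  unfold cw; split_ifs <;> norm_num

lemma sum_inv {v : Lat} (hv : 4 ≤ rho v) :
    ∑ q ∈ nbF v, (1 - 1 / rho q) ≤ 4 * (1 - 1 / rho v) - 1 / 2 * (1 / rho v) ^ 3 := by
  have h := inv_super hv
  unfold avg at h
  rw [sum_nbF] at h ⊢
  linarith

lemma rho_pow_err {ρ C : ℝ} (hC : 0 < C) (h1 : 1 ≤ ρ) (h : (2 * C + 1) ^ 2 ≤ ρ) :
    C * (ρ ^ (1/4 : ℝ) * (1/ρ) ^ 4) < 1/2 * (1/ρ)^3 ∧ C * (ρ ^ (1/2 : ℝ) * (1/ρ) ^ 4) < 1/2 * (1/ρ)^3 := by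
  have h0 : 0 < ρ := by linarith
  have e2 : ρ ^ (1/4 : ℝ) ≤ ρ ^ (1/2 : ℝ) := Real.rpow_le_rpow_of_exponent_le h1 (by norm_num)
  have e3 : C * (ρ ^ (1/2 : ℝ) * (1/ρ) ^ 4) < 1/2 * (1/ρ)^3 := by
    have s1 : ρ ^ (1/2 : ℝ) * ρ ^ (1/2 : ℝ) = ρ := by
      rw [← Real.rpow_add h0]; norm_num
    have s2 : 2 * C + 1 ≤ ρ ^ (1/2 : ℝ) := by
      rw [← Real.sqrt_eq_rpow]; exact Real.le_sqrt_of_sq_le h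
    have s3 : C * ρ ^ (1/2 : ℝ) < 1/2 * ρ := by
      have : 0 < ρ ^ (1/2 : ℝ) := by positivity
      nlinarith
    have s4 : 0 < (1/ρ)^4 := by positivity
    calc C * (ρ ^ (1/2 : ℝ) * (1/ρ) ^ 4) = (C * ρ ^ (1/2 : ℝ)) * (1/ρ)^4 := by ring
      _ < (1/2 * ρ) * (1/ρ)^4 := by gcongr
      _ = 1/2 * (1/ρ)^3 := by field_simp
  refine ⟨lt_of_le_of_lt ?_ e3, e3⟩
  gcongr

lemma APsi_sum : ∃ N : ℝ, 4 ≤ N ∧ ∀ M v, 1 ≤ M → N ≤ rho v →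
    ∑ q ∈ nbF v, APsi M v q < 4 * Psi M v := by
  obtain ⟨C1, N1, hC1, hN1, h1⟩ := AQ_sum (1/4)
  obtain ⟨C2, N2, hC2, hN2, h2⟩ := AQ_sum (1/2)
  refine ⟨max (max N1 N2) ((2 * (C1 + C2) + 1) ^ 2), ?_, ?_⟩
  · exact hN1.trans ((le_max_left _ _).trans (le_max_left _ _))
  intro M v hM hv
  have g1 : N1 ≤ rho v := ((le_max_left _ _).trans (le_max_left _ _)).trans hv
  have g2 : N2 ≤ rho v := ((le_max_right _ _).trans (le_max_left _ _)).trans hv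
  have g3 := (le_max_right _ _).trans hv
  have k1 := h1 (-(Real.pi/4)) v g1
  have k2 := h2 (Real.pi/2) v g2
  have k3 := sum_inv (hN1.trans g1)
  have h0 : 0 < rho v := by linarith
  obtain ⟨-, e⟩ := rho_pow_err (ρ := rho v) (by linarith : 0 < C1 + C2) (by linarith) g3
  have e2 : rho v ^ (1/4 : ℝ) ≤ rho v ^ (1/2 : ℝ) :=
    Real.rpow_le_rpow_of_exponent_le (by linarith) (by norm_num)
  have hM' : 1 / (4 * M) ≤ 1 := by
    rw [div_le_one (by linarith)]; linarith
  have hM0 : 0 < 1 / (4 * M) := by positivity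
  unfold APsi Psi
  rw [Finset.sum_add_distrib, Finset.sum_add_distrib, ← Finset.mul_sum]
  have k2' := mul_le_mul_of_nonneg_left k2 hM0.le
  have t1 : C1 * rho v ^ (1/4 : ℝ) * (1 / rho v) ^ 4 ≤ C1 * (rho v ^ (1/2 : ℝ) * (1 / rho v) ^ 4) := by
    rw [mul_assoc]; gcongr
  have t2 : 1 / (4 * M) * (C2 * rho v ^ (1/2 : ℝ) * (1 / rho v) ^ 4) ≤
      C2 * (rho v ^ (1/2 : ℝ) * (1 / rho v) ^ 4) := by
    have : 0 ≤ C2 * (rho v ^ (1/2 : ℝ) * (1 / rho v) ^ 4) := by positivity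
    nlinarith
  linarith

lemma Psj_sum : ∃ N : ℝ, 4 ≤ N ∧ ∀ v, N ≤ rho v →
    ∑ q ∈ nbF v, (AQ (1/4) 0 v q + (1 - 1 / rho q)) < 4 * Psj v := by
  obtain ⟨C1, N1, hC1, hN1, h1⟩ := AQ_sum (1/4)
  refine ⟨max N1 ((2 * C1 + 1) ^ 2), hN1.trans (le_max_left _ _), ?_⟩
  intro v hv
  have g1 : N1 ≤ rho v := (le_max_left _ _).trans hv
  have g3 := (le_max_right _ _).trans hv
  have k1 := h1 0 v g1
  have k3 := sum_inv (hN1.trans g1)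
  obtain ⟨e, -⟩ := rho_pow_err (ρ := rho v) hC1 (by linarith) g3
  unfold Psj
  rw [Finset.sum_add_distrib]
  linarith

lemma adj4 (v : Lat) : Adj v (v.1 + 1, v.2) ∧ Adj v (v.1 - 1, v.2) ∧ Adj v (v.1, v.2 + 1) ∧
    Adj v (v.1, v.2 - 1) := by
  unfold Adj; refine ⟨?_, ?_, ?_, ?_⟩ <;> ring

lemma AQ_nc (b κ : ℝ) {v q : Lat} (h : Adj v q) (hr : 2 ≤ rho v) (hc : ¬ Crs v q) :
    AQ b κ v q = QQ b κ q := by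
  unfold AQ QQ; rw [ang_nc h hr hc]

lemma APsi_nc (M : ℝ) {v q : Lat} (h : Adj v q) (hr : 2 ≤ rho v) (hc : ¬ Crs v q) :
    APsi M v q = Psi M q := by
  unfold APsi Psi; rw [AQ_nc _ _ h hr hc, AQ_nc _ _ h hr hc]

lemma Psi_super : ∃ N : ℝ, 4 ≤ N ∧ ∀ M v, 1 ≤ M → N ≤ rho v → 4 ≤ linf v →
    ∑ q ∈ nbF v, cw v q * Psi M q < Psi M v := by
  obtain ⟨N, hN, h⟩ := APsi_sum
  refine ⟨N, hN, ?_⟩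
  intro M v hM hv hl
  have hs := h M v hM hv
  have hr : 2 ≤ rho v := by linarith
  obtain ⟨a1, a2, a3, a4⟩ := adj4 v
  by_cases c1 : 1 ≤ v.1 ∧ v.2 = 1
  · obtain ⟨x, y⟩ := v
    obtain ⟨c1, c2⟩ := c1
    simp only at c1 c2
    subst c2
    have hx : 2 ≤ x := by
      unfold linf at hl; simp at hl; rw [abs_of_nonneg (by omega)] at hl; omega
    rw [sum_nbF] at hs ⊢
    simp only at *
    rw [APsi_nc M a1 hr (by unfold Crs; simp), APsi_nc M a2 hr (by unfold Crs; simp),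
      APsi_nc M a3 hr (by unfold Crs; simp)] at hs
    have e : 0 ≤ APsi M (x, 1) (x, 1 - 1) := by
      norm_num
      unfold APsi AQ
      rw [ang_down hx]
      have e1 : (1/4 : ℝ) * -Real.pi + -(Real.pi/4) = -(Real.pi/2) := by ring
      have e2 : (1/2 : ℝ) * -Real.pi + Real.pi/2 = 0 := by ring
      rw [e1, e2, Real.cos_neg, Real.cos_pi_div_two, Real.cos_zero]
      have hx1 : (1 : ℝ) ≤ rho (x, 0) := by
        have h1 := rho_sq (x, 0); have h2 := rho_nonneg (x, 0)
        have hx' : (2 : ℝ) ≤ x := by exact_mod_cast hx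
        simp [nsq] at h1; nlinarith
      have : 1 / rho (x, 0) ≤ 1 := by rw [div_le_one (by linarith)]; exact hx1
      have : 0 ≤ 1 / (4 * M) * (rho (x, 0) ^ (1/2 : ℝ) * 1) := by positivity
      linarith
    simp [cw, c1]
    norm_num at hs e
    linarith
  by_cases c2 : 1 ≤ v.1 ∧ v.2 = 0
  · obtain ⟨x, y⟩ := v
    obtain ⟨c2, c3⟩ := c2
    simp only at c2 c3
    subst c3
    have hx : 2 ≤ x := by
      unfold linf at hl; simp at hl; rw [abs_of_nonneg (by omega)] at hl; omega
    rw [sum_nbF] at hs ⊢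
    simp only at *
    rw [APsi_nc M a1 hr (by unfold Crs; simp), APsi_nc M a2 hr (by unfold Crs; simp)] at hs
    have e : APsi M (x, 0) (x, 0 + 1) = APsi M (x, 0) (x, 0 - 1) := by
      norm_num
      unfold APsi AQ
      rw [ang_L hx]
      have er : rho (x, 1) = rho (x, -1) := by
        have h1 := rho_sq (x, 1); have h2 := rho_nonneg (x, 1)
        have h3 := rho_sq (x, -1); have h4 := rho_nonneg (x, -1)
        simp [nsq] at h1 h3; nlinarith
      set t := angc (x, 0) (x, -1)
      have e1 : (1/4 : ℝ) * (2 * Real.pi - t) + -(Real.pi/4) = -(1/4 * t + -(Real.pi/4)) := by ring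
      have e2 : (1/2 : ℝ) * (2 * Real.pi - t) + Real.pi/2 = -(1/2 * t + Real.pi/2) + 2 * Real.pi := by
        ring
      rw [e1, e2, Real.cos_add_two_pi, Real.cos_neg, Real.cos_neg, er]
    rw [e, APsi_nc M a4 hr (by unfold Crs; simp)] at hs
    simp [cw, c2]
    simp at hs
    linarith
  · have hnc : ∀ q, ¬ Crs v q := by
      intro q hq
      rcases hq with ⟨q1, q2 | q2⟩
      · exact c1 ⟨q1, q2.1⟩
      · exact c2 ⟨q1, q2.1⟩
    have hcw : ∀ q, cw v q = 1/4 := by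
      intro q; unfold cw
      rw [if_neg (fun hq => c1 ⟨hq.1, hq.2.1⟩), if_neg c2]
    rw [sum_nbF] at hs ⊢
    rw [APsi_nc M a1 hr (hnc _), APsi_nc M a2 hr (hnc _), APsi_nc M a3 hr (hnc _),
      APsi_nc M a4 hr (hnc _)] at hs
    rw [hcw, hcw, hcw, hcw]
    linarith

lemma Psj_super : ∃ N : ℝ, 4 ≤ N ∧ ∀ v : Lat, N ≤ rho v → 4 ≤ linf v → ¬ (1 ≤ v.1 ∧ v.2 = 0) →
    ∑ q ∈ nbF v, 1/4 * Psj q < Psj v := by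
  obtain ⟨N, hN, h⟩ := Psj_sum
  refine ⟨N, hN, ?_⟩
  intro v hv hl c2
  have hs := h v hv
  have hr : 2 ≤ rho v := by linarith
  have e : ∀ q, Adj v q → AQ (1/4) 0 v q = QQ (1/4) 0 q := by
    intro q hq
    by_cases hc : Crs v q
    · obtain ⟨h1, h2 | h2⟩ := hc
      · obtain ⟨x, y⟩ := v
        obtain ⟨x', y'⟩ := q
        have hx' : x' = x := by
          rcases adj_cases hq with h | h | h | h <;> simp at * <;> omega
        simp only at h1 h2
        obtain ⟨h2, h3⟩ := h2
        subst h2 h3 hx'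
        have hx : 2 ≤ x' := by
          unfold linf at hl; simp at hl; rw [abs_of_nonneg (by omega)] at hl; omega
        have ea : ang (x', 0) = Real.pi := by
          have hx1 : (2 : ℝ) ≤ x' := by exact_mod_cast hx
          unfold ang
          have : -zc (x', 0) = ((-(x' : ℝ) : ℝ) : ℂ) := by apply Complex.ext <;> simp [zc]
          rw [this, Complex.arg_ofReal_of_neg (by linarith)]
        unfold AQ QQ
        rw [ang_down hx, ea, add_zero, add_zero, mul_neg, Real.cos_neg]
      · exact absurd ⟨h1, h2.1⟩ c2
    · exact AQ_nc _ _ hq hr hc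
  have : ∑ q ∈ nbF v, (AQ (1/4) 0 v q + (1 - 1 / rho q)) = ∑ q ∈ nbF v, Psj q := by
    apply Finset.sum_congr rfl
    intro q hq
    rw [e q (mem_nbF.mp hq)]; rfl
  rw [this] at hs
  rw [← Finset.mul_sum]; linarith

lemma Psi_bounds {M : ℝ} {v : Lat} (hM : 1 ≤ M) (h1 : 1 ≤ rho v) (h2 : rho v ^ (1/4 : ℝ) ≤ M) :
    rho v ^ (1/2 : ℝ) / (4 * M) ≤ Psi M v ∧ Psi M v ≤ 3 * rho v ^ (1/4 : ℝ) := by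
  have h0 : 0 < rho v := by linarith
  set p := rho v ^ (1/4 : ℝ) with hp
  have hpp : rho v ^ (1/2 : ℝ) = p * p := by
    rw [hp, ← Real.rpow_add h0]; norm_num
  have hp1 : 1 ≤ p := Real.one_le_rpow h1 (by norm_num)
  have hi : 1 / rho v ≤ 1 := by rw [div_le_one h0]; exact h1
  have hi0 : 0 < 1 / rho v := by positivity
  unfold Psi QQ
  rw [← hp, hpp]
  have a1 := Complex.neg_pi_lt_arg (-zc v)
  have a2 := Complex.arg_le_pi (-zc v)
  change -Real.pi < ang v at a1
  change ang v ≤ Real.pi at a2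
  set φ := (ang v + Real.pi) / 4 with hφ
  have e1 : (1/4 : ℝ) * ang v + -(Real.pi/4) = φ - Real.pi/2 := by rw [hφ]; ring
  have e2 : (1/2 : ℝ) * ang v + Real.pi/2 = 2 * φ := by rw [hφ]; ring
  rw [e1, e2, Real.cos_sub_pi_div_two, Real.cos_two_mul]
  have hu : 0 ≤ Real.sin φ := Real.sin_nonneg_of_nonneg_of_le_pi (by rw [hφ]; linarith)
    (by rw [hφ]; linarith [Real.pi_pos])
  have hu1 : Real.sin φ ≤ 1 := Real.sin_le_one φ
  have hcs := Real.sin_sq_add_cos_sq φ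
  set u := Real.sin φ
  have hc : Real.cos φ ^ 2 = 1 - u ^ 2 := by linarith
  rw [hc]
  set α := 1 / (4 * M) * p with hα
  have hα1 : α ≤ 1/4 := by
    rw [hα, one_div, inv_mul_le_iff₀ (by linarith)]; linarith
  have hα0 : 0 ≤ α := by rw [hα]; positivity
  have e3 : 1 / (4 * M) * (p * p * (2 * (1 - u ^ 2) - 1)) = p * (α * (1 - 2 * u ^ 2)) := by
    rw [hα]; ring
  have e4 : p * p / (4 * M) = p * α := by rw [hα]; ring
  rw [e3, e4]
  constructor
  · have : 0 ≤ u - 2 * α * u ^ 2 := by nlinarith [mul_nonneg hu hα0]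
    nlinarith
  · have : u + α * (1 - 2 * u ^ 2) ≤ 2 := by nlinarith [mul_nonneg hα0 (sq_nonneg u)]
    nlinarith

lemma Psj_bounds {v : Lat} (h1 : 1 ≤ rho v) :
    1 / 2 * rho v ^ (1/4 : ℝ) ≤ Psj v ∧ Psj v ≤ 2 * rho v ^ (1/4 : ℝ) := by
  have h0 : 0 < rho v := by linarith
  set p := rho v ^ (1/4 : ℝ) with hp
  have hp1 : 1 ≤ p := Real.one_le_rpow h1 (by norm_num)
  have hi : 1 / rho v ≤ 1 := by rw [div_le_one h0]; exact h1
  have hi0 : 0 < 1 / rho v := by positivity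
  have a1 := Complex.neg_pi_lt_arg (-zc v)
  have a2 := Complex.arg_le_pi (-zc v)
  change -Real.pi < ang v at a1
  change ang v ≤ Real.pi at a2
  unfold Psj QQ
  rw [← hp, add_zero]
  have hc : 1/2 ≤ Real.cos (1/4 * ang v) := by
    rw [← Real.cos_pi_div_three, ← Real.cos_abs (1/4 * ang v)]
    have : |1/4 * ang v| ≤ Real.pi / 3 := by
      rw [abs_le]; constructor <;> linarith [Real.pi_pos]
    exact Real.cos_le_cos_of_nonneg_of_le_pi (abs_nonneg _) (by linarith [Real.pi_pos]) this
  have hc1 := Real.cos_le_one (1/4 * ang v)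
  constructor <;> nlinarith

/-- Annulus as a finset. -/
def ann (s m : ℤ) : Finset Lat := ((box_finite m).subset
  (fun _ hv => hv.2.le : {v : Lat | s < linf v ∧ linf v < m} ⊆ _)).toFinset

lemma mem_ann {s m : ℤ} {v : Lat} : v ∈ ann s m ↔ s < linf v ∧ linf v < m := by
  unfold ann; rw [Set.Finite.mem_toFinset]; rfl

/-- Edge phase. -/
def eph (v q : Lat) : ℂ := phc ((nuF f0 v q : ℤ) : ZMod 4)

lemma phc_one : phc 1 = Complex.I := by
  have : (1 : ZMod 4).val = 1 := rfl
  simp [phc, this]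

lemma phc_neg_one : phc (-1) = -Complex.I := by rw [phc_neg, phc_one, Complex.conj_I]

lemma eph_eq (v q : Lat) : eph v q = if 0 < v.1 then (if v.2 = 0 ∧ q.2 = 1 then Complex.I else
    if v.2 = 1 ∧ q.2 = 0 then -Complex.I else 1) else 1 := by
  unfold eph nuF f0
  simp only [zero_add]
  split_ifs <;> simp [phc_one, phc_zero, phc_neg_one]

lemma eph_norm (v q : Lat) : ‖eph v q‖ = 1 := phc_norm _

/-- Folded function. -/
def fold (F : Lat → ℂ) (v : Lat) : ℂ := if 1 ≤ v.1 ∧ v.2 = 0 then 2 * F v else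
  F v + Complex.I * F (v.1, -v.2)

lemma linf_conj (x y : ℤ) : linf (x, -y) = linf (x, y) := by unfold linf; simp

lemma fold_sub {F : Lat → ℂ} {x y : ℤ} (hl : 2 ≤ linf (x, y))
    (h1 : F (x, y) = 1/4 * ∑ q ∈ nbF (x, y), eph (x, y) q * F q)
    (h2 : F (x, -y) = 1/4 * ∑ q ∈ nbF (x, -y), eph (x, -y) q * F q) :
    ‖fold F (x, y)‖ ≤ ∑ q ∈ nbF (x, y), cw (x, y) q * ‖fold F q‖ := by
  have key : fold F (x, y) = ∑ q ∈ nbF (x, y), (cw (x, y) q : ℂ) * fold F q := by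
    rw [sum_nbF] at h1 h2 ⊢
    simp only [eph_eq] at h1 h2
    have hI := Complex.I_sq
    by_cases hx : 1 ≤ x
    · have hx0 : 0 < x := by omega
      by_cases hy : y = 0
      · subst hy
        have hx2 : 2 ≤ x := by
          unfold linf at hl; simp at hl; rw [abs_of_nonneg (by omega)] at hl; omega
        have e1 : 1 ≤ x + 1 := by omega
        have e2 : 1 ≤ x - 1 := by omega
        simp [hx0] at h1
        simp [fold, cw, hx, e1]
        rw [if_pos (by omega)]
        linear_combination 2 * h1
      by_cases hy1 : y = 1
      · subst hy1
        simp [hx0] at h1 h2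
        simp [fold, cw, hx]
        have e : (-1 + -1 : ℤ) = -2 := rfl
        norm_num at h1 h2 ⊢
        linear_combination h1 + Complex.I * h2
      by_cases hy2 : y = -1
      · subst hy2
        simp [hx0] at h1 h2
        simp [fold, cw, hx]
        norm_num at h1 h2 ⊢
        linear_combination h1 + Complex.I * h2 - 1/4 * F (x, 0) * hI
      · have n1 : y + 1 ≠ 0 := by omega
        have n2 : y - 1 ≠ 0 := by omega
        have n3 : -y ≠ 1 := by omega
        have n4 : -y ≠ 0 := by omega
        simp [hx0, hy, hy1, n3] at h1 h2
        simp [fold, cw, hx, hy, hy1, n1, n2]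
        have e : -(y + 1) = -y - 1 := by ring
        have e' : 1 - y = -y + 1 := by ring
        have e'' : -1 + -y = -y - 1 := by ring
        simp only [e, e', e''] at *
        linear_combination h1 + Complex.I * h2
    · have hx0 : ¬ 0 < x := by omega
      simp [hx0] at h1 h2
      have hx1 : ¬ 1 ≤ x - 1 := by omega
      have hx2 : ¬ (1 ≤ x + 1 ∧ y = 0) := by
        rintro ⟨k1, k2⟩
        have : x = 0 := by omega
        subst this k2
        simp [linf] at hl
      simp [fold, cw, hx, hx0, hx1]
      rw [if_neg (by intro h; exact hx2 ⟨by omega, h.2⟩)]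
      have e : -(y + 1) = -y - 1 := by ring
      have e' : 1 - y = -y + 1 := by ring
      have e'' : -1 + -y = -y - 1 := by ring
      simp only [e, e', e''] at *
      linear_combination h1 + Complex.I * h2
  rw [key]
  refine (norm_sum_le _ _).trans (Finset.sum_le_sum fun q _ => ?_)
  rw [norm_mul, Complex.norm_of_nonneg (cw_nonneg _ _)]

lemma decay : ∃ N : ℤ, 4 ≤ N ∧ ∀ (s m : ℤ) (F : Lat → ℂ) (H0 : ℝ), N ≤ s → 0 < H0 → s < m →
    (∀ v, s < linf v → linf v < m → F v = 1/4 * ∑ q ∈ nbF v, eph v q * F q) →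
    (∀ v, linf v ≤ s → F v = 0) → (∀ v, linf v = m → ‖F v‖ ≤ H0) →
    ∀ v, s < linf v → linf v < m → ‖F v‖ ≤ 96 * (rho v ^ (1/4:ℝ) / (m:ℝ) ^ (1/4:ℝ)) * H0 := by
  obtain ⟨N1, hN1, P1⟩ := Psi_super
  obtain ⟨N2, hN2, P2⟩ := Psj_super
  refine ⟨max 4 ⌈max N1 N2⌉, le_max_left _ _, ?_⟩
  intro s m F H0 hs hH0 hsm hF h0 hm
  have hs4 : 4 ≤ s := (le_max_left _ _).trans hs
  have hsN : max N1 N2 ≤ s := Int.ceil_le.mp ((le_max_right _ _).trans hs)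
  have hlr : ∀ v : Lat, s < linf v → N1 ≤ rho v ∧ N2 ≤ rho v := by
    intro v hv
    have h1 := (rho_linf v (by omega)).1
    have h2 : (s : ℝ) ≤ linf v := by exact_mod_cast hv.le
    exact ⟨((le_max_left _ _).trans hsN).trans (h2.trans h1),
      ((le_max_right _ _).trans hsN).trans (h2.trans h1)⟩
  have hr1 : ∀ v : Lat, 1 ≤ linf v → 1 ≤ rho v := by
    intro v hv
    have h1 := (rho_linf v (by omega)).1
    have h2 : (1 : ℝ) ≤ linf v := by exact_mod_cast hv
    linarith
  have hmR : (4 : ℝ) ≤ m := by exact_mod_cast (by omega : (4:ℤ) ≤ m)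
  set p : ℝ := (m : ℝ) ^ (1/4 : ℝ) with hp
  have hp1 : 1 ≤ p := Real.one_le_rpow (by linarith) (by norm_num)
  set M : ℝ := (2 * m : ℝ) ^ (1/4 : ℝ) with hM
  have hM1 : 1 ≤ M := Real.one_le_rpow (by linarith) (by norm_num)
  have hM2 : M ≤ 2 * p := by
    rw [hM, Real.mul_rpow (by norm_num) (by linarith)]
    have : (2 : ℝ) ^ (1/4 : ℝ) ≤ 2 ^ (1 : ℝ) := Real.rpow_le_rpow_of_exponent_le (by norm_num) (by norm_num)
    rw [Real.rpow_one] at this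
    gcongr
  have hrM : ∀ v : Lat, 0 ≤ linf v → linf v ≤ m → rho v ^ (1/4 : ℝ) ≤ M := by
    intro v hv hv2
    have h1 := (rho_linf v hv).2
    have h2 : (linf v : ℝ) ≤ m := by exact_mod_cast hv2
    exact Real.rpow_le_rpow (rho_nonneg v) (by linarith) (by norm_num)
  have hpr : ∀ v : Lat, linf v = m → p ≤ rho v ^ (1/4 : ℝ) := by
    intro v hv
    have h1 := (rho_linf v (by omega)).1
    rw [hv] at h1
    exact Real.rpow_le_rpow (by linarith) h1 (by norm_num)
  set K : ℝ := 16 * H0 / p with hK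
  have hK0 : 0 < K := by positivity
  have hPsi : ∀ v : Lat, 1 ≤ linf v → linf v ≤ m → 0 < Psi M v ∧ Psi M v ≤ 3 * rho v ^ (1/4:ℝ) := by
    intro v h1 h2
    obtain ⟨b1, b2⟩ := Psi_bounds hM1 (hr1 v h1) (hrM v (by omega) h2)
    refine ⟨lt_of_lt_of_le ?_ b1, b2⟩
    have := hr1 v h1
    positivity
  have G1 : ∀ v ∈ ann s m, ‖fold F v‖ ≤ K * Psi M v := by
    apply mpc (ann s m) cw (fun v => ‖fold F v‖) (fun v => K * Psi M v) cw_nonneg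
    · intro v hv
      rw [mem_ann] at hv
      exact mul_pos hK0 (hPsi v (by omega) (by omega)).1
    · intro v hv
      rw [mem_ann] at hv
      have := P1 M v hM1 (hlr v hv.1).1 (by omega)
      have e : ∑ q ∈ nbF v, cw v q * (K * Psi M q) = K * ∑ q ∈ nbF v, cw v q * Psi M q := by
        rw [Finset.mul_sum]; exact Finset.sum_congr rfl fun q _ => by ring
      rw [e]
      exact mul_lt_mul_of_pos_left this hK0
    · rintro ⟨x, y⟩ hv
      rw [mem_ann] at hv
      exact fold_sub (by omega) (hF _ hv.1 hv.2)
        (hF _ (by rw [linf_conj]; exact hv.1) (by rw [linf_conj]; exact hv.2))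
    · intro v hv q hq hqS _
      rw [mem_ann] at hv hqS
      have hl := linf_adj hq
      have hP := hPsi q (by omega) (by omega)
      refine ⟨?_, (mul_pos hK0 hP.1).le⟩
      by_cases hqs : linf q ≤ s
      · have : fold F q = 0 := by
          unfold fold
          rw [h0 q hqs, h0 (q.1, -q.2) (by rw [linf_conj]; exact hqs)]; simp
        rw [this, norm_zero]
        exact (mul_pos hK0 hP.1).le
      · have hqm : linf q = m := by omega
        have f1 := hm q hqm
        have f2 := hm (q.1, -q.2) (by rw [linf_conj]; exact hqm)
        have f3 : ‖fold F q‖ ≤ 2 * H0 := by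
          unfold fold
          split_ifs
          · rw [norm_mul]; simp; exact f1
          · refine (norm_add_le _ _).trans ?_
            rw [norm_mul, Complex.norm_I]; linarith
        refine f3.trans ?_
        have b := (Psi_bounds hM1 (hr1 q (by omega)) (hrM q (by omega) hqm.le)).1
        have hpq := hpr q hqm
        have hpp : rho q ^ (1/2 : ℝ) = rho q ^ (1/4 : ℝ) * rho q ^ (1/4 : ℝ) := by
          have := hr1 q (by omega)
          rw [← Real.rpow_add (by linarith)]; norm_num
        have b2 : p / 8 ≤ Psi M q := by
          refine le_trans ?_ b
          rw [hpp, div_le_div_iff₀ (by norm_num) (by linarith)]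
          nlinarith
        calc 2 * H0 = K * (p / 8) := by rw [hK]; field_simp; norm_num
          _ ≤ K * Psi M q := by gcongr
  have hFL : ∀ v ∈ ann s m, (1 ≤ v.1 ∧ v.2 = 0) → ‖F v‖ ≤ 24 * H0 / p * rho v ^ (1/4 : ℝ) := by
    intro v hv hL
    have h1 := G1 v hv
    rw [mem_ann] at hv
    unfold fold at h1
    rw [if_pos hL, norm_mul] at h1
    have h2 := (hPsi v (by omega) (by omega)).2
    have h3 : K * Psi M v ≤ K * (3 * rho v ^ (1/4 : ℝ)) := by gcongr
    simp at h1
    have e : K * (3 * rho v ^ (1/4 : ℝ)) = 2 * (24 * H0 / p * rho v ^ (1/4 : ℝ)) := by rw [hK]; ring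
    simp only [one_div] at *
    linarith
  have G2 : ∀ v ∈ (ann s m).filter (fun v => ¬ (1 ≤ v.1 ∧ v.2 = 0)), ‖F v‖ ≤ 48 * H0 / p * Psj v := by
    apply mpc _ (fun _ _ => 1/4) (fun v => ‖F v‖) (fun v => 48 * H0 / p * Psj v) (fun _ _ => by norm_num)
    · intro v hv
      rw [Finset.mem_filter, mem_ann] at hv
      have b := (Psj_bounds (hr1 v (by omega))).1
      have := hr1 v (by omega)
      have b2 : 0 < Psj v := lt_of_lt_of_le (by positivity) b
      positivity
    · intro v hv
      rw [Finset.mem_filter, mem_ann] at hv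
      have := P2 v (hlr v hv.1.1).2 (by omega) hv.2
      have e : ∑ q ∈ nbF v, (1/4 : ℝ) * (48 * H0 / p * Psj q) =
          48 * H0 / p * ∑ q ∈ nbF v, 1/4 * Psj q := by
        rw [Finset.mul_sum]; exact Finset.sum_congr rfl fun q _ => by ring
      simp only [e]
      exact mul_lt_mul_of_pos_left this (by positivity)
    · intro v hv
      rw [Finset.mem_filter, mem_ann] at hv
      rw [hF v hv.1.1 hv.1.2, norm_mul, ← Finset.mul_sum]
      simp only [one_div, norm_inv, Complex.norm_ofNat]
      gcongr
      refine (norm_sum_le _ _).trans (Finset.sum_le_sum fun q _ => ?_)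
      rw [norm_mul, eph_norm, one_mul]
    · intro v hv q hq hqS _
      rw [Finset.mem_filter, mem_ann] at hv hqS
      have hl := linf_adj hq
      have b := (Psj_bounds (hr1 q (by omega))).1
      have hr := hr1 q (by omega)
      have b0 : 0 < Psj q := lt_of_lt_of_le (by positivity) b
      have hHq : 0 ≤ 48 * H0 / p * Psj q := by positivity
      refine ⟨?_, hHq⟩
      have e : 48 * H0 / p * (1 / 2 * rho q ^ (1/4 : ℝ)) ≤ 48 * H0 / p * Psj q := by gcongr
      by_cases hqs : linf q ≤ s
      · rw [h0 q hqs, norm_zero]; exact hHq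
      by_cases hqm : linf q = m
      · refine (hm q hqm).trans (le_trans ?_ e)
        have hpq := hpr q hqm
        calc H0 ≤ 24 * H0 := by linarith
          _ = 48 * H0 / p * (1 / 2 * p) := by field_simp; norm_num
          _ ≤ _ := by gcongr
      · have hqa : s < linf q ∧ linf q < m := by omega
        have hL : 1 ≤ q.1 ∧ q.2 = 0 := by
          by_contra hcon; exact hqS ⟨hqa, hcon⟩
        refine (hFL q (mem_ann.mpr hqa) hL).trans (le_trans (le_of_eq ?_) e)
        ring
  intro v hv1 hv2
  have hv := mem_ann.mpr ⟨hv1, hv2⟩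
  have hr := hr1 v (by omega)
  have hpos : 0 < rho v ^ (1/4 : ℝ) := by positivity
  by_cases hL : 1 ≤ v.1 ∧ v.2 = 0
  · refine (hFL v hv hL).trans ?_
    have : 0 ≤ H0 / p * rho v ^ (1/4 : ℝ) := by positivity
    calc 24 * H0 / p * rho v ^ (1/4 : ℝ) = 24 * (H0 / p * rho v ^ (1/4 : ℝ)) := by ring
      _ ≤ 96 * (H0 / p * rho v ^ (1/4 : ℝ)) := by linarith
      _ = _ := by ring
  · refine (G2 v (Finset.mem_filter.mpr ⟨hv, hL⟩)).trans ?_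
    have b := (Psj_bounds hr).2
    calc 48 * H0 / p * Psj v ≤ 48 * H0 / p * (2 * rho v ^ (1/4 : ℝ)) := by gcongr
      _ = _ := by ring

section TFs
variable {r1 R1 : ℤ}

/-- Twisted Green function extended by zero. -/
def TF (u : AV r1 R1) (v : Lat) : ℂ := if h : r1 < linf v ∧ linf v < R1 then TG r1 R1 ⟨v, h⟩ u else 0

lemma TF_in (u : AV r1 R1) (a : AV r1 R1) : TF u a.1 = TG r1 R1 a u := by
  unfold TF; rw [dif_pos a.2]

lemma TF_out (u : AV r1 R1) {v : Lat} (h : ¬ (r1 < linf v ∧ linf v < R1)) : TF u v = 0 := by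
  unfold TF; rw [dif_neg h]

lemma TF_eq (u a : AV r1 R1) : TF u a.1 = (if a = u then 1 else 0) +
    1/4 * ∑ q ∈ nbF a.1, eph a.1 q * TF u q := by
  haveI : Nonempty (AV r1 R1) := ⟨u⟩
  have h := congrFun (congrFun (TG_right (r1 := r1) (R1 := R1)) a) u
  rw [sub_mul, one_mul, Matrix.sub_apply, Matrix.one_apply, Matrix.mul_apply] at h
  rw [TF_in]
  have e : ∑ j, TA r1 R1 a j * TG r1 R1 j u = 1/4 * ∑ q ∈ nbF a.1, eph a.1 q * TF u q := by
    have e1 : ∑ q ∈ nbF a.1, eph a.1 q * TF u q = ∑ q ∈ (nbF a.1).filter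
        (fun q => r1 < linf q ∧ linf q < R1), eph a.1 q * TF u q := by
      rw [Finset.sum_filter]
      refine Finset.sum_congr rfl fun q _ => ?_
      split_ifs with hq
      · rfl
      · rw [TF_out u hq, mul_zero]
    have e2 : ∑ j, TA r1 R1 a j * TG r1 R1 j u = ∑ j ∈ Finset.univ.filter
        (fun j : AV r1 R1 => Adj a.1 j.1), 1/4 * (eph a.1 j.1 * TF u j.1) := by
      rw [Finset.sum_filter]
      refine Finset.sum_congr rfl fun j _ => ?_
      unfold TA
      split_ifs with hj
      · rw [TF_in, eph]; ring
      · rw [zero_mul]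
    rw [e1, e2, Finset.mul_sum]
    refine Finset.sum_bij (fun j _ => j.1) ?_ ?_ ?_ ?_
    · intro j hj
      rw [Finset.mem_filter] at hj ⊢
      exact ⟨mem_nbF.mpr hj.2, j.2⟩
    · intro j _ k _ h; exact Subtype.ext h
    · intro q hq
      rw [Finset.mem_filter] at hq
      exact ⟨⟨q, hq.2⟩, by simpa using mem_nbF.mp hq.1, rfl⟩
    · intro j _; rfl
  rw [e] at h
  rw [← h]; ring

lemma TF_sub (u : AV r1 R1) {v : Lat} (h : r1 < linf v ∧ linf v < R1) : ‖TF u v‖ ≤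
    (if v = u.1 then 1 else 0) + avg (fun q => ‖TF u q‖) v := by
  have e := TF_eq u ⟨v, h⟩
  simp only at e
  rw [e]
  refine (norm_add_le _ _).trans ?_
  apply add_le_add
  · by_cases hv : v = u.1
    · rw [if_pos (Subtype.ext hv), if_pos hv]; simp
    · rw [if_neg (fun h' => hv (congrArg Subtype.val h')), if_neg hv]; simp
  · rw [norm_mul]
    unfold avg
    simp only [one_div, norm_inv, Complex.norm_ofNat]
    gcongr
    refine (norm_sum_le _ _).trans (Finset.sum_le_sum fun q _ => ?_)
    rw [norm_mul, eph_norm, one_mul]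

lemma TA_herm : (TA r1 R1).conjTranspose = TA r1 R1 := by
  ext a b
  rw [Matrix.conjTranspose_apply]
  unfold TA
  by_cases h : Adj a.1 b.1
  · rw [if_pos (adj_symm h), if_pos h, nuF_symm f0 h]
    push_cast
    rw [phc_neg]
    simp
  · rw [if_neg (fun h' => h (adj_symm h')), if_neg h, star_zero]

lemma TG_norm_symm (a b : AV r1 R1) : ‖TG r1 R1 a b‖ = ‖TG r1 R1 b a‖ := by
  have h : (TG r1 R1).conjTranspose = TG r1 R1 := by
    unfold TG
    rw [Matrix.conjTranspose_nonsing_inv, Matrix.conjTranspose_sub, Matrix.conjTranspose_one, TA_herm]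
  have h1 := congrFun (congrFun h a) b
  rw [Matrix.conjTranspose_apply] at h1
  rw [← h1, norm_star]

end TFs

lemma avg_tr (g : Lat → ℝ) (a v : Lat) : avg (fun q => g (q - a)) v = avg g (v - a) := by
  unfold avg
  rw [sum_nbF, sum_nbF]
  have e1 : ((v.1 + 1, v.2) : Lat) - a = ((v - a).1 + 1, (v - a).2) := by
    ext <;> simp; ring
  have e2 : ((v.1 - 1, v.2) : Lat) - a = ((v - a).1 - 1, (v - a).2) := by
    ext <;> simp; ring
  have e3 : ((v.1, v.2 + 1) : Lat) - a = ((v - a).1, (v - a).2 + 1) := by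
    ext <;> simp; ring
  have e4 : ((v.1, v.2 - 1) : Lat) - a = ((v - a).1, (v - a).2 - 1) := by
    ext <;> simp; ring
  rw [e1, e2, e3, e4]

lemma log_sub_tr (c : ℝ) (a v : Lat) : (if v = a then 1 else 0) +
    avg (fun q => c - Real.log (nsq (q - a) + 1/2)) v ≤ c - Real.log (nsq (v - a) + 1/2) := by
  have h := log_sub (v - a)
  have e := avg_tr (fun w => Real.log (nsq w + 1/2)) a v
  have e2 : avg (fun q => c - Real.log (nsq (q - a) + 1/2)) v =
      c - avg (fun q => Real.log (nsq (q - a) + 1/2)) v := by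
    unfold avg; rw [sum_nbF, sum_nbF]; ring
  rw [e2, e]
  by_cases hv : v = a
  · rw [if_pos hv]; rw [if_pos (sub_eq_zero.mpr hv)] at h; linarith
  · rw [if_neg hv]; rw [if_neg (fun h' => hv (sub_eq_zero.mp h'))] at h; linarith

lemma linf_abs (v : Lat) : |v.1| ≤ linf v ∧ |v.2| ≤ linf v := ⟨le_max_left _ _, le_max_right _ _⟩

lemma linf_sub (a v : Lat) : linf v - linf a ≤ linf (v - a) ∧ linf (v - a) ≤ linf v + linf a := by
  have h1 := (linf_le_iff (v := v) (n := linf v)).mp le_rfl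
  have h2 := (linf_le_iff (v := a) (n := linf a)).mp le_rfl
  have h3 := (linf_le_iff (v := v - a) (n := linf (v - a))).mp le_rfl
  simp only [Prod.fst_sub, Prod.snd_sub] at h3
  constructor
  · have : linf v ≤ linf (v - a) + linf a := by rw [linf_le_iff]; omega
    linarith
  · rw [linf_le_iff]; simp only [Prod.fst_sub, Prod.snd_sub]; omega

lemma TF_bound1 {s m : ℤ} (hs : 1 ≤ s) (hm : s ≤ m) (a : AV s (4*m)) (ha : linf a.1 ≤ m) {v : Lat}
    (hv : 2 * m ≤ linf v) : ‖TF a v‖ ≤ 4 := by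
  have hm1 : (1 : ℝ) ≤ m := by exact_mod_cast (by omega : 1 ≤ m)
  by_cases hD : s < linf v ∧ linf v < 4 * m
  swap
  · rw [TF_out a hD, norm_zero]; norm_num
  have key : ∀ v ∈ ann s (4*m), ‖TF a v‖ ≤ Real.log (51 * (m:ℝ)^2) - Real.log (nsq (v - a.1) + 1/2) := by
    apply mp2 (ann s (4*m)) (fun v => ‖TF a v‖)
      (fun v => Real.log (51 * (m:ℝ)^2) - Real.log (nsq (v - a.1) + 1/2))
      (fun v => if v = a.1 then 1 else 0)
    · intro v hv
      rw [mem_ann] at hv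
      exact TF_sub a hv
    · intro v hv
      exact log_sub_tr _ _ _
    · rintro v hv ⟨u, hu, huv⟩
      rw [mem_ann] at hv hu
      rw [TF_out a hv, norm_zero, sub_nonneg]
      have h1 := linf_adj huv
      have h2 := (linf_sub a.1 v).2
      have h3 : (linf (v - a.1) : ℝ) ≤ 5 * m := by exact_mod_cast (by omega : linf (v - a.1) ≤ 5 * m)
      have h4 : (0 : ℝ) ≤ linf (v - a.1) := by
        exact_mod_cast (le_trans (abs_nonneg _) (linf_abs (v - a.1)).1)
      have h5 := (linf_nsq (v := v - a.1)).2
      apply Real.log_le_log (by linarith [nsq_nonneg (v - a.1)])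
      nlinarith
  refine (key v (mem_ann.mpr hD)).trans ?_
  have h2 := (linf_sub a.1 v).1
  have h3 : (m : ℝ) ≤ linf (v - a.1) := by exact_mod_cast (by omega : m ≤ linf (v - a.1))
  have h5 := (linf_nsq (v := v - a.1)).1
  have h6 : (m : ℝ)^2 ≤ nsq (v - a.1) + 1/2 := by nlinarith
  rw [← Real.log_div (by positivity) (by nlinarith)]
  rw [Real.log_le_iff_le_exp (by apply div_pos <;> nlinarith)]
  have h7 : 51 * (m:ℝ)^2 / (nsq (v - a.1) + 1/2) ≤ 51 := by
    rw [div_le_iff₀ (by nlinarith)]; nlinarith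
  refine h7.trans ?_
  have e1 := Real.exp_one_gt_d9
  have e2 : Real.exp 4 = Real.exp 1 ^ 4 := by rw [← Real.exp_nat_mul]; norm_num
  rw [e2]
  calc (51 : ℝ) ≤ 2.7 ^ 4 := by norm_num
    _ ≤ _ := by gcongr; linarith

lemma TF_bound2 {s m : ℤ} (hs : 1 ≤ s) (hm : s ≤ m) (a : AV s (4*m)) (ha : linf a.1 ≤ m)
    (ℓ : Lat → ℤ) (hℓ : ∀ v, avg (fun q => (ℓ q : ℝ)) v = ℓ v) (hℓ2 : ∀ v, ℓ v ≤ linf v)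
    {v : Lat} (hv : s < linf v ∧ linf v < 4*m) (hv2 : 2*m < ℓ v) :
    ‖TF a v‖ ≤ 4 * ((4*m : ℝ) - ℓ v) / (2*m) := by
  have hm1 : (1 : ℝ) ≤ m := by exact_mod_cast (by omega : 1 ≤ m)
  refine mp2 ((ann s (4*m)).filter (fun v => 2*m < ℓ v)) (fun v => ‖TF a v‖)
      (fun v => 4 * ((4*m : ℝ) - ℓ v) / (2*m)) (fun _ => 0) ?_ ?_ ?_ v
      (Finset.mem_filter.mpr ⟨mem_ann.mpr hv, hv2⟩)
  · intro v hv
    rw [Finset.mem_filter, mem_ann] at hv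
    have := TF_sub a hv.1
    rw [if_neg] at this
    · exact this
    · rintro rfl
      have := hℓ2 a.1; omega
  · intro v hv
    rw [zero_add]
    have h := hℓ v
    unfold avg at h ⊢
    rw [sum_nbF] at h ⊢
    rw [← h]
    apply le_of_eq
    field_simp
    ring
  · rintro v hv ⟨u, hu, huv⟩
    rw [Finset.mem_filter, mem_ann] at hv hu
    have h1 := linf_adj huv
    have h2 := hℓ2 v
    by_cases hD : s < linf v ∧ linf v < 4 * m
    · have h3 : ℓ v ≤ 2 * m := by
        by_contra hcon
        exact hv ⟨hD, by omega⟩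
      have h3' : (ℓ v : ℝ) ≤ 2 * m := by exact_mod_cast h3
      have h4 : ‖TF a v‖ ≤ 4 := by
        have h5 := hℓ2 u
        exact TF_bound1 hs hm a ha (by omega)
      refine h4.trans ?_
      rw [le_div_iff₀ (by linarith)]
      linarith
    · rw [TF_out a hD, norm_zero]
      have : (ℓ v : ℝ) ≤ 4 * m := by exact_mod_cast (by omega : ℓ v ≤ 4 * m)
      apply div_nonneg <;> linarith

lemma TG_bound3 {s m : ℤ} (hs : 1 ≤ s) (hm : s ≤ m) (a u : AV s (4*m)) (ha : linf a.1 ≤ m)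
    (hu : linf u.1 = 4*m - 1) : ‖TG s (4*m) u a‖ ≤ 2 / m := by
  have hm1 : (1 : ℝ) ≤ m := by exact_mod_cast (by omega : 1 ≤ m)
  have hd : linf u.1 = |u.1.1| ∨ linf u.1 = |u.1.2| := max_choice _ _
  rw [← TF_in]
  have fin : ∀ ℓ : Lat → ℤ, (∀ v, avg (fun q => (ℓ q : ℝ)) v = ℓ v) → (∀ v, ℓ v ≤ linf v) →
      ℓ u.1 = 4*m - 1 → ‖TF a u.1‖ ≤ 2 / m := by
    intro ℓ h1 h2 h3
    have hm2 : 2 ≤ m ∨ m = 1 := by omega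
    rcases hm2 with hm2 | rfl
    · refine (TF_bound2 hs hm a ha ℓ h1 h2 u.2 (by omega)).trans (le_of_eq ?_)
      rw [h3]; push_cast; field_simp; ring
    · refine (TF_bound2 hs hm a ha ℓ h1 h2 u.2 (by omega)).trans (le_of_eq ?_)
      rw [h3]; push_cast; field_simp; ring
  have av1 : ∀ v : Lat, v.1 ≤ linf v := fun v => (le_abs_self _).trans (linf_abs v).1
  have av2 : ∀ v : Lat, v.2 ≤ linf v := fun v => (le_abs_self _).trans (linf_abs v).2
  have av3 : ∀ v : Lat, -v.1 ≤ linf v := fun v => (neg_le_abs _).trans (linf_abs v).1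
  have av4 : ∀ v : Lat, -v.2 ≤ linf v := fun v => (neg_le_abs _).trans (linf_abs v).2
  rcases hd with h | h
  · rcases abs_choice u.1.1 with h' | h'
    · exact fin (fun v => v.1) (fun v => by rw [avg_eq]; push_cast; ring) av1 (by omega)
    · exact fin (fun v => -v.1) (fun v => by rw [avg_eq]; push_cast; ring) av3 (by omega)
  · rcases abs_choice u.1.2 with h' | h'
    · exact fin (fun v => v.2) (fun v => by rw [avg_eq]; push_cast; ring) av2 (by omega)
    · exact fin (fun v => -v.2) (fun v => by rw [avg_eq]; push_cast; ring) av4 (by omega)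

/-- Escape function. -/
structure IsE (s R : ℤ) (e : Lat → ℝ) : Prop where
  harm : ∀ v, s < linf v → linf v < R → e v = avg e v
  zero : ∀ v, linf v ≤ s → e v = 0
  one : ∀ v, R ≤ linf v → e v = 1

lemma IsE_exists {s R : ℤ} (h : s < R) : ∃ e, IsE s R e := by
  obtain ⟨g, h1, h2⟩ := dirichlet (ann s R) (fun v => if linf v ≤ s then 0 else 1)
  refine ⟨g, fun v hv hv2 => h1 v (mem_ann.mpr ⟨hv, hv2⟩), fun v hv => ?_, fun v hv => ?_⟩
  · rw [h2 v (by rw [mem_ann]; omega), if_pos hv]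
  · rw [h2 v (by rw [mem_ann]; omega), if_neg (by omega)]

lemma IsE.nonneg {s R : ℤ} {e : Lat → ℝ} (h : IsE s R e) (v : Lat) : 0 ≤ e v := by
  by_cases h1 : linf v ≤ s
  · rw [h.zero v h1]
  by_cases h2 : R ≤ linf v
  · rw [h.one v h2]; norm_num
  have := mp2 (ann s R) (fun _ => 0) e (fun _ => 0) (fun v _ => by unfold avg; simp)
    (fun v hv => by rw [mem_ann] at hv; rw [zero_add, ← h.harm v hv.1 hv.2])
    (fun v hv _ => by
      rw [mem_ann] at hv
      by_cases h1 : linf v ≤ s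
      · rw [h.zero v h1]
      · rw [h.one v (by omega)]; norm_num)
  exact this v (mem_ann.mpr ⟨by omega, by omega⟩)

lemma IsE.le_one {s R : ℤ} {e : Lat → ℝ} (h : IsE s R e) (v : Lat) : e v ≤ 1 := by
  by_cases h1 : linf v ≤ s
  · rw [h.zero v h1]; norm_num
  by_cases h2 : R ≤ linf v
  · rw [h.one v h2]
  have := mp2 (ann s R) e (fun _ => 1) (fun _ => 0)
    (fun v hv => by rw [mem_ann] at hv; rw [zero_add, ← h.harm v hv.1 hv.2])
    (fun v _ => by rw [avg_eq]; norm_num)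
    (fun v hv _ => by
      rw [mem_ann] at hv
      by_cases h1 : linf v ≤ s
      · rw [h.zero v h1]; norm_num
      · rw [h.one v (by omega)])
  exact this v (mem_ann.mpr ⟨by omega, by omega⟩)

lemma IsE.lower {s R : ℤ} {e : Lat → ℝ} (h : IsE s R e) (hs : 1 ≤ s) (hR : 2 * s < R) {v : Lat}
    (hv : linf v = 2 * s) : 1 ≤ 5 * Real.log (R / s) * e v := by
  have hs1 : (1 : ℝ) ≤ s := by exact_mod_cast hs
  have hR1 : (2 * s : ℝ) < R := by exact_mod_cast hR
  have hR0 : (0 : ℝ) < R := by linarith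
  set Λ := Real.log (2 * (R:ℝ)^2 + 1/2) - Real.log (2 * (s:ℝ)^2 + 1/2) with hΛ
  have hΛ0 : 0 < Λ := by
    rw [hΛ, sub_pos]; apply Real.log_lt_log (by positivity); nlinarith
  have hΛ2 : Λ ≤ 2 * Real.log (R / s) := by
    rw [hΛ, ← Real.log_div (by positivity) (by positivity)]
    have : 2 * Real.log ((R:ℝ) / s) = Real.log ((R / s : ℝ)^2) := by rw [Real.log_pow]; norm_num
    rw [this]
    apply Real.log_le_log (by positivity)
    rw [div_pow, div_le_div_iff₀ (by positivity) (by positivity)]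
    nlinarith
  have key := mp2 (ann s R) (fun v => (Real.log (nsq v + 1/2) - Real.log (2 * (s:ℝ)^2 + 1/2)) / Λ) e
    (fun _ => 0)
    (fun v hv => by
      have := log_sub v
      have h2 : Real.log (nsq v + 1/2) ≤ avg (fun q => Real.log (nsq q + 1/2)) v := by
        split_ifs at this <;> linarith
      have e2 : avg (fun v => (Real.log (nsq v + 1/2) - Real.log (2 * (s:ℝ)^2 + 1/2)) / Λ) v =
          (avg (fun q => Real.log (nsq q + 1/2)) v - Real.log (2 * (s:ℝ)^2 + 1/2)) / Λ := by
        unfold avg; rw [sum_nbF, sum_nbF]; field_simp; ring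
      rw [e2, zero_add]
      gcongr)
    (fun v hv => by rw [mem_ann] at hv; rw [zero_add, ← h.harm v hv.1 hv.2])
    (fun v hv hu => by
      obtain ⟨u, hu, huv⟩ := hu
      rw [mem_ann] at hv hu
      have h1 := linf_adj huv
      have h5 := (linf_nsq (v := v)).2
      have h0 := nsq_nonneg v
      have hl0 : (0 : ℝ) ≤ linf v := by exact_mod_cast (by omega : 0 ≤ linf v)
      by_cases h1 : linf v ≤ s
      · rw [h.zero v h1]
        apply div_nonpos_of_nonpos_of_nonneg _ hΛ0.le
        rw [sub_nonpos]
        have h2 : (linf v : ℝ) ≤ s := by exact_mod_cast h1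
        apply Real.log_le_log (by linarith); nlinarith
      · rw [h.one v (by omega), div_le_one hΛ0, hΛ]
        have h2 : (linf v : ℝ) ≤ R := by exact_mod_cast (by omega : linf v ≤ R)
        have : Real.log (nsq v + 1/2) ≤ Real.log (2 * (R:ℝ)^2 + 1/2) := by
          apply Real.log_le_log (by linarith); nlinarith
        linarith)
  have k := key v (mem_ann.mpr ⟨by omega, by omega⟩)
  have h5 := (linf_nsq (v := v)).1
  rw [hv] at h5
  push_cast at h5
  have l1 : 0.4 ≤ Real.log (nsq v + 1/2) - Real.log (2 * (s:ℝ)^2 + 1/2) := by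
    have q0 : (1.8 : ℝ) * (2 * (s:ℝ)^2 + 1/2) ≤ nsq v + 1/2 := by nlinarith
    rw [← Real.log_div (by nlinarith) (by positivity)]
    have q1 : (1.8 : ℝ) ≤ (nsq v + 1/2) / (2 * (s:ℝ)^2 + 1/2) := by
      rw [le_div_iff₀ (by positivity)]; exact q0
    have q2 := Real.one_sub_inv_le_log_of_pos (by norm_num : (0:ℝ) < 1.8)
    have q3 := Real.log_le_log (by norm_num) q1
    norm_num at q2 q3 ⊢
    linarith
  rw [div_le_iff₀ hΛ0] at k
  have he := h.nonneg v
  nlinarith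

lemma TG_bound : ∃ N : ℤ, 4 ≤ N ∧ ∀ (s m R : ℤ) (e : Lat → ℝ), N ≤ s → 2 * s < m → 2 * s < R →
    IsE s R e → ∀ x u : AV s (4*m), linf x.1 ≤ 2 * s → linf u.1 = 4*m - 1 →
    ‖TG s (4*m) x u‖ ≤ 2000 * Real.log (R / s) * ((s / m : ℝ) ^ (1/4 : ℝ) / m) * e x.1 := by
  obtain ⟨N, hN, hdec⟩ := decay
  refine ⟨N, hN, ?_⟩
  intro s m R e hs hm hR he x u hx hu
  have hs1 : (1 : ℝ) ≤ s := by exact_mod_cast (by omega : 1 ≤ s)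
  have hm1 : (2 * s : ℝ) < m := by exact_mod_cast hm
  have hm0 : (0 : ℝ) < m := by linarith
  have D := hdec s m (TF u) (2 / m) hs (by positivity) (by omega)
    (fun v h1 h2 => by
      have := TF_eq u ⟨v, h1, by omega⟩
      rw [if_neg (fun h => by
        have h3 := congrArg (fun z : AV s (4*m) => linf z.1) h
        simp only at h3; omega), zero_add] at this
      exact this)
    (fun v h1 => TF_out u (by omega))
    (fun v h1 => by
      have := TF_in u ⟨v, by omega, by omega⟩
      simp only at this
      rw [this, TG_norm_symm]
      exact TG_bound3 (by omega) (by omega) _ _ h1.le hu)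
  have ring2 : ∀ v, linf v = 2 * s → ‖TF u v‖ ≤ 400 * ((s / m : ℝ) ^ (1/4 : ℝ) / m) := by
    intro v hv
    refine (D v (by omega) (by omega)).trans ?_
    have h1 := (rho_linf v (by omega)).2
    rw [hv] at h1
    push_cast at h1
    have h2 : rho v ^ (1/4 : ℝ) ≤ 2 * (s:ℝ) ^ (1/4 : ℝ) := by
      calc rho v ^ (1/4 : ℝ) ≤ (4 * s : ℝ) ^ (1/4 : ℝ) :=
            Real.rpow_le_rpow (rho_nonneg v) (by linarith) (by norm_num)
        _ = 4 ^ (1/4 : ℝ) * (s:ℝ) ^ (1/4 : ℝ) := Real.mul_rpow (by norm_num) (by linarith)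
        _ ≤ 2 * (s:ℝ) ^ (1/4 : ℝ) := by
            gcongr
            calc (4:ℝ) ^ (1/4 : ℝ) ≤ 4 ^ (1/2 : ℝ) :=
                  Real.rpow_le_rpow_of_exponent_le (by norm_num) (by norm_num)
              _ = 2 := by
                  rw [← Real.sqrt_eq_rpow]
                  have : (4:ℝ) = 2 ^ 2 := by norm_num
                  rw [this, Real.sqrt_sq (by norm_num)]
    rw [Real.div_rpow (by linarith) hm0.le]
    have hp : 0 < (m:ℝ) ^ (1/4 : ℝ) := by positivity
    have hsp : 0 < (s:ℝ) ^ (1/4 : ℝ) := by positivity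
    calc 96 * (rho v ^ (1/4:ℝ) / (m:ℝ) ^ (1/4:ℝ)) * (2 / m)
        ≤ 96 * ((2 * (s:ℝ) ^ (1/4 : ℝ)) / (m:ℝ) ^ (1/4:ℝ)) * (2 / m) := by gcongr
      _ = 384 * ((s:ℝ) ^ (1/4 : ℝ) / (m:ℝ) ^ (1/4:ℝ) / m) := by ring
      _ ≤ _ := by
        have : 0 ≤ (s:ℝ) ^ (1/4 : ℝ) / (m:ℝ) ^ (1/4:ℝ) / m := by positivity
        linarith
  have hlog : 0 < Real.log (R / s) := by
    apply Real.log_pos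
    rw [one_lt_div (by linarith)]
    exact_mod_cast (by omega : s < R)
  set B := 2000 * Real.log (R / s) * ((s / m : ℝ) ^ (1/4 : ℝ) / m) with hB
  have hB0 : 0 ≤ B := by positivity
  have r2 : ∀ v, linf v = 2 * s → ‖TF u v‖ ≤ B * e v := by
    intro v hv
    have h1 := he.lower (by omega) hR hv
    have h2 := ring2 v hv
    have h3 : 0 ≤ 400 * ((s / m : ℝ) ^ (1/4 : ℝ) / m) := by positivity
    calc ‖TF u v‖ ≤ 400 * ((s / m : ℝ) ^ (1/4 : ℝ) / m) * 1 := by linarith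
      _ ≤ 400 * ((s / m : ℝ) ^ (1/4 : ℝ) / m) * (5 * Real.log (R / s) * e v) := by gcongr
      _ = _ := by rw [hB]; ring
  rw [← TF_in]
  have hxs := x.2
  by_cases hx2 : linf x.1 = 2 * s
  · exact r2 _ hx2
  refine mp2 (ann s (2*s)) (fun v => ‖TF u v‖) (fun v => B * e v) (fun _ => 0) ?_ ?_ ?_ x.1
    (mem_ann.mpr ⟨hxs.1, by omega⟩)
  · intro v hv
    rw [mem_ann] at hv
    have := TF_sub u (v := v) (by omega)
    rw [if_neg] at this
    · exact this
    · rintro rfl; omega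
  · intro v hv
    rw [mem_ann] at hv
    have := he.harm v hv.1 (by omega)
    beta_reduce
    rw [this, zero_add]
    unfold avg
    rw [← Finset.mul_sum]
    apply le_of_eq; ring
  · rintro v hv ⟨w, hw, hwv⟩
    rw [mem_ann] at hv hw
    have h1 := linf_adj hwv
    by_cases h2 : linf v ≤ s
    · rw [TF_out u (by omega), norm_zero]
      exact mul_nonneg hB0 (he.nonneg v)
    · exact r2 v (by omega)

lemma cover {α ι : Type*} (f : α → ℝ≥0∞) (g : ι → ℝ≥0∞) (D : ι → α)
    (h : ∀ m, f m ≠ 0 → ∃ t, D t = m ∧ f m ≤ g t) : ∑' m, f m ≤ ∑' t, g t := by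
  have e : ∑' m, f m = ∑' m : Function.support f, f m := by
    rw [tsum_subtype_eq_of_support_subset (Set.Subset.refl _)]
  rw [e]
  choose T hT using h
  refine (ENNReal.tsum_le_tsum (g := fun m : Function.support f => g (T m.1 m.2))
    (fun m => (hT m.1 m.2).2)).trans ?_
  exact ENNReal.tsum_comp_le_tsum_of_injective (f := fun m : Function.support f => T m.1 m.2)
    (fun m m' hm => by
      apply Subtype.ext
      rw [← (hT m.1 m.2).1, ← (hT m'.1 m'.2).1]
      exact congrArg D hm) g

lemma cover2 {α ι κ : Type*} (f : α → ℝ≥0∞) (g : ι → ℝ≥0∞) (D : ι → α) (g' : κ → ℝ≥0∞) (D' : κ → α)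
    (h : ∀ m, f m ≠ 0 → (∃ t, D t = m ∧ f m ≤ g t) ∨ ∃ t, D' t = m ∧ f m ≤ g' t) :
    ∑' m, f m ≤ ∑' t, g t + ∑' t, g' t := by
  have e : ∑' m, f m = ∑' m, (if ∃ t, D t = m ∧ f m ≤ g t then f m else 0) +
      ∑' m, (if ∃ t, D t = m ∧ f m ≤ g t then 0 else f m) := by
    rw [← ENNReal.tsum_add]
    refine tsum_congr fun m => ?_
    split_ifs <;> simp
  rw [e]
  apply add_le_add
  · apply cover _ _ D
    intro m hm
    split_ifs at hm ⊢ with h1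
    · exact h1
    · exact absurd rfl hm
  · apply cover _ _ D'
    intro m hm
    split_ifs at hm ⊢ with h1
    · exact absurd rfl hm
    · exact (h m hm).resolve_left h1

/-- Weight of a list. -/
def w4 (l : List Lat) : ℝ≥0∞ := (4 : ℝ≥0∞)⁻¹ ^ l.length

lemma w4_append (l l' : List Lat) : w4 (l ++ l') = w4 l * w4 l' := by
  unfold w4; rw [List.length_append, pow_add]

lemma w4_cons (a : Lat) (l : List Lat) : w4 (a :: l) = 4⁻¹ * w4 l := by
  unfold w4; rw [List.length_cons, pow_succ']

/-- Total weight. -/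
def ms (P : List Lat → Prop) : ℝ≥0∞ := ∑' l, if P l then w4 l else 0

lemma ms_mono {P Q : List Lat → Prop} (h : ∀ l, P l → Q l) : ms P ≤ ms Q := by
  unfold ms
  refine ENNReal.tsum_le_tsum fun l => ?_
  by_cases hp : P l
  · rw [if_pos hp, if_pos (h l hp)]
  · rw [if_neg hp]; exact zero_le

/-- Chains in `S` between two points. -/
structure ChL (S : Lat → Prop) (a b : Lat) (l : List Lat) : Prop where
  chain : l.IsChain Adj
  head : l.head? = some a
  last : l.getLast? = some b
  mem : ∀ v ∈ l, S v

/-- Green mass. -/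
def Gr (S : Lat → Prop) (a b : Lat) : ℝ≥0∞ := ms (ChL S a b)

lemma ChL.reverse {S : Lat → Prop} {a b : Lat} {l : List Lat} (h : ChL S a b l) : ChL S b a l.reverse := by
  refine ⟨?_, ?_, ?_, ?_⟩
  · rw [List.isChain_reverse]
    exact h.chain.imp (fun _ _ h => adj_symm h)
  · rw [List.head?_reverse]; exact h.last
  · rw [List.getLast?_reverse]; exact h.head
  · intro v hv; exact h.mem v (List.mem_reverse.mp hv)

lemma Gr_symm_le (S : Lat → Prop) (a b : Lat) : Gr S a b ≤ Gr S b a := by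
  unfold Gr ms
  apply cover _ _ List.reverse
  intro l hl
  have hG : ChL S a b l := by
    by_contra hcon; rw [if_neg hcon] at hl; exact hl rfl
  refine ⟨l.reverse, List.reverse_reverse l, ?_⟩
  rw [if_pos hG, if_pos hG.reverse]
  unfold w4; rw [List.length_reverse]

lemma Gr_symm (S : Lat → Prop) (a b : Lat) : Gr S a b = Gr S b a :=
  le_antisymm (Gr_symm_le S a b) (Gr_symm_le S b a)

/-- Truncated sums. -/
def TrS (S : Lat → Prop) (f : Lat → ℝ≥0∞) (k : ℕ) (a : Lat) : ℝ≥0∞ :=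
  ∑' p : Lat × List Lat, if ChL S a p.1 p.2 ∧ p.2.length ≤ k then 4 * w4 p.2 * f p.1 else 0

lemma TrS_succ (S : Lat → Prop) (f : Lat → ℝ≥0∞) (k : ℕ) (a : Lat) : TrS S f (k + 1) a ≤
    f a + 4⁻¹ * ∑ q ∈ nbF a, if S q then TrS S f k q else 0 := by
  have h44 : (4 : ℝ≥0∞) * 4⁻¹ = 1 := ENNReal.mul_inv_cancel (by norm_num) (by norm_num)
  have e : f a + 4⁻¹ * ∑ q ∈ nbF a, (if S q then TrS S f k q else 0) =
      ∑' _ : Unit, f a + ∑' t : Lat × Lat × List Lat, (if t.1 ∈ nbF a then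
        (if S t.1 ∧ ChL S t.1 t.2.1 t.2.2 ∧ t.2.2.length ≤ k then
          4⁻¹ * (4 * w4 t.2.2 * f t.2.1) else 0) else 0) := by
    congr 1
    · rw [tsum_fintype]; simp
    rw [ENNReal.tsum_prod', tsum_eq_sum (s := nbF a), Finset.mul_sum]
    · refine Finset.sum_congr rfl fun q hq => ?_
      simp only [hq, if_true]
      by_cases hS : S q
      · rw [if_pos hS]
        unfold TrS
        rw [← ENNReal.tsum_mul_left]
        refine tsum_congr fun p => ?_
        by_cases hp : ChL S q p.1 p.2 ∧ p.2.length ≤ k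
        · rw [if_pos hp, if_pos ⟨hS, hp⟩]
        · rw [if_neg hp, if_neg (fun h => hp h.2), mul_zero]
      · rw [if_neg hS]; simp [hS]
    · intro q hq; simp [hq]
  rw [e]
  unfold TrS
  apply cover2 _ _ (fun _ => (a, [a])) _ (fun t => (t.2.1, a :: t.2.2))
  rintro ⟨b, l⟩ hl
  have hG : ChL S a b l ∧ l.length ≤ k + 1 := by
    by_contra hcon; rw [if_neg hcon] at hl; exact hl rfl
  rw [if_pos hG]
  obtain ⟨⟨hc, hh, hla, hm⟩, hk⟩ := hG
  cases l with
  | nil => simp at hh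
  | cons x t =>
    simp at hh
    subst hh
    cases t with
    | nil =>
      simp at hla
      subst hla
      refine Or.inl ⟨(), rfl, ?_⟩
      simp [w4, h44]
    | cons q t =>
      refine Or.inr ⟨(q, b, q :: t), rfl, ?_⟩
      rw [List.isChain_cons_cons] at hc
      have hGq : S q ∧ ChL S q b (q :: t) ∧ (q :: t).length ≤ k := by
        refine ⟨hm q (by simp), ⟨hc.2, rfl, ?_, fun v hv => hm v (List.mem_cons_of_mem _ hv)⟩, ?_⟩
        · rw [← hla, List.getLast?_cons_cons]
        · simp at hk ⊢; omega
      rw [if_pos (mem_nbF.mpr hc.1), if_pos hGq, w4_cons]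
      apply le_of_eq; ring

lemma TrS_le (S : Lat → Prop) (f h : Lat → ℝ≥0∞)
    (hh : ∀ v, S v → f v + 4⁻¹ * ∑ q ∈ nbF v, (if S q then h q else 0) ≤ h v) (k : ℕ) :
    ∀ a, S a → TrS S f k a ≤ h a := by
  induction k with
  | zero =>
    intro a ha
    have : TrS S f 0 a = 0 := by
      unfold TrS
      rw [ENNReal.tsum_eq_zero]
      rintro ⟨b, l⟩
      rw [if_neg]
      rintro ⟨hG, hl⟩
      have : l = [] := List.length_eq_zero_iff.mp (by simpa using hl)
      have h2 := hG.head
      simp only at h2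
      rw [this] at h2
      simp at h2
    rw [this]; exact zero_le
  | succ k ih =>
    intro a ha
    refine (TrS_succ S f k a).trans (le_trans ?_ (hh a ha))
    gcongr with q hq
    split_ifs with hS
    · exact ih q hS
    · exact le_rfl

lemma barrier (S : Lat → Prop) (f h : Lat → ℝ≥0∞)
    (hh : ∀ v, S v → f v + 4⁻¹ * ∑ q ∈ nbF v, (if S q then h q else 0) ≤ h v)
    {a : Lat} (ha : S a) : 4 * ∑' b, Gr S a b * f b ≤ h a := by
  have e : 4 * ∑' b, Gr S a b * f b =
      ∑' p : Lat × List Lat, (if ChL S a p.1 p.2 then 4 * w4 p.2 * f p.1 else (0:ℝ≥0∞)) := by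
    rw [← ENNReal.tsum_mul_left]
    refine Eq.trans ?_ (ENNReal.tsum_prod' (f := fun p : Lat × List Lat =>
      (if ChL S a p.1 p.2 then 4 * w4 p.2 * f p.1 else (0:ℝ≥0∞)))).symm
    apply tsum_congr
    intro b
    unfold Gr ms
    rw [← ENNReal.tsum_mul_right, ← ENNReal.tsum_mul_left]
    refine tsum_congr fun l => ?_
    split_ifs
    · ring
    · simp
  rw [e, ENNReal.tsum_eq_iSup_sum]
  apply iSup_le
  intro s
  obtain ⟨k, hk⟩ : ∃ k, ∀ p ∈ s, p.2.length ≤ k :=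
    ⟨s.sup (fun p => p.2.length), fun p hp => Finset.le_sup (f := fun p => p.2.length) hp⟩
  refine le_trans ?_ (TrS_le S f h hh k a ha)
  unfold TrS
  refine le_trans (Finset.sum_le_sum fun p hp => ?_) (ENNReal.sum_le_tsum (f := fun p : Lat × List Lat => if ChL S a p.1 p.2 ∧ p.2.length ≤ k then 4 * w4 p.2 * f p.1 else 0) s)
  split_ifs with h1 h2 h2
  · exact le_rfl
  · exact absurd ⟨h1, hk p hp⟩ h2
  · exact zero_le
  · exact le_rfl

lemma barrier_real (S : Lat → Prop) (f h : Lat → ℝ) (hf : ∀ v, 0 ≤ f v) 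
    (h0 : ∀ v q, S v → Adj v q → 0 ≤ h q)
    (hh : ∀ v, S v → f v + avg h v ≤ h v) {a : Lat} (ha : S a) :
    4 * ∑' b, Gr S a b * ENNReal.ofReal (f b) ≤ ENNReal.ofReal (h a) := by
  apply barrier S (fun v => ENNReal.ofReal (f v)) (fun v => ENNReal.ofReal (h v)) _ ha
  intro v hv
  have h1 := hh v hv
  have h2 : ∑ q ∈ nbF v, (if S q then ENNReal.ofReal (h q) else 0) ≤
      ENNReal.ofReal (∑ q ∈ nbF v, h q) := by
    rw [ENNReal.ofReal_sum_of_nonneg (fun q hq => h0 v q hv (mem_nbF.mp hq))]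
    refine Finset.sum_le_sum fun q _ => ?_
    split_ifs
    · exact le_rfl
    · exact zero_le
  have h3 : (4 : ℝ≥0∞)⁻¹ = ENNReal.ofReal (1/4) := by
    rw [one_div, ENNReal.ofReal_inv_of_pos (by norm_num)]; norm_num
  have h4 : 0 ≤ ∑ q ∈ nbF v, h q := Finset.sum_nonneg fun q hq => h0 v q hv (mem_nbF.mp hq)
  calc _ ≤ ENNReal.ofReal (f v) + 4⁻¹ * ENNReal.ofReal (∑ q ∈ nbF v, h q) := by gcongr
    _ = ENNReal.ofReal (f v + 1/4 * ∑ q ∈ nbF v, h q) := by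
      rw [h3, ← ENNReal.ofReal_mul (by norm_num), ENNReal.ofReal_add (hf v) (by positivity)]
    _ ≤ _ := ENNReal.ofReal_le_ofReal h1

/-- The ring of radius `n`. -/
def ringF (n : ℤ) : Finset Lat := ann (n - 1) (n + 1)

lemma mem_ringF {n : ℤ} {v : Lat} : v ∈ ringF n ↔ linf v = n := by
  unfold ringF; rw [mem_ann]; omega

lemma card_ringF {n : ℤ} (hn : 1 ≤ n) : ((ringF n).card : ℝ) ≤ 8 * n := by
  have h1 : ringF n ⊆ (Finset.Ico 0 (8 * n)).image (thp n) := by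
    intro v hv
    obtain ⟨k, h0, h1, h2⟩ := thp_surj hn (mem_ringF.mp hv)
    exact Finset.mem_image.mpr ⟨k, Finset.mem_Ico.mpr ⟨h0, h1⟩, h2⟩
  have h2 := (Finset.card_le_card h1).trans Finset.card_image_le
  rw [Int.card_Ico, sub_zero] at h2
  have h3 : ((8 * n).toNat : ℤ) = 8 * n := Int.toNat_of_nonneg (by omega)
  have h4 : ((ringF n).card : ℤ) ≤ 8 * n := by omega
  exact_mod_cast h4

/-- Exit rate. -/
def fE (s : ℤ) (e : Lat → ℝ) (x : Lat) : ℝ := if linf x = s then ∑ q ∈ nbF x, e q else 0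

lemma fE_nonneg {s R : ℤ} {e : Lat → ℝ} (h : IsE s R e) (x : Lat) : 0 ≤ fE s e x := by
  unfold fE; split_ifs
  · exact Finset.sum_nonneg fun q _ => h.nonneg q
  · exact le_rfl

lemma IsE.eqn {s R : ℤ} {e : Lat → ℝ} (h : IsE s R e) {v : Lat} (hs : s < R) (hv : linf v < R) :
    fE s e v / 4 + avg (fun q => 1 - e q) v = 1 - e v := by
  have e1 : avg (fun q => 1 - e q) v = 1 - avg e v := by rw [avg_eq, avg_eq]; ring
  rw [e1]
  rcases lt_trichotomy (linf v) s with h1 | h1 | h1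
  · have h2 : avg e v = 0 := by
      unfold avg
      rw [Finset.sum_eq_zero, mul_zero]
      intro q hq
      have := linf_adj (mem_nbF.mp hq)
      exact h.zero q (by omega)
    unfold fE
    rw [if_neg (by omega), h2, h.zero v h1.le]; norm_num
  · unfold fE avg
    rw [if_pos h1, h.zero v h1.le]; ring
  · rw [← h.harm v h1 hv]; unfold fE
    rw [if_neg (by omega)]; ring

lemma Gr_fE {s R : ℤ} {e : Lat → ℝ} (h : IsE s R e) (hs : s < R) {a : Lat} (ha : linf a < R) :
    ∑' b, Gr (fun v => linf v < R) a b * ENNReal.ofReal (fE s e b) ≤ 1 := by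
  have h1 := barrier_real (fun v => linf v < R) (fun v => fE s e v / 4) (fun v => 1 - e v)
    (fun v => by have := fE_nonneg h v; positivity) (fun v q _ _ => by linarith [h.le_one q])
    (fun v hv => (h.eqn hs hv).le) ha
  have h4 : ∀ b, ENNReal.ofReal (fE s e b) = 4 * ENNReal.ofReal (fE s e b / 4) := by
    intro b
    have : (4 : ℝ≥0∞) = ENNReal.ofReal 4 := by norm_num
    rw [this, ← ENNReal.ofReal_mul (by norm_num)]; congr 1; ring
  calc _ = 4 * ∑' b, Gr (fun v => linf v < R) a b * ENNReal.ofReal (fE s e b / 4) := by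
        rw [← ENNReal.tsum_mul_left]
        refine tsum_congr fun b => ?_
        rw [h4 b]; ring
    _ ≤ _ := h1
    _ ≤ 1 := by
      rw [← ENNReal.ofReal_one]
      exact ENNReal.ofReal_le_ofReal (by linarith [h.nonneg a])

lemma IsE.strip {s R : ℤ} {e : Lat → ℝ} (h : IsE s R e) (hs : s < R) (φ : Lat → ℤ)
    (h1 : ∀ v, φ v ≤ linf v) (h2 : ∀ v, avg (fun q => (φ q : ℝ)) v = φ v) :
    ∀ v, s < linf v → linf v < R → 1 - e v ≤ (R - φ v) / (R - s) := by
  have hsR : (0 : ℝ) < R - s := by rw [sub_pos]; exact_mod_cast hs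
  have key := mp2 (ann s R) (fun v => 1 - e v) (fun v => ((R:ℝ) - φ v) / (R - s)) (fun _ => 0)
    (fun v hv => by
      rw [mem_ann] at hv
      have := h.harm v hv.1 hv.2
      rw [avg_eq] at this ⊢
      linarith)
    (fun v hv => by
      have := h2 v
      rw [avg_eq] at this ⊢
      rw [zero_add, ← this]
      apply le_of_eq; field_simp; ring)
    (fun v hv hu => by
      obtain ⟨u, hu, huv⟩ := hu
      rw [mem_ann] at hv hu
      have h6 := linf_adj huv
      have h3 : (φ v : ℝ) ≤ linf v := by exact_mod_cast h1 v
      by_cases h4 : linf v ≤ s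
      · rw [h.zero v h4, le_div_iff₀ hsR]
        have : (linf v : ℝ) ≤ s := by exact_mod_cast h4
        linarith
      · rw [h.one v (by omega), sub_self]
        apply div_nonneg _ hsR.le
        have : (linf v : ℝ) ≤ R := by exact_mod_cast (by omega : linf v ≤ R)
        linarith)
  intro v hv hv2
  exact key v (mem_ann.mpr ⟨hv, hv2⟩)

lemma IsE.near {s R : ℤ} {e : Lat → ℝ} (h : IsE s R e) (hs1 : 1 ≤ s) (hs : 2 * s < R) {v q : Lat}
    (hv : linf v = R) (hq : Adj v q) : 1 - e q ≤ 2 / R := by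
  have hR : (0 : ℝ) < R := by exact_mod_cast (by omega : 0 < R)
  have hl := linf_adj hq
  by_cases h1 : R ≤ linf q
  · rw [h.one q h1, sub_self]; positivity
  have main : ∀ φ : Lat → ℤ, (∀ v, φ v ≤ linf v) → (∀ v, avg (fun q => (φ q : ℝ)) v = φ v) →
      φ q ≥ R - 1 → 1 - e q ≤ 2 / R := by
    intro φ p1 p2 p3
    refine (h.strip (by omega) φ p1 p2 q (by omega) (by omega)).trans ?_
    have h2 : (2 * s : ℝ) ≤ R := by exact_mod_cast hs.le
    have h3 : (R - 1 : ℝ) ≤ φ q := by exact_mod_cast p3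
    rw [div_le_div_iff₀ (by have : (1:ℝ) ≤ s := by exact_mod_cast hs1
                            linarith) hR]
    nlinarith
  have hab := linf_abs
  have hc : v.1 = R ∨ v.1 = -R ∨ v.2 = R ∨ v.2 = -R := by
    by_contra hcon
    have h3 := (linf_le_iff (v := v) (n := R)).mp hv.le
    have : linf v ≤ R - 1 := by rw [linf_le_iff]; omega
    omega
  have hq' := adj_cases hq
  rcases hc with hc | hc | hc | hc
  · exact main (fun v => v.1) (fun v => (le_abs_self _).trans (hab v).1)
      (fun v => by rw [avg_eq]; push_cast; ring) (by beta_reduce; omega)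
  · exact main (fun v => -v.1) (fun v => (neg_le_abs _).trans (hab v).1)
      (fun v => by rw [avg_eq]; push_cast; ring) (by beta_reduce; omega)
  · exact main (fun v => v.2) (fun v => (le_abs_self _).trans (hab v).2)
      (fun v => by rw [avg_eq]; push_cast; ring) (by beta_reduce; omega)
  · exact main (fun v => -v.2) (fun v => (neg_le_abs _).trans (hab v).2)
      (fun v => by rw [avg_eq]; push_cast; ring) (by beta_reduce; omega)

lemma sum_avg (n : ℤ) (g : Lat → ℝ) (hg : ∀ v, n ≤ linf v → g v = 0) :
    ∑ v ∈ ann (-1) (n + 1), avg g v = ∑ v ∈ ann (-1) (n + 1), g v := by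
  have h1 : ∀ v ∈ ann (-1) (n + 1), avg g v =
      1/4 * ∑ q ∈ ann (-1) (n + 1), if Adj v q then g q else 0 := by
    intro v _
    unfold avg
    congr 1
    rw [← Finset.sum_filter]
    symm
    apply Finset.sum_subset
    · intro q hq; rw [mem_nbF]; exact (Finset.mem_filter.mp hq).2
    · intro q hq hq2
      apply hg
      by_contra hcon
      apply hq2
      rw [Finset.mem_filter, mem_ann]
      have := (abs_nonneg _).trans (linf_abs q).1
      exact ⟨by omega, mem_nbF.mp hq⟩
  rw [Finset.sum_congr rfl h1, ← Finset.mul_sum, Finset.sum_comm, Finset.mul_sum]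
  refine Finset.sum_congr rfl fun q hq => ?_
  by_cases hq1 : n ≤ linf q
  · rw [hg q hq1]; simp
  · rw [← Finset.sum_filter, Finset.sum_const]
    have : (ann (-1) (n + 1)).filter (fun v => Adj v q) = nbF q := by
      ext v
      rw [Finset.mem_filter, mem_ann, mem_nbF]
      constructor
      · intro h; exact adj_symm h.2
      · intro h
        have h1 := linf_adj h
        have := (abs_nonneg _).trans (linf_abs v).1
        exact ⟨by omega, adj_symm h⟩
    rw [this]
    have h4 : (nbF q).card = 4 := by
      have := sum_nbF q (fun _ => (1 : ℕ))
      simpa using this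
    rw [h4]; simp

lemma sum_fE {s R : ℤ} {e : Lat → ℝ} (h : IsE s R e) (hs1 : 1 ≤ s) (hs : 2 * s < R) :
    ∑ y ∈ ringF s, fE s e y ≤ 64 := by
  have hR : (0 : ℝ) < R := by exact_mod_cast (by omega : 0 < R)
  have h1 := sum_avg R (fun v => 1 - e v) (fun v hv => by rw [h.one v hv, sub_self])
  have h2 : ann (-1) (R + 1) = ann (-1) R ∪ ringF R := by
    ext v
    rw [Finset.mem_union, mem_ann, mem_ann, mem_ringF]
    have := (abs_nonneg _).trans (linf_abs v).1
    omega
  have hd : Disjoint (ann (-1) R) (ringF R) := by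
    rw [Finset.disjoint_left]
    intro v; rw [mem_ann, mem_ringF]; omega
  rw [h2, Finset.sum_union hd, Finset.sum_union hd] at h1
  have h3 : ∑ v ∈ ringF R, (1 - e v) = 0 := Finset.sum_eq_zero fun v hv => by
    rw [h.one v (mem_ringF.mp hv).ge, sub_self]
  have h4 : ∑ v ∈ ann (-1) R, (1 - e v) = ∑ v ∈ ann (-1) R, fE s e v / 4 +
      ∑ v ∈ ann (-1) R, avg (fun q => 1 - e q) v := by
    rw [← Finset.sum_add_distrib]
    exact Finset.sum_congr rfl fun v hv => (h.eqn (by omega) (mem_ann.mp hv).2).symm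
  have h5 : ∑ y ∈ ringF s, fE s e y = ∑ v ∈ ann (-1) R, fE s e v := by
    apply Finset.sum_subset
    · intro v; rw [mem_ann, mem_ringF]; omega
    · intro v _ hv
      rw [mem_ringF] at hv
      unfold fE; rw [if_neg hv]
  have h6 : ∀ v ∈ ringF R, avg (fun q => 1 - e q) v ≤ 2 / R := by
    intro v hv
    have hn : ∀ q, Adj v q → 1 - e q ≤ 2 / R := fun q hq => h.near hs1 hs (mem_ringF.mp hv) hq
    have := avg_mono (g := fun q => 1 - e q) (h := fun _ => 2 / (R:ℝ)) hn
    refine this.trans ?_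
    rw [avg_eq]; apply le_of_eq; ring
  have h7 := Finset.sum_le_sum h6
  rw [Finset.sum_const, nsmul_eq_mul] at h7
  have h8 : ((ringF R).card : ℝ) * (2 / R) ≤ 16 := by
    rw [mul_div_assoc', div_le_iff₀ hR]
    linarith [card_ringF (n := R) (by omega)]
  rw [h5]
  rw [← Finset.sum_div] at h4
  linarith

lemma sum_sym (F : ℤ → ℝ) (hF : ∀ j, F (-j) = F j) (N : ℕ) :
    ∑ j ∈ Finset.Icc (-(N : ℤ)) N, F j = F 0 + 2 * ∑ k ∈ Finset.range N, F ((k : ℤ) + 1) := by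
  induction N with
  | zero => simp
  | succ N ih =>
    have h1 : Finset.Icc (-((N + 1 : ℕ) : ℤ)) ((N + 1 : ℕ) : ℤ) =
        insert ((N : ℤ) + 1) (insert (-((N : ℤ) + 1)) (Finset.Icc (-(N : ℤ)) N)) := by
      ext j; simp only [Finset.mem_insert, Finset.mem_Icc]; push_cast; omega
    rw [h1, Finset.sum_insert, Finset.sum_insert, ih, Finset.sum_range_succ, hF]
    · ring
    · simp only [Finset.mem_Icc]; omega
    · simp only [Finset.mem_insert, Finset.mem_Icc]; omega

lemma sum_log_le (x : ℝ) (hx : 0 < x) (N : ℕ) :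
    ∑ k ∈ Finset.range N, (Real.log x - Real.log ((k : ℝ) + 1)) ≤ x := by
  have h : ∑ k ∈ Finset.range N, (Real.log x - Real.log ((k : ℝ) + 1)) =
      Real.log (x ^ N / (N.factorial : ℝ)) := by
    induction N with
    | zero => simp
    | succ N ih =>
      rw [Finset.sum_range_succ, ih, Nat.factorial_succ, pow_succ]
      have hf : (N.factorial : ℝ) ≠ 0 := by exact_mod_cast Nat.factorial_ne_zero N
      rw [Real.log_div (by positivity) hf, Real.log_div (by positivity) (by positivity),
        Real.log_mul (by positivity) hx.ne']
      push_cast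
      rw [Real.log_mul (by positivity) hf]
      ring
  rw [h]
  have h2 := Real.pow_div_factorial_le_exp x hx.le N
  have h3 : 0 < x ^ N / (N.factorial : ℝ) := by
    have := Nat.factorial_pos N
    positivity
  exact (Real.log_le_log h3 h2).trans (Real.log_exp x).le

/-- One-dimensional log profile. -/
def FL (m j : ℤ) : ℝ := Real.log (256 * (m:ℝ)^2) - Real.log ((j:ℝ)^2 + 1/2)

lemma FL_nonneg {m j : ℤ} (hm : 1 ≤ m) (h1 : -(8 * m) ≤ j) (h2 : j ≤ 8 * m) : 0 ≤ FL m j := by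
  unfold FL
  have h1' : (-(8 * m) : ℝ) ≤ j := by exact_mod_cast h1
  have h2' : (j : ℝ) ≤ 8 * m := by exact_mod_cast h2
  have hm' : (1 : ℝ) ≤ m := by exact_mod_cast hm
  rw [sub_nonneg]
  apply Real.log_le_log (by positivity)
  nlinarith

lemma FL_sum {m : ℤ} (hm : 1 ≤ m) : ∑ j ∈ Finset.Icc (-(8 * m)) (8 * m), FL m j ≤ 110 * m := by
  obtain ⟨N, hN⟩ : ∃ N : ℕ, (N : ℤ) = 8 * m := ⟨(8 * m).toNat, Int.toNat_of_nonneg (by omega)⟩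
  have hm' : (1 : ℝ) ≤ m := by exact_mod_cast hm
  rw [← hN, sum_sym _ (fun j => by unfold FL; push_cast; rw [neg_sq])]
  have h1 : FL m 0 ≤ 46 * m := by
    have : FL m 0 = Real.log (512 * (m:ℝ)^2) := by
      unfold FL
      rw [← Real.log_div (by positivity) (by norm_num)]
      congr 1; push_cast; ring
    rw [this]
    have h2 : Real.log (512 * (m:ℝ)^2) ≤ Real.log ((23 * m : ℝ)^2) :=
      Real.log_le_log (by positivity) (by nlinarith)
    rw [Real.log_pow] at h2
    have h3 := Real.log_le_sub_one_of_pos (x := 23 * (m:ℝ)) (by positivity)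
    push_cast at h2
    linarith
  have h2 : ∑ k ∈ Finset.range N, FL m ((k : ℤ) + 1) ≤
      ∑ k ∈ Finset.range N, 2 * (Real.log (16 * m) - Real.log ((k : ℝ) + 1)) := by
    refine Finset.sum_le_sum fun k _ => ?_
    unfold FL
    have e1 : (256 * (m:ℝ)^2) = (16 * m : ℝ)^2 := by ring
    rw [e1, Real.log_pow]
    have : Real.log (((k:ℝ) + 1)^2) ≤ Real.log ((((k:ℤ) + 1 : ℤ) : ℝ)^2 + 1/2) := by
      apply Real.log_le_log (by positivity); push_cast; linarith
    rw [Real.log_pow] at this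
    push_cast at this ⊢
    linarith
  rw [← Finset.mul_sum] at h2
  have h3 := sum_log_le (16 * (m:ℝ)) (by positivity) N
  linarith

lemma FL_shift {m c : ℤ} (hm : 1 ≤ m) (hc : -(4 * m) ≤ c ∧ c ≤ 4 * m) :
    ∑ t ∈ Finset.Icc (-(4 * m)) (4 * m), FL m (c - t) ≤ 110 * m := by
  refine le_trans ?_ (FL_sum hm)
  rw [← Finset.sum_image (s := Finset.Icc (-(4 * m)) (4 * m)) (g := fun t => c - t) (f := FL m)]
  · apply Finset.sum_le_sum_of_subset_of_nonneg
    · intro j hj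
      obtain ⟨t, ht, rfl⟩ := Finset.mem_image.mp hj
      rw [Finset.mem_Icc] at ht ⊢; omega
    · intro j hj _
      rw [Finset.mem_Icc] at hj
      exact FL_nonneg hm hj.1 hj.2
  · intro a _ b _ h
    simp only at h
    omega

lemma ring_log_sum {m : ℤ} (hm : 1 ≤ m) {u : Lat} (hu : linf u = 4 * m) :
    ∑ p ∈ ringF (4 * m), (Real.log (256 * (m:ℝ)^2) - Real.log (nsq (u - p) + 1/2)) ≤ 440 * m := by
  set I := Finset.Icc (-(4 * m)) (4 * m) with hI
  have hu2 := (linf_le_iff (v := u) (n := 4 * m)).mp hu.le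
  set T : Lat → ℝ := fun p => (if p.1 = 4 * m then FL m (u.2 - p.2) else 0) +
      (if p.1 = -(4 * m) then FL m (u.2 - p.2) else 0) +
      ((if p.2 = 4 * m then FL m (u.1 - p.1) else 0) +
      (if p.2 = -(4 * m) then FL m (u.1 - p.1) else 0)) with hT
  have hnn : ∀ p ∈ I ×ˢ I, 0 ≤ FL m (u.2 - p.2) ∧ 0 ≤ FL m (u.1 - p.1) := by
    intro p hp
    rw [Finset.mem_product, hI, Finset.mem_Icc, Finset.mem_Icc] at hp
    exact ⟨FL_nonneg hm (by omega) (by omega), FL_nonneg hm (by omega) (by omega)⟩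
  have hTn : ∀ p ∈ I ×ˢ I, 0 ≤ T p := by
    intro p hp
    obtain ⟨h1, h2⟩ := hnn p hp
    simp only [hT]
    refine add_nonneg (add_nonneg ?_ ?_) (add_nonneg ?_ ?_) <;> split_ifs <;> first | assumption | exact le_rfl
  have hsub : ringF (4 * m) ⊆ I ×ˢ I := by
    intro p hp
    have := (linf_le_iff (v := p) (n := 4 * m)).mp (mem_ringF.mp hp).le
    rw [Finset.mem_product, hI, Finset.mem_Icc, Finset.mem_Icc]
    omega
  have h1 : ∀ p ∈ ringF (4 * m), Real.log (256 * (m:ℝ)^2) - Real.log (nsq (u - p) + 1/2) ≤ T p := by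
    intro p hp
    obtain ⟨n1, n2⟩ := hnn p (hsub hp)
    have a2 : Real.log (256 * (m:ℝ)^2) - Real.log (nsq (u - p) + 1/2) ≤ FL m (u.2 - p.2) := by
      unfold FL
      apply sub_le_sub_left
      apply Real.log_le_log (by positivity)
      unfold nsq
      push_cast [Prod.snd_sub, Prod.fst_sub]
      nlinarith [sq_nonneg ((u.1 : ℝ) - p.1)]
    have a1 : Real.log (256 * (m:ℝ)^2) - Real.log (nsq (u - p) + 1/2) ≤ FL m (u.1 - p.1) := by
      unfold FL
      apply sub_le_sub_left
      apply Real.log_le_log (by positivity)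
      unfold nsq
      push_cast [Prod.snd_sub, Prod.fst_sub]
      nlinarith [sq_nonneg ((u.2 : ℝ) - p.2)]
    have hc : p.1 = 4 * m ∨ p.1 = -(4 * m) ∨ p.2 = 4 * m ∨ p.2 = -(4 * m) := by
      by_contra hcon
      have hp' := mem_ringF.mp hp
      have h3 := (linf_le_iff (v := p) (n := 4 * m)).mp hp'.le
      have : linf p ≤ 4 * m - 1 := by rw [linf_le_iff]; omega
      omega
    simp only [hT]
    clear hTn hnn hT
    split_ifs <;> first | linarith | (exfalso; omega)
  refine (Finset.sum_le_sum h1).trans ?_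
  refine (Finset.sum_le_sum_of_subset_of_nonneg hsub (fun p hp _ => hTn p hp)).trans ?_
  have hmem1 : (4 * m) ∈ I := by rw [hI, Finset.mem_Icc]; omega
  have hmem2 : -(4 * m) ∈ I := by rw [hI, Finset.mem_Icc]; omega
  simp only [hT]
  rw [Finset.sum_add_distrib, Finset.sum_add_distrib, Finset.sum_add_distrib]
  have f1 := FL_shift hm hu2.1
  have f2 := FL_shift hm hu2.2
  rw [← hI] at f1 f2
  have e1 : ∀ c ∈ I, ∑ p ∈ I ×ˢ I, (if p.1 = c then FL m (u.2 - p.2) else 0) =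
      ∑ t ∈ I, FL m (u.2 - t) := by
    intro c hc
    rw [Finset.sum_product_right]
    refine Finset.sum_congr rfl fun t _ => ?_
    rw [Finset.sum_ite_eq', if_pos hc]
  have e2 : ∀ c ∈ I, ∑ p ∈ I ×ˢ I, (if p.2 = c then FL m (u.1 - p.1) else 0) =
      ∑ t ∈ I, FL m (u.1 - t) := by
    intro c hc
    rw [Finset.sum_product]
    refine Finset.sum_congr rfl fun t _ => ?_
    rw [Finset.sum_ite_eq', if_pos hc]
  rw [e1 _ hmem1, e1 _ hmem2, e2 _ hmem1, e2 _ hmem2]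
  linarith

lemma Gr_out {s m : ℤ} (hs : 5 ≤ s) (hm : s ≤ m) {u p : Lat} (hu : linf u = 4 * m)
    (hp : linf p = 4 * m) : 4 * Gr (fun v => s < linf v) u p ≤
    ENNReal.ofReal (Real.log (133 * ((m:ℝ)/s)^2) +
      (Real.log (256 * (m:ℝ)^2) - Real.log (nsq (u - p) + 1/2))) := by
  have hs' : (5 : ℝ) ≤ s := by exact_mod_cast hs
  have hm' : (s : ℝ) ≤ m := by exact_mod_cast hm
  set A0 := Real.log (133 * ((m:ℝ)/s)^2) with hA0
  have hnsq : ∀ v : Lat, s ≤ linf v → (s:ℝ)^2 ≤ nsq v := by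
    intro v hv
    have h1 := (linf_nsq (v := v)).1
    have h2 : (s : ℝ) ≤ linf v := by exact_mod_cast hv
    nlinarith
  have h1 := barrier_real (fun v => s < linf v) (fun v => if v = p then 1 else 0)
    (fun v => Real.log (nsq v - 1) + (A0 - Real.log (nsq (v - p) + 1/2)))
    (fun v => by split_ifs <;> norm_num)
    (fun v q hv hq => by
      have hq2 := linf_adj hq
      have h2 := hnsq q (by omega)
      have hx : (25 : ℝ) ≤ nsq q := by nlinarith
      have h3 : nsq (q - p) ≤ 2 * nsq q + 64 * (m:ℝ)^2 := by
        have h4 : nsq (q - p) ≤ 2 * nsq q + 2 * nsq p := by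
          unfold nsq
          push_cast [Prod.snd_sub, Prod.fst_sub]
          nlinarith [sq_nonneg ((q.1 : ℝ) + p.1), sq_nonneg ((q.2 : ℝ) + p.2)]
        have h5 := (linf_nsq (v := p)).2
        rw [hp] at h5
        push_cast at h5
        nlinarith
      have h6 : nsq (q - p) + 1/2 ≤ (nsq q - 1) * (133 * ((m:ℝ)/s)^2) := by
        have h7 : (1 : ℝ) ≤ ((m:ℝ)/s)^2 := by
          rw [div_pow, one_le_div (by positivity)]; nlinarith
        have h8 : (m:ℝ)^2 ≤ nsq q * ((m:ℝ)/s)^2 := by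
          calc (m:ℝ)^2 = (s:ℝ)^2 * ((m:ℝ)/s)^2 := by field_simp
            _ ≤ _ := by gcongr
        nlinarith
      have h9 : Real.log (nsq (q - p) + 1/2) ≤ Real.log (nsq q - 1) + A0 := by
        rw [hA0, ← Real.log_mul (by linarith) (by
          have : (0:ℝ) < m := by linarith
          positivity)]
        exact Real.log_le_log (by linarith [nsq_nonneg (q - p)]) h6
      linarith)
    (fun v hv => by
      have h2 := log_super (v := v) (by omega)
      have h3 := log_sub_tr A0 p v
      have e : avg (fun v => Real.log (nsq v - 1) + (A0 - Real.log (nsq (v - p) + 1/2))) v =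
          avg (fun v => Real.log (nsq v - 1)) v + avg (fun v => A0 - Real.log (nsq (v - p) + 1/2)) v := by
        unfold avg; rw [Finset.sum_add_distrib]; ring
      rw [e]; linarith)
    (a := u) (by omega)
  have h2 : Gr (fun v => s < linf v) u p ≤
      ∑' b, Gr (fun v => s < linf v) u b * ENNReal.ofReal (if b = p then 1 else 0) := by
    refine le_trans ?_ (ENNReal.le_tsum p)
    simp
  refine (mul_le_mul_right h2 4).trans (h1.trans ?_)
  apply ENNReal.ofReal_le_ofReal
  have h3 : Real.log (nsq u - 1) ≤ Real.log (256 * (m:ℝ)^2) := by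
    have h4 := hnsq u (by omega)
    have h5 := (linf_nsq (v := u)).2
    rw [hu] at h5; push_cast at h5
    apply Real.log_le_log <;> nlinarith
  linarith

lemma Gr_ring {s m : ℤ} (hs : 5 ≤ s) (hm : 2 * s < m) :
    ∑ u ∈ ringF (4 * m), ∑ p ∈ ringF (4 * m), Gr (fun v => s < linf v) u p ≤
      ENNReal.ofReal (9600 * (m:ℝ)^2 * Real.log ((m:ℝ)/s)) := by
  have hs' : (5 : ℝ) ≤ s := by exact_mod_cast hs
  have hm' : (2 * s : ℝ) < m := by exact_mod_cast hm
  set L := Real.log ((m:ℝ)/s) with hL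
  have hx : 2 ≤ (m:ℝ)/s := by rw [le_div_iff₀ (by linarith)]; exact hm'.le
  have hL2 : Real.log 2 ≤ L := Real.log_le_log (by norm_num) hx
  have hl2 := Real.log_two_gt_d9
  have hA : Real.log (133 * ((m:ℝ)/s)^2) ≤ 10 * L := by
    have : 10 * L = Real.log (((m:ℝ)/s)^10) := by rw [Real.log_pow, hL]; norm_num
    rw [this]
    apply Real.log_le_log (by positivity)
    have h8 : (2:ℝ)^8 ≤ ((m:ℝ)/s)^8 := by gcongr
    calc 133 * ((m:ℝ)/s)^2 ≤ ((m:ℝ)/s)^8 * ((m:ℝ)/s)^2 := by gcongr; linarith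
      _ = _ := by ring
  have key : ∀ u ∈ ringF (4 * m), ∑ p ∈ ringF (4 * m), Gr (fun v => s < linf v) u p ≤
      ENNReal.ofReal (300 * m * L) := by
    intro u hu
    have hu' := mem_ringF.mp hu
    have hG : ∀ p ∈ ringF (4 * m), Gr (fun v => s < linf v) u p ≤ ENNReal.ofReal
      (1/4 * (10 * L + (Real.log (256 * (m:ℝ)^2) - Real.log (nsq (u - p) + 1/2)))) := by
      intro p hp
      have h1 := Gr_out hs (by omega) hu' (mem_ringF.mp hp)
      have h2 : Gr (fun v => s < linf v) u p = 4⁻¹ * (4 * Gr (fun v => s < linf v) u p) := by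
        rw [← mul_assoc, ENNReal.inv_mul_cancel (by norm_num) (by norm_num), one_mul]
      have h3 : (4 : ℝ≥0∞)⁻¹ = ENNReal.ofReal (1/4) := by
        rw [one_div, ENNReal.ofReal_inv_of_pos (by norm_num)]; norm_num
      rw [h2, ENNReal.ofReal_mul (by norm_num), h3]
      gcongr
      exact h1.trans (ENNReal.ofReal_le_ofReal (by linarith))
    refine (Finset.sum_le_sum hG).trans ?_
    rw [← ENNReal.ofReal_sum_of_nonneg]
    · apply ENNReal.ofReal_le_ofReal
      rw [← Finset.mul_sum, Finset.sum_add_distrib, Finset.sum_const, nsmul_eq_mul]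
      have h1 := ring_log_sum (m := m) (by omega) hu'
      have h2 := card_ringF (n := 4 * m) (by omega)
      push_cast at h2
      have h3 : ((ringF (4 * m)).card : ℝ) * (10 * L) ≤ (8 * (4 * m)) * (10 * L) :=
        mul_le_mul_of_nonneg_right h2 (by linarith)
      nlinarith
    · intro p hp
      have : 0 ≤ Real.log (256 * (m:ℝ)^2) - Real.log (nsq (u - p) + 1/2) := by
        rw [sub_nonneg]
        apply Real.log_le_log (by linarith [nsq_nonneg (u - p)])
        have h1 := (linf_nsq (v := u - p)).2
        have h2 := (linf_sub p u).2
        have h3 : (linf (u - p) : ℝ) ≤ 8 * m := by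
          have := mem_ringF.mp hp
          exact_mod_cast (by omega : linf (u - p) ≤ 8 * m)
        have h4 : (0 : ℝ) ≤ linf (u - p) := by
          exact_mod_cast (le_trans (abs_nonneg _) (linf_abs (u - p)).1)
        nlinarith
      have : 0 ≤ L := by linarith
      positivity
  refine (Finset.sum_le_sum key).trans ?_
  rw [Finset.sum_const, nsmul_eq_mul]
  have h2 := card_ringF (n := 4 * m) (by omega)
  push_cast at h2
  have h3 : ((ringF (4 * m)).card : ℝ≥0∞) = ENNReal.ofReal ((ringF (4 * m)).card : ℝ) := by
    rw [ENNReal.ofReal_natCast]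
  rw [h3, ← ENNReal.ofReal_mul (by positivity)]
  apply ENNReal.ofReal_le_ofReal
  have : 0 ≤ m * L := by
    apply mul_nonneg <;> linarith
  nlinarith

lemma first_split {α : Type*} (P : α → Prop) (l : List α) (h : ∃ v ∈ l, P v) :
    ∃ l1 v l2, l = l1 ++ v :: l2 ∧ P v ∧ ∀ w ∈ l1, ¬ P w := by
  induction l with
  | nil => obtain ⟨v, hv, _⟩ := h; simp at hv
  | cons a t ih =>
    by_cases ha : P a
    · exact ⟨[], a, t, rfl, ha, by simp⟩
    · obtain ⟨v, hv, hp⟩ := h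
      have hv' : v ∈ t := by
        rcases List.mem_cons.mp hv with rfl | h
        · exact absurd hp ha
        · exact h
      obtain ⟨l1, v, l2, e, p1, p2⟩ := ih ⟨v, hv', hp⟩
      refine ⟨a :: l1, v, l2, by rw [e]; rfl, p1, ?_⟩
      intro w hw
      rcases List.mem_cons.mp hw with rfl | h
      · exact ha
      · exact p2 w h

lemma last_split {α : Type*} (P : α → Prop) (l : List α) (h : ∃ v ∈ l, P v) :
    ∃ l1 v l2, l = l1 ++ v :: l2 ∧ P v ∧ ∀ w ∈ l2, ¬ P w := by
  obtain ⟨l1, v, l2, e, p1, p2⟩ := first_split P l.reverse (by simpa using h)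
  refine ⟨l2.reverse, v, l1.reverse, ?_, p1, by simpa using p2⟩
  rw [← List.reverse_reverse l, e]; simp

lemma chain_adj {A B : List Lat} {a b : Lat} (h : (A ++ a :: b :: B).IsChain Adj) : Adj a b := by
  have := h.right_of_append
  rw [List.isChain_cons_cons] at this
  exact this.1

lemma ms_union {ι : Type*} (K : Finset ι) (Q : ι → List Lat → Prop) :
    ms (fun l => ∃ k ∈ K, Q k l) ≤ ∑ k ∈ K, ms (Q k) := by
  unfold ms
  rw [← Summable.tsum_finsetSum (fun _ _ => ENNReal.summable)]
  refine ENNReal.tsum_le_tsum fun l => ?_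
  split_ifs with h
  · obtain ⟨k, hk, hq⟩ := h
    refine le_trans ?_ (Finset.single_le_sum (fun _ _ => zero_le) hk)
    rw [if_pos hq]
  · exact zero_le

lemma w4_ofReal (l : List Lat) : w4 l = ENNReal.ofReal (Wt l) := by
  unfold w4 Wt
  rw [ENNReal.ofReal_pow (by norm_num), one_div, ENNReal.ofReal_inv_of_pos (by norm_num)]
  norm_num

/-- Excursions. -/
structure Exc (r R s n : ℤ) (x y : Lat) (e : List Lat) : Prop where
  chain : (x :: e ++ [y]).IsChain Adj
  nd : ND (x :: e ++ [y]) r R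
  mem : ∀ v ∈ e, s < linf v
  far : ∃ v ∈ e, n ≤ linf v

/-- Split excursions. -/
def ExcQ (r R s n : ℤ) (x y u v u' v' x' y' : Lat) (e : List Lat) : Prop :=
  ∃ η1 mid η2 : List Lat, e = η1 ++ mid ++ η2 ∧ ChL (fun v => s < linf v) u v mid ∧
    PairND r R s n x x' u' u v v' y' y (η1, η2)

lemma Exc.split {r R s n : ℤ} {x y : Lat} {e : List Lat} (h : Exc r R s n x y e) (hx : linf x = s)
    (hy : linf y = s) (hn : s + 1 < n) :
    ∃ u ∈ ringF n, ∃ v ∈ ringF n, ∃ u' ∈ nbF u, ∃ v' ∈ nbF v, ∃ x' ∈ nbF x, ∃ y' ∈ nbF y,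
      ExcQ r R s n x y u v u' v' x' y' e := by
  obtain ⟨hc, hnd, hm, hf⟩ := h
  obtain ⟨η1, u, t, rfl, hu, hη1⟩ := first_split (fun v => n ≤ linf v) e hf
  obtain ⟨mid1, v, η2, ht, hv, hη2⟩ := last_split (fun v => n ≤ linf v) (u :: t) ⟨u, by simp, hu⟩
  have hmm : ∃ t', mid1 ++ [v] = u :: t' := by
    cases mid1 with
    | nil => simp at ht; exact ⟨[], by rw [ht.1]; rfl⟩
    | cons a b => simp at ht; exact ⟨b ++ [v], by rw [ht.1]; rfl⟩
  obtain ⟨t', ht'⟩ := hmm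
  rw [ht] at hc hnd hm ⊢
  obtain rfl | ⟨c1, u', hc1⟩ := List.eq_nil_or_concat' η1
  · exfalso
    have : Adj x u := by
      apply chain_adj (A := []) (B := t' ++ η2 ++ [y])
      have e2 : x :: ([] ++ (mid1 ++ v :: η2)) ++ [y] = [] ++ x :: u :: (t' ++ η2 ++ [y]) := by
        have : mid1 ++ v :: η2 = (mid1 ++ [v]) ++ η2 := by simp
        rw [this, ht']; simp
      rw [← e2]; exact hc
    have := linf_adj this
    omega
  cases η2 with
  | nil =>
    exfalso
    have : Adj v y := by
      apply chain_adj (A := x :: (η1 ++ mid1)) (B := [])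
      simpa using hc
    have := linf_adj this
    omega
  | cons v' c3 =>
  obtain ⟨x', c2, hc2⟩ : ∃ x' c2, η1 = x' :: c2 := by
    cases η1 with
    | nil => simp at hc1
    | cons a b => exact ⟨a, b, rfl⟩
  obtain ⟨c4, y', hc4⟩ : ∃ c4 y', v' :: c3 = c4 ++ [y'] := by
    obtain h | ⟨c, w, hw⟩ := List.eq_nil_or_concat' (v' :: c3)
    · simp at h
    · exact ⟨c, w, hw⟩
  have hmid : mid1 ++ v :: (v' :: c3) = (mid1 ++ [v]) ++ (v' :: c3) := by simp
  have hxx : Adj x x' := by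
    apply chain_adj (A := []) (B := c2 ++ (mid1 ++ v :: (v' :: c3)) ++ [y])
    rw [hc2] at hc; simpa using hc
  have huu : Adj u' u := by
    apply chain_adj (A := x :: c1) (B := t' ++ (v' :: c3) ++ [y])
    rw [hmid, ht', hc1] at hc; simpa using hc
  have hvv : Adj v v' := by
    apply chain_adj (A := x :: (η1 ++ mid1)) (B := c3 ++ [y])
    simpa using hc
  have hyy : Adj y' y := by
    apply chain_adj (A := x :: (η1 ++ mid1) ++ v :: c4) (B := [])
    rw [hc4] at hc; simpa using hc
  have hu'm : u' ∈ η1 := by rw [hc1]; simp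
  have l1 := linf_adj huu
  have l2 := linf_adj hvv
  have l3 := hη1 u' hu'm
  have l4 := hη2 v' (by simp)
  refine ⟨u, mem_ringF.mpr (by omega), v, mem_ringF.mpr (by omega), u', mem_nbF.mpr (adj_symm huu),
    v', mem_nbF.mpr hvv, x', mem_nbF.mpr hxx, y', mem_nbF.mpr (adj_symm hyy),
    η1, mid1 ++ [v], v' :: c3, by simp, ⟨?_, ?_, ?_, ?_⟩, ⟨?_, ?_, ?_, ?_⟩, ⟨?_, ?_, ?_, ?_⟩, 
    x :: (η1 ++ (mid1 ++ v :: v' :: c3)) ++ [y], hc, hnd, ?_, ?_⟩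
  · refine isChain_mid hc ⟨x :: η1, (v' :: c3) ++ [y], by simp⟩
  · rw [ht']; rfl
  · simp
  · intro w hw; apply hm; simp at hw ⊢; tauto
  · refine isChain_mid hc ⟨[x], (mid1 ++ v :: v' :: c3) ++ [y], by simp⟩
  · intro w hw
    exact ⟨hm w (List.mem_append_left _ hw), not_le.mp (hη1 w hw)⟩
  · simp [hc2]
  · simp [hc1]
  · refine isChain_mid hc ⟨x :: (η1 ++ mid1) ++ [v], [y], by simp⟩
  · intro w hw
    exact ⟨hm w (by simp at hw ⊢; tauto), not_le.mp (hη2 w hw)⟩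
  · simp
  · simp [hc4]
  · refine ⟨[], t' ++ (v' :: c3) ++ [y], ?_⟩
    rw [hmid, ht']; simp
  · exact ⟨x :: (η1 ++ mid1), [], by simp⟩

lemma pair_tsum {r R s n : ℤ} {x x' u' u v v' y' y : Lat} (X : ℝ)
    (h : ∀ M : Finset (List Lat × List Lat), (∀ p ∈ M, PairND r R s n x x' u' u v v' y' y p) →
      ∑ p ∈ M, Wt p.1 * Wt p.2 ≤ X) :
    ∑' p : List Lat × List Lat, (if PairND r R s n x x' u' u v v' y' y p then w4 p.1 * w4 p.2 else 0) ≤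
      ENNReal.ofReal X := by
  rw [ENNReal.tsum_eq_iSup_sum]
  apply iSup_le
  intro F
  rw [← Finset.sum_filter]
  have e : ∀ p : List Lat × List Lat, w4 p.1 * w4 p.2 = ENNReal.ofReal (Wt p.1 * Wt p.2) := by
    intro p
    rw [ENNReal.ofReal_mul (Wt_nonneg _), w4_ofReal, w4_ofReal]
  simp only [e]
  rw [← ENNReal.ofReal_sum_of_nonneg (fun p _ => mul_nonneg (Wt_nonneg _) (Wt_nonneg _))]
  apply ENNReal.ofReal_le_ofReal
  exact h _ (fun p hp => (Finset.mem_filter.mp hp).2)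

lemma ExcQ_bound {r R s n : ℤ} {e : Lat → ℝ} {B : ℝ} (he : ∀ v, 0 ≤ e v) (hB0 : 0 ≤ B)
    (h0 : 0 ≤ r) (h1 : r + 1 ≤ s) (h2 : s + 1 ≤ n) (h3 : n + 1 ≤ R)
    (hB : ∀ x u : AV s n, linf x.1 ≤ 2 * s → linf u.1 = n - 1 → ‖TG s n x u‖ ≤ B * e x.1)
    {x y u v u' v' x' y' : Lat} (hx : linf x = s) (hy : linf y = s) (hu : linf u = n)
    (hv : linf v = n) (hu' : Adj u u') (hv' : Adj v v') (hx' : Adj x x') (hy' : Adj y y') :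
    ms (ExcQ r R s n x y u v u' v' x' y') ≤
      Gr (fun v => s < linf v) u v * ENNReal.ofReal (2 * B^2 * e x' * e y') := by
  have hp : ∑' p : List Lat × List Lat,
      (if PairND r R s n x x' u' u v v' y' y p then w4 p.1 * w4 p.2 else 0) ≤
      ENNReal.ofReal (2 * B^2 * e x' * e y') := by
    apply pair_tsum
    intro M hM
    rcases M.eq_empty_or_nonempty with rfl | ⟨p, hp⟩
    · simp
      have := he x'; have := he y'; positivity
    obtain ⟨⟨_, m1, a1, b1⟩, ⟨_, m2, a2, b2⟩, _⟩ := hM p hp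
    have ix' := m1 x' (List.mem_of_mem_head? a1)
    have iu' := m1 u' (List.mem_of_getLast? b1)
    have iv' := m2 v' (List.mem_of_mem_head? a2)
    have iy' := m2 y' (List.mem_of_getLast? b2)
    have lx := linf_adj hx'
    have ly := linf_adj hy'
    have lu := linf_adj hu'
    have lv := linf_adj hv'
    have hpb := pair_bound (x' := (⟨x', ix'⟩ : AV s n)) (u' := ⟨u', iu'⟩) (v' := ⟨v', iv'⟩)
      (y' := ⟨y', iy'⟩) h0 h1 h2 h3 hx hy hu hv M hM
    refine hpb.trans ?_
    have t1 := hB ⟨x', ix'⟩ ⟨u', iu'⟩ (by simp only; omega) (by simp only; omega)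
    have t2 := hB ⟨y', iy'⟩ ⟨v', iv'⟩ (by simp only; omega) (by simp only; omega)
    have t3 := hB ⟨x', ix'⟩ ⟨v', iv'⟩ (by simp only; omega) (by simp only; omega)
    have t4 := hB ⟨y', iy'⟩ ⟨u', iu'⟩ (by simp only; omega) (by simp only; omega)
    rw [TG_norm_symm] at t2 t4
    have q1 := mul_le_mul t1 t2 (norm_nonneg _) (mul_nonneg hB0 (he _))
    have q2 := mul_le_mul t3 t4 (norm_nonneg _) (mul_nonneg hB0 (he _))
    simp only at q1 q2 ⊢
    refine (add_le_add q1 q2).trans (le_of_eq (by ring))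
  refine le_trans ?_ (mul_le_mul_right hp _)
  unfold Gr ms
  rw [← ENNReal.tsum_mul_right]
  simp only [← ENNReal.tsum_mul_left]
  rw [← ENNReal.tsum_prod' (f := fun t : List Lat × (List Lat × List Lat) =>
    (if ChL (fun v => s < linf v) u v t.1 then w4 t.1 else 0) *
    (if PairND r R s n x x' u' u v v' y' y t.2 then w4 t.2.1 * w4 t.2.2 else 0))]
  apply cover _ _ (fun t => t.2.1 ++ t.1 ++ t.2.2)
  intro l hl
  have hQ : ExcQ r R s n x y u v u' v' x' y' l := by
    by_contra hcon; rw [if_neg hcon] at hl; exact hl rfl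
  rw [if_pos hQ]
  obtain ⟨η1, mid, η2, rfl, hc, hpp⟩ := hQ
  refine ⟨(mid, (η1, η2)), rfl, ?_⟩
  rw [if_pos hc, if_pos hpp, w4_append, w4_append]
  apply le_of_eq; ring

/-- Excursion constant. -/
def epsf (RA s m : ℤ) : ℝ := 32 * 9600 * 2000^2 * Real.log ((RA:ℝ) / s)^2 * ((s:ℝ) / m) ^ (1/2 : ℝ) *
  Real.log ((m:ℝ)/s)

lemma Exc_bound : ∃ N : ℤ, 5 ≤ N ∧ ∀ (r R s m RA : ℤ) (e : Lat → ℝ), N ≤ s → 2 * s < m →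
    2 * s < RA → IsE s RA e → 0 ≤ r → r + 1 ≤ s → 4 * m + 1 ≤ R → ∀ x y : Lat, linf x = s →
    linf y = s → ms (Exc r R s (4 * m) x y) ≤
      ENNReal.ofReal (epsf RA s m) * (ENNReal.ofReal (fE s e x) * ENNReal.ofReal (fE s e y)) := by
  obtain ⟨N, hN, hTG⟩ := TG_bound
  refine ⟨max N 5, le_max_right _ _, ?_⟩
  intro r R s m RA e hs hm hRA he h0 h1 h3 x y hx hy
  have hs5 : 5 ≤ s := le_trans (le_max_right _ _) hs
  have hs1 : (5 : ℝ) ≤ s := by exact_mod_cast hs5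
  have hm1 : (2 * s : ℝ) < m := by exact_mod_cast hm
  have hm0 : (0 : ℝ) < m := by linarith
  have hR1 : (2 * s : ℝ) < RA := by exact_mod_cast hRA
  have hlog : 0 ≤ Real.log ((RA:ℝ) / s) := by
    apply Real.log_nonneg; rw [one_le_div (by linarith)]; linarith
  set B := 2000 * Real.log ((RA:ℝ) / s) * ((s / m : ℝ) ^ (1/4 : ℝ) / m) with hBdef
  have hB0 : 0 ≤ B := by
    have : 0 ≤ (s / m : ℝ) := by apply div_nonneg <;> linarith
    positivity
  have hB := hTG s m RA e (le_trans (le_max_left _ _) hs) hm hRA he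
  have c1 : ms (Exc r R s (4 * m) x y) ≤ ∑ u ∈ ringF (4*m), ∑ v ∈ ringF (4*m), ∑ u' ∈ nbF u,
      ∑ v' ∈ nbF v, ∑ x' ∈ nbF x, ∑ y' ∈ nbF y,
      Gr (fun v => s < linf v) u v * ENNReal.ofReal (2 * B^2 * e x' * e y') := by
    refine (ms_mono (fun e he => he.split hx hy (by omega))).trans ?_
    refine (ms_union _ _).trans (Finset.sum_le_sum fun u hu => ?_)
    refine (ms_union _ _).trans (Finset.sum_le_sum fun v hv => ?_)
    refine (ms_union _ _).trans (Finset.sum_le_sum fun u' hu' => ?_)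
    refine (ms_union _ _).trans (Finset.sum_le_sum fun v' hv' => ?_)
    refine (ms_union _ _).trans (Finset.sum_le_sum fun x' hx' => ?_)
    refine (ms_union _ _).trans (Finset.sum_le_sum fun y' hy' => ?_)
    exact ExcQ_bound he.nonneg hB0 h0 h1 (by omega) h3 hB hx hy (mem_ringF.mp hu) (mem_ringF.mp hv)
      (mem_nbF.mp hu') (mem_nbF.mp hv') (mem_nbF.mp hx') (mem_nbF.mp hy')
  have hfx := fE_nonneg he x
  have hfy := fE_nonneg he y
  have c2 : ∑ x' ∈ nbF x, ∑ y' ∈ nbF y, ENNReal.ofReal (2 * B^2 * e x' * e y') =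
      ENNReal.ofReal (2 * B^2 * (fE s e x * fE s e y)) := by
    have q0 : ∀ x' y', 0 ≤ 2 * B^2 * e x' * e y' := fun x' y' => by
      have := he.nonneg x'; have := he.nonneg y'; positivity
    have q1 : ∀ x' ∈ nbF x, ∑ y' ∈ nbF y, ENNReal.ofReal (2 * B^2 * e x' * e y') =
        ENNReal.ofReal (∑ y' ∈ nbF y, 2 * B^2 * e x' * e y') := fun x' _ =>
      (ENNReal.ofReal_sum_of_nonneg fun y' _ => q0 x' y').symm
    rw [Finset.sum_congr rfl q1, ← ENNReal.ofReal_sum_of_nonneg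
      (fun x' _ => Finset.sum_nonneg fun y' _ => q0 x' y')]
    congr 1
    unfold fE
    rw [if_pos hx, if_pos hy, Finset.sum_mul_sum, Finset.mul_sum]
    refine Finset.sum_congr rfl fun x' _ => ?_
    rw [Finset.mul_sum]
    refine Finset.sum_congr rfl fun y' _ => ?_
    ring
  have h4 : ∀ q, (nbF q).card = 4 := by
    intro q
    have := sum_nbF q (fun _ => (1 : ℕ))
    simpa using this
  have c3 : ∀ u v : Lat, ∑ u' ∈ nbF u, ∑ v' ∈ nbF v, ∑ x' ∈ nbF x, ∑ y' ∈ nbF y,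
      Gr (fun v => s < linf v) u v * ENNReal.ofReal (2 * B^2 * e x' * e y') =
      Gr (fun v => s < linf v) u v * (16 * ENNReal.ofReal (2 * B^2 * (fE s e x * fE s e y))) := by
    intro u v
    simp only [← Finset.mul_sum]
    rw [c2, Finset.sum_const, Finset.sum_const, h4, h4]
    simp only [nsmul_eq_mul]
    push_cast
    ring
  simp only [c3, ← Finset.sum_mul] at c1
  refine c1.trans ((mul_le_mul_left (Gr_ring hs5 hm) _).trans ?_)
  have hlm : 0 ≤ Real.log ((m:ℝ)/s) := by
    apply Real.log_nonneg; rw [one_le_div (by linarith)]; linarith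
  have e16 : (16 : ℝ≥0∞) = ENNReal.ofReal 16 := by norm_num
  rw [e16, ← ENNReal.ofReal_mul (by norm_num), ← ENNReal.ofReal_mul (by positivity),
    ← ENNReal.ofReal_mul hfx, ← ENNReal.ofReal_mul (by
      unfold epsf
      have : 0 ≤ (s / m : ℝ) := by apply div_nonneg <;> linarith
      positivity)]
  apply ENNReal.ofReal_le_ofReal
  apply le_of_eq
  unfold epsf
  have hsq : ((s:ℝ) / m) ^ (1/2 : ℝ) = (((s:ℝ) / m) ^ (1/4 : ℝ))^2 := by
    rw [← Real.rpow_natCast, ← Real.rpow_mul (by apply div_nonneg <;> linarith)]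
    norm_num
  rw [hsq, hBdef]
  field_simp
  ring

lemma ms_or (P Q : List Lat → Prop) : ms (fun l => P l ∨ Q l) ≤ ms P + ms Q := by
  unfold ms
  rw [← ENNReal.tsum_add]
  refine ENNReal.tsum_le_tsum fun l => ?_
  by_cases hP : P l <;> by_cases hQ : Q l <;> simp [hP, hQ]

lemma ms_triple (P E Q : List Lat → Prop) :
    ms (fun l => ∃ p e t, l = p ++ e ++ t ∧ P p ∧ E e ∧ Q t) ≤ ms P * (ms E * ms Q) := by
  unfold ms
  simp only [← ENNReal.tsum_mul_right, ← ENNReal.tsum_mul_left]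
  have e2 : ∀ t : List Lat, ∑' (e : List Lat), ∑' (p : List Lat), (if P p then w4 p else 0) *
      ((if E e then w4 e else 0) * (if Q t then w4 t else 0)) =
      ∑' z : List Lat × List Lat, (if P z.2 then w4 z.2 else 0) *
      ((if E z.1 then w4 z.1 else 0) * (if Q t then w4 t else 0)) := fun t =>
    (ENNReal.tsum_prod' (f := fun z : List Lat × List Lat => (if P z.2 then w4 z.2 else 0) *
      ((if E z.1 then w4 z.1 else 0) * (if Q t then w4 t else 0)))).symm
  rw [tsum_congr e2]
  rw [← (ENNReal.tsum_prod' (f := fun z : List Lat × (List Lat × List Lat) =>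
      (if P z.2.2 then w4 z.2.2 else 0) *
      ((if E z.2.1 then w4 z.2.1 else 0) * (if Q z.1 then w4 z.1 else 0))))]
  apply cover _ _ (fun z => z.2.2 ++ z.2.1 ++ z.1)
  intro l hl
  have hG : ∃ p e t, l = p ++ e ++ t ∧ P p ∧ E e ∧ Q t := by
    by_contra hcon; rw [if_neg hcon] at hl; exact hl rfl
  rw [if_pos hG]
  obtain ⟨p, e, t, rfl, h1, h2, h3⟩ := hG
  refine ⟨(t, e, p), rfl, ?_⟩
  rw [if_pos h1, if_pos h2, if_pos h3, w4_append, w4_append]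
  apply le_of_eq; ring

/-- Decomposable lists. -/
def Dec (S : Lat → Prop) (s : ℤ) (E : Lat → Lat → List Lat → Prop) (Q : Lat → List Lat → Prop)
    (a : Lat) (l : List Lat) : Prop :=
  ∃ x ∈ ringF s, ∃ y ∈ ringF s, ∃ p e t, l = p ++ e ++ t ∧ ChL S a x p ∧ E x y e ∧ Q y t

lemma Dec_bound {s RA : ℤ} {e : Lat → ℝ} (he : IsE s RA e) (hs : s < RA)
    (E : Lat → Lat → List Lat → Prop) (Q : Lat → List Lat → Prop) (ε : ℝ≥0∞)
    (hE : ∀ x y, linf x = s → linf y = s → ms (E x y) ≤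
      ε * (ENNReal.ofReal (fE s e x) * ENNReal.ofReal (fE s e y))) {a : Lat} (ha : linf a < RA) :
    ms (Dec (fun v => linf v < RA) s E Q a) ≤
      ε * ∑ y ∈ ringF s, ENNReal.ofReal (fE s e y) * ms (Q y) := by
  have c1 : ms (Dec (fun v => linf v < RA) s E Q a) ≤ ∑ x ∈ ringF s, ∑ y ∈ ringF s,
      Gr (fun v => linf v < RA) a x *
      ((ε * (ENNReal.ofReal (fE s e x) * ENNReal.ofReal (fE s e y))) * ms (Q y)) := by
    unfold Dec
    refine (ms_union _ _).trans (Finset.sum_le_sum fun x hx => ?_)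
    refine (ms_union _ _).trans (Finset.sum_le_sum fun y hy => ?_)
    refine (ms_triple _ _ _).trans ?_
    unfold Gr
    gcongr
    exact hE x y (mem_ringF.mp hx) (mem_ringF.mp hy)
  refine c1.trans ?_
  have c2 : ∑ x ∈ ringF s, ∑ y ∈ ringF s, Gr (fun v => linf v < RA) a x *
      ((ε * (ENNReal.ofReal (fE s e x) * ENNReal.ofReal (fE s e y))) * ms (Q y)) =
      (∑ x ∈ ringF s, Gr (fun v => linf v < RA) a x * ENNReal.ofReal (fE s e x)) *
      (ε * ∑ y ∈ ringF s, ENNReal.ofReal (fE s e y) * ms (Q y)) := by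
    rw [Finset.sum_mul]
    refine Finset.sum_congr rfl fun x _ => ?_
    rw [Finset.mul_sum, Finset.mul_sum]
    refine Finset.sum_congr rfl fun y _ => ?_
    ring
  rw [c2]
  have c3 := (ENNReal.sum_le_tsum (f := fun x => Gr (fun v => linf v < RA) a x *
    ENNReal.ofReal (fE s e x)) (ringF s)).trans (Gr_fE he hs ha)
  calc _ ≤ 1 * (ε * ∑ y ∈ ringF s, ENNReal.ofReal (fE s e y) * ms (Q y)) := by gcongr
    _ = _ := one_mul _

/-- Truncated nondisconnecting lists. -/
structure QL (r R : ℤ) (w : Lat) (L : ℕ) (a : Lat) (l : List Lat) : Prop where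
  chain : l.IsChain Adj
  head : l.head? = some a
  last : l.getLast? = some w
  nd : ND l r R
  len : l.length ≤ L

lemma QL_split {r R s RA : ℤ} (hs : s < RA) {w a : Lat} (hw : linf w ≤ s) (ha : linf a ≤ s) {L : ℕ}
    {l : List Lat} (h : QL r R w L a l) : ChL (fun v => linf v < RA) a w l ∨
    Dec (fun v => linf v < RA) s (Exc r R s RA) (QL r R w L) a l := by
  obtain ⟨hc, hh, hl, hn, hL⟩ := h
  by_cases hf : ∃ v ∈ l, RA ≤ linf v
  swap
  · left
    push Not at hf
    exact ⟨hc, hh, hl, hf⟩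
  right
  obtain ⟨P, v, T, rfl, hv, hP⟩ := first_split (fun v => RA ≤ linf v) l hf
  have haP : a ∈ P := by
    cases P with
    | nil => simp at hh; subst hh; omega
    | cons b P => simp at hh; subst hh; simp
  have hwT : w ∈ T := by
    obtain rfl | ⟨T', w', rfl⟩ := List.eq_nil_or_concat' T
    · simp at hl; subst hl; omega
    · have : P ++ v :: (T' ++ [w']) = (P ++ v :: T') ++ [w'] := by simp
      rw [this, List.getLast?_concat] at hl
      simp at hl; subst hl; simp
  obtain ⟨A1, x, A2, rfl, hx, hA2⟩ := last_split (fun v => linf v ≤ s) P ⟨a, haP, ha⟩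
  obtain ⟨B1, y, B2, rfl, hy, hB1⟩ := first_split (fun v => linf v ≤ s) T ⟨w, hwT, hw⟩
  have hE : ∀ u ∈ A2 ++ v :: B1, s < linf u := by
    intro u hu
    rw [List.mem_append, List.mem_cons] at hu
    rcases hu with h | h | h
    · exact not_le.mp (hA2 u h)
    · rw [h]; omega
    · exact not_le.mp (hB1 u h)
  have hxs : linf x = s := by
    obtain ⟨q, t, hq⟩ : ∃ q t, A2 ++ v :: B1 = q :: t := by
      cases A2 with
      | nil => exact ⟨v, B1, rfl⟩
      | cons b A2 => exact ⟨b, A2 ++ v :: B1, rfl⟩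
    have h1 := hE q (by rw [hq]; simp)
    have : Adj x q := by
      apply chain_adj (A := A1) (B := t ++ y :: B2)
      have e : A1 ++ x :: q :: (t ++ y :: B2) = A1 ++ x :: A2 ++ v :: (B1 ++ y :: B2) := by
        have : q :: (t ++ y :: B2) = (q :: t) ++ y :: B2 := rfl
        rw [this, ← hq]; simp
      rw [e]; exact hc
    have := linf_adj this
    omega
  have hys : linf y = s := by
    obtain ⟨t, q, hq⟩ : ∃ t q, A2 ++ v :: B1 = t ++ [q] := by
      obtain h | ⟨c, w, hw⟩ := List.eq_nil_or_concat' (A2 ++ v :: B1)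
      · simp at h
      · exact ⟨c, w, hw⟩
    have h1 := hE q (by rw [hq]; simp)
    have : Adj q y := by
      apply chain_adj (A := A1 ++ x :: t) (B := B2)
      have e : A1 ++ x :: t ++ q :: y :: B2 = A1 ++ x :: A2 ++ v :: (B1 ++ y :: B2) := by
        have : A1 ++ x :: t ++ q :: y :: B2 = A1 ++ x :: (t ++ [q]) ++ y :: B2 := by simp
        rw [this, ← hq]; simp
      rw [e]; exact hc
    have := linf_adj this
    omega
  refine ⟨x, mem_ringF.mpr hxs, y, mem_ringF.mpr hys, A1 ++ [x], A2 ++ v :: B1, y :: B2, by simp,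
    ⟨?_, ?_, ?_, ?_⟩, ⟨?_, ?_, hE, ⟨v, by simp, hv⟩⟩, ⟨?_, rfl, ?_, ?_, ?_⟩⟩
  · exact isChain_mid hc ⟨[], A2 ++ v :: (B1 ++ y :: B2), by simp⟩
  · cases A1 with
    | nil => simpa using hh
    | cons b A1 => simpa using hh
  · simp
  · intro u hu
    apply not_le.mp
    apply hP u
    simp at hu ⊢; tauto
  · exact isChain_mid hc ⟨A1, B2, by simp⟩
  · exact ND_mono ⟨A1, B2, by simp⟩ hn
  · exact isChain_mid hc ⟨A1 ++ x :: A2 ++ v :: B1, [], by simp⟩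
  · have : A1 ++ x :: A2 ++ v :: (B1 ++ y :: B2) = (A1 ++ x :: A2 ++ v :: B1) ++ (y :: B2) := by simp
    rw [this, List.getLast?_append_of_ne_nil _ (by simp)] at hl
    exact hl
  · exact ND_mono ⟨A1 ++ x :: A2 ++ v :: B1, [], by simp⟩ hn
  · simp at hL ⊢; omega

lemma BL_split {r R s RA RK : ℤ} (hs : s < RA) (hAK : RA ≤ RK) {w a : Lat} (hw : linf w ≤ s)
    (ha : linf a ≤ s) {L : ℕ} {l : List Lat} (h : QL r R w L a l) (hf : ∃ v ∈ l, RK ≤ linf v) :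
    Dec (fun v => linf v < RA) s (Exc r R s RK) (QL r R w L) a l ∨
    Dec (fun v => linf v < RA) s (Exc r R s RA)
      (fun y t => QL r R w L y t ∧ ∃ v ∈ t, RK ≤ linf v) a l := by
  obtain ⟨v, hvl, hv⟩ := hf
  rcases QL_split hs hw ha h with h1 | ⟨x, hx, y, hy, p, e, t, rfl, h1, h2, h3⟩
  · have := h1.mem v hvl
    omega
  by_cases hfe : ∃ v ∈ e, RK ≤ linf v
  · left
    exact ⟨x, hx, y, hy, p, e, t, rfl, h1, ⟨h2.chain, h2.nd, h2.mem, hfe⟩, h3⟩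
  · right
    refine ⟨x, hx, y, hy, p, e, t, rfl, h1, h2, h3, v, ?_, hv⟩
    rw [List.mem_append, List.mem_append] at hvl
    rcases hvl with (h | h) | h
    · have := h1.mem v h
      omega
    · exact absurd ⟨v, h, hv⟩ hfe
    · exact h

lemma TrS_one (k : ℕ) : ∀ a, TrS (fun _ => True) (fun _ => 1) k a ≤ k := by
  induction k with
  | zero =>
    intro a
    have := TrS_le (fun _ => True) (fun _ => 1) (fun _ => ⊤) (fun v _ => le_top) 0 a trivial
    have h0 : TrS (fun _ => True) (fun _ => 1) 0 a = 0 := by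
      unfold TrS
      rw [ENNReal.tsum_eq_zero]
      rintro ⟨b, l⟩
      rw [if_neg]
      rintro ⟨hG, hl⟩
      have : l = [] := List.length_eq_zero_iff.mp (by simpa using hl)
      have h2 := hG.head
      simp only at h2
      rw [this] at h2
      simp at h2
    rw [h0]; exact zero_le
  | succ k ih =>
    intro a
    refine (TrS_succ _ _ k a).trans ?_
    have h1 : ∑ q ∈ nbF a, (if True then TrS (fun _ => True) (fun _ => 1) k q else 0) ≤ 4 * k := by
      calc _ ≤ ∑ q ∈ nbF a, (k : ℝ≥0∞) := Finset.sum_le_sum fun q _ => by rw [if_pos trivial]; exact ih q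
        _ = 4 * k := by
          have h4 : (nbF a).card = 4 := by
            have := sum_nbF a (fun _ => (1 : ℕ))
            simpa using this
          rw [Finset.sum_const, h4, nsmul_eq_mul]; norm_num
    calc _ ≤ 1 + 4⁻¹ * (4 * (k : ℝ≥0∞)) := by
          gcongr
          refine le_trans (le_of_eq ?_) h1
          refine Finset.sum_congr rfl fun q _ => ?_
          simp
      _ = 1 + k := by
        rw [← mul_assoc, ENNReal.inv_mul_cancel (by norm_num) (by norm_num), one_mul]
      _ = _ := by push_cast; ring

lemma QL_fin (r R : ℤ) (w : Lat) (L : ℕ) (a : Lat) : ms (QL r R w L a) ≠ ⊤ := by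
  have h : ms (QL r R w L a) ≤ TrS (fun _ => True) (fun _ => 1) L a := by
    unfold ms TrS
    apply cover _ _ (fun p : Lat × List Lat => p.2)
    intro l hl
    have hQ : QL r R w L a l := by
      by_contra hcon; rw [if_neg hcon] at hl; exact hl rfl
    refine ⟨(w, l), rfl, ?_⟩
    rw [if_pos hQ, if_pos ⟨⟨hQ.chain, hQ.head, hQ.last, fun _ _ => trivial⟩, hQ.len⟩, mul_one]
    calc w4 l = 1 * w4 l := (one_mul _).symm
      _ ≤ 4 * w4 l := by gcongr; norm_num
  exact ((h.trans (TrS_one L a)).trans_lt (ENNReal.natCast_lt_top L)).ne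

lemma absorb {U c : ℝ≥0∞} (hU : U ≠ ⊤) (h : U ≤ c + 2⁻¹ * U) : U ≤ 2 * c := by
  have e : U = 2⁻¹ * U + 2⁻¹ * U := by rw [← add_mul, ENNReal.inv_two_add_inv_two, one_mul]
  have h2 : 2⁻¹ * U + 2⁻¹ * U ≤ c + 2⁻¹ * U := by rw [← e]; exact h
  have h3 : 2⁻¹ * U ≤ c := (ENNReal.add_le_add_iff_right (ENNReal.mul_ne_top (by norm_num) hU)).mp h2
  calc U = 2 * (2⁻¹ * U) := by
        rw [← mul_assoc, ENNReal.mul_inv_cancel (by norm_num) (by norm_num), one_mul]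
    _ ≤ 2 * c := by gcongr

lemma rec_bound {r R s RA RK : ℤ} {e : Lat → ℝ} {εA εK : ℝ≥0∞} (he : IsE s RA e) (hs1 : 1 ≤ s)
    (hsA : 2 * s < RA) (hAK : RA ≤ RK) (hεA : 64 * εA ≤ 2⁻¹)
    (hEA : ∀ x y, linf x = s → linf y = s → ms (Exc r R s RA x y) ≤
      εA * (ENNReal.ofReal (fE s e x) * ENNReal.ofReal (fE s e y)))
    (hEK : ∀ x y, linf x = s → linf y = s → ms (Exc r R s RK x y) ≤
      εK * (ENNReal.ofReal (fE s e x) * ENNReal.ofReal (fE s e y)))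
    {w a : Lat} (hw : linf w ≤ s) (ha : linf a ≤ s) (L : ℕ) :
    ms (fun l => QL r R w L a l ∧ ∃ v ∈ l, RK ≤ linf v) ≤ 130 * εK := by
  have hsR : s < RA := by omega
  set F : Lat → ℝ≥0∞ := fun y => ENNReal.ofReal (fE s e y) with hF
  set U := ∑ y ∈ ringF s, F y * ms (QL r R w L y) with hU
  set V := ∑ y ∈ ringF s, F y * ms (fun l => QL r R w L y l ∧ ∃ v ∈ l, RK ≤ linf v) with hV
  have hF64 : ∑ y ∈ ringF s, F y ≤ 64 := by
    rw [hF, ← ENNReal.ofReal_sum_of_nonneg (fun y _ => fE_nonneg he y)]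
    refine (ENNReal.ofReal_le_ofReal (sum_fE he hs1 hsA)).trans ?_
    norm_num
  have hUf : U ≠ ⊤ := by
    rw [hU]
    exact (ENNReal.sum_lt_top.mpr fun y _ =>
      (ENNReal.mul_lt_top ENNReal.ofReal_lt_top (QL_fin r R w L y).lt_top)).ne
  have hVU : V ≤ U := by
    rw [hU, hV]
    refine Finset.sum_le_sum fun y _ => ?_
    gcongr
    exact ms_mono fun l hl => hl.1
  have hVf : V ≠ ⊤ := (hVU.trans_lt hUf.lt_top).ne
  have hq : ∀ b, linf b ≤ s → ms (QL r R w L b) ≤ Gr (fun v => linf v < RA) b w + εA * U := by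
    intro b hb
    refine (ms_mono (fun l hl => QL_split hsR hw hb hl)).trans ((ms_or _ _).trans ?_)
    unfold Gr
    gcongr
    exact Dec_bound he hsR _ _ εA hEA (by omega)
  have hB : ∀ b, linf b ≤ s → ms (fun l => QL r R w L b l ∧ ∃ v ∈ l, RK ≤ linf v) ≤
      εK * U + εA * V := by
    intro b hb
    refine (ms_mono (fun l hl => BL_split hsR hAK hw hb hl.1 hl.2)).trans ((ms_or _ _).trans ?_)
    exact add_le_add (Dec_bound he hsR _ _ εK hEK (by omega)) (Dec_bound he hsR _ _ εA hEA (by omega))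
  have hU2 : U ≤ 2 * 1 := by
    apply absorb hUf
    calc U ≤ ∑ y ∈ ringF s, (F y * Gr (fun v => linf v < RA) y w + F y * (εA * U)) := by
          rw [hU]
          refine Finset.sum_le_sum fun y hy => ?_
          rw [← mul_add]
          gcongr
          exact hq y (mem_ringF.mp hy).le
      _ = ∑ y ∈ ringF s, Gr (fun v => linf v < RA) w y * F y + (∑ y ∈ ringF s, F y) * (εA * U) := by
          rw [Finset.sum_add_distrib, Finset.sum_mul]
          congr 1
          refine Finset.sum_congr rfl fun y _ => ?_
          rw [Gr_symm, mul_comm]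
      _ ≤ 1 + 64 * (εA * U) := by
          gcongr
          exact (ENNReal.sum_le_tsum (f := fun x => Gr (fun v => linf v < RA) w x * F x)
            (ringF s)).trans (Gr_fE he hsR (by omega))
      _ = 1 + (64 * εA) * U := by rw [mul_assoc]
      _ ≤ 1 + 2⁻¹ * U := by gcongr
  have hV2 : V ≤ 2 * (64 * (εK * U)) := by
    apply absorb hVf
    calc V ≤ ∑ y ∈ ringF s, F y * (εK * U + εA * V) := by
          rw [hV]
          refine Finset.sum_le_sum fun y hy => ?_
          gcongr
          exact hB y (mem_ringF.mp hy).le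
      _ = (∑ y ∈ ringF s, F y) * (εK * U + εA * V) := by rw [Finset.sum_mul]
      _ ≤ 64 * (εK * U + εA * V) := by gcongr
      _ = 64 * (εK * U) + (64 * εA) * V := by ring
      _ ≤ _ := by gcongr
  refine (hB a ha).trans ?_
  calc εK * U + εA * V ≤ εK * U + εA * (2 * (64 * (εK * U))) := by gcongr
    _ = εK * U + (64 * εA) * (2 * (εK * U)) := by ring
    _ ≤ εK * U + 2⁻¹ * (2 * (εK * U)) := by gcongr
    _ = 2 * (εK * U) := by
      rw [← mul_assoc, ENNReal.inv_mul_cancel (by norm_num) (by norm_num)]; ring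
    _ ≤ 2 * (εK * (2 * 1)) := by gcongr
    _ = 4 * εK := by ring
    _ ≤ 130 * εK := by gcongr; norm_num

lemma path_mass_bound {r R RK : ℤ} {z w : Lat} (X : ℝ≥0∞) (h1 : RK ≤ R) (h0 : 0 ≤ r) (hrR : r < R)
    (h : ∀ L, ms (fun l => QL r R w L z l ∧ ∃ v ∈ l, RK ≤ linf v) ≤ X) :
    pathMass (MSet z w r R) ≤ 4 * X := by
  have e : pathMass (MSet z w r R) = 4 * ∑' l : MSet z w r R, w4 l.1 := by
    unfold pathMass
    rw [← ENNReal.tsum_mul_left]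
    refine tsum_congr fun l => ?_
    have hl := l.2.1.2.2.2
    unfold w4 steps
    obtain ⟨k, hk⟩ : ∃ k, l.1.length = k + 1 := ⟨l.1.length - 1, by omega⟩
    rw [hk, pow_succ', ← mul_assoc, ENNReal.mul_inv_cancel (by norm_num) (by norm_num), one_mul]
    simp
  rw [e]
  gcongr
  rw [ENNReal.tsum_eq_iSup_sum]
  apply iSup_le
  intro F
  obtain ⟨L, hL⟩ : ∃ L, ∀ p ∈ F, p.1.length ≤ L :=
    ⟨F.sup (fun p => p.1.length), fun p hp => Finset.le_sup (f := fun p => p.1.length) hp⟩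
  refine le_trans ?_ (h L)
  have h3 : ∀ l ∈ F, QL r R w L z l.1 ∧ ∃ v ∈ l.1, RK ≤ linf v := by
    intro l hl
    obtain ⟨⟨hp, hh, hla, h2⟩, hi, hd⟩ := l.2
    obtain ⟨v, hv, hvR⟩ := hits_ring hp hi
    refine ⟨⟨hp.2, hh, hla, ?_, hL l hl⟩, v, hv, by omega⟩
    exact ND_of_not_disconnects hd
  unfold ms
  calc ∑ l ∈ F, w4 l.1 = ∑ l ∈ F, (if QL r R w L z l.1 ∧ ∃ v ∈ l.1, RK ≤ linf v then w4 l.1 else 0) :=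
        Finset.sum_congr rfl fun l hl => by rw [if_pos (h3 l hl)]
    _ ≤ ∑' l : MSet z w r R, (if QL r R w L z l.1 ∧ ∃ v ∈ l.1, RK ≤ linf v then w4 l.1 else 0) :=
        ENNReal.sum_le_tsum (f := fun l : MSet z w r R =>
          if QL r R w L z l.1 ∧ ∃ v ∈ l.1, RK ≤ linf v then w4 l.1 else 0) F
    _ ≤ _ := ENNReal.tsum_comp_le_tsum_of_injective
        (f := (Subtype.val : MSet z w r R → List Lat)) Subtype.val_injective
        (fun l => if QL r R w L z l ∧ ∃ v ∈ l, RK ≤ linf v then w4 l else 0)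
    _ ≤ _ := le_of_eq (tsum_congr fun l => by congr)

lemma exists_A (C : ℝ) (hC : 0 < C) : ∃ A : ℕ, 3 ≤ A ∧
    C * Real.log (4 * (A : ℝ)) ^ 2 * (1 / (A : ℝ)) ^ (1 / 2 : ℝ) * Real.log (A : ℝ) ≤ 1 / 128 := by
  have h := (isLittleO_log_rpow_rpow_atTop (3 : ℝ) (show (0 : ℝ) < 1 / 2 by norm_num)).bound
    (show 0 < 1 / (256 * C) by positivity)
  have h2 : Filter.Tendsto (fun n : ℕ => (4 : ℝ) * n) Filter.atTop Filter.atTop :=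
    Filter.Tendsto.const_mul_atTop (by norm_num) tendsto_natCast_atTop_atTop
  obtain ⟨A, hA, hA3⟩ := ((h2.eventually h).and (Filter.eventually_ge_atTop 3)).exists
  refine ⟨A, hA3, ?_⟩
  have hA' : (3 : ℝ) ≤ A := by exact_mod_cast hA3
  have hl0 : 0 ≤ Real.log (A : ℝ) := Real.log_nonneg (by linarith)
  have hl1 : Real.log (A : ℝ) ≤ Real.log (4 * (A : ℝ)) := Real.log_le_log (by linarith) (by linarith)
  have h4 : 0 ≤ Real.log (4 * (A : ℝ)) := hl0.trans hl1
  rw [Real.norm_of_nonneg (by positivity), Real.norm_of_nonneg (by positivity),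
    show (3 : ℝ) = ((3 : ℕ) : ℝ) by norm_num, Real.rpow_natCast,
    Real.mul_rpow (by norm_num) (by linarith)] at hA
  have e4 : (4 : ℝ) ^ (1 / 2 : ℝ) = 2 := by
    rw [← Real.sqrt_eq_rpow, show (4 : ℝ) = 2 ^ 2 by norm_num, Real.sqrt_sq (by norm_num)]
  rw [e4] at hA
  have hp : 0 < (A : ℝ) ^ (1 / 2 : ℝ) := by positivity
  rw [Real.div_rpow (by norm_num) (by linarith), Real.one_rpow]
  set q := (A : ℝ) ^ (1 / 2 : ℝ)
  calc C * Real.log (4 * (A : ℝ)) ^ 2 * (1 / q) * Real.log (A : ℝ)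
      ≤ C * Real.log (4 * (A : ℝ)) ^ 2 * (1 / q) * Real.log (4 * (A : ℝ)) := by gcongr
    _ = C * (1 / q) * Real.log (4 * (A : ℝ)) ^ 3 := by ring
    _ ≤ C * (1 / q) * (1 / (256 * C) * (2 * q)) := by gcongr
    _ = 1 / 128 := by field_simp; norm_num
/-- There are universal constants `ρ ≥ 2` and `c' > 0` such that for all
`1 ≤ r < R` with `ρ·r < R` and all `z, w ∈ ∂B_r`, the total `μ^{z,w}`-mass of the set of
paths from `z` to `w` which meet `∂B_R` without disconnecting `B_r` from `∂B_R` is at most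
`c'·(R/r)^{-1/2}·log(R/r)`. -/
theorem mass_nondisconnecting_paths :
    ∃ ρ c' : ℝ, 2 ≤ ρ ∧ 0 < c' ∧
      ∀ (r R : ℤ) (z w : Lat),
        1 ≤ r → r < R → ρ * (r : ℝ) < (R : ℝ) →
        z ∈ bdry (box 0 r) → w ∈ bdry (box 0 r) →
        pathMass (MSet z w r R) ≤
          ENNReal.ofReal
            (c' * ((R : ℝ) / (r : ℝ)) ^ (-(1 / 2) : ℝ) * Real.log ((R : ℝ) / (r : ℝ))) := by

  obtain ⟨N, hN5, hN⟩ := Exc_bound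
  obtain ⟨A, hA3, hA⟩ := exists_A (32 * 9600 * 2000 ^ 2) (by norm_num)
  have hA' : (3 : ℝ) ≤ A := by exact_mod_cast hA3
  have hAz : (3 : ℤ) ≤ A := by exact_mod_cast hA3
  have hN' : (5 : ℝ) ≤ N := by exact_mod_cast hN5
  have hl4 : 0 < Real.log (4 * (A : ℝ)) := Real.log_pos (by linarith)
  refine ⟨8 * A * N + 8,
    520 * (32 * 9600 * 2000 ^ 2 * Real.log (4 * (A : ℝ)) ^ 2 * (8 * (N : ℝ)) ^ (1 / 2 : ℝ)), ?_, ?_, ?_⟩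
  · have : 0 ≤ 8 * (A : ℝ) * N := by positivity
    linarith
  · positivity
  intro r R z w hr hrR hρ hz hw
  have hr' : (1 : ℝ) ≤ r := by exact_mod_cast hr
  have hρz : (8 * (A : ℤ) * N + 8) * r < R := by exact_mod_cast hρ
  have hANr : 15 * r ≤ A * N * r := by
    have : 15 ≤ (A : ℤ) * N := by nlinarith
    nlinarith
  set s : ℤ := N * r with hs
  have hsN : N ≤ s := by nlinarith
  have hsr : r + 1 ≤ s := by nlinarith
  have hs5 : 5 ≤ s := by omega
  have hs' : (5 : ℝ) ≤ s := by exact_mod_cast hs5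
  set mA : ℤ := A * s with hmA
  have hmAs : 3 * s ≤ mA := by nlinarith
  have hRm : 8 * mA + 8 ≤ R := by nlinarith
  set mK : ℤ := (R - 1) / 4 with hmK
  have hmK1 : 4 * mK + 1 ≤ R := by omega
  have hmK2 : R ≤ 8 * mK := by omega
  obtain ⟨e, he⟩ := IsE_exists (show s < 4 * mA by omega)
  have hlog : (((4 * mA : ℤ) : ℝ) / (s : ℝ)) = 4 * (A : ℝ) := by
    rw [hmA]; push_cast; field_simp
  have hEA := hN r R s mA (4 * mA) e hsN (by omega) (by omega) he (by omega) hsr (by omega)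
  have hEK := hN r R s mK (4 * mA) e hsN (by omega) (by omega) he (by omega) hsr (by omega)
  have hεA : 64 * ENNReal.ofReal (epsf (4 * mA) s mA) ≤ 2⁻¹ := by
    have h1 : epsf (4 * mA) s mA ≤ 1 / 128 := by
      refine le_trans (le_of_eq ?_) hA
      unfold epsf
      rw [hlog]
      congr 2
      · congr 1
        rw [hmA]; push_cast; field_simp
      · congr 1
        rw [hmA]; push_cast; field_simp
    calc 64 * ENNReal.ofReal (epsf (4 * mA) s mA) ≤ ENNReal.ofReal 64 * ENNReal.ofReal (1 / 128) := by
          rw [show (64 : ℝ≥0∞) = ENNReal.ofReal 64 by norm_num]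
          gcongr
      _ = ENNReal.ofReal (2⁻¹) := by
          rw [← ENNReal.ofReal_mul (by norm_num)]; norm_num
      _ = 2⁻¹ := by rw [ENNReal.ofReal_inv_of_pos (by norm_num)]; norm_num
  have hz' := linf_bdry hz
  have hw' := linf_bdry hw
  have hfin := path_mass_bound (z := z) (w := w) (RK := 4 * mK) (r := r) (R := R)
    (130 * ENNReal.ofReal (epsf (4 * mA) s mK)) (by omega) (by omega) hrR
    (fun L => rec_bound he (by omega) (by omega) (by omega) hεA hEA hEK (by omega) (by omega) L)
  refine hfin.trans ?_
  have hR' : (0 : ℝ) < R := by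
    have : (0 : ℤ) < R := by omega
    exact_mod_cast this
  have hmKr : (R : ℝ) ≤ 8 * mK := by exact_mod_cast hmK2
  have hmKr2 : 4 * (mK : ℝ) + 1 ≤ R := by exact_mod_cast hmK1
  have hmK0 : (0 : ℝ) < mK := by linarith
  have hsmK : (s : ℝ) < mK := by
    have : s < mK := by omega
    exact_mod_cast this
  have hrs : (r : ℝ) ≤ s := by
    have : r ≤ s := by omega
    exact_mod_cast this
  have key : epsf (4 * mA) s mK ≤ 32 * 9600 * 2000 ^ 2 * Real.log (4 * (A : ℝ)) ^ 2 *
      (8 * (N : ℝ)) ^ (1 / 2 : ℝ) * ((R : ℝ) / (r : ℝ)) ^ (-(1 / 2) : ℝ) *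
      Real.log ((R : ℝ) / (r : ℝ)) := by
    unfold epsf
    rw [hlog]
    have hp : ((s : ℝ) / mK) ^ (1 / 2 : ℝ) ≤
        (8 * (N : ℝ)) ^ (1 / 2 : ℝ) * ((R : ℝ) / (r : ℝ)) ^ (-(1 / 2) : ℝ) := by
      rw [Real.rpow_neg (by positivity), ← Real.inv_rpow (by positivity),
        ← Real.mul_rpow (by positivity) (by positivity)]
      refine Real.rpow_le_rpow (by positivity) ?_ (by norm_num)
      rw [hs]; push_cast
      rw [inv_div, ← mul_div_assoc, div_le_div_iff₀ hmK0 hR']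
      have : 0 ≤ (N : ℝ) * r := by positivity
      nlinarith
    have hl : Real.log ((mK : ℝ) / s) ≤ Real.log ((R : ℝ) / r) := by
      apply Real.log_le_log (by positivity)
      gcongr
      linarith
    have hl0 : 0 ≤ Real.log ((mK : ℝ) / s) := Real.log_nonneg (by rw [le_div_iff₀] <;> linarith)
    calc _ ≤ 32 * 9600 * 2000 ^ 2 * Real.log (4 * (A : ℝ)) ^ 2 *
      ((8 * (N : ℝ)) ^ (1 / 2 : ℝ) * ((R : ℝ) / (r : ℝ)) ^ (-(1 / 2) : ℝ)) *
      Real.log ((R : ℝ) / (r : ℝ)) := by gcongr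
      _ = _ := by ring
  calc 4 * (130 * ENNReal.ofReal (epsf (4 * mA) s mK)) = ENNReal.ofReal 520 * ENNReal.ofReal (epsf (4 * mA) s mK) := by
        rw [← mul_assoc]; congr 1; norm_num
    _ = ENNReal.ofReal (520 * epsf (4 * mA) s mK) := by rw [← ENNReal.ofReal_mul (by norm_num)]
    _ ≤ _ := by
      apply ENNReal.ofReal_le_ofReal
      refine (mul_le_mul_of_nonneg_left key (by norm_num)).trans (le_of_eq ?_)
      ring

end RWLSPaper
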